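/- Let Γ ≤ SO_Q(ℤ) be a finitely generated subgroup whose critical exponent δ satisfies δ > 0.9992, let O = (3,4,5)·Γ, let F_H(x,y,z) = z, and assume the pair (O, F_H) is strongly primitive. Then the set S = {(x,y,z) ∈ O : z ≠ 0 and Ω(z) ≤ 14} is Zariski dense in the cone {Q = 0}: every polynomial P ∈ ℝ[X,Y,Z] that vanishes at every point of S vanishes at every (x,y,z) ∈ ℝ³ with x² + y² − z² = 0. -/

import Mathlib

noncomputable section

open scoped BigOperators

/-- `SL₃(ℤ)`. -/
abbrev SL3Z := Matrix.SpecialLinearGroup (Fin 3) ℤ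

/-- The Pythagorean quadratic form `Q(x,y,z) = x² + y² − z²`. -/
def Qform (v : Fin 3 → ℝ) : ℝ := v 0 ^ 2 + v 1 ^ 2 - v 2 ^ 2

/-- `g` preserves `Q` under the row-vector action on ℝ³, i.e. `g ∈ SO_Q(ℤ)`. -/
def PreservesQ (g : SL3Z) : Prop :=
  ∀ v : Fin 3 → ℝ,
    Qform (Matrix.vecMul v (((g : Matrix (Fin 3) (Fin 3) ℤ)).map (Int.cast : ℤ → ℝ))) = Qform v

/-- The Frobenius norm of a 3×3 integer matrix. -/
def frobZ (g : SL3Z) : ℝ :=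
  Real.sqrt (∑ i : Fin 3, ∑ j : Fin 3, ((g : Matrix (Fin 3) (Fin 3) ℤ) i j : ℝ) ^ 2)

/-- The critical exponent of `Γ`: the infimum of the `s > 0` for which the
Poincaré series `Σ_γ ‖γ‖^{-s}` (Frobenius norm) converges. -/
def critExp (Γ : Subgroup SL3Z) : ℝ :=
  sInf {s : ℝ | 0 < s ∧ Summable (fun γ : Γ => frobZ (γ : SL3Z) ^ (-s))}

/-- The orbit `(3,4,5)·Γ` under the row-vector action. -/
def orbit345 (Γ : Subgroup SL3Z) : Set (Fin 3 → ℤ) :=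
  {v | ∃ γ ∈ Γ, v = Matrix.vecMul ![3, 4, 5] ((γ : SL3Z) : Matrix (Fin 3) (Fin 3) ℤ)}

/-- The Euclidean norm on ℤ³. -/
def euclZ (v : Fin 3 → ℤ) : ℝ := Real.sqrt (∑ i : Fin 3, ((v i : ℝ)) ^ 2)

/-- `Ω(n)`: the number of prime factors of `|n|` counted with multiplicity. -/
def OmegaZ (n : ℤ) : ℕ := n.natAbs.primeFactorsList.length


open scoped BigOperators Matrix
open Matrix (det_one single_apply det_pow mul_nonsing_inv nonsing_inv_mul smul_vecMul vecMul vecMul_vecMul zero_vecMul det_mul map_apply isUnit_iff_isUnit_det det_fin_two mul_adjugate)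
open Finset (sum_mul_sq_le_sq_mul_sq card_filter_add_card_filter_not prod_singleton disjoint_iff_inter_eq_empty sum_range_succ sum_ite_eq card_le_card card_eq_zero sum_product mem_coe prod_dvd_of_coprime sum_eq_zero card_le_card_of_injOn sum_add_distrib prod_nonneg sum_nonneg sum_le_sum_of_subset_of_nonneg sum_Ioc_succ_top mem_erase mem_univ prod_pos Ioc prod_le_prod sum_Ioc_consecutive card_product card_erase_of_mem inter_eq_left mem_image union_inter_distrib_right sum_mul sum_boole ne_of_mem_erase card_image_of_injOn sum_const sum_image card_image_of_injective mul_sum sum_congr erase_insert sum_map inter_subset_right card_filter card_union_le sum_eq_single prod_eq_zero sum_singleton prod_insert prod_empty sum_mul_sum mem_powerset mem_insert_self prod_add mul_prod_erase prod_union filter_ne' mem_union mem_singleton mem_filter mem_Icc sum_attach card_image_le sum_ite_eq' prod_mul_distrib induction_on sum_fiberwise_of_maps_to prod_univ_sum empty_union card_eq_sum_card_fiberwise card_pos dvd_sum abs_sum_le_sum_abs mem_product sum_filter mem_powersetCard coe_product sum_product' sum_le_sum union_empty sum_div filter_eq_empty_iff disjoint_left mem_image_of_mem prod_congr filter_subset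 nonempty_iff_ne_empty disjoint_biUnion_right mem_insert_of_mem card_range univ dvd_prod_of_mem sum_le_card_nsmul card_univ univ_unique mem_range Icc prod_pow sum_comm add_sum_erase card_singleton prod_const sum_sub_distrib powersetCard_one prod_ne_zero_iff single_le_sum coe_filter)
open Real (abs_le_sqrt rpow_add exp finsetProd_rpow rpow_le_rpow log_rpow rpow_lt_one_of_one_lt_of_neg log_le_log log_div rpow_neg log_two_lt_d9 rpow_le_rpow_of_exponent_le rpow_mul log_two_gt_d9 sq_sqrt rpow_one le_log_iff_exp_le one_le_rpow exp_one_lt_d9 mul_rpow rpow_natCast rpow_pos_of_pos log_le_sub_one_of_pos sqrt log_pow log_le_rpow_div rpow_le_rpow_of_nonpos log_pos logb)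
open Nat (floor_le prime_five isCoprime_iff_coprime one_le_iff_ne_zero mem_divisors cast_div_le primeFactors_prod coprime_primes le_mul_of_pos_left lt_succ_iff cast_le cast_sub floor_lt findGreatest lt_mul_div_succ find cast_nonneg floor_le_floor lt_floor_add_one log_mono_right le_floor le_induction one_le_pow prime_iff_prime_int factorial_succ exists_eq_add_of_le Coprime)
open Int (emod_nonneg ediv_nonneg natCast_dvd natCast_natAbs toNat_of_nonneg card_Icc ediv_lt_of_lt_mul natCast_dvd_natCast sq_of_gcd_eq_one modEq_iff_dvd mul_ediv_add_emod eq_one_of_mul_eq_one_right emod_lt_of_pos one_le_abs ediv_le_ediv add_mul_ediv_left castRingHom)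
notation "ppp" => by positivity
notation "nnn" => by norm_num
notation "ooo" => by omega
notation "I1" => (1:ℝ)
notation "I0" => (0:ℝ)
notation "I2" => (2:ℝ)
notation "lgg" => Real.log
notation "rgg" => Finset.range
notation:max "↟" x:max => (x:ℝ)

theorem tau_bound (ε : ℝ) (hε : 0 < ε) : ∃ C : ℝ, 1 ≤ C ∧ ∀ n : ℕ, n ≠ 0 →
    (n.divisors.card : ℝ) ≤ C * (n : ℝ) ^ ε := by
  set K : ℝ := 1 + 1 / (ε * lgg 2) with hK
  have hl2 : 0 < lgg 2 := log_pos nnn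
  have hK1 : 1 ≤ K := by rw [hK]; have : 0 < 1 / (ε * lgg 2) := by positivity
                         linarith
  obtain ⟨P, hP⟩ := exists_nat_gt (I2 ^ (1/ε))
  refine ⟨K ^ P, one_le_pow₀ hK1, fun n hn => ?_⟩
  have key : ∀ p ∈ n.primeFactors, ((n.factorization p + 1 : ℕ) : ℝ) ≤
      (if p < P then K else 1) * ((p ^ n.factorization p : ℕ) : ℝ) ^ ε := by
    intro p hp
    have hpp := Nat.prime_of_mem_primeFactors hp
    set e := n.factorization p
    have hp2 : I2 ≤ p := by exact_mod_cast hpp.two_le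
    have hp0 : I0 < p := by linarith
    have h1 : ((p ^ e : ℕ) : ℝ) ^ ε = (↟p ^ ε) ^ e := by
      push_cast
      rw [← rpow_natCast, ← rpow_natCast, ← rpow_mul hp0.le,
        ← rpow_mul hp0.le, mul_comm]
    rw [h1]; push_cast
    split_ifs with h
    · have h2 : 1 + e * (ε * lgg 2) ≤ (↟p ^ ε) ^ e := by
        have h3 : 1 + ε * lgg 2 ≤ ↟p ^ ε := by
          calc 1 + ε * lgg 2 ≤ exp (ε * lgg 2) := by
                have := Real.add_one_le_exp (ε * lgg 2); linarith
            _ = I2 ^ ε := by rw [Real.rpow_def_of_pos nnn]; ring_nf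
            _ ≤ _ := rpow_le_rpow nnn hp2 hε.le
        have h4 := one_add_mul_le_pow (a := ε * lgg 2) (by have : 0 < ε * lgg 2 := (by positivity); linarith) e
        exact h4.trans (pow_le_pow_left₀ ppp h3 e)
      have h5 : ↟e + 1 ≤ K * (1 + e * (ε * lgg 2)) := by
        rw [hK]
        have : (1 + 1 / (ε * lgg 2)) * (1 + e * (ε * lgg 2)) =
          1 + e + 1 / (ε * lgg 2) + e * (ε * lgg 2) := by field_simp; ring
        rw [this]
        have : 0 ≤ 1 / (ε * lgg 2) + e * (ε * lgg 2) := by positivity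
        linarith
      exact h5.trans (mul_le_mul_of_nonneg_left h2 (by linarith))
    · have h2 : I2 ≤ ↟p ^ ε := by
        have hpP : I2 ^ (1/ε) ≤ p := hP.le.trans (by exact_mod_cast not_lt.mp h)
        calc I2 = (I2 ^ (1/ε)) ^ ε := by
              rw [← rpow_mul nnn]; field_simp; simp
          _ ≤ _ := rpow_le_rpow ppp hpP hε.le
      have h3 : (↟e + 1) ≤ 2 ^ e := by
        have : e + 1 ≤ 2 ^ e := e.lt_two_pow_self
        exact_mod_cast this
      rw [one_mul]
      exact h3.trans (pow_le_pow_left₀ nnn h2 e)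
  rw [Nat.card_divisors hn]
  push_cast
  calc (∏ p ∈ n.primeFactors, ((n.factorization p : ℝ) + 1))
      ≤ ∏ p ∈ n.primeFactors, ((if p < P then K else 1) * ((p ^ n.factorization p : ℕ) : ℝ) ^ ε) :=
        prod_le_prod (fun _ _ => by positivity) (fun p hp => by exact_mod_cast key p hp)
    _ = (∏ p ∈ n.primeFactors, (if p < P then K else 1)) *
          ((∏ p ∈ n.primeFactors, p ^ n.factorization p : ℕ) : ℝ) ^ ε := by
        rw [prod_mul_distrib]; congr 1
        push_cast
        rw [finsetProd_rpow _ _ (fun _ _ => by positivity)]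
    _ ≤ K ^ P * ↟n ^ ε := by
        have : ∏ p ∈ n.primeFactors, p ^ n.factorization p = n := Nat.prod_factorization_pow_eq_self hn
        rw [this]
        refine mul_le_mul_of_nonneg_right ?_ ppp
        rw [Finset.prod_ite]
        simp only [prod_const, one_pow, mul_one]
        refine pow_le_pow_right₀ hK1 ?_
        calc _ ≤ (rgg P).card := card_le_card (fun x hx => by simp at hx ⊢; exact hx.2)
          _ = P := by simp


def chx (n : ℕ) : ℝ := ((ZMod.χ₄ (n : ZMod 4) : ℤ) : ℝ)

def Xch (n : ℕ) : ℝ := if n % 4 = 1 ∨ n % 4 = 2 then 1 else 0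

lemma chx_eq (n : ℕ) : chx n = if n % 2 = 0 then 0 else if n % 4 = 1 then 1 else -1 := by
  unfold chx; rw [ZMod.χ₄_nat_eq_if_mod_four]; push_cast; rfl

lemma chx_mul (a b : ℕ) : chx (a * b) = chx a * chx b := by
  unfold chx; push_cast; rw [map_mul]; push_cast; rfl

lemma chx_succ (n : ℕ) : chx (n + 1) = Xch (n + 1) - Xch n := by
  rw [chx_eq]; unfold Xch
  have : n % 4 = 0 ∨ n % 4 = 1 ∨ n % 4 = 2 ∨ n % 4 = 3 := by omega
  rcases this with h | h | h | h
  · have h1 : (n+1) % 4 = 1 := by omega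
    have h2 : (n+1) % 2 = 1 := by omega
    simp [h, h1, h2]
  · have h1 : (n+1) % 4 = 2 := by omega
    have h2 : (n+1) % 2 = 0 := by omega
    simp [h, h1, h2]
  · have h1 : (n+1) % 4 = 3 := by omega
    have h2 : (n+1) % 2 = 1 := by omega
    simp [h, h1, h2]
  · have h1 : (n+1) % 4 = 0 := by omega
    have h2 : (n+1) % 2 = 0 := by omega
    simp [h, h1, h2]

lemma Xch_bd (n : ℕ) : 0 ≤ Xch n ∧ Xch n ≤ 1 := by
  unfold Xch; split_ifs <;> norm_num

lemma abel_chx (b : ℕ → ℝ) (j : ℕ) (hb : ∀ k, j < k → b (k+1) ≤ b k) (h0 : ∀ k, j < k → 0 ≤ b k)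
    (i : ℕ) : |∑ k ∈ Ioc j i, chx k * b k| ≤ b (j+1) := by
  rcases le_or_gt i j with h | h
  · rw [Finset.Ioc_eq_empty ooo]; simpa using h0 (j+1) ooo
  · have key : ∀ i, j + 1 ≤ i →
        (∑ k ∈ Ioc j i, chx k * b k ≤ Xch i * b i - Xch j * b (j+1) + (b (j+1) - b i)) ∧
        (Xch i * b i - Xch j * b (j+1) ≤ ∑ k ∈ Ioc j i, chx k * b k) := by
      intro i hi
      induction i, hi using le_induction with
      | base =>
        simp only [Nat.Ioc_succ_singleton, sum_singleton, chx_succ]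
        constructor <;> linarith
      | succ i hi ih =>
        rw [sum_Ioc_succ_top ooo, chx_succ]
        have h1 := hb i ooo
        have h2 := Xch_bd i
        constructor <;> nlinarith [ih.1, ih.2]
    obtain ⟨k1, k2⟩ := key i h
    have h1 := h0 i h
    have h2 := h0 (j+1) ooo
    have h3 := Xch_bd i
    have h4 := Xch_bd j
    rw [abs_le]
    constructor <;> nlinarith

open ArithmeticFunction in
lemma psi_bd (N : ℕ) : ∑ n ∈ Ioc 0 N, Λ n ≤ 6 * N := by
  have h := Chebyshev.psi_le_const_mul_self (x := ↟N) ppp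
  rw [Chebyshev.psi, Nat.floor_natCast] at h
  have h4 : lgg 4 ≤ 2 := by
    rw [show ↟4 = 2^2 by norm_num, log_pow]
    have := log_two_lt_d9
    push_cast; linarith
  have : I0 ≤ N := by positivity
  nlinarith

open ArithmeticFunction in
lemma mert1 (N : ℕ) (hN : 1 ≤ N) : |∑ n ∈ Ioc 0 N, Λ n / n - lgg N| ≤ 6 := by
  have e : ∑ n ∈ Ioc 0 N, Λ n * ((N / n : ℕ) : ℝ) = lgg (N.factorial) := by
    rw [← sum_Ioc_mul_zeta_eq_sum, vonMangoldt_mul_zeta]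
    clear hN
    induction N with
    | zero => simp
    | succ n ih =>
      rw [sum_Ioc_succ_top ooo, ih, factorial_succ]
      push_cast
      rw [Real.log_mul ppp ppp]
      simp [ArithmeticFunction.log_apply, add_comm]
  have hNp : I0 < N := by exact_mod_cast hN
  have u : lgg (N.factorial) ≤ N * lgg N := by
    rw [← log_pow]
    apply log_le_log ppp
    exact_mod_cast Nat.factorial_le_pow N
  have l : N * lgg N - N ≤ lgg (N.factorial) := by
    have := Real.pow_div_factorial_le_exp ↟N hNp.le N
    have h2 := log_le_log ppp this
    rw [Real.log_exp, log_div ppp ppp, log_pow] at h2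
    linarith
  have p := psi_bd N
  have a1 : ∑ n ∈ Ioc 0 N, Λ n * ((N / n : ℕ) : ℝ) ≤ N * ∑ n ∈ Ioc 0 N, Λ n / n := by
    rw [mul_sum]
    apply sum_le_sum
    intro n hn
    have := @cast_div_le ℝ _ _ _ N n
    calc Λ n * ((N / n : ℕ) : ℝ) ≤ Λ n * (N / n) := mul_le_mul_of_nonneg_left this vonMangoldt_nonneg
      _ = _ := by ring
  have a2 : N * ∑ n ∈ Ioc 0 N, Λ n / n ≤ ∑ n ∈ Ioc 0 N, Λ n * ((N / n : ℕ) : ℝ) + ∑ n ∈ Ioc 0 N, Λ n := by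
    rw [mul_sum, ← sum_add_distrib]
    apply sum_le_sum
    intro n hn
    have h1 : ↟N / n ≤ ((N / n : ℕ) : ℝ) + 1 := by
      rw [← Nat.floor_div_eq_div (K := ℝ)]
      exact (lt_floor_add_one (↟N/n)).le
    calc ↟N * (Λ n / n) = Λ n * (N / n) := by ring
      _ ≤ Λ n * (((N / n : ℕ) : ℝ) + 1) := mul_le_mul_of_nonneg_left h1 vonMangoldt_nonneg
      _ = _ := by ring
  rw [abs_le]
  constructor
  · have : ↟N * (lgg N - 1) ≤ N * ∑ n ∈ Ioc 0 N, Λ n / n := by linarith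
    have := le_of_mul_le_mul_left this hNp
    linarith
  · have : N * ∑ n ∈ Ioc 0 N, Λ n / n ≤ ↟N * (lgg N + 6) := by linarith
    have := le_of_mul_le_mul_left this hNp
    linarith

open ArithmeticFunction in
lemma mert2 (N : ℕ) (hN : 1 ≤ N) : |∑ n ∈ Ioc 0 N, chx n * Λ n / n| ≤ 12 := by
  let f : ArithmeticFunction ℝ := ⟨fun n => chx n * Λ n / n, by simp⟩
  let g : ArithmeticFunction ℝ := ⟨fun n => chx n * (1 / n), by simp⟩
  have hNp : I0 < N := by exact_mod_cast hN
  have hfg : ∀ n, (f * g) n = chx n * (lgg n / n) := by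
    intro n
    rw [ArithmeticFunction.mul_apply, ← vonMangoldt_sum, ← Nat.map_div_right_divisors, sum_map,
      sum_div, mul_sum]
    apply sum_congr rfl
    intro d hd
    obtain ⟨⟨k, rfl⟩, hn⟩ := mem_divisors.1 hd
    have hd0 : d ≠ 0 := by rintro rfl; simp at hn
    have hk0 : k ≠ 0 := by rintro rfl; simp at hn
    have hd1 : ↟d ≠ 0 := by exact_mod_cast hd0
    have hk1 : ↟k ≠ 0 := by exact_mod_cast hk0
    show chx d * Λ d / d * (chx (d * k / d) * (1 / (d*k/d : ℕ))) = _
    rw [Nat.mul_div_cancel_left _ ooo, chx_mul]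
    push_cast
    field_simp
  have e := sum_Ioc_mul_eq_sum_sum f g N
  simp only [hfg] at e
  set K : ℕ → ℝ := fun j => ∑ m ∈ Ioc 0 j, g m with hK
  have hlog : |∑ n ∈ Ioc 0 N, chx n * (lgg n / n)| ≤ 1 := by
    have : ∑ n ∈ Ioc 0 N, chx n * (lgg n / n) = ∑ n ∈ Ioc 2 N, chx n * (lgg n / n) := by
      symm
      apply Finset.sum_subset
      · intro x hx; simp at hx ⊢; omega
      · intro x hx hx'; simp at hx hx'
        have : x = 1 ∨ x = 2 := by omega
        rcases this with rfl | rfl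
        · simp
        · simp [chx_eq]
    rw [this]
    refine (abel_chx (fun n => lgg n / n) 2 ?_ ?_ N).trans ?_
    · intro k hk
      have hk3 : ↟3 ≤ k := by exact_mod_cast hk
      have he := exp_one_lt_d9
      apply Real.log_div_self_antitoneOn
      · simp; linarith
      · simp; linarith
      · simp
    · intro k hk; positivity
    · have := log_le_sub_one_of_pos (x := 3) nnn
      norm_num; rw [div_le_one nnn]; linarith
  have hg : ∀ i j, |∑ m ∈ Ioc j i, g m| ≤ 1 / ((j+1 : ℕ):ℝ) := by
    intro i j
    refine abel_chx (fun n => 1 / ↟n) j ?_ ?_ i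
    · intro k hk
      have : I0 < k := by exact_mod_cast (by omega : 0 < k)
      apply one_div_le_one_div_of_le this; simp
    · intro k hk; positivity
  have hKd : ∀ m ∈ Ioc 0 N, |K N - K (N / m)| ≤ m / N := by
    intro m hm
    simp at hm
    have : K N - K (N/m) = ∑ k ∈ Ioc (N/m) N, g k := by
      rw [sub_eq_iff_eq_add, add_comm, hK]
      exact (sum_Ioc_consecutive g (Nat.zero_le _) (Nat.div_le_self _ _)).symm
    rw [this]
    refine (hg _ _).trans ?_
    have hm0 : I0 < m := by exact_mod_cast hm.1
    rw [div_le_div_iff₀ ppp hNp]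
    have := lt_mul_div_succ N hm.1
    have h2 : ↟N ≤ m * (N/m+1 : ℕ) := by exact_mod_cast this.le
    linarith
  have hKN : 2/3 ≤ K N := by
    have h1 : K N = K 1 + ∑ k ∈ Ioc 1 N, g k := by
      rw [hK]; exact (sum_Ioc_consecutive g (Nat.zero_le _) hN).symm
    have hK1 : K 1 = 1 := by simp [hK, g, chx]
    rcases Nat.lt_or_ge N 2 with h | h
    · have : N = 1 := by omega
      subst this; rw [hK1]; norm_num
    · have h2 : ∑ k ∈ Ioc 1 N, g k = g 2 + ∑ k ∈ Ioc 2 N, g k := by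
        rw [← sum_Ioc_consecutive g (by norm_num : 1 ≤ 2) h]; simp
      have hg2 : g 2 = 0 := by simp [g, chx_eq]
      have h3 := hg N 2
      rw [abs_le] at h3
      norm_num at h3
      rw [h1, hK1, h2, hg2]; linarith
  have hsum : K N * ∑ n ∈ Ioc 0 N, f n = ∑ n ∈ Ioc 0 N, chx n * (lgg n / n) + ∑ n ∈ Ioc 0 N, f n * (K N - K (N/n)) := by
    rw [e, ← sum_add_distrib, mul_sum]
    apply sum_congr rfl
    intro n _
    simp only [hK]; ring
  have hch : ∀ n, |chx n| ≤ 1 := by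
    intro n; rw [chx_eq]; split_ifs <;> norm_num
  have herr : |∑ n ∈ Ioc 0 N, f n * (K N - K (N/n))| ≤ 6 := by
    calc _ ≤ ∑ n ∈ Ioc 0 N, |f n * (K N - K (N/n))| := abs_sum_le_sum_abs _ _
      _ ≤ ∑ n ∈ Ioc 0 N, Λ n / N := by
        apply sum_le_sum
        intro n hn
        have hn0 : I0 < n := by simp at hn; exact_mod_cast hn.1
        rw [abs_mul]
        have h1 : |f n| ≤ Λ n / n := by
          show |chx n * Λ n / n| ≤ _
          rw [abs_div, abs_mul, abs_of_nonneg (vonMangoldt_nonneg (n := n)), abs_of_pos hn0]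
          gcongr
          have := mul_le_mul_of_nonneg_right (hch n) (vonMangoldt_nonneg (n := n))
          linarith
        calc |f n| * |K N - K (N/n)| ≤ (Λ n / n) * (n / N) :=
              mul_le_mul h1 (hKd n hn) (abs_nonneg _) (div_nonneg vonMangoldt_nonneg hn0.le)
          _ = _ := by field_simp
      _ = (∑ n ∈ Ioc 0 N, Λ n) / N := by rw [sum_div]
      _ ≤ 6 := by rw [div_le_iff₀ hNp]; exact psi_bd N
  have hfin : |K N * ∑ n ∈ Ioc 0 N, f n| ≤ 7 := by
    rw [hsum]; refine (abs_add_le _ _).trans ?_; linarith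
  rw [abs_mul, abs_of_nonneg (by linarith)] at hfin
  show |∑ n ∈ Ioc 0 N, f n| ≤ 12
  nlinarith [abs_nonneg (∑ n ∈ Ioc 0 N, f n)]

def aM (n : ℕ) : ℝ := if n.Prime ∧ n % 4 = 1 then 2 * lgg n / n else 0

open ArithmeticFunction in
lemma mert3 : ∃ C : ℝ, 0 ≤ C ∧ ∀ N : ℕ, 1 ≤ N → |∑ n ∈ Ioc 0 N, aM n - lgg N| ≤ C := by
  have hs := vonMangoldt.summable_residueClass_non_primes_div (q := 1) 1
  have hr : ∀ n : ℕ, vonMangoldt.residueClass (1 : ZMod 1) n = Λ n := by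
    intro n
    simp only [vonMangoldt.residueClass]
    rw [Set.indicator_of_mem]
    exact Subsingleton.elim _ _
  simp only [hr] at hs
  set w : ℕ → ℝ := fun n => (if n.Prime then 0 else Λ n) / n with hw
  have hw0 : ∀ n, 0 ≤ w n := by
    intro n; simp only [hw]; split_ifs
    · simp
    · exact div_nonneg vonMangoldt_nonneg (cast_nonneg _)
  refine ⟨18 + 2 * (∑' n, w n) + 1, by have : 0 ≤ ∑' n, w n := tsum_nonneg hw0; linarith, ?_⟩
  intro N hN
  have h1 := mert1 N hN
  have h2 := mert2 N hN
  have h3 : ∑ n ∈ Ioc 0 N, w n ≤ ∑' n, w n := hs.sum_le_tsum _ (fun i _ => hw0 i)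
  have h2b : ∀ N : ℕ, |∑ n ∈ Ioc 0 N, (if n = 2 then I1 else 0)| ≤ 1 := by
    intro N
    rw [sum_ite_eq']; split_ifs <;> simp
  have key : ∀ n ∈ Ioc 0 N, |aM n - (Λ n / n + chx n * Λ n / n)| ≤ 2 * w n + (if n = 2 then 1 else 0) := by
    intro n hn
    have hn0 : I0 < n := by simp at hn; exact_mod_cast hn.1
    by_cases hp : n.Prime
    · have hΛ : Λ n = lgg n := vonMangoldt_apply_prime hp
      rw [hΛ, chx_eq]
      have hwn := hw0 n
      rcases hp.eq_two_or_odd with h | h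
      · subst h
        simp only [aM, hw]; norm_num
        have := log_two_lt_d9
        have := log_two_gt_d9
        rw [abs_le]; constructor <;> linarith
      · have hn2 : n ≠ 2 := by omega
        by_cases h4 : n % 4 = 1
        · simp only [aM, hp, h, h4, hn2]; simp
          rw [show (2 * lgg n / n - (lgg n / n + lgg n / n)) = 0 by ring]; simpa using hwn
        · simp only [aM, hp, h, h4, hn2]; simp
          rw [show (-(-lgg n / n) + -(lgg n / n)) = 0 by ring]; simpa using hwn
    · have : aM n = 0 := by simp [aM, hp]
      rw [this]
      have hwe : w n = Λ n / n := by simp [hw, hp]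
      rw [hwe, zero_sub, abs_neg]
      have hq : 0 ≤ Λ n / n := div_nonneg vonMangoldt_nonneg hn0.le
      have : chx n * Λ n / n = chx n * (Λ n / n) := by ring
      rw [this]
      have hx : chx n = 0 ∨ chx n = 1 ∨ chx n = -1 := by rw [chx_eq]; split_ifs <;> simp
      have : I0 ≤ if n = 2 then 1 else 0 := by split_ifs <;> simp
      rcases hx with h | h | h <;> rw [h, abs_le] <;> constructor <;> linarith
  have h4 : |∑ n ∈ Ioc 0 N, (aM n - (Λ n / n + chx n * Λ n / n))| ≤ 2 * (∑' n, w n) + 1 := by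
    refine (abs_sum_le_sum_abs _ _).trans ((sum_le_sum key).trans ?_)
    rw [sum_add_distrib, ← mul_sum]
    have := (abs_le.1 (h2b N)).2
    linarith
  rw [sum_sub_distrib, sum_add_distrib] at h4
  rw [abs_le] at *
  constructor <;> linarith

lemma mertens4 : ∃ C : ℝ, 0 ≤ C ∧ ∀ m k : ℕ, 2 ≤ m → m ≤ k →
    ∑ p ∈ (Ioc m k).filter (fun n => n.Prime ∧ n % 4 = 1), (2 / ↟p) ≤
      lgg (lgg k) - lgg (lgg m) + C / lgg m := by
  obtain ⟨C, hC0, hC⟩ := mert3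
  refine ⟨2 * C, by linarith, ?_⟩
  intro m k hm hk
  have hlog : ∀ n : ℕ, 2 ≤ n → 0 < lgg n := fun n hn => log_pos (by exact_mod_cast hn)
  set S : ℕ → ℝ := fun N => ∑ n ∈ Ioc 0 N, aM n with hS
  have e : ∑ p ∈ (Ioc m k).filter (fun n => n.Prime ∧ n % 4 = 1), (2 / ↟p) =
      ∑ n ∈ Ioc m k, aM n / lgg n := by
    rw [sum_filter]
    apply sum_congr rfl
    intro n hn
    simp at hn
    have := hlog n ooo
    unfold aM
    split_ifs
    · field_simp
    · simp
  rw [e]; clear e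
  have main : ∑ n ∈ Ioc m k, aM n / lgg n ≤ lgg (lgg k) - lgg (lgg m)
      + (S k - lgg k - C) / lgg k + 2 * C / lgg m := by
    induction k, hk using le_induction with
    | base =>
      simp only [Finset.Ioc_self, Finset.sum_empty, sub_self, zero_add]
      rw [← add_div]
      apply div_nonneg _ (hlog m hm).le
      have := (abs_le.1 (hC m ooo)).1
      linarith
    | succ k hk ih =>

      rw [sum_Ioc_succ_top ooo]
      have l1 := hlog k ooo
      have l2 := hlog (k+1) ooo
      have hSs : S (k+1) = S k + aM (k+1) := sum_Ioc_succ_top ooo _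
      have hle : lgg k ≤ lgg (k+1 : ℕ) := log_le_log (by exact_mod_cast (by omega : 0 < k)) (by simp)
      have hE := (abs_le.1 (hC k ooo)).2
      have hmono : (S k - lgg k - C) / lgg k ≤ (S k - lgg k - C) / lgg (k+1 : ℕ) := by
        rw [div_le_div_iff₀ l1 l2]
        apply mul_le_mul_of_nonpos_left hle
        simp only [hS]; linarith
      have hll : 1 - lgg k / lgg (k+1 : ℕ) ≤ lgg (lgg (k+1 : ℕ)) - lgg (lgg k) := by
        have := Real.one_sub_inv_le_log_of_pos (x := lgg (k+1 : ℕ) / lgg k) ppp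
        rw [inv_div, log_div l2.ne' l1.ne'] at this
        exact this
      have : aM (k+1) / lgg (k+1 : ℕ) = (S (k+1) - lgg (k+1:ℕ) - C) / lgg (k+1:ℕ) - (S k - lgg k - C) / lgg (k+1:ℕ) + (1 - lgg k / lgg (k+1:ℕ)) := by
        rw [hSs]; field_simp; ring
      rw [this]
      linarith
  have hE := (abs_le.1 (hC k ooo)).2
  have : (S k - lgg k - C) / lgg k ≤ 0 := by
    apply div_nonpos_of_nonpos_of_nonneg _ (hlog k ooo).le
    simp only [hS]; linarith
  linarith


def intDiv (n : ℤ) : Finset ℤ :=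
  (n.natAbs.divisors.image (fun d : ℕ => (d:ℤ))) ∪ (n.natAbs.divisors.image (fun d : ℕ => -(d:ℤ)))

theorem mem_intDiv {n d : ℤ} (hn : n ≠ 0) (h : d ∣ n) : d ∈ intDiv n := by
  have h1 : d.natAbs ∈ n.natAbs.divisors := by
    simp [mem_divisors, Int.natAbs_dvd_natAbs, h, hn]
  simp only [intDiv, mem_union, mem_image]
  rcases Int.natAbs_eq d with h2 | h2
  · exact Or.inl ⟨_, h1, h2.symm⟩
  · exact Or.inr ⟨_, h1, h2.symm⟩

theorem card_intDiv (n : ℤ) : (intDiv n).card ≤ 2 * n.natAbs.divisors.card := by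
  refine (card_union_le _ _).trans ?_
  have h1 := card_image_le (s := n.natAbs.divisors) (f := fun d : ℕ => (d:ℤ))
  have h2 := card_image_le (s := n.natAbs.divisors) (f := fun d : ℕ => -(d:ℤ))
  omega

set_option maxHeartbeats 1000000 in
theorem hp_core (ε : ℝ) (hε : 0 < ε) : ∃ C : ℝ, 1 ≤ C ∧ ∀ (Y : ℕ) (α β γ δ k e : ℤ), 1 ≤ Y → α ≠ 0 →
    |α| ≤ Y → |β| ≤ Y → |γ| ≤ Y → |δ| ≤ Y → |e| = 1 → ∀ S : Finset (ℤ × ℤ × ℤ × ℤ),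
    (∀ s ∈ S, |s.1| ≤ Y ∧ |s.2.1| ≤ Y ∧ |s.2.2.1| ≤ Y ∧ |s.2.2.2| ≤ Y ∧
      s.1 * s.2.1 - s.2.2.1 * s.2.2.2 = e ∧
      α * s.1 + β * s.2.1 + γ * s.2.2.1 + δ * s.2.2.2 = k) →
    (S.card : ℝ) ≤ C * ↟Y ^ (1 + ε) := by
  obtain ⟨C, hC1, hC⟩ := tau_bound (ε/4) ppp
  refine ⟨6 * C * ↟7^(ε/4) + 12 * C, ?_, ?_⟩
  · have : 0 ≤ 6 * C * ↟7^(ε/4) := by positivity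
    linarith
  intro Y α β γ δ k e hY hα hα' hβ hγ hδ he S hS
  rcases S.eq_empty_or_nonempty with rfl | ⟨s0, hs0⟩
  · simp; positivity
  have hY' : (1:ℤ) ≤ Y := by exact_mod_cast hY
  have hk : |k| ≤ 4 * (Y:ℤ)^2 := by
    obtain ⟨h1, h2, h3, h4, -, h6⟩ := hS s0 hs0
    have a1 : |α * s0.1| ≤ (Y:ℤ) * Y := by rw [abs_mul]; gcongr
    have a2 : |β * s0.2.1| ≤ (Y:ℤ) * Y := by rw [abs_mul]; gcongr
    have a3 : |γ * s0.2.2.1| ≤ (Y:ℤ) * Y := by rw [abs_mul]; gcongr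
    have a4 : |δ * s0.2.2.2| ≤ (Y:ℤ) * Y := by rw [abs_mul]; gcongr
    rw [abs_le] at *
    constructor <;> nlinarith
  set n : ℤ → ℤ := fun y => α * k * y - α * β * y^2 + γ * δ * y^2 - α^2 * e with hn
  have hfac : ∀ s ∈ S, (α * s.2.2.1 + δ * s.2.1) * (α * s.2.2.2 + γ * s.2.1) = n s.2.1 := by
    intro s hs
    obtain ⟨-, -, -, -, h5, h6⟩ := hS s hs
    simp only [hn]
    linear_combination (α * s.2.1) * h6 - α^2 * h5
  have hinj : ∀ s ∈ S, ∀ t ∈ S, s.2.1 = t.2.1 → s.2.2.1 = t.2.2.1 → s.2.2.2 = t.2.2.2 → s = t := by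
    intro s hs t ht h1 h2 h3
    obtain ⟨-, -, -, -, -, h6⟩ := hS s hs
    obtain ⟨-, -, -, -, -, h7⟩ := hS t ht
    rw [h1, h2, h3] at h6
    have : s.1 = t.1 := by apply mul_left_cancel₀ hα; linarith
    exact Prod.ext this (Prod.ext h1 (Prod.ext h2 h3))
  have hIcc : ∀ x : ℤ, |x| ≤ Y → x ∈ Icc (-(Y:ℤ)) Y := fun x hx => by
    rw [abs_le] at hx; simpa using hx
  have hcI : ((Icc (-(Y:ℤ)) Y).card : ℝ) ≤ 3 * Y := by
    rw [card_Icc]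
    have : ((Y:ℤ) + 1 - -Y).toNat = 2 * Y + 1 := by omega
    rw [this]; push_cast
    have : I1 ≤ Y := by exact_mod_cast hY
    linarith
  have hYr : I1 ≤ Y := by exact_mod_cast hY
  have hY0 : I0 < Y := by linarith
  have hτ1 : ∀ y : ℤ, |y| ≤ Y → n y ≠ 0 → ((intDiv (n y)).card : ℝ) ≤ 2 * (C * (↟7^(ε/4) * ↟Y^ε)) := by
    intro y hy hny
    have h1 : ((intDiv (n y)).card : ℝ) ≤ 2 * ((n y).natAbs.divisors.card : ℝ) := by
      exact_mod_cast card_intDiv (n y)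
    have h2 := hC (n y).natAbs (by simpa using hny)
    have hb : |n y| ≤ 7 * (Y:ℤ)^4 := by
      have b1 : |α * k * y| ≤ (Y:ℤ) * (4 * (Y:ℤ)^2) * Y := by rw [abs_mul, abs_mul]; gcongr
      have b2 : |α * β * y^2| ≤ (Y:ℤ) * Y * Y^2 := by rw [abs_mul, abs_mul, abs_pow]; gcongr
      have b3 : |γ * δ * y^2| ≤ (Y:ℤ) * Y * Y^2 := by rw [abs_mul, abs_mul, abs_pow]; gcongr
      have b4 : |α^2 * e| ≤ (Y:ℤ)^2 := by rw [abs_mul, abs_pow, he, mul_one]; gcongr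
      have b5 : (Y:ℤ)^2 ≤ Y^4 := pow_le_pow_right₀ hY' nnn
      simp only [hn]
      rw [abs_le] at *
      constructor <;> nlinarith
    have h3 : (((n y).natAbs : ℕ) : ℝ) ≤ 7 * ↟Y^4 := by
      have : (((n y).natAbs : ℕ) : ℤ) ≤ 7 * (Y:ℤ)^4 := by rw [natCast_natAbs]; exact hb
      exact_mod_cast this
    have h4 : (((n y).natAbs : ℕ) : ℝ)^(ε/4) ≤ ↟7^(ε/4) * ↟Y^ε := by
      calc _ ≤ (7 * ↟Y^4)^(ε/4) := rpow_le_rpow ppp h3 ppp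
        _ = _ := by
          rw [mul_rpow nnn ppp, ← rpow_natCast, ← rpow_mul hY0.le]
          congr 2; push_cast; ring
    have : C * (((n y).natAbs : ℕ) : ℝ)^(ε/4) ≤ C * (↟7^(ε/4) * ↟Y^ε) := by gcongr
    linarith
  have hτ2 : ((intDiv (α^2)).card : ℝ) ≤ 2 * (C * ↟Y^ε) := by
    have hA0 : |α^2| ≤ (Y:ℤ)^4 := by
      rw [abs_pow]
      calc |α|^2 ≤ (Y:ℤ)^2 := by gcongr
        _ ≤ _ := pow_le_pow_right₀ hY' nnn
    have hA1 : α^2 ≠ 0 := pow_ne_zero _ hα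
    generalize α^2 = A at hA0 hA1
    have h1 : ((intDiv A).card : ℝ) ≤ 2 * (A.natAbs.divisors.card : ℝ) := by
      exact_mod_cast card_intDiv A
    have h2 := hC A.natAbs (by simpa using hA1)
    have h3 : ((A.natAbs : ℕ) : ℝ) ≤ ↟Y^4 := by
      have : ((A.natAbs : ℕ) : ℤ) ≤ (Y:ℤ)^4 := by
        rw [natCast_natAbs]; exact hA0
      exact_mod_cast this
    have h4 : ((A.natAbs : ℕ) : ℝ)^(ε/4) ≤ ↟Y^ε := by
      calc _ ≤ (↟Y^4)^(ε/4) := rpow_le_rpow ppp h3 ppp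
        _ = _ := by
          rw [← rpow_natCast, ← rpow_mul hY0.le]
          congr 1; push_cast; ring
    have : C * ((A.natAbs : ℕ) : ℝ)^(ε/4) ≤ C * ↟Y^ε := by gcongr
    linarith
  classical
  have hS1 : ((S.filter (fun s => n s.2.1 ≠ 0)).card : ℝ) ≤ 3 * Y * (2 * (C * (↟7^(ε/4) * ↟Y^ε))) := by
    have hmap : ∀ s ∈ S.filter (fun s => n s.2.1 ≠ 0), s.2.1 ∈ Icc (-(Y:ℤ)) Y := fun s hs =>
      hIcc _ (hS s (mem_filter.mp hs).1).2.1
    rw [card_eq_sum_card_fiberwise (s := S.filter (fun s => n s.2.1 ≠ 0)) (t := Icc (-(Y:ℤ)) Y) (f := fun s => s.2.1) (fun s hs => by exact_mod_cast hmap s (by exact_mod_cast hs))]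
    push_cast
    calc _ ≤ ∑ y ∈ Icc (-(Y:ℤ)) Y, (2 * (C * (↟7^(ε/4) * ↟Y^ε))) := by
          refine sum_le_sum fun y hy => ?_
          have hy' : |y| ≤ Y := by rw [abs_le]; simpa using hy
          by_cases hny : n y = 0
          · rw [Finset.filter_filter, card_eq_zero.mpr]
            · simp; positivity
            · refine filter_eq_empty_iff.mpr ?_
              rintro s hs ⟨h1, h2⟩; exact h1 (h2 ▸ hny)
          · refine le_trans ?_ (hτ1 y hy' hny)
            norm_cast
            refine card_le_card_of_injOn (fun s => α * s.2.2.1 + δ * s.2.1) ?_ ?_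
            · intro s hs
              simp only [coe_filter, mem_filter, Set.mem_ofPred_eq] at hs
              refine mem_intDiv hny ?_
              rw [← hs.2, ← hfac s hs.1.1]; exact Dvd.intro _ rfl
            · intro s hs t ht hst
              simp only [coe_filter, mem_filter, Set.mem_ofPred_eq] at hs ht
              have e1 := hfac s hs.1.1
              have e2 := hfac t ht.1.1
              simp only at hst
              have hyy : s.2.1 = t.2.1 := by rw [hs.2, ht.2]
              have hu : s.2.2.1 = t.2.2.1 := by
                apply mul_left_cancel₀ hα; rw [hyy] at hst; linarith
              have hv : s.2.2.2 = t.2.2.2 := by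
                apply mul_left_cancel₀ hα
                rw [hst, hyy] at e1
                have h0 : α * t.2.2.1 + δ * t.2.1 ≠ 0 := by
                  intro h0; rw [h0, zero_mul, ht.2] at e2; exact hny e2.symm
                have := mul_left_cancel₀ h0 (e1.trans e2.symm)
                linarith
              exact hinj s hs.1.1 t ht.1.1 hyy hu hv
      _ = ((Icc (-(Y:ℤ)) Y).card : ℝ) * _ := by rw [sum_const, nsmul_eq_mul]
      _ ≤ _ := by gcongr
  have hS2 : ((S.filter (fun s => ¬ n s.2.1 ≠ 0)).card : ℝ) ≤ (2 * (C * ↟Y^ε)) * (2 * (3 * Y)) := by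
    have hmap : ∀ s ∈ S.filter (fun s => ¬ n s.2.1 ≠ 0), s.2.1 ∈ intDiv (α^2) := fun s hs => by
      have h0 := (mem_filter.mp hs).2
      push Not at h0
      refine mem_intDiv (by simpa using hα) ?_
      simp only [hn] at h0
      have he2 : e * e = 1 := by
        have := abs_mul_abs_self e; rw [he] at this; linarith
      refine ⟨(α * k - α * β * s.2.1 + γ * δ * s.2.1) * e, ?_⟩
      linear_combination -e * h0 - α^2 * he2
    rw [card_eq_sum_card_fiberwise (s := S.filter (fun s => ¬ n s.2.1 ≠ 0)) (t := intDiv (α^2)) (f := fun s => s.2.1) (fun s hs => by exact_mod_cast hmap s (by exact_mod_cast hs))]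
    push_cast
    calc _ ≤ ∑ y ∈ intDiv (α^2), (I2 * (3 * Y)) := by
          refine sum_le_sum fun y hy => ?_
          have hsub : ((S.filter (fun s => ¬ n s.2.1 ≠ 0)).filter (fun s => s.2.1 = y)) ⊆
            (S.filter (fun s => s.2.1 = y ∧ α * s.2.2.1 + δ * s.2.1 = 0)) ∪
            (S.filter (fun s => s.2.1 = y ∧ α * s.2.2.2 + γ * s.2.1 = 0)) := by
            intro s hs
            simp only [mem_filter, not_not] at hs
            have := hfac s hs.1.1
            rw [hs.1.2] at this
            simp only [mem_union, mem_filter]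
            rcases mul_eq_zero.mp this with h | h
            · exact Or.inl ⟨hs.1.1, hs.2, h⟩
            · exact Or.inr ⟨hs.1.1, hs.2, h⟩
          have c1 : (S.filter (fun s => s.2.1 = y ∧ α * s.2.2.1 + δ * s.2.1 = 0)).card ≤
              (Icc (-(Y:ℤ)) Y).card := by
            refine card_le_card_of_injOn (fun s => s.2.2.2) ?_ ?_
            · intro s hs
              simp only [coe_filter, Set.mem_ofPred_eq] at hs
              exact hIcc _ (hS s hs.1).2.2.2.1
            · intro s hs t ht hst
              simp only [coe_filter, Set.mem_ofPred_eq] at hs ht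
              refine hinj s hs.1 t ht.1 (by rw [hs.2.1, ht.2.1]) ?_ hst
              apply mul_left_cancel₀ hα
              have h1 := hs.2.2
              have h2 := ht.2.2
              rw [hs.2.1] at h1; rw [ht.2.1] at h2; linarith
          have c2 : (S.filter (fun s => s.2.1 = y ∧ α * s.2.2.2 + γ * s.2.1 = 0)).card ≤
              (Icc (-(Y:ℤ)) Y).card := by
            refine card_le_card_of_injOn (fun s => s.2.2.1) ?_ ?_
            · intro s hs
              simp only [coe_filter, Set.mem_ofPred_eq] at hs
              exact hIcc _ (hS s hs.1).2.2.1
            · intro s hs t ht hst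
              simp only [coe_filter, Set.mem_ofPred_eq] at hs ht
              refine hinj s hs.1 t ht.1 (by rw [hs.2.1, ht.2.1]) hst ?_
              apply mul_left_cancel₀ hα
              have h1 := hs.2.2
              have h2 := ht.2.2
              rw [hs.2.1] at h1; rw [ht.2.1] at h2; linarith
          have c3 := (card_le_card hsub).trans (card_union_le _ _)
          have c4 : (((S.filter (fun s => ¬ n s.2.1 ≠ 0)).filter (fun s => s.2.1 = y)).card : ℝ) ≤
              ((2 * (Icc (-(Y:ℤ)) Y).card : ℕ) : ℝ) := by
            exact_mod_cast c3.trans ooo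
          push_cast at c4
          linarith
      _ = ((intDiv (α^2)).card : ℝ) * _ := by rw [sum_const, nsmul_eq_mul]
      _ ≤ _ := by gcongr
  have hsum : (S.card : ℝ) = ((S.filter (fun s => n s.2.1 ≠ 0)).card : ℝ) +
      ((S.filter (fun s => ¬ n s.2.1 ≠ 0)).card : ℝ) := by
    exact_mod_cast (card_filter_add_card_filter_not (s := S) (fun s => n s.2.1 ≠ 0)).symm
  rw [hsum, rpow_add hY0, rpow_one]
  calc _ ≤ _ := add_le_add hS1 hS2
    _ = _ := by ring

abbrev M2 := Matrix (Fin 2) (Fin 2) ℤ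

theorem hp_matrix (ε : ℝ) (hε : 0 < ε) : ∃ C : ℝ, 1 ≤ C ∧ ∀ (Y : ℕ) (h : M2) (k : ℤ), 1 ≤ Y → h ≠ 0 →
    (∀ i j, |h i j| ≤ Y) → ∀ S : Finset M2,
    (∀ g ∈ S, g.det = 1 ∧ (∀ i j, |g i j| ≤ Y) ∧
      h 0 0 * g 0 0 + h 0 1 * g 0 1 + h 1 0 * g 1 0 + h 1 1 * g 1 1 = k) →
    (S.card : ℝ) ≤ C * ↟Y ^ (1 + ε) := by
  obtain ⟨C, hC1, hC⟩ := hp_core ε hε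
  refine ⟨C, hC1, fun Y h k hY h0 hb S hS => ?_⟩
  have main : ∀ (a b c d a' b' c' d' : Fin 2) (e : ℤ), |e| = 1 →
      h a a' ≠ 0 → (∀ g ∈ S, g a a' * g b b' - g c c' * g d d' = e) →
      (∀ g ∈ S, h a a' * g a a' + h b b' * g b b' + h c c' * g c c' + h d d' * g d d' = k) →
      (∀ g g' : M2, g a a' = g' a a' → g b b' = g' b b' → g c c' = g' c c' → g d d' = g' d d' → g = g') →
      (S.card : ℝ) ≤ C * ↟Y ^ (1 + ε) := by
    intro a b c d a' b' c' d' e he ha h1 h2 h3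
    classical
    have hinj : Set.InjOn (fun g : M2 => (g a a', g b b', g c c', g d d')) (S : Set M2) := by
      intro g _ g' _ hg
      simp only [Prod.mk.injEq] at hg
      exact h3 g g' hg.1 hg.2.1 hg.2.2.1 hg.2.2.2
    rw [← card_image_of_injOn hinj]
    refine hC Y _ _ _ _ k e hY ha (hb _ _) (hb b b') (hb c c') (hb d d') he _ ?_
    intro s hs
    obtain ⟨g, hg, rfl⟩ := mem_image.mp hs
    obtain ⟨-, h5, -⟩ := hS g hg
    exact ⟨h5 _ _, h5 _ _, h5 _ _, h5 _ _, h1 g hg, h2 g hg⟩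
  have hext : ∀ g g' : M2, g 0 0 = g' 0 0 → g 0 1 = g' 0 1 → g 1 0 = g' 1 0 → g 1 1 = g' 1 1 → g = g' := by
    intro g g' h1 h2 h3 h4
    ext i j; fin_cases i <;> fin_cases j <;> assumption
  have hdet : ∀ g ∈ S, g 0 0 * g 1 1 - g 0 1 * g 1 0 = 1 := fun g hg => by
    rw [← det_fin_two]; exact (hS g hg).1
  by_cases h00 : h 0 0 = 0
  · by_cases h11 : h 1 1 = 0
    · by_cases h01 : h 0 1 = 0
      · by_cases h10 : h 1 0 = 0
        · exact absurd (hext h 0 h00 h01 h10 h11) h0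
        · exact main 1 0 0 1 0 1 0 1 (-1) nnn h10 (fun g hg => by linarith [hdet g hg])
            (fun g hg => by linarith [(hS g hg).2.2]) (fun g g' h1 h2 h3 h4 => hext _ _ h3 h2 h1 h4)
      · exact main 0 1 0 1 1 0 0 1 (-1) nnn h01 (fun g hg => by linarith [hdet g hg])
            (fun g hg => by linarith [(hS g hg).2.2]) (fun g g' h1 h2 h3 h4 => hext _ _ h3 h1 h2 h4)
    · exact main 1 0 0 1 1 0 1 0 1 nnn h11 (fun g hg => by linarith [hdet g hg])
            (fun g hg => by linarith [(hS g hg).2.2]) (fun g g' h1 h2 h3 h4 => hext _ _ h2 h3 h4 h1)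
  · exact main 0 1 0 1 0 1 1 0 1 nnn h00 (fun g hg => by linarith [hdet g hg])
            (fun g hg => by linarith [(hS g hg).2.2]) (fun g g' h1 h2 h3 h4 => hext _ _ h1 h3 h4 h2)


def boxM (K : ℕ) : Finset M2 :=
  (Fintype.piFinset (fun _ : Fin 2 => Fintype.piFinset (fun _ : Fin 2 => Icc (-(K:ℤ)) K)) :
    Finset (Fin 2 → Fin 2 → ℤ))

theorem mem_boxM {K : ℕ} {h : M2} : h ∈ boxM K ↔ ∀ i j, |h i j| ≤ K := by
  have : h ∈ boxM K ↔ ∀ i j, h i j ∈ Icc (-(K:ℤ)) K := by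
    unfold boxM
    refine Fintype.mem_piFinset.trans (forall_congr' fun i => Fintype.mem_piFinset)
  rw [this]
  simp only [mem_Icc, abs_le]

theorem card_boxM (K : ℕ) : (boxM K).card = (2 * K + 1) ^ 4 := by
  unfold boxM
  refine (Fintype.card_piFinset _).trans ?_
  simp only [Fintype.card_piFinset, card_Icc, prod_const, card_univ, Fintype.card_fin]
  have : ((K:ℤ) + 1 - -K).toNat = 2 * K + 1 := by omega
  rw [this]; ring

def E2 (M : Finset M2) (q : ℕ) : Finset (M2 × M2) :=
  (M ×ˢ M).filter (fun x => ∀ i j, (q:ℤ) ∣ x.2 i j - x.1 i j)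

set_option maxHeartbeats 400000 in
theorem flat_bound (ε : ℝ) (hε : 0 < ε) : ∃ C : ℝ, 1 ≤ C ∧ ∀ (H q : ℕ) (M : Finset M2), 1 ≤ q → q ≤ H →
    (∀ g ∈ M, g.det = 1 ∧ ∀ i j, 0 ≤ g i j ∧ g i j ≤ H) →
    ((E2 M q).card : ℝ) ≤ M.card + C * ↟H ^ (5 + ε) / ↟q ^ 4 := by
  obtain ⟨C, hC1, hC⟩ := hp_matrix ε hε
  refine ⟨81 * C, by linarith, fun H q M hq hqH hM => ?_⟩
  classical
  set K := H / q with hK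
  have hq0 : (0:ℤ) < q := by exact_mod_cast hq
  have hH1 : 1 ≤ H := hq.trans hqH
  let f : M2 × M2 → M2 := fun x => Matrix.of fun i j => (x.2 i j - x.1 i j) / q
  have hf : ∀ x ∈ E2 M q, ∀ i j, x.2 i j = x.1 i j + q * f x i j := by
    intro x hx i j
    have h1 := (mem_filter.mp hx).2 i j
    have := Int.mul_ediv_cancel' h1
    simp only [f, Matrix.of_apply]; linarith
  have hfb : ∀ x ∈ E2 M q, f x ∈ boxM K := by
    intro x hx
    rw [mem_boxM]; intro i j
    have h1 := hf x hx i j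
    have hx' := (mem_product.mp (mem_filter.mp hx).1)
    have h2 := (hM _ hx'.1).2 i j
    have h3 := (hM _ hx'.2).2 i j
    have h4 : q * |f x i j| ≤ (H:ℤ) := by
      rw [← abs_of_pos hq0, ← abs_mul, abs_le]; constructor <;> linarith [h2.1, h3.1]
    have : |f x i j| ≤ (H:ℤ) / q := by
      rw [Int.le_ediv_iff_mul_le hq0]; linarith
    simpa [hK] using this
  have hfib : ∀ h ∈ boxM K, (((E2 M q).filter (fun x => f x = h)).card : ℝ) ≤
      if h = 0 then (M.card : ℝ) else C * ↟H ^ (1 + ε) := by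
    intro h hh
    have hinj : Set.InjOn (fun x : M2 × M2 => x.1) ((E2 M q).filter (fun x => f x = h) : Set (M2 × M2)) := by
      intro x hx y hy hxy
      simp only [coe_filter, Set.mem_ofPred_eq] at hx hy
      refine Prod.ext hxy ?_
      ext i j
      rw [hf x hx.1, hf y hy.1, hx.2, hy.2]; simp only at hxy; rw [hxy]
    rw [← card_image_of_injOn hinj]
    split_ifs with h0
    · norm_cast
      refine card_le_card ?_
      intro g hg
      obtain ⟨x, hx, rfl⟩ := mem_image.mp hg
      exact (mem_product.mp (mem_filter.mp (mem_filter.mp hx).1).1).1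
    · rw [mem_boxM] at hh
      have hKH : K ≤ H := Nat.div_le_self _ _
      refine hC H (!![h 1 1, -h 1 0; -h 0 1, h 0 0]) (-(q * h.det)) hH1 ?_ ?_ _ ?_
      · intro hz
        apply h0
        have e1 := congrFun (congrFun hz 0) 0
        have e2 := congrFun (congrFun hz 0) 1
        have e3 := congrFun (congrFun hz 1) 0
        have e4 := congrFun (congrFun hz 1) 1
        simp at e1 e2 e3 e4
        ext i j; fin_cases i <;> fin_cases j <;> simp [e1, e2, e3, e4]
      · have hb : ∀ i j, |h i j| ≤ H := fun i j => (hh i j).trans (by exact_mod_cast hKH)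
        intro i j; fin_cases i <;> fin_cases j <;> simp [abs_neg, hb]
      · intro g hg
        obtain ⟨x, hx, rfl⟩ := mem_image.mp hg
        obtain ⟨hx1, hx2⟩ := mem_filter.mp hx
        have hx' := (mem_product.mp (mem_filter.mp hx1).1)
        refine ⟨(hM _ hx'.1).1, fun i j => ?_, ?_⟩
        · have := (hM _ hx'.1).2 i j
          rw [abs_le]; constructor <;> linarith [this.1]
        · have d1 := (hM _ hx'.1).1
          have d2 := (hM _ hx'.2).1
          rw [det_fin_two] at d1 d2 ⊢
          simp only [hf x hx1, hx2] at d2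
          have hq' : (q:ℤ) ≠ 0 := hq0.ne'
          apply mul_left_cancel₀ hq'
          simp
          linear_combination d2 - d1
  rw [card_eq_sum_card_fiberwise (s := E2 M q) (t := boxM K) (f := f)
    (fun s hs => by exact_mod_cast hfb s (by exact_mod_cast hs))]
  push_cast
  have hH0 : I0 < H := by exact_mod_cast hH1
  have hqr : I0 < q := by exact_mod_cast hq
  calc _ ≤ ∑ h ∈ boxM K, ((if h = 0 then (M.card : ℝ) else 0) + C * ↟H ^ (1 + ε)) := by
        refine sum_le_sum fun h hh => (hfib h hh).trans ?_
        have : 0 ≤ C * ↟H ^ (1 + ε) := by positivity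
        split_ifs <;> linarith
    _ = M.card + (2 * K + 1 : ℝ)^4 * (C * ↟H ^ (1 + ε)) := by
        rw [sum_add_distrib, sum_ite_eq', sum_const, card_boxM]
        have : (0 : M2) ∈ boxM K := by rw [mem_boxM]; simp
        simp [this]
    _ ≤ M.card + (3 * (H / q : ℝ))^4 * (C * ↟H ^ (1 + ε)) := by
        gcongr
        have h1 : ↟K ≤ H / q := cast_div_le
        have h2 : I1 ≤ H / q := by rw [le_div_iff₀ hqr]; simpa using (by exact_mod_cast hqH)
        linarith
    _ = _ := by
        have : ↟H ^ (5 + ε) = ↟H^4 * ↟H ^ (1 + ε) := by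
          rw [← rpow_natCast, ← rpow_add hH0]; congr 1; push_cast; ring
        rw [this]; field_simp; ring


def wedge {R : Type*} [CommRing R] (x y : Fin 2 → R) : R := x 0 * y 1 - x 1 * y 0

abbrev Vp (p : ℕ) := Fin 2 → ZMod p
abbrev SLp (p : ℕ) := Matrix.SpecialLinearGroup (Fin 2) (ZMod p)

theorem wedge_vecMul {R : Type*} [CommRing R] (x y : Fin 2 → R) (g : Matrix (Fin 2) (Fin 2) R) :
    wedge (x ᵥ* g) (y ᵥ* g) = wedge x y * g.det := by
  simp only [wedge, vecMul, dotProduct, Fin.sum_univ_two, det_fin_two]; ring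

structure Nw (p : ℕ) [NeZero p] (f : Vp p → ℝ) : Prop where
  zero : f 0 = 0
  hom : ∀ c : ZMod p, c ≠ 0 → ∀ v, f (c • v) = f v
  sum : ∑ v, f v = 0

def cc (p : ℕ) (v v' : Vp p) : ℝ :=
  if v = 0 ∨ v' = 0 then 0 else if wedge v v' = 0 then p else -1

section single
variable {p : ℕ} [Fact p.Prime]

theorem exists_wedge_one {F : Type*} [Field F] (x : Fin 2 → F) (hx : x ≠ 0) : ∃ w : Fin 2 → F, wedge x w = 1 := by
  by_cases h0 : x 0 = 0
  · have h1 : x 1 ≠ 0 := fun h1 => hx (by ext i; fin_cases i <;> assumption)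
    exact ⟨![-(x 1)⁻¹, 0], by simp [wedge, h1]⟩
  · exact ⟨![0, (x 0)⁻¹], by simp [wedge, h0]⟩

theorem decomp_eq {F : Type*} [Field F] (x w y : Fin 2 → F) (h : wedge x w = 1) :
    y = wedge y w • x + wedge x y • w := by
  simp only [wedge] at *
  ext i; fin_cases i
  · simp; linear_combination (-y 0) * h
  · simp; linear_combination (-y 1) * h

theorem sum_decomp (x w : Vp p) (h : wedge x w = 1) (Φ : Vp p → ℝ) :
    ∑ y, Φ y = ∑ b : ZMod p, ∑ a : ZMod p, Φ (a • x + b • w) := by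
  rw [← Fintype.sum_prod_type' (f := fun b a => Φ (a • x + b • w))]
  symm
  refine Fintype.sum_bijective (fun z : ZMod p × ZMod p => z.2 • x + z.1 • w) ?_ _ _ (fun _ => rfl)
  constructor
  · rintro ⟨b, a⟩ ⟨b', a'⟩ hz
    simp only at hz
    have e1 := congrArg (fun y => wedge x y) hz
    have e2 := congrArg (fun y => wedge y w) hz
    simp only [wedge, Pi.add_apply, Pi.smul_apply, smul_eq_mul] at e1 e2 h
    ext
    · show b = b'; linear_combination e1 - (b - b') * h
    · show a = a'; linear_combination e2 - (a - a') * h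
  · intro y
    exact ⟨(wedge x y, wedge y w), (decomp_eq x w y h).symm⟩

theorem wedge_decomp (x w : Vp p) (h : wedge x w = 1) (a b : ZMod p) : wedge x (a • x + b • w) = b := by
  simp only [wedge, Pi.add_apply, Pi.smul_apply, smul_eq_mul] at *
  linear_combination b * h

theorem sum_SL_indep (v v' : Vp p) (t : ZMod p) (ht : t ≠ 0) (hvv : wedge v v' = t) (F : Vp p → Vp p → ℝ) :
    ∑ g : SLp p, F (v ᵥ* g.1) (v' ᵥ* g.1) =
      ∑ x, ∑ x', if wedge x x' = t then F x x' else 0 := by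
  rw [← Fintype.sum_prod_type' (f := fun x x' => if wedge x x' = t then F x x' else 0),
    ← sum_filter]
  set A : Matrix (Fin 2) (Fin 2) (ZMod p) := Matrix.of ![v, v'] with hA
  have hAdet : A.det = t := by rw [det_fin_two, ← hvv]; simp [hA, wedge]
  have hAu : IsUnit A.det := by rw [hAdet]; exact isUnit_iff_ne_zero.mpr ht
  have hrow : ∀ g : Matrix (Fin 2) (Fin 2) (ZMod p), A * g = Matrix.of ![v ᵥ* g, v' ᵥ* g] := by
    intro g; ext i j; fin_cases i <;> simp [hA, Matrix.mul_apply, vecMul, dotProduct]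
  refine Finset.sum_bij (fun g _ => (v ᵥ* g.1, v' ᵥ* g.1)) ?_ ?_ ?_ ?_
  · intro g _
    simp [wedge_vecMul, hvv]
  · intro g _ g' _ hgg
    simp only [Prod.mk.injEq] at hgg
    have : A * g.1 = A * g'.1 := by rw [hrow, hrow, hgg.1, hgg.2]
    apply Subtype.ext
    have := congrArg (fun X => A⁻¹ * X) this
    simpa [← Matrix.mul_assoc, nonsing_inv_mul _ hAu] using this
  · rintro ⟨x, x'⟩ hx
    simp only [mem_filter, mem_univ, true_and] at hx
    set X : Matrix (Fin 2) (Fin 2) (ZMod p) := Matrix.of ![x, x'] with hX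
    have hXdet : X.det = t := by rw [det_fin_two, ← hx]; simp [hX, wedge]
    refine ⟨⟨A⁻¹ * X, ?_⟩, mem_univ _, ?_⟩
    · rw [det_mul, hXdet, Matrix.det_nonsing_inv, hAdet, Ring.inverse_mul_cancel]
      exact isUnit_iff_ne_zero.mpr ht
    · have h1 := hrow (A⁻¹ * X)
      rw [← Matrix.mul_assoc, mul_nonsing_inv _ hAu, Matrix.one_mul] at h1
      have e0 := congrFun h1 0
      have e1 := congrFun h1 1
      simp only [hX] at e0 e1
      exact Prod.ext e0.symm e1.symm
  · intro g _; rfl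

theorem card_nonzero : ((univ.filter (fun a : ZMod p => a ≠ 0)).card : ℝ) = p - 1 := by
  rw [filter_ne', card_erase_of_mem (mem_univ _), card_univ, ZMod.card,
    cast_sub (Fact.out : p.Prime).one_le]; simp

theorem line_sum (f : Vp p → ℝ) (hf : Nw p f) (x : Vp p) (hx : x ≠ 0) :
    (∑ x', if wedge x x' = 0 then f x' else 0) = (p - 1) * f x := by
  obtain ⟨w, hw⟩ := exists_wedge_one x hx
  rw [sum_decomp x w hw]
  simp only [wedge_decomp x w hw]
  rw [sum_eq_single 0 (fun b _ hb => by simp [hb]) (by simp)]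
  simp only [if_true, zero_smul, add_zero]
  rw [← card_nonzero (p := p), ← nsmul_eq_mul, ← sum_const, sum_filter]
  refine sum_congr rfl fun a _ => ?_
  split_ifs with h
  · exact hf.hom a h x
  · push Not at h; rw [h, zero_smul, hf.zero]

theorem single_ident (f f' : Vp p → ℝ) (hf : Nw p f) (hf' : Nw p f') (v v' : Vp p) :
    ∑ g : SLp p, f (v ᵥ* g.1) * f' (v' ᵥ* g.1) = cc p v v' * ∑ x, f x * f' x := by
  unfold cc
  have hp1 : I1 < p := by exact_mod_cast (Fact.out : p.Prime).one_lt
  by_cases h0 : v = 0 ∨ v' = 0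
  · rw [if_pos h0, zero_mul]
    refine sum_eq_zero fun g _ => ?_
    rcases h0 with h | h
    · rw [h, zero_vecMul, hf.zero, zero_mul]
    · rw [h, zero_vecMul, hf'.zero, mul_zero]
  rw [if_neg h0]; push Not at h0
  by_cases hw : wedge v v' = 0
  · rw [if_pos hw]
    obtain ⟨w, hw1⟩ := exists_wedge_one v h0.1
    have hv' : v' = wedge v' w • v := by
      have := decomp_eq v w v' hw1; rw [hw, zero_smul, add_zero] at this; exact this
    have hc : wedge v' w ≠ 0 := fun h => h0.2 (by rw [hv', h, zero_smul])
    have h1 : ∀ g : SLp p, f (v ᵥ* g.1) * f' (v' ᵥ* g.1) =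
        (fun x (_ : Vp p) => f x * f' x) (v ᵥ* g.1) (w ᵥ* g.1) := by
      intro g; simp only
      rw [hv', smul_vecMul, hf'.hom _ hc]
    refine (sum_congr rfl (fun g _ => h1 g)).trans ((sum_SL_indep v w 1 one_ne_zero hw1 (fun x (_ : Vp p) => f x * f' x)).trans ?_)
    rw [mul_sum]
    refine sum_congr rfl fun x _ => ?_
    by_cases hx : x = 0
    · simp [hx, hf.zero]
    obtain ⟨w', hw'⟩ := exists_wedge_one x hx
    rw [sum_decomp x w' hw']
    simp only [wedge_decomp x w' hw']
    rw [sum_eq_single 1 (fun b _ hb => by simp [hb]) (by simp)]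
    simp [ZMod.card]
  · rw [if_neg hw]
    set t := wedge v v' with ht
    set S : ZMod p → ℝ := fun t => ∑ x, ∑ x', if wedge x x' = t then f x * f' x' else 0 with hS
    have h1 := sum_SL_indep v v' t hw rfl (fun x x' => f x * f' x')
    rw [h1]
    show S t = _
    have hscale : ∀ s : ZMod p, s ≠ 0 → S s = S t := by
      intro s hs
      simp only [hS]
      refine sum_congr rfl fun x _ => ?_
      have hu : t / s ≠ 0 := div_ne_zero hw hs
      refine Fintype.sum_equiv (MulAction.toPerm (Units.mk0 _ hu)) _ _ fun x' => ?_
      have e1 : (MulAction.toPerm (Units.mk0 _ hu)) x' = (t / s) • x' := rfl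
      rw [e1, hf'.hom _ hu]
      have e2 : wedge x ((t/s) • x') = (t / s) * wedge x x' := by simp [wedge]; ring
      rw [e2]
      congr 1
      rw [eq_iff_iff]
      constructor
      · intro h; rw [h]; field_simp
      · intro h; field_simp at h; exact h
    have htot : ∑ s, S s = 0 := by
      simp only [hS]
      rw [sum_comm]
      have : ∀ x, ∑ s : ZMod p, ∑ x', (if wedge x x' = s then f x * f' x' else 0) = 0 := by
        intro x
        rw [sum_comm]
        simp [← mul_sum, hf'.sum]
      simp [this]
    have hS0 : S 0 = (p - 1) * ∑ x, f x * f' x := by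
      simp only [hS]
      rw [mul_sum]
      refine sum_congr rfl fun x _ => ?_
      by_cases hx : x = 0
      · simp [hx, hf.zero]
      rw [show (p - 1 : ℝ) * (f x * f' x) = f x * ((p-1) * f' x) by ring, ← line_sum f' hf' x hx,
        mul_sum]
      simp
    have hsplit : ∑ s, S s = S 0 + (p - 1) * S t := by
      rw [← add_sum_erase _ _ (mem_univ (0 : ZMod p))]
      rw [sum_congr rfl (fun s hs => hscale s (ne_of_mem_erase hs)), sum_const,
        nsmul_eq_mul, ← card_nonzero (p := p), filter_ne']
    rw [htot, hS0] at hsplit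
    have : (p - 1 : ℝ) * (S t + ∑ x, f x * f' x) = 0 := by linarith
    rcases mul_eq_zero.mp this with h | h <;> linarith

theorem cc_symm (v v' : Vp p) : cc p v v' = cc p v' v := by
  have : wedge v' v = - wedge v v' := by simp [wedge]; ring
  unfold cc; rw [this]; simp [or_comm]

theorem cc_row (v : Vp p) : ∑ x, |cc p v x| ≤ 2 * (p:ℝ)^2 := by
  by_cases hv : v = 0
  · simp [cc, hv]
  obtain ⟨w, hw⟩ := exists_wedge_one v hv
  rw [sum_decomp v w hw]
  have h1 : ∀ b a : ZMod p, |cc p v (a • v + b • w)| ≤ (if b = 0 then ↟p else 0) + 1 := by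
    intro b a
    unfold cc; rw [wedge_decomp v w hw]
    split_ifs <;> simp <;> positivity
  refine (sum_le_sum fun b _ => sum_le_sum fun a _ => h1 b a).trans (le_of_eq ?_)
  simp [sum_add_distrib, ZMod.card, mul_add]; ring

end single

theorem prod_ident (n : ℕ) : ∀ (V G : Fin n → Type) [∀ i, Fintype (V i)] [∀ i, Fintype (G i)]
    (act : ∀ i, V i → G i → V i) (N : ∀ i, (V i → ℝ) → Prop) (c : ∀ i, V i → V i → ℝ)
    (_ : ∀ i f f', N i f → N i f' → ∀ v v', ∑ g, f (act i v g) * f' (act i v' g) = c i v v' * ∑ x, f x * f' x)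
    (f f' : (∀ i, V i) → ℝ) (_ : ∀ i v, N i (fun x => f (Function.update v i x)))
    (_ : ∀ i v, N i (fun x => f' (Function.update v i x))) (v v' : ∀ i, V i),
    ∑ g : (∀ i, G i), f (fun i => act i (v i) (g i)) * f' (fun i => act i (v' i) (g i)) =
      (∏ i, c i (v i) (v' i)) * ∑ x, f x * f' x := by
  induction n with
  | zero =>
    intro V G _ _ act N c h f f' hf hf' v v'
    simp only [Finset.univ_eq_empty, prod_empty, one_mul]
    rw [Fintype.sum_unique, Fintype.sum_unique]
    congr 2 <;> exact Subsingleton.elim _ _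
  | succ n ih =>
    intro V G _ _ act N c h f f' hf hf' v v'
    rw [← (Fin.consEquiv G).sum_comp, ← (Fin.consEquiv V).sum_comp, Fintype.sum_prod_type,
      Fintype.sum_prod_type, sum_comm, Fin.prod_univ_succ]
    have hcons : ∀ (u : ∀ i, V i) (g0 : G 0) (g : ∀ i : Fin n, G i.succ),
        (fun i => act i (u i) ((Fin.consEquiv G) (g0, g) i)) =
          Fin.cons (act 0 (u 0) g0) (fun i => act i.succ (u i.succ) (g i)) := by
      intro u g0 g; funext i; refine Fin.cases ?_ (fun i => ?_) i <;> simp [Fin.consEquiv]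
    simp only [hcons]
    have hN0 : ∀ (F : (∀ i, V i) → ℝ) (_ : ∀ i v, N i (fun x => F (Function.update v i x)))
        (u : ∀ i : Fin n, V i.succ), N 0 (fun x => F (Fin.cons x u)) := by
      intro F hF u
      have := hF 0 (Fin.cons (v 0) u)
      simpa [Fin.update_cons_zero] using this
    have hNs : ∀ (F : (∀ i, V i) → ℝ) (_ : ∀ i v, N i (fun x => F (Function.update v i x))) (x0 : V 0)
        (i : Fin n) (u : ∀ i : Fin n, V i.succ), N i.succ (fun x => F (Fin.cons x0 (Function.update u i x))) := by
      intro F hF x0 i u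
      have := hF i.succ (Fin.cons x0 u)
      simpa [Fin.cons_update] using this
    have step1 : ∀ g : (∀ i : Fin n, G i.succ), (∑ g0 : G 0,
        f (Fin.cons (act 0 (v 0) g0) (fun i => act i.succ (v i.succ) (g i))) *
        f' (Fin.cons (act 0 (v' 0) g0) (fun i => act i.succ (v' i.succ) (g i)))) =
        c 0 (v 0) (v' 0) * ∑ x0, f (Fin.cons x0 (fun i => act i.succ (v i.succ) (g i))) *
          f' (Fin.cons x0 (fun i => act i.succ (v' i.succ) (g i))) := fun g =>
      h 0 _ _ (hN0 f hf _) (hN0 f' hf' _) (v 0) (v' 0)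
    rw [sum_congr rfl (fun g _ => step1 g), ← mul_sum, sum_comm, mul_assoc]
    congr 1
    rw [mul_sum]
    refine sum_congr rfl fun x0 _ => ?_
    exact ih (fun i => V i.succ) (fun i => G i.succ) (fun i => act i.succ) (fun i => N i.succ)
      (fun i => c i.succ) (fun i => h i.succ) (fun u => f (Fin.cons x0 u)) (fun u => f' (Fin.cons x0 u))
      (hNs f hf x0) (hNs f' hf' x0) (fun i => v i.succ) (fun i => v' i.succ)


section family
variable {n : ℕ} (p : Fin n → ℕ) [hp : ∀ i, Fact (p i).Prime]

abbrev VV := ∀ i, Vp (p i)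

def rdM (m : M2) (k : ℕ) : Matrix (Fin 2) (Fin 2) (ZMod k) := m.map (Int.cast : ℤ → ZMod k)

theorem rdM_mul (m m' : M2) (k : ℕ) : rdM (m * m') k = rdM m k * rdM m' k := by
  unfold rdM
  exact Matrix.map_mul (f := castRingHom (ZMod k))

theorem rdM_det (m : M2) (k : ℕ) : (rdM m k).det = ((m.det : ℤ) : ZMod k) := by
  simp [rdM, det_fin_two]

def actM (v : VV p) (m : M2) : VV p := fun i => v i ᵥ* rdM m (p i)

theorem actM_mul (v : VV p) (m m' : M2) : actM p v (m * m') = actM p (actM p v m) m' := by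
  funext i; simp [actM, rdM_mul, vecMul_vecMul]

def TM (M : Finset M2) (f : VV p → ℝ) (v : VV p) : ℝ := ∑ m ∈ M, f (actM p v m)

def New (f : VV p → ℝ) : Prop := ∀ i v, Nw (p i) (fun x => f (Function.update v i x))

theorem actM_update (v : VV p) (m : M2) (i : Fin n) (x : Vp (p i)) :
    actM p (Function.update v i x) m = Function.update (actM p v m) i (x ᵥ* rdM m (p i)) := by
  funext j
  by_cases h : j = i
  · subst h; simp [actM]
  · simp [actM, h]

theorem vecMul_bij {k : ℕ} (g : Matrix (Fin 2) (Fin 2) (ZMod k)) (hg : IsUnit g.det) :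
    Function.Bijective (fun x : Vp k => x ᵥ* g) := by
  constructor
  · intro x y h
    have := congrArg (fun z => z ᵥ* g⁻¹) h
    simpa [vecMul_vecMul, mul_nonsing_inv _ hg] using this
  · intro y
    exact ⟨y ᵥ* g⁻¹, by simp [vecMul_vecMul, nonsing_inv_mul _ hg]⟩

theorem Nw.comp {k : ℕ} [NeZero k] {f : Vp k → ℝ} (hf : Nw k f) (g : Matrix (Fin 2) (Fin 2) (ZMod k))
    (hg : IsUnit g.det) : Nw k (fun x => f (x ᵥ* g)) where
  zero := by simp [hf.zero]
  hom c hc v := by simp [smul_vecMul, hf.hom c hc]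
  sum := by
    rw [← hf.sum]
    exact Fintype.sum_bijective _ (vecMul_bij g hg) _ _ (fun _ => rfl)

theorem rdM_unit {m : M2} (hm : m.det = 1) (k : ℕ) : IsUnit (rdM m k).det := by
  rw [rdM_det, hm]; simp

theorem New.TM {f : VV p → ℝ} (hf : New p f) (M : Finset M2) (hM : ∀ m ∈ M, m.det = 1) : New p (TM p M f) := by
  intro i v
  have key : ∀ m ∈ M, Nw (p i) (fun x => f (actM p (Function.update v i x) m)) := by
    intro m hm
    simp only [actM_update]
    exact (hf i (actM p v m)).comp _ (rdM_unit (hM m hm) _)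
  refine ⟨?_, ?_, ?_⟩
  · exact sum_eq_zero fun m hm => (key m hm).zero
  · intro c hc x
    exact sum_congr rfl fun m hm => (key m hm).hom c hc x
  · simp only [_root_.TM]
    rw [sum_comm]
    exact sum_eq_zero fun m hm => (key m hm).sum

theorem actM_bij {m : M2} (hm : m.det = 1) : Function.Bijective (fun v : VV p => actM p v m) := by
  constructor
  · intro x y h; funext i
    exact (vecMul_bij _ (rdM_unit hm (p i))).1 (congrFun h i)
  · intro y
    choose z hz using fun i => (vecMul_bij _ (rdM_unit hm (p i))).2 (y i)
    exact ⟨z, funext hz⟩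

def toG (m : M2) (hm : m.det = 1) : ∀ i, SLp (p i) := fun i => ⟨rdM m (p i), by rw [rdM_det, hm]; simp⟩

def nrm (f : VV p → ℝ) : ℝ := ∑ v, f v ^ 2

theorem nrm_nonneg (f : VV p → ℝ) : 0 ≤ nrm p f := sum_nonneg fun _ _ => sq_nonneg _

theorem toG_eq_iff (hinj : Function.Injective p) {m m' : M2} (hm : m.det = 1) (hm' : m'.det = 1) :
    toG p m hm = toG p m' hm' ↔ ∀ i j, ((∏ k, p k : ℕ) : ℤ) ∣ m' i j - m i j := by
  constructor
  · intro h i j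
    push_cast
    refine prod_dvd_of_coprime ?_ ?_
    · intro a _ b _ hab
      have : Coprime (p a) (p b) := (coprime_primes (hp a).out (hp b).out).mpr (fun h => hab (hinj h))
      exact isCoprime_iff_coprime.mpr this
    · intro k _
      have h1 := congrArg (fun z => z.1 i j) (congrFun h k)
      simp only [toG, rdM, map_apply] at h1
      exact ((ZMod.intCast_eq_intCast_iff_dvd_sub _ _ _).mp h1)
  · intro h
    funext k
    apply Subtype.ext
    ext i j
    simp only [toG, rdM, map_apply]
    refine (ZMod.intCast_eq_intCast_iff_dvd_sub _ _ _).mpr (dvd_trans ?_ (h i j))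
    exact_mod_cast dvd_prod_of_mem p (mem_univ k)

theorem contraction (hinj : Function.Injective p) (M : Finset M2) (hM : ∀ m ∈ M, m.det = 1)
    (f : VV p → ℝ) (hf : New p f) :
    nrm p (TM p M f) ≤ (E2 M (∏ k, p k)).card * (∏ k, (2 * (p k : ℝ)^2)) * nrm p f := by
  classical
  set u := TM p M f with hu
  set N := nrm p u with hN
  have hN0 : 0 ≤ N := nrm_nonneg p u
  set R : ℝ := ∏ k, (2 * (p k : ℝ)^2) with hR
  have hR0 : 0 ≤ R := prod_nonneg fun _ _ => by positivity
  let ψ : (∀ i, SLp (p i)) → ℝ := fun g => ∑ v : VV p, u v * f (fun i => v i ᵥ* (g i).1)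
  let μ : (∀ i, SLp (p i)) → ℝ := fun g => ∑ m ∈ M.attach, if toG p m.1 (hM m.1 m.2) = g then 1 else 0
  have h1 : N = ∑ g, μ g * ψ g := by
    have : ∀ g, μ g * ψ g = ∑ m ∈ M.attach, if toG p m.1 (hM m.1 m.2) = g then ψ g else 0 := by
      intro g; simp only [μ]; rw [sum_mul]; simp
    rw [sum_congr rfl (fun g _ => this g), sum_comm]
    simp only [sum_ite_eq, mem_univ, if_true]
    simp only [ψ]
    rw [sum_comm]
    refine sum_congr rfl fun v _ => ?_
    rw [← mul_sum, pow_two]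
    congr 1
    rw [hu]; unfold TM
    rw [← sum_attach]
    rfl
  have h2 : N ^ 2 ≤ (∑ g, μ g ^ 2) * (∑ g, ψ g ^ 2) := by
    rw [h1]; exact sum_mul_sq_le_sq_mul_sq _ _ _
  have h3 : ∑ g, μ g ^ 2 = (E2 M (∏ k, p k)).card := by
    have : ∀ g, μ g ^ 2 = ∑ m ∈ M.attach, ∑ m' ∈ M.attach,
        if toG p m.1 (hM m.1 m.2) = g then (if toG p m'.1 (hM m'.1 m'.2) = g then 1 else 0) else 0 := by
      intro g; simp only [μ, pow_two]; rw [sum_mul_sum]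
      refine sum_congr rfl fun m _ => sum_congr rfl fun m' _ => ?_
      split_ifs <;> simp
    rw [sum_congr rfl (fun g _ => this g), sum_comm]
    have h5 : ∀ m ∈ M.attach, ∑ g, ∑ m' ∈ M.attach,
        (if toG p m.1 (hM m.1 m.2) = g then (if toG p m'.1 (hM m'.1 m'.2) = g then I1 else 0) else 0) =
        ∑ m' ∈ M, if ∀ i j, ((∏ k, p k : ℕ) : ℤ) ∣ m' i j - m.1 i j then I1 else 0 := by
      intro m _
      rw [sum_comm, ← sum_attach M]
      refine sum_congr rfl fun m' _ => ?_
      rw [sum_ite_eq, if_pos (mem_univ _)]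
      congr 1
      rw [eq_iff_iff, eq_comm, toG_eq_iff p hinj]
    rw [sum_congr rfl h5, sum_attach M (fun m => ∑ m' ∈ M,
      if ∀ i j, ((∏ k, p k : ℕ) : ℤ) ∣ m' i j - m i j then I1 else 0), ← sum_product']
    unfold E2
    rw [card_filter]; push_cast; rfl
  let c : VV p → VV p → ℝ := fun v v' => ∏ i, cc (p i) (v i) (v' i)
  have h4 : ∑ g, ψ g ^ 2 = ∑ v, ∑ v', u v * u v' * (c v v' * nrm p f) := by
    have e1 : ∀ g, ψ g ^ 2 = ∑ v, ∑ v', u v * u v' *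
        (f (fun i => v i ᵥ* (g i).1) * f (fun i => v' i ᵥ* (g i).1)) := by
      intro g; simp only [ψ, pow_two]; rw [sum_mul_sum]
      refine sum_congr rfl fun v _ => sum_congr rfl fun v' _ => ?_
      ring
    rw [sum_congr rfl (fun g _ => e1 g), sum_comm]
    refine sum_congr rfl fun v _ => ?_
    rw [sum_comm]
    refine sum_congr rfl fun v' _ => ?_
    rw [← mul_sum]
    congr 1
    have := prod_ident n (fun i => Vp (p i)) (fun i => SLp (p i)) (fun i v g => v ᵥ* g.1)
      (fun i => Nw (p i)) (fun i => cc (p i)) (fun i f f' hf hf' v v' => single_ident f f' hf hf' v v')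
      f f hf hf v v'
    rw [this]
    simp only [c, nrm, pow_two]
  have hcs : ∀ v v', c v v' = c v' v := fun v v' => prod_congr rfl fun i _ => cc_symm _ _
  have hrow : ∀ v, ∑ v', |c v v'| ≤ R := by
    intro v
    have : ∀ v', |c v v'| = ∏ i, |cc (p i) (v i) (v' i)| := fun v' => Finset.abs_prod _ _
    rw [sum_congr rfl (fun v' _ => this v')]
    have e := prod_univ_sum (fun i => (univ : Finset (Vp (p i)))) (fun i x => |cc (p i) (v i) x|)
    rw [Fintype.piFinset_univ] at e
    rw [← e]
    exact prod_le_prod (fun i _ => sum_nonneg fun _ _ => abs_nonneg _) (fun i _ => cc_row _)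
  have h6 : ∑ g, ψ g ^ 2 ≤ N * R * nrm p f := by
    rw [h4]
    have hf0 := nrm_nonneg p f
    calc _ ≤ ∑ v, ∑ v', (u v ^ 2 / 2 * |c v v'| + u v' ^ 2 / 2 * |c v' v|) * nrm p f := by
          refine sum_le_sum fun v _ => sum_le_sum fun v' _ => ?_
          rw [← mul_assoc]
          refine mul_le_mul_of_nonneg_right ?_ hf0
          rw [hcs v' v]
          have : |u v * u v'| ≤ u v ^ 2 / 2 + u v' ^ 2 / 2 := by
            rw [abs_le]; constructor <;> nlinarith [sq_nonneg (u v + u v'), sq_nonneg (u v - u v')]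
          calc u v * u v' * c v v' ≤ |u v * u v' * c v v'| := le_abs_self _
            _ = |u v * u v'| * |c v v'| := abs_mul _ _
            _ ≤ (u v ^ 2 / 2 + u v' ^ 2 / 2) * |c v v'| := by gcongr
            _ = _ := by ring
      _ = (∑ v, u v ^ 2 * ∑ v', |c v v'|) * nrm p f := by
          simp only [add_mul, sum_add_distrib]
          have : ∑ v, ∑ v', u v' ^ 2 / 2 * |c v' v| * nrm p f = ∑ v, ∑ v', u v ^ 2 / 2 * |c v v'| * nrm p f :=
            sum_comm
          rw [this, ← two_mul, mul_sum, sum_mul]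
          refine sum_congr rfl fun v _ => ?_
          rw [mul_sum, mul_sum, sum_mul]
          refine sum_congr rfl fun v' _ => by ring
      _ ≤ (∑ v, u v ^ 2 * R) * nrm p f := by
          refine mul_le_mul_of_nonneg_right ?_ hf0
          exact sum_le_sum fun v _ => mul_le_mul_of_nonneg_left (hrow v) (sq_nonneg _)
      _ = _ := by rw [← sum_mul]; rfl
  rw [h3] at h2
  rcases hN0.eq_or_lt with h0 | h0
  · rw [← h0]
    exact mul_nonneg (mul_nonneg (cast_nonneg _) hR0) (nrm_nonneg p f)
  · have : N * N ≤ N * ((E2 M (∏ k, p k)).card * R * nrm p f) := by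
      calc N * N = N^2 := by ring
        _ ≤ _ := h2
        _ ≤ (E2 M (∏ k, p k)).card * (N * R * nrm p f) := by gcongr
        _ = _ := by ring
    exact le_of_mul_le_mul_left this h0

end family


section family
variable {n : ℕ} (p : Fin n → ℕ) [hp : ∀ i, Fact (p i).Prime]

def redV (a : Fin 2 → ℤ) : VV p := fun i j => (a j : ZMod (p i))

theorem redV_vecMul (a : Fin 2 → ℤ) (m : M2) : redV p (a ᵥ* m) = actM p (redV p a) m := by
  funext i j
  simp [redV, actM, rdM, vecMul, dotProduct]

theorem New.hom_all {F : VV p → ℝ} (hF : New p F) (c : ∀ i, (ZMod (p i))ˣ) (v : VV p) :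
    F (fun i => c i • v i) = F v := by
  classical
  have key : ∀ s : Finset (Fin n), F (fun i => if i ∈ s then c i • v i else v i) = F v := by
    intro s
    induction s using induction_on with
    | empty => simp
    | insert i s hi ih =>
      rw [← ih]
      set w : VV p := fun i => if i ∈ s then c i • v i else v i with hw
      have h1 : (fun j => if j ∈ insert i s then c j • v j else v j) =
          Function.update w i (((c i : (ZMod (p i))ˣ) : ZMod (p i)) • v i) := by
        funext j
        by_cases h : j = i
        · subst h; simp [Units.smul_def]
        · simp [h, hw]
      have h2 : w = Function.update w i (v i) := by
        funext j
        by_cases h : j = i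
        · subst h; simp [hw, hi]
        · simp [h]
      rw [h1]
      have := (hF i w).hom (c i : ZMod (p i)) (Units.ne_zero _) (v i)
      rw [this, ← h2]
  simpa using key univ

theorem initial_block (hinj : Function.Injective p) {ι : Type*} (W : Finset ι) (a : ι → Fin 2 → ℤ)
    (hnz : ∀ R ∈ W, ∀ i, redV p (a R) i ≠ 0) (F : VV p → ℝ) (hF : New p F) :
    (∑ R ∈ W, F (redV p (a R)))^2 * (∏ i, ((p i : ℝ) - 1)) ≤
      nrm p F * ((W ×ˢ W).filter (fun x => ((∏ i, p i : ℕ) : ℤ) ∣ wedge (a x.1) (a x.2))).card := by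
  classical
  set φ : ℝ := ∏ i, ((p i : ℝ) - 1) with hφ
  have hφ0 : 0 < φ := prod_pos fun i _ => by
    have : I1 < p i := by exact_mod_cast (hp i).out.one_lt
    linarith
  have hcard : (Fintype.card (∀ i, (ZMod (p i))ˣ) : ℝ) = φ := by
    rw [Fintype.card_pi]; push_cast
    refine prod_congr rfl fun i _ => ?_
    rw [ZMod.card_units_eq_totient, Nat.totient_prime (hp i).out, cast_sub (hp i).out.one_le]; simp
  let sm : (∀ i, (ZMod (p i))ˣ) → VV p → VV p := fun c v i => c i • v i
  let ν : VV p → ℝ := fun v => ∑ R ∈ W, ∑ c : (∀ i, (ZMod (p i))ˣ), if sm c (redV p (a R)) = v then 1 else 0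
  have h1 : φ * ∑ R ∈ W, F (redV p (a R)) = ∑ v, ν v * F v := by
    have e : ∀ v, ν v * F v = ∑ R ∈ W, ∑ c : (∀ i, (ZMod (p i))ˣ), if sm c (redV p (a R)) = v then F v else 0 := by
      intro v; simp only [ν, sum_mul]; simp
    rw [sum_congr rfl (fun v _ => e v), sum_comm, mul_sum]
    refine sum_congr rfl fun R _ => ?_
    rw [sum_comm]
    simp only [sum_ite_eq, mem_univ, if_true]
    have : ∀ c, F (sm c (redV p (a R))) = F (redV p (a R)) := fun c => hF.hom_all p c _
    simp only [this, sum_const, nsmul_eq_mul, card_univ]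
    rw [hcard]
  set NP := ((W ×ˢ W).filter (fun x => ((∏ i, p i : ℕ) : ℤ) ∣ wedge (a x.1) (a x.2))).card with hNP
  have h2 : ∑ v, ν v ^ 2 ≤ φ * NP := by
    have e : ∀ v, ν v ^ 2 = ∑ R ∈ W, ∑ R' ∈ W, ∑ c : (∀ i, (ZMod (p i))ˣ), ∑ c' : (∀ i, (ZMod (p i))ˣ),
        if sm c (redV p (a R)) = v then (if sm c' (redV p (a R')) = v then 1 else 0) else 0 := by
      intro v
      simp only [ν, pow_two]
      rw [sum_mul_sum]
      refine sum_congr rfl fun R _ => sum_congr rfl fun R' _ => ?_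
      rw [sum_mul_sum]
      refine sum_congr rfl fun c _ => sum_congr rfl fun c' _ => ?_
      split_ifs <;> simp
    have e2 : ∑ v, ν v ^ 2 = ∑ R ∈ W, ∑ R' ∈ W, ∑ c : (∀ i, (ZMod (p i))ˣ), ∑ c' : (∀ i, (ZMod (p i))ˣ),
        if sm c' (redV p (a R')) = sm c (redV p (a R)) then I1 else 0 := by
      rw [sum_congr rfl (fun v _ => e v), sum_comm]
      refine sum_congr rfl fun R _ => ?_
      rw [sum_comm]
      refine sum_congr rfl fun R' _ => ?_
      rw [sum_comm]
      refine sum_congr rfl fun c _ => ?_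
      rw [sum_comm]
      refine sum_congr rfl fun c' _ => ?_
      simp
    rw [e2, hNP, card_filter, sum_product]
    push_cast
    rw [mul_sum]
    refine sum_le_sum fun R hR => ?_
    rw [mul_sum]
    refine sum_le_sum fun R' hR' => ?_
    have hone : ∀ c : (∀ i, (ZMod (p i))ˣ), (∑ c' : (∀ i, (ZMod (p i))ˣ),
        if sm c' (redV p (a R')) = sm c (redV p (a R)) then I1 else 0) ≤
        if (∏ i, (p i : ℤ)) ∣ wedge (a R) (a R') then 1 else 0 := by
      intro c
      rw [← sum_filter, sum_const, nsmul_eq_mul, mul_one]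
      have hle : (univ.filter (fun c' => sm c' (redV p (a R')) = sm c (redV p (a R)))).card ≤ 1 := by
        rw [Finset.card_le_one]
        intro c1 hc1 c2 hc2
        simp only [mem_filter, mem_univ, true_and] at hc1 hc2
        funext i
        have := congrFun (hc1.trans hc2.symm) i
        simp only [sm, Units.smul_def] at this
        have h0 := hnz R' hR' i
        obtain ⟨j, hj⟩ := Function.ne_iff.mp h0
        have h3 := congrFun this j
        simp only [Pi.smul_apply, smul_eq_mul] at h3
        exact Units.ext (mul_right_cancel₀ hj h3)
      split_ifs with hd
      · exact_mod_cast hle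
      · rw [card_eq_zero.mpr]; · simp
        rw [filter_eq_empty_iff]
        intro c' _ hc'
        apply hd
        refine prod_dvd_of_coprime ?_ ?_
        · intro x _ y _ hxy
          have : Coprime (p x) (p y) := (coprime_primes (hp x).out (hp y).out).mpr (fun h => hxy (hinj h))
          exact isCoprime_iff_coprime.mpr this
        · intro i _
          rw [← ZMod.intCast_zmod_eq_zero_iff_dvd]
          have h4 := congrFun hc' i
          simp only [sm, Units.smul_def] at h4
          have e0 := congrFun h4 0
          have e1 := congrFun h4 1
          simp only [Pi.smul_apply, smul_eq_mul, redV] at e0 e1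
          have hc0 : ((c i : (ZMod (p i))ˣ) : ZMod (p i)) ≠ 0 := Units.ne_zero _
          apply mul_left_cancel₀ hc0
          simp only [wedge]; push_cast
          linear_combination (-(a R' 1 : ZMod (p i))) * e0 + (a R' 0 : ZMod (p i)) * e1
    refine (sum_le_sum fun c _ => hone c).trans ?_
    rw [sum_const, nsmul_eq_mul, card_univ, hcard]
  have h3 : (∑ v, ν v * F v)^2 ≤ (∑ v, ν v ^ 2) * nrm p F := sum_mul_sq_le_sq_mul_sq _ _ _
  rw [← h1] at h3
  have hF0 := nrm_nonneg p F
  have h4 : φ * ((∑ R ∈ W, F (redV p (a R)))^2 * φ) ≤ φ * (nrm p F * NP) := by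
    calc _ = (φ * ∑ R ∈ W, F (redV p (a R)))^2 := by ring
      _ ≤ _ := h3
      _ ≤ (φ * NP) * nrm p F := by gcongr
      _ = _ := by ring
  exact le_of_mul_le_mul_left h4 hφ0
end family

theorem count_parallel (q H : ℕ) (hq : 1 ≤ q) (hH : q ≤ H) (a : Fin 2 → ℤ) (ha : IsCoprime (a 0) (a 1))
    (S : Finset (Fin 2 → ℤ)) (hS : ∀ b ∈ S, (∀ i, 0 ≤ b i ∧ b i ≤ H) ∧ (q:ℤ) ∣ wedge a b) :
    (S.card : ℝ) ≤ 4 * ↟H^2 / q := by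
  obtain ⟨u, v, huv⟩ := ha
  classical
  have hq0 : (0:ℤ) < q := by exact_mod_cast hq
  let s : (Fin 2 → ℤ) → ℤ := fun b => b 0 * u + b 1 * v
  have hdec : ∀ b : Fin 2 → ℤ, b 0 = s b * a 0 - wedge a b * v ∧ b 1 = s b * a 1 + wedge a b * u := by
    intro b; simp only [s, wedge]; constructor
    · linear_combination (-b 0) * huv
    · linear_combination (-b 1) * huv
  let T : Finset (ℤ × ℤ × ℤ) := Finset.Ico 0 (q:ℤ) ×ˢ Icc 0 ((H:ℤ)/q) ×ˢ Icc 0 ((H:ℤ)/q)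
  have hcard : S.card ≤ T.card := by
    refine card_le_card_of_injOn (fun b => (s b % q, b 0 / q, b 1 / q)) ?_ ?_
    · intro b hb
      have h1 := (hS b (by exact_mod_cast hb)).1
      simp only [T, coe_product, Set.mem_prod, Finset.coe_Ico, Finset.coe_Icc, Set.mem_Ico, Set.mem_Icc]
      exact ⟨⟨emod_nonneg _ hq0.ne', emod_lt_of_pos _ hq0⟩,
        ⟨ediv_nonneg (h1 0).1 hq0.le, ediv_le_ediv hq0 (h1 0).2⟩,
        ⟨ediv_nonneg (h1 1).1 hq0.le, ediv_le_ediv hq0 (h1 1).2⟩⟩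
    · intro b hb b' hb' h
      simp only [Prod.mk.injEq] at h
      obtain ⟨h1, h2, h3⟩ := h
      have d1 := (hS b (by exact_mod_cast hb)).2
      have d2 := (hS b' (by exact_mod_cast hb')).2
      have hs : (q:ℤ) ∣ s b - s b' := Int.ModEq.dvd (show s b' ≡ s b [ZMOD q] from h1.symm)
      have m0 : b 0 % q = b' 0 % q := by
        have : (q:ℤ) ∣ b 0 - b' 0 := by
          rw [(hdec b).1, (hdec b').1]
          have : s b * a 0 - wedge a b * v - (s b' * a 0 - wedge a b' * v) =
            (s b - s b') * a 0 - wedge a b * v + wedge a b' * v := by ring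
          rw [this]
          exact dvd_add (dvd_sub (hs.mul_right _) (d1.mul_right _)) (d2.mul_right _)
        exact (modEq_iff_dvd.mpr this).symm
      have m1 : b 1 % q = b' 1 % q := by
        have : (q:ℤ) ∣ b 1 - b' 1 := by
          rw [(hdec b).2, (hdec b').2]
          have : s b * a 1 + wedge a b * u - (s b' * a 1 + wedge a b' * u) =
            (s b - s b') * a 1 + wedge a b * u - wedge a b' * u := by ring
          rw [this]
          exact dvd_sub (dvd_add (hs.mul_right _) (d1.mul_right _)) (d2.mul_right _)
        exact (modEq_iff_dvd.mpr this).symm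
      ext i; fin_cases i
      · have e1 := mul_ediv_add_emod (b 0) q
        have e2 := mul_ediv_add_emod (b' 0) q
        rw [h2, m0] at e1; exact e1.symm.trans e2
      · have e1 := mul_ediv_add_emod (b 1) q
        have e2 := mul_ediv_add_emod (b' 1) q
        rw [h3, m1] at e1; exact e1.symm.trans e2
  have hT : T.card = q * ((H/q + 1) * (H/q+1)) := by
    simp only [T, card_product, Int.card_Ico, card_Icc]
    have : ((H:ℤ)/q + 1 - 0).toNat = H/q + 1 := by
      rw [← Int.natCast_div]; generalize H / q = z; omega
    rw [this]; simp
  rw [hT] at hcard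
  have hqr : I0 < q := by exact_mod_cast hq
  have hx : ((H/q : ℕ):ℝ) + 1 ≤ 2 * (H/q) := by
    have h1 : ((H/q:ℕ):ℝ) ≤ H / q := cast_div_le
    have h2 : I1 ≤ H / q := by rw [le_div_iff₀ hqr]; simpa using (by exact_mod_cast hH)
    linarith
  calc (S.card : ℝ) ≤ q * ((((H/q : ℕ):ℝ) + 1) * (((H/q : ℕ):ℝ) + 1)) := by exact_mod_cast hcard
    _ ≤ q * ((2 * (H/q)) * (2 * (H/q))) := by gcongr
    _ = _ := by field_simp; ring

theorem mult_one (a : Fin 2 → ℤ) (ha : IsCoprime (a 0) (a 1)) (h0 : 0 < a 0) (h1 : 0 < a 1)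
    (h2 : 2 ≤ a 0 * a 1) (R R' : M2) (hR : R.det = 1) (hR' : R'.det = 1) (hn : ∀ i j, 0 ≤ R i j)
    (hn' : ∀ i j, 0 ≤ R' i j) (h : a ᵥ* R = a ᵥ* R') : R = R' := by
  rw [det_fin_two] at hR hR'
  have hcol : ∀ j, a 0 * R 0 j + a 1 * R 1 j = a 0 * R' 0 j + a 1 * R' 1 j := by
    intro j; have := congrFun h j
    simpa [vecMul, dotProduct, Fin.sum_univ_two] using this
  have hk : ∀ j, ∃ k, R' 0 j = R 0 j + k * a 1 ∧ R' 1 j = R 1 j - k * a 0 := by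
    intro j
    have hd : a 1 ∣ a 0 * (R' 0 j - R 0 j) := ⟨R 1 j - R' 1 j, by linear_combination (-1) * hcol j⟩
    obtain ⟨k, hk⟩ := ha.symm.dvd_of_dvd_mul_left hd
    refine ⟨k, by linarith, ?_⟩
    apply mul_left_cancel₀ h1.ne'
    have := hcol j
    have e : R' 0 j = R 0 j + a 1 * k := by linarith
    rw [e] at this; linarith
  obtain ⟨k0, e00, e10⟩ := hk 0
  obtain ⟨k1, e01, e11⟩ := hk 1
  set s0 := a 0 * R 0 0 + a 1 * R 1 0 with hs0
  set s1 := a 0 * R 0 1 + a 1 * R 1 1 with hs1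
  have hcross : k0 * s1 = k1 * s0 := by
    rw [e00, e01, e10, e11] at hR'
    rw [hs0, hs1]; linear_combination hR' - hR
  have hcop : IsCoprime s0 s1 := by
    obtain ⟨u, v, huv⟩ := ha
    refine ⟨u * R 1 1 - v * R 0 1, -u * R 1 0 + v * R 0 0, ?_⟩
    rw [hs0, hs1]; linear_combination huv + (a 0 * u + a 1 * v) * hR
  have bound : ∀ (k x y : ℤ) (s : ℤ), s = a 0 * x + a 1 * y → 0 ≤ x → 0 ≤ y → 0 ≤ x + k * a 1 → 0 ≤ y - k * a 0 →
      2 * |k| ≤ s := by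
    intro k x y s hs hx hy hx' hy'
    rcases le_total 0 k with hk | hk
    · rw [abs_of_nonneg hk]
      have : k * a 0 * a 1 ≤ y * a 1 := by nlinarith
      nlinarith
    · rw [abs_of_nonpos hk]
      have : (-k) * a 1 * a 0 ≤ x * a 0 := by nlinarith
      nlinarith
  have b0 := bound k0 _ _ s0 hs0 (hn 0 0) (hn 1 0) (e00 ▸ hn' 0 0) (e10 ▸ hn' 1 0)
  have b1 := bound k1 _ _ s1 hs1 (hn 0 1) (hn 1 1) (e01 ▸ hn' 0 1) (e11 ▸ hn' 1 1)
  have d0 : s0 ∣ k0 := hcop.dvd_of_dvd_mul_right (Dvd.intro_left _ hcross.symm)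
  have d1 : s1 ∣ k1 := hcop.symm.dvd_of_dvd_mul_right (Dvd.intro_left _ hcross)
  have z0 : k0 = 0 := by
    by_contra hne
    have := Int.le_of_dvd (abs_pos.mpr hne) ((dvd_abs _ _).mpr d0)
    have := abs_pos.mpr hne
    linarith
  have z1 : k1 = 0 := by
    by_contra hne
    have := Int.le_of_dvd (abs_pos.mpr hne) ((dvd_abs _ _).mpr d1)
    have := abs_pos.mpr hne
    linarith
  ext i j; fin_cases i <;> fin_cases j <;> simp [e00, e01, e10, e11, z0, z1]


def nn (g : M2) : Prop := ∀ i j, 0 ≤ g i j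
def sg (g : M2) : ℤ := g 0 0 + g 0 1 + g 1 0 + g 1 1

lemma nn_mul {g h : M2} (hg : nn g) (hh : nn h) : nn (g * h) := by
  intro i j
  rw [Matrix.mul_apply]
  exact sum_nonneg fun k _ => mul_nonneg (hg _ _) (hh _ _)

lemma nn_one : nn 1 := by
  intro i j; rw [Matrix.one_apply]; split_ifs <;> norm_num

lemma sg_mul {g h : M2} (hg : nn g) (hh : nn h) : sg (g * h) ≤ sg g * sg h := by
  simp only [sg, Matrix.mul_apply, Fin.sum_univ_two]
  have a := hg 0 0; have b := hg 0 1; have c := hg 1 0; have d := hg 1 1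
  have a' := hh 0 0; have b' := hh 0 1; have c' := hh 1 0; have d' := hh 1 1
  have := mul_nonneg a c'; have := mul_nonneg a d'
  have := mul_nonneg c c'; have := mul_nonneg c d'
  have := mul_nonneg b a'; have := mul_nonneg b b'
  have := mul_nonneg d a'; have := mul_nonneg d b'
  nlinarith

lemma le_sg {g : M2} (hg : nn g) (i j : Fin 2) : g i j ≤ sg g := by
  have a := hg 0 0; have b := hg 0 1; have c := hg 1 0; have d := hg 1 1
  unfold sg
  fin_cases i <;> fin_cases j <;> simp <;> linarith

structure Code (A : Finset M2) (Y : ℕ) : Prop where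
  det : ∀ g ∈ A, g.det = 1
  pos : ∀ g ∈ A, ∀ i j, 0 < g i j
  sz : ∀ g ∈ A, sg g ≤ Y
  pre : ∀ g ∈ A, ∀ g' ∈ A, ∀ P : M2, P.det = 1 → nn P → g' = g * P → g = g'

lemma det_one_cancel {g a b : M2} (hg : g.det = 1) (h : g * a = g * b) : a = b := by
  have : g.adjugate * (g * a) = g.adjugate * (g * b) := by rw [h]
  rwa [← mul_assoc, ← mul_assoc, Matrix.adjugate_mul, hg, one_smul, one_mul, one_mul] at this

lemma lc_np {a b x y : ℤ} (ha : 0 ≤ a) (hb : 0 ≤ b) (hx : x ≤ 0) (hy : y ≤ 0) : a * x + b * y ≤ 0 := by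
  have := mul_nonneg ha (by omega : 0 ≤ -x)
  have := mul_nonneg hb (by omega : 0 ≤ -y)
  linarith

lemma prefix_cmp {g g' p p' : M2} (hg : ∀ i j, 0 < g i j) (hg' : ∀ i j, 0 < g' i j)
    (dg : g.det = 1) (dg' : g'.det = 1) (hp : nn p) (hp' : nn p') (dp : p.det = 1)
    (dp' : p'.det = 1) (h : g * p = g' * p') :
    ∃ q : M2, q.det = 1 ∧ nn q ∧ (g' = g * q ∨ g = g' * q) := by
  set q : M2 := g.adjugate * g' with hq
  have h1 : g * q = g' := by
    rw [hq, ← mul_assoc, mul_adjugate, dg, one_smul, one_mul]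
  have h2 : q * p' = p := by
    apply det_one_cancel dg
    rw [← mul_assoc, h1, h]
  have dq : q.det = 1 := by
    have := congrArg Matrix.det h1
    rw [det_mul, dg, dg', one_mul] at this; exact this
  have e1 := fun i j => congrFun (congrFun h1 i) j
  have e2 := fun i j => congrFun (congrFun h2 i) j
  simp only [Matrix.mul_apply, Fin.sum_univ_two] at e1 e2
  have dq' := dq
  rw [det_fin_two] at dq' dp
  generalize hx : q 0 0 = x at *
  generalize hy : q 0 1 = y at *
  generalize hz : q 1 0 = z at *
  generalize hw : q 1 1 = w at *
  have a1 := e1 0 0; have a2 := e1 0 1; have a3 := e1 1 0; have a4 := e1 1 1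
  have b1 := e2 0 0; have b2 := e2 0 1; have b3 := e2 1 0; have b4 := e2 1 1
  rw [hx, hz] at a1 a3
  rw [hy, hw] at a2 a4
  rw [hx, hy] at b1 b2
  rw [hz, hw] at b3 b4
  have p1 := hg 0 0; have p2 := hg 0 1; have p3 := hg 1 0; have p4 := hg 1 1
  have q1 := hg' 0 0; have q2 := hg' 0 1; have q3 := hg' 1 0; have q4 := hg' 1 1
  have r1 := hp 0 0; have r2 := hp 0 1; have r3 := hp 1 0; have r4 := hp 1 1
  have s1 := hp' 0 0; have s2 := hp' 0 1; have s3 := hp' 1 0; have s4 := hp' 1 1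
  have cxz : 0 < x ∨ 0 < z := by by_contra! hh; have := lc_np p1.le p2.le hh.1 hh.2; omega
  have cyw : 0 < y ∨ 0 < w := by by_contra! hh; have := lc_np p1.le p2.le hh.1 hh.2; omega
  have rxy : 0 < x ∨ 0 < y := by
    by_contra! hh
    have z1 : p 0 0 = 0 := by have := lc_np s1 s3 hh.1 hh.2; linarith
    have z2 : p 0 1 = 0 := by have := lc_np s2 s4 hh.1 hh.2; linarith
    rw [z1, z2] at dp; simp at dp
  have rzw : 0 < z ∨ 0 < w := by
    by_contra! hh
    have z1 : p 1 0 = 0 := by have := lc_np s1 s3 hh.1 hh.2; linarith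
    have z2 : p 1 1 = 0 := by have := lc_np s2 s4 hh.1 hh.2; linarith
    rw [z1, z2] at dp; simp at dp
  have hxp : 0 < x := by
    by_contra! hh
    have hy0 : 0 < y := by rcases rxy with h | h <;> omega
    have hz0 : 0 < z := by rcases cxz with h | h <;> omega
    have hw0 : w < 0 := by
      by_contra! hw0
      have := mul_pos hy0 hz0; have := mul_nonneg hw0 (by omega : 0 ≤ -x); linarith
    have t1 : g 0 0 * (-x) < g 0 1 * z := by linarith
    have t2 : g 0 1 * (-w) < g 0 0 * y := by linarith
    have t3 := mul_lt_mul'' t1 t2 (mul_nonneg p1.le ooo) (mul_nonneg p2.le ooo)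
    have t4 : (g 0 0 * g 0 1) * (x * w) < (g 0 0 * g 0 1) * (y * z) := by linarith
    have := lt_of_mul_lt_mul_left t4 (mul_pos p1 p2).le
    linarith
  have hwp : 0 < w := by
    by_contra! hh
    have hy0 : 0 < y := by rcases cyw with h | h <;> omega
    have hz0 : 0 < z := by rcases rzw with h | h <;> omega
    have := mul_pos hy0 hz0; have := mul_nonneg hxp.le (by omega : 0 ≤ -w); linarith
  have hyz : 0 ≤ y * z := by have := mul_pos hxp hwp; linarith
  have hyz1 : 0 < y → 0 ≤ z := fun h => by
    by_contra! h'; have := mul_pos h (by omega : 0 < -z); linarith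
  have hyz2 : 0 < z → 0 ≤ y := fun h => by
    by_contra! h'; have := mul_pos h (by omega : 0 < -y); linarith
  by_cases hc : 0 ≤ y ∧ 0 ≤ z
  · refine ⟨q, dq, ?_, Or.inl h1.symm⟩
    intro i j
    fin_cases i <;> fin_cases j <;> simp [hx, hy, hz, hw] <;> omega
  · have hy0 : y ≤ 0 := by
      by_contra! hh
      apply hc; exact ⟨hh.le, hyz1 hh⟩
    have hz0 : z ≤ 0 := by
      by_contra! hh
      apply hc; exact ⟨hyz2 hh, hh.le⟩
    refine ⟨q.adjugate, by rw [Matrix.det_adjugate, dq]; simp, ?_, Or.inr ?_⟩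
    · intro i j
      rw [Matrix.adjugate_fin_two]
      fin_cases i <;> fin_cases j <;> simp [hx, hy, hz, hw] <;> omega
    · rw [← h1, mul_assoc, mul_adjugate, dq, one_smul, mul_one]

lemma Code.uniq {A : Finset M2} {Y : ℕ} (hA : Code A Y) {g g' p p' : M2} (hg : g ∈ A) (hg' : g' ∈ A)
    (hp : nn p) (hp' : nn p') (dp : p.det = 1) (dp' : p'.det = 1) (h : g * p = g' * p') :
    g = g' ∧ p = p' := by
  have : g = g' := by
    obtain ⟨q, dq, nq, h1 | h1⟩ := prefix_cmp (hA.pos g hg) (hA.pos g' hg') (hA.det g hg) (hA.det g' hg') hp hp' dp dp' h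
    · exact hA.pre g hg g' hg' q dq nq h1
    · exact (hA.pre g' hg' g hg q dq nq h1).symm
  subst this
  exact ⟨rfl, det_one_cancel (hA.det g hg) h⟩

def Wd (A : Finset M2) : ℕ → Finset M2
  | 0 => {1}
  | (j+1) => (A ×ˢ Wd A j).image (fun x => x.1 * x.2)

lemma Code.wd_props {A : Finset M2} {Y : ℕ} (hA : Code A Y) (j : ℕ) :
    ∀ w ∈ Wd A j, w.det = 1 ∧ nn w ∧ sg w ≤ 2 * Y^j ∧ (1 ≤ j → (∀ i k, 0 < w i k) ∧ sg w ≤ Y^j) := by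
  induction j with
  | zero =>
    intro w hw
    simp only [Wd, mem_singleton] at hw
    subst hw
    refine ⟨by simp, nn_one, by simp [sg], by simp⟩
  | succ j ih =>
    intro w hw
    simp only [Wd, mem_image, mem_product, Prod.exists] at hw
    obtain ⟨g, u, ⟨hg, hu⟩, rfl⟩ := hw
    obtain ⟨i1, i2, i3, i4⟩ := ih u hu
    have hgn : nn g := fun i k => (hA.pos g hg i k).le
    have hpos : ∀ i k, 0 < (g * u) i k := by
      intro i k
      rw [Matrix.mul_apply, Fin.sum_univ_two]
      have h0 := i2 0 k; have h1 := i2 1 k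
      have g0 := hA.pos g hg i 0; have g1 := hA.pos g hg i 1
      have : 0 < u 0 k ∨ 0 < u 1 k := by
        by_contra! hh
        have z0 : u 0 k = 0 := by omega
        have z1 : u 1 k = 0 := by omega
        rw [det_fin_two] at i1
        fin_cases k <;> simp at z0 z1 <;> rw [z0, z1] at i1 <;> simp at i1
      rcases this with h | h
      · have := mul_pos g0 h; have := mul_nonneg g1.le h1; linarith
      · have := mul_pos g1 h; have := mul_nonneg g0.le h0; linarith
    have hsz : sg (g * u) ≤ (Y:ℤ)^(j+1) := by
      rcases Nat.eq_zero_or_pos j with h | h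
      · subst h
        simp only [Wd, mem_singleton] at hu
        subst hu; simpa using hA.sz g hg
      · have h1 := (i4 h).2
        have h2 := hA.sz g hg
        have h3 : 0 ≤ sg u := by unfold sg; have := i2 0 0; have := i2 0 1; have := i2 1 0; have := i2 1 1; omega
        calc sg (g * u) ≤ sg g * sg u := sg_mul hgn i2
          _ ≤ Y * Y^j := mul_le_mul h2 h1 h3 ppp
          _ = _ := by ring
    refine ⟨by rw [det_mul, hA.det g hg, i1, one_mul], nn_mul hgn i2, ?_, fun _ => ⟨hpos, hsz⟩⟩
    have : (0:ℤ) ≤ (Y:ℤ)^(j+1) := by positivity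
    linarith

lemma Code.wd_sum {A : Finset M2} {Y : ℕ} (hA : Code A Y) (j : ℕ) (f : M2 → ℝ) :
    ∑ w ∈ Wd A (j+1), f w = ∑ g ∈ A, ∑ u ∈ Wd A j, f (g * u) := by
  rw [Wd, sum_image, sum_product]
  rintro ⟨g, u⟩ h ⟨g', u'⟩ h' e
  simp only [coe_product, Set.mem_prod, mem_coe] at h h'
  have p := hA.wd_props j u h.2
  have p' := hA.wd_props j u' h'.2
  obtain ⟨h1, h2⟩ := hA.uniq h.1 h'.1 p.2.1 p'.2.1 p.1 p'.1 e
  rw [h1, h2]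

lemma Code.wd_add {A : Finset M2} {Y : ℕ} (hA : Code A Y) (i j : ℕ) (f : M2 → ℝ) :
    ∑ w ∈ Wd A (i+j), f w = ∑ u ∈ Wd A i, ∑ w ∈ Wd A j, f (u * w) := by
  induction i generalizing f with
  | zero => simp [Wd]
  | succ i ih =>
    rw [show i + 1 + j = (i + j) + 1 by ring, hA.wd_sum, hA.wd_sum]
    apply sum_congr rfl
    intro g _
    rw [ih]
    simp only [mul_assoc]

lemma Code.wd_card {A : Finset M2} {Y : ℕ} (hA : Code A Y) (j : ℕ) :
    ((Wd A j).card : ℝ) = (A.card:ℝ)^j := by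
  induction j with
  | zero => simp [Wd]
  | succ j ih =>
    have := hA.wd_sum j (fun _ => 1)
    simp only [sum_const, nsmul_eq_mul, mul_one] at this
    rw [this, ih, pow_succ]; ring

lemma Code.wd_code {A : Finset M2} {Y : ℕ} (hA : Code A Y) (j : ℕ) (hj : 1 ≤ j) :
    Code (Wd A j) (Y^j) := by
  refine ⟨fun g hg => (hA.wd_props j g hg).1, fun g hg => ((hA.wd_props j g hg).2.2.2 hj).1,
    fun g hg => by have := ((hA.wd_props j g hg).2.2.2 hj).2; push_cast; exact this, ?_⟩
  clear hj
  induction j with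
  | zero => intro g hg g' hg' P _ _ _; simp [Wd] at hg hg'; rw [hg, hg']
  | succ j ih =>
    intro w hw w' hw' P dP nP h
    simp only [Wd, mem_image, mem_product, Prod.exists] at hw hw'
    obtain ⟨g, u, ⟨hg, hu⟩, rfl⟩ := hw
    obtain ⟨g', u', ⟨hg', hu'⟩, rfl⟩ := hw'
    have p := hA.wd_props j u hu
    have p' := hA.wd_props j u' hu'
    rw [mul_assoc] at h
    obtain ⟨h1, h2⟩ := hA.uniq hg' hg p'.2.1 (nn_mul p.2.1 nP) p'.1
      (by rw [det_mul, p.1, dP, one_mul]) h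
    rw [ih u hu u' hu' P dP nP h2, h1]

lemma Code.mono {A B : Finset M2} {Y : ℕ} (hA : Code A Y) (h : B ⊆ A) : Code B Y :=
  ⟨fun g hg => hA.det g (h hg), fun g hg => hA.pos g (h hg), fun g hg => hA.sz g (h hg),
   fun g hg g' hg' => hA.pre g (h hg) g' (h hg')⟩


open Classical in
def ep (p : ℕ) (G : M2) (v : Vp p) : ℝ :=
  if v = 0 then 0 else
    (if (v ᵥ* rdM G p) 0 ^ 2 + (v ᵥ* rdM G p) 1 ^ 2 = 0 then 1 else 0) - 2 / (↟p + 1)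

lemma iso_count (p : ℕ) [hp : Fact p.Prime] (h4 : p % 4 = 1) :
    ((univ : Finset (Vp p)).filter (fun w => w ≠ 0 ∧ w 0 ^ 2 + w 1 ^ 2 = 0)).card = 2 * (p - 1) := by
  classical
  obtain ⟨i, hi⟩ := (ZMod.exists_sq_eq_neg_one_iff (p := p)).2 ooo
  have hi2 : i * i = -1 := hi.symm
  have h2 : (2 : ZMod p) ≠ 0 := by
    intro h
    have h' : ((2:ℕ) : ZMod p) = 0 := by exact_mod_cast h
    rw [ZMod.natCast_eq_zero_iff] at h'
    have := Nat.le_of_dvd nnn h'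
    have := hp.out.two_le
    interval_cases p; omega
  have hi0 : i ≠ 0 := by rintro rfl; simp at hi2
  have hne : ∀ t : ZMod p, t ≠ 0 → i * t ≠ -i * t := by
    intro t ht h
    have : 2 * (i * t) = 0 := by linear_combination h
    rcases mul_eq_zero.1 this with h | h
    · exact h2 h
    · exact (mul_ne_zero hi0 ht) h
  let N : Finset (ZMod p) := univ.erase 0
  have hN : N.card = p - 1 := by simp [N, card_erase_of_mem, ZMod.card]
  have : ((univ : Finset (Vp p)).filter (fun w => w ≠ 0 ∧ w 0 ^ 2 + w 1 ^ 2 = 0)) =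
      N.image (fun t => ![t, i * t]) ∪ N.image (fun t => ![t, -i * t]) := by
    ext w
    simp only [mem_filter, mem_univ, true_and, mem_union, mem_image, N,
      mem_erase, and_true]
    constructor
    · rintro ⟨hw, h⟩
      have hf : (w 1 - i * w 0) * (w 1 - (-i * w 0)) = 0 := by linear_combination h + (- w 0 ^2) * hi2
      have hw0 : w 0 ≠ 0 := by
        intro h0
        rw [h0] at h
        have h1 : w 1 = 0 := by simpa using h
        apply hw; funext j; fin_cases j <;> simp [h0, h1]
      rcases mul_eq_zero.1 hf with h | h
      · left; refine ⟨w 0, hw0, ?_⟩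
        funext j; fin_cases j
        · rfl
        · simp; linear_combination -h
      · right; refine ⟨w 0, hw0, ?_⟩
        funext j; fin_cases j
        · rfl
        · simp; linear_combination -h
    · rintro (⟨t, ht, rfl⟩ | ⟨t, ht, rfl⟩)
      · refine ⟨fun h => ht (by simpa using congrFun h 0), ?_⟩
        simp; linear_combination t^2 * hi2
      · refine ⟨fun h => ht (by simpa using congrFun h 0), ?_⟩
        simp; linear_combination t^2 * hi2
  rw [this, Finset.card_union_of_disjoint, card_image_of_injective, card_image_of_injective, hN]
  · ring
  · intro a b h; simpa using congrFun h 0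
  · intro a b h; simpa using congrFun h 0
  · rw [disjoint_left]
    intro w h1 h2
    simp only [mem_image, N, mem_erase] at h1 h2
    obtain ⟨t, ht, rfl⟩ := h1
    obtain ⟨s, hs, h⟩ := h2
    have e0 : s = t := by simpa using congrFun h 0
    subst e0
    exact hne s ht.1 (by simpa using (congrFun h 1).symm)

lemma rdM_unit' {G : M2} (hG : IsUnit G.det) (k : ℕ) : IsUnit (rdM G k).det := by
  rw [rdM_det]; exact hG.map (castRingHom (ZMod k))

lemma ep_props (p : ℕ) [hp : Fact p.Prime] (h4 : p % 4 = 1) (G : M2) (hG : IsUnit G.det) :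
    Nw p (ep p G) ∧ ∑ v, ep p G v ^ 2 ≤ 2 * p := by
  classical
  have hb := vecMul_bij (k := p) (rdM G p) (rdM_unit' hG p)
  have hz : ∀ v : Vp p, v ᵥ* rdM G p = 0 ↔ v = 0 := fun v =>
    ⟨fun h => hb.1 (by simpa using h), fun h => by simp [h]⟩
  set g : ℝ := 2 / (↟p + 1) with hg
  have hp1 : I1 < p := by exact_mod_cast hp.out.one_lt
  let E : Vp p → ℝ := fun w => if w = 0 then 0 else (if w 0 ^ 2 + w 1 ^ 2 = 0 then 1 else 0) - g
  have hE : ∀ v, ep p G v = E (v ᵥ* rdM G p) := by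
    intro v; simp only [ep, E, hz, ← hg]; 
  have hc := iso_count p h4
  have hS1 : ∑ w : Vp p, (if w ≠ 0 ∧ w 0 ^ 2 + w 1 ^ 2 = 0 then I1 else 0) = 2 * (p - 1) := by
    rw [sum_boole, hc]; push_cast [hp.out.one_le]; ring
  have hS2 : ∑ w : Vp p, (if w ≠ 0 then I1 else 0) = p^2 - 1 := by
    rw [sum_boole]
    have : ((univ : Finset (Vp p)).filter (fun w => w ≠ 0)).card = p^2 - 1 := by
      rw [filter_ne', card_erase_of_mem (mem_univ _), card_univ]
      simp [Vp, ZMod.card]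
    rw [this]; push_cast [one_le_pow 2 p hp.out.pos]; ring
  have e1 : ∀ w : Vp p, E w = (if w ≠ 0 ∧ w 0 ^ 2 + w 1 ^ 2 = 0 then I1 else 0) - g * (if w ≠ 0 then I1 else 0) := by
    intro w; simp only [E]; by_cases h : w = 0
    · simp [h]
    · simp [h]
  have e2 : ∀ w : Vp p, E w ^ 2 = (1 - g) * (if w ≠ 0 ∧ w 0 ^ 2 + w 1 ^ 2 = 0 then I1 else 0) - g * E w := by
    intro w; simp only [E]; by_cases h : w = 0
    · simp [h]
    · by_cases h' : w 0 ^ 2 + w 1 ^ 2 = 0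
      · simp [h, h']; ring
      · simp [h, h']; ring
  have hsum : ∑ w, E w = 0 := by
    simp only [e1]
    rw [sum_sub_distrib, ← mul_sum, hS1, hS2, hg]
    have : ↟p + 1 ≠ 0 := by positivity
    field_simp; ring
  have hbs : ∀ f : Vp p → ℝ, ∑ v : Vp p, f (v ᵥ* rdM G p) = ∑ w, f w := fun f =>
    Function.Bijective.sum_comp hb f
  refine ⟨⟨by simp [ep], ?_, ?_⟩, ?_⟩
  · intro c hc v
    rw [hE, hE, smul_vecMul]
    generalize v ᵥ* rdM G p = w
    have h1 : c • w = 0 ↔ w = 0 := by simp [hc]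
    have h2 : (c • w) 0 ^ 2 + (c • w) 1 ^ 2 = 0 ↔ w 0 ^ 2 + w 1 ^ 2 = 0 := by
      have : (c • w) 0 ^ 2 + (c • w) 1 ^ 2 = c^2 * (w 0 ^ 2 + w 1 ^ 2) := by simp; ring
      rw [this]; simp [hc]
    simp only [E, h1, h2]
  · simp only [hE]; rw [hbs, hsum]
  · simp only [hE]; rw [hbs (fun w => E w ^ 2)]
    simp only [e2]
    rw [sum_sub_distrib, ← mul_sum, ← mul_sum, hS1, hsum]
    have : 0 ≤ g := by positivity
    nlinarith

variable {n : ℕ} (p : Fin n → ℕ) [hp : ∀ i, Fact (p i).Prime]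

def eF (G : M2) (v : VV p) : ℝ := ∏ i, ep (p i) G (v i)

lemma eF_new (h4 : ∀ i, p i % 4 = 1) (G : M2) (hG : IsUnit G.det) : New p (eF p G) := by
  classical
  intro i v
  have h := (ep_props (p i) (h4 i) G hG).1
  have e : ∀ x, eF p G (Function.update v i x) = (∏ j ∈ univ.erase i, ep (p j) G (v j)) * ep (p i) G x := by
    intro x
    rw [eF, ← mul_prod_erase _ _ (mem_univ i), mul_comm]
    congr 1
    · apply prod_congr rfl
      intro j hj
      rw [Function.update_of_ne (ne_of_mem_erase hj)]
    · rw [Function.update_self]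
  simp only [e]
  refine ⟨by rw [h.zero, mul_zero], fun c hc v => by rw [h.hom c hc], by rw [← mul_sum, h.sum, mul_zero]⟩

lemma eF_nrm (h4 : ∀ i, p i % 4 = 1) (G : M2) (hG : IsUnit G.det) :
    nrm p (eF p G) ≤ 2^n * (∏ i, p i : ℕ) := by
  classical
  have : nrm p (eF p G) = ∏ i, ∑ x, ep (p i) G x ^ 2 := by
    rw [prod_univ_sum, Fintype.piFinset_univ, nrm]
    apply sum_congr rfl
    intro v _
    rw [eF, prod_pow]
  rw [this]
  calc _ ≤ ∏ i, (2 * (p i : ℝ)) := prod_le_prod (fun i _ => sum_nonneg fun _ _ => sq_nonneg _)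
        (fun i _ => (ep_props (p i) (h4 i) G hG).2)
    _ = _ := by rw [prod_mul_distrib]; simp

lemma nrm_TM_le (M : Finset M2) (hM : ∀ m ∈ M, m.det = 1) (f : VV p → ℝ) :
    nrm p (TM p M f) ≤ (M.card:ℝ)^2 * nrm p f := by
  unfold nrm TM
  calc ∑ v, (∑ m ∈ M, f (actM p v m))^2 ≤ ∑ v, (M.card:ℝ) * ∑ m ∈ M, f (actM p v m)^2 :=
        sum_le_sum fun v _ => sq_sum_le_card_mul_sum_sq
    _ = (M.card:ℝ) * ∑ m ∈ M, ∑ v, f (actM p v m)^2 := by rw [← mul_sum, sum_comm]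
    _ = (M.card:ℝ) * ∑ m ∈ M, ∑ v, f v^2 := by
        congr 1
        apply sum_congr rfl
        intro m hm
        exact Function.Bijective.sum_comp (actM_bij p (hM m hm)) (fun v => f v^2)
    _ = _ := by rw [sum_const, nsmul_eq_mul]; ring

lemma two_pow_le_tau (hinj : Function.Injective p) : I2^n ≤ ((∏ i, p i).divisors.card : ℝ) := by
  have : ∀ s : Finset (Fin n), (∏ i ∈ s, p i).divisors.card = 2^s.card := by
    classical
    intro s
    induction s using induction_on with
    | empty => simp
    | insert i s hi ih =>
      rw [prod_insert hi, Coprime.card_divisors_mul, ih, Finset.card_insert_of_notMem hi,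
        (hp i).out.divisors, Finset.card_pair (hp i).out.one_lt.ne]
      · ring
      · apply Coprime.prod_right
        intro j hj
        exact (coprime_primes (hp i).out (hp j).out).2 (fun h => hi (hinj h ▸ hj))
  rw [this]; simp

lemma op_block : ∃ q0 : ℝ, 2 ≤ q0 ∧ ∀ (A : Finset M2) (Y : ℕ), Code A Y → 2 ≤ Y →
    ↟Y^(1.97:ℝ) ≤ A.card → ∀ (n : ℕ) (p : Fin n → ℕ) [hp : ∀ i, Fact (p i).Prime],
    Function.Injective p → q0 ≤ ((∏ i, p i : ℕ):ℝ) → Y^100 ≤ ∏ i, p i →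
    ∃ j : ℕ, 1 ≤ j ∧ ((∏ i, p i : ℕ):ℝ)^(1.32:ℝ) ≤ ↟Y^j ∧ ↟Y^j ≤ ((∏ i, p i : ℕ):ℝ)^(1.33:ℝ) ∧
      ((E2 (Wd A j) (∏ i, p i)).card : ℝ) ≤ (A.card:ℝ)^(2*j) * ((∏ i, p i : ℕ):ℝ)^(-(2.58:ℝ)) ∧
      ∀ f : VV p → ℝ, New p f →
        nrm p (TM p (Wd A j) f) ≤ (A.card:ℝ)^(2*j) * ((∏ i, p i : ℕ):ℝ)^(-(0.57:ℝ)) * nrm p f := by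
  obtain ⟨C, hC1, hC⟩ := flat_bound 0.001 nnn
  obtain ⟨C2, hC21, hC2⟩ := tau_bound 0.001 nnn
  refine ⟨max 2 (((1 + C) * C2)^↟1000), le_max_left _ _, ?_⟩
  intro A Y hA hY hcard n p hp hinj hq0 hYq
  set q : ℕ := ∏ i, p i with hq
  have hq2 : I2 ≤ q := (le_max_left _ _).trans hq0
  have hqp : I0 < q := by linarith
  have hq1 : I1 ≤ q := by linarith
  have hCC : (1 + C) * C2 ≤ ↟q^(0.001:ℝ) := by
    have h := (le_max_right _ _).trans hq0
    have := rpow_le_rpow ppp h (by norm_num : I0 ≤ 0.001)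
    rw [← rpow_mul ppp] at this
    norm_num at this ⊢
    exact this
  have hYp : I1 < Y := by exact_mod_cast (by omega : 1 < Y)
  have hY0 : I0 < Y := by linarith
  have hYq' : ↟Y ≤ ↟q^(0.01:ℝ) := by
    have h : ↟Y^100 ≤ q := by exact_mod_cast hYq
    have := rpow_le_rpow ppp h (by norm_num : I0 ≤ 0.01)
    rw [← rpow_natCast, ← rpow_mul hY0.le] at this
    norm_num at this ⊢
    exact this
  obtain ⟨j0, hj1, hj2⟩ := exists_nat_pow_near (y := ↟Y) (x := ↟q^(1.32:ℝ))
    (one_le_rpow hq1 nnn) hYp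
  have hjle : ↟Y^(j0+1) ≤ ↟q^(1.33:ℝ) := by
    calc ↟Y^(j0+1) = Y^j0 * Y := pow_succ _ _
      _ ≤ ↟q^(1.32:ℝ) * ↟q^(0.01:ℝ) := by gcongr
      _ = _ := by rw [← rpow_add hqp]; norm_num
  set j := j0 + 1 with hj
  set X : ℝ := ↟Y^j with hX
  have hXp : 0 < X := by positivity
  have hX1 : 1 ≤ X := one_le_pow₀ hYp.le
  have hXc : X^(1.97:ℝ) ≤ (A.card:ℝ)^j := by
    rw [hX, ← rpow_natCast, ← rpow_natCast, ← rpow_mul hY0.le, mul_comm, rpow_mul hY0.le]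
    exact rpow_le_rpow ppp hcard ppp
  have hXq : ↟q ≤ X := by
    calc ↟q = ↟q^I1 := by simp
      _ ≤ ↟q^(1.32:ℝ) := rpow_le_rpow_of_exponent_le hq1 nnn
      _ ≤ X := hj2.le
  have hMd : ∀ m ∈ Wd A j, m.det = 1 := fun m hm => (hA.wd_props j m hm).1
  have hE := hC (Y^j) q (Wd A j) (by exact_mod_cast hq1) (by rw [hX] at hXq; exact_mod_cast hXq) (fun g hg => by
    obtain ⟨h1, h2, h3, h4⟩ := hA.wd_props j g hg
    refine ⟨h1, fun i k => ⟨h2 i k, ?_⟩⟩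
    push_cast
    exact (le_sg h2 i k).trans (h4 ooo).2)
  rw [hA.wd_card] at hE
  push_cast at hE
  rw [← hX] at hE
  set c : ℝ := (A.card:ℝ)^j with hc
  have hXl : 0 < X^(1.97:ℝ) := rpow_pos_of_pos hXp _
  have hcp : 0 < c := lt_of_lt_of_le hXl hXc
  have hE2 : ((E2 (Wd A j) q).card : ℝ) ≤ c^2 * ((1 + C) * ↟q^(-(2.588:ℝ))) := by
    refine hE.trans ?_
    have t1 : c ≤ c^2 * ↟q^(-(2.588:ℝ)) := by
      have : ↟q^(2.588:ℝ) ≤ c := by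
        calc ↟q^(2.588:ℝ) ≤ ↟q^((1.32:ℝ)*1.97) := rpow_le_rpow_of_exponent_le hq1 nnn
          _ = (↟q^(1.32:ℝ))^(1.97:ℝ) := by rw [rpow_mul hqp.le]
          _ ≤ X^(1.97:ℝ) := rpow_le_rpow ppp hj2.le nnn
          _ ≤ c := hXc
      have h3 : ↟q^(2.588:ℝ) * ↟q^(-(2.588:ℝ)) = 1 := by
        rw [← rpow_add hqp]; norm_num
      have h4 : 0 < ↟q^(-(2.588:ℝ)) := rpow_pos_of_pos hqp _
      calc c = c * (↟q^(2.588:ℝ) * ↟q^(-(2.588:ℝ))) := by rw [h3, mul_one]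
        _ ≤ c * (c * ↟q^(-(2.588:ℝ))) := by gcongr
        _ = _ := by ring
    have t2 : C * X^(5 + (0.001:ℝ)) / ↟q^4 ≤ c^2 * (C * ↟q^(-(2.588:ℝ))) := by
      have h1 : X^(5 + (0.001:ℝ)) = (X^(1.97:ℝ))^2 * X^(1.061:ℝ) := by
        rw [← rpow_natCast, ← rpow_mul hXp.le, ← rpow_add hXp]; norm_num
      have h2 : X^(1.061:ℝ) ≤ ↟q^(4:ℕ) * ↟q^(-(2.588:ℝ)) := by
        calc X^(1.061:ℝ) ≤ (↟q^(1.33:ℝ))^(1.061:ℝ) := rpow_le_rpow hXp.le hjle nnn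
          _ = ↟q^((1.33:ℝ)*1.061) := by rw [rpow_mul hqp.le]
          _ ≤ ↟q^((4:ℕ) + (-(2.588:ℝ))) := rpow_le_rpow_of_exponent_le hq1 nnn
          _ = _ := by rw [rpow_add hqp, rpow_natCast]
      rw [div_le_iff₀ ppp, h1]
      calc C * ((X^(1.97:ℝ))^2 * X^(1.061:ℝ)) ≤ C * (c^2 * (↟q^(4:ℕ) * ↟q^(-(2.588:ℝ)))) := by gcongr
        _ = _ := by ring
    calc _ ≤ c^2 * ↟q^(-(2.588:ℝ)) + c^2 * (C * ↟q^(-(2.588:ℝ))) := add_le_add t1 t2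
      _ = _ := by ring
  have hcc : (A.card:ℝ)^(2*j) = c^2 := by rw [hc, ← pow_mul, mul_comm]
  have hC0 : 1 + C ≤ ↟q^(0.001:ℝ) := by
    refine le_trans ?_ hCC
    nlinarith
  refine ⟨j, by omega, hj2.le, hjle, ?_, ?_⟩
  · rw [hcc]
    refine hE2.trans ?_
    gcongr
    calc (1 + C) * ↟q^(-(2.588:ℝ)) ≤ ↟q^(0.001:ℝ) * ↟q^(-(2.588:ℝ)) := by gcongr
      _ = ↟q^(0.001 + -(2.588:ℝ)) := by rw [rpow_add hqp]
      _ ≤ _ := rpow_le_rpow_of_exponent_le hq1 nnn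
  · intro f hf
    refine (contraction p hinj (Wd A j) hMd f hf).trans ?_
    rw [← hq, hcc]
    apply mul_le_mul_of_nonneg_right _ (nrm_nonneg p f)
    have hprod : ∏ k, (2 * (p k : ℝ)^2) = 2^n * ↟q^2 := by
      rw [prod_mul_distrib, prod_pow, hq]; simp
    have h2n : I2^n ≤ C2 * ↟q^(0.001:ℝ) := (two_pow_le_tau p hinj).trans
      (hC2 q (by rintro h; rw [h] at hq2; norm_num at hq2))
    rw [hprod]
    calc _ ≤ (c^2 * ((1 + C) * ↟q^(-(2.588:ℝ)))) * ((C2 * ↟q^(0.001:ℝ)) * ↟q^2) := by gcongr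
      _ = c^2 * (((1 + C) * C2) * (↟q^(-(2.588:ℝ)) * ↟q^(0.001:ℝ) * ↟q^2)) := by ring
      _ ≤ c^2 * (↟q^(0.001:ℝ) * (↟q^(-(2.588:ℝ)) * ↟q^(0.001:ℝ) * ↟q^2)) := by gcongr
      _ = c^2 * ↟q^(-(0.586:ℝ)) := by
          rw [← rpow_natCast ↟q 2, ← rpow_add hqp, ← rpow_add hqp, ← rpow_add hqp]; norm_num
      _ ≤ _ := by
          gcongr
          norm_num


lemma coprime_vecMul (a : Fin 2 → ℤ) (ha : IsCoprime (a 0) (a 1)) (m : M2) (hm : IsUnit m.det) :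
    IsCoprime ((a ᵥ* m) 0) ((a ᵥ* m) 1) := by
  obtain ⟨u, v, h⟩ := ha
  obtain ⟨d, hd⟩ := hm.exists_left_inv
  rw [det_fin_two] at hd
  refine ⟨d * (u * m 1 1 - v * m 0 1), d * (- u * m 1 0 + v * m 0 0), ?_⟩
  simp only [vecMul, dotProduct, Fin.sum_univ_two]
  linear_combination h + (u * a 0 + v * a 1) * hd

lemma redV_ne_zero {n : ℕ} (p : Fin n → ℕ) [hp : ∀ i, Fact (p i).Prime] (a : Fin 2 → ℤ)
    (ha : IsCoprime (a 0) (a 1)) (i : Fin n) : redV p a i ≠ 0 := by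
  intro h
  have h0 : ((a 0 : ℤ) : ZMod (p i)) = 0 := congrFun h 0
  have h1 : ((a 1 : ℤ) : ZMod (p i)) = 0 := congrFun h 1
  obtain ⟨u, v, huv⟩ := ha
  have := congrArg (fun z : ℤ => (z : ZMod (p i))) huv
  push_cast at this
  rw [h0, h1] at this
  simp at this

lemma vec_bd (a : Fin 2 → ℤ) (h0 : 0 ≤ a 0) (h1 : 0 ≤ a 1) (m : M2) (hm : nn m) (X : ℤ)
    (hX : sg m ≤ X) (i : Fin 2) : 0 ≤ (a ᵥ* m) i ∧ (a ᵥ* m) i ≤ (a 0 + a 1) * X := by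
  simp only [vecMul, dotProduct, Fin.sum_univ_two]
  have b0 := (le_sg hm 0 i).trans hX
  have b1 := (le_sg hm 1 i).trans hX
  have c0 := hm 0 i
  have c1 := hm 1 i
  constructor
  · exact add_nonneg (mul_nonneg h0 c0) (mul_nonneg h1 c1)
  · have := mul_le_mul_of_nonneg_left b0 h0
    have := mul_le_mul_of_nonneg_left b1 h1
    linarith

lemma pair_count (A : Finset M2) (Y : ℕ) (hA : Code A Y) (k : ℕ) (hk : 1 ≤ k) (q : ℕ) (hq : 1 ≤ q)
    (hqY : q ≤ Y^k) (a : Fin 2 → ℤ) (ha : IsCoprime (a 0) (a 1)) (h0 : 0 < a 0) (h1 : 0 < a 1)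
    (h2 : 2 ≤ a 0 * a 1) :
    (((Wd A k ×ˢ Wd A k).filter (fun x => (q:ℤ) ∣ wedge (a ᵥ* x.1) (a ᵥ* x.2))).card : ℝ) ≤
      (A.card:ℝ)^k * (4 * ((a 0 + a 1 : ℤ) * ↟Y^k)^2 / q) := by
  classical
  rw [← hA.wd_card]
  have e : ((Wd A k ×ˢ Wd A k).filter (fun x => (q:ℤ) ∣ wedge (a ᵥ* x.1) (a ᵥ* x.2))).card =
      ∑ R ∈ Wd A k, ((Wd A k).filter (fun R' => (q:ℤ) ∣ wedge (a ᵥ* R) (a ᵥ* R'))).card := by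
    rw [card_filter, sum_product]
    apply sum_congr rfl
    intro R _
    rw [card_filter]
  rw [e]
  push_cast
  rw [← nsmul_eq_mul, ← sum_const]
  apply sum_le_sum
  intro R hR
  obtain ⟨c, hc⟩ := Int.eq_ofNat_of_zero_le (by omega : 0 ≤ a 0 + a 1)
  have := count_parallel q (c * Y^k) hq (by
      have : 1 ≤ c := by omega
      nlinarith) (a ᵥ* R) (coprime_vecMul a ha R (by rw [(hA.wd_props k R hR).1]; exact isUnit_one))
    (((Wd A k).filter (fun R' => (q:ℤ) ∣ wedge (a ᵥ* R) (a ᵥ* R'))).image (fun R' => a ᵥ* R')) (by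
      intro b hb
      simp only [mem_image, mem_filter] at hb
      obtain ⟨R', ⟨hR', hw⟩, rfl⟩ := hb
      obtain ⟨_, p2, _, p4⟩ := hA.wd_props k R' hR'
      refine ⟨fun i => ?_, hw⟩
      have := vec_bd a h0.le h1.le R' p2 _ (p4 hk).2 i
      refine ⟨this.1, this.2.trans ?_⟩
      rw [hc]; push_cast; exact le_refl _)
  rw [card_image_of_injOn] at this
  · have hc' : ((a 0:ℤ):ℝ) + ((a 1:ℤ):ℝ) = c := by exact_mod_cast hc
    push_cast at this ⊢
    rw [hc']; exact this
  · intro R1 m1 R2 m2 h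
    simp only [coe_filter, Set.mem_ofPred_eq] at m1 m2
    have p1 := hA.wd_props k R1 m1.1
    have p2 := hA.wd_props k R2 m2.1
    exact mult_one a ha h0 h1 h2 R1 R2 p1.1 p2.1 p1.2.1 p2.2.1 h

lemma iter_blocks {n : ℕ} (p : Fin n → ℕ) [hp : ∀ i, Fact (p i).Prime] (A : Finset M2) (Y : ℕ)
    (hA : Code A Y) (j : ℕ) (Λ : ℝ) (hΛ : 0 ≤ Λ)
    (hT : ∀ f : VV p → ℝ, New p f → nrm p (TM p (Wd A j) f) ≤ Λ * nrm p f) (k1 : ℕ) (a : Fin 2 → ℤ)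
    (m : ℕ) : ∀ f : VV p → ℝ, New p f → ∃ F : VV p → ℝ, New p F ∧ nrm p F ≤ Λ^m * nrm p f ∧
      ∑ R ∈ Wd A (k1 + j * m), f (redV p (a ᵥ* R)) = ∑ R ∈ Wd A k1, F (redV p (a ᵥ* R)) := by
  induction m with
  | zero => intro f hf; exact ⟨f, hf, by simp, by simp⟩
  | succ m ih =>
    intro f hf
    have hMd : ∀ m ∈ Wd A j, m.det = 1 := fun m hm => (hA.wd_props j m hm).1
    obtain ⟨F, h1, h2, h3⟩ := ih (TM p (Wd A j) f) (hf.TM p _ hMd)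
    refine ⟨F, h1, ?_, ?_⟩
    · refine h2.trans ?_
      rw [pow_succ, mul_assoc]
      exact mul_le_mul_of_nonneg_left (hT f hf) ppp
    · rw [← h3, show k1 + j * (m+1) = (k1 + j * m) + j by ring, hA.wd_add]
      apply sum_congr rfl
      intro R _
      rw [TM]
      apply sum_congr rfl
      intro w _
      rw [← redV_vecMul, vecMul_vecMul]

lemma eps_large : ∃ q0 : ℝ, 2 ≤ q0 ∧ ∀ (A : Finset M2) (Y : ℕ), Code A Y → 2 ≤ Y →
    ↟Y^(1.97:ℝ) ≤ A.card → ∀ (a : Fin 2 → ℤ), IsCoprime (a 0) (a 1) → 0 < a 0 → 0 < a 1 →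
    2 ≤ a 0 * a 1 → ∃ Cst : ℝ, 0 < Cst ∧ ∀ (F : Finset M2), (∀ P ∈ F, P.det = 1) →
    ∀ (G : M2), IsUnit G.det → 
    ∀ (n : ℕ) (p : Fin n → ℕ) [hp : ∀ i, Fact (p i).Prime],
    Function.Injective p → (∀ i, p i % 4 = 1) → q0 ≤ ((∏ i, p i : ℕ):ℝ) → Y^100 ≤ ∏ i, p i →
    ∀ k : ℕ, (∏ i, p i)^4 ≤ Y^k →
    |∑ R ∈ Wd A k, ∑ P ∈ F, eF p G (redV p (a ᵥ* (R * P)))| ≤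
      (A.card:ℝ)^k * F.card * (Cst * ((∏ i, p i : ℕ):ℝ)^(-I1) * (↟Y^k)^(-(0.005:ℝ))) := by
  obtain ⟨q0, hq02, hop⟩ := op_block
  obtain ⟨C2, hC21, hC2⟩ := tau_bound 0.001 nnn
  refine ⟨q0, hq02, ?_⟩
  intro A Y hA hY hcard a hac ha0 ha1 ha2
  obtain ⟨c, hc⟩ : ∃ c : ℝ, c = ((a 0 + a 1 : ℤ) : ℝ) := ⟨_, rfl⟩
  have hcp : 0 < c := by rw [hc]; exact_mod_cast (by omega : 0 < a 0 + a 1)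
  refine ⟨2 * C2 * c, by positivity, ?_⟩
  intro F hF G hG n p hp hinj h4 hq0 hYq k hk
  obtain ⟨j, hj1, hX1, hX2, -, hT⟩ := hop A Y hA hY hcard n p hinj hq0 hYq
  set q : ℕ := ∏ i, p i with hq
  have hq2 : I2 ≤ q := hq02.trans hq0
  have hqp : I0 < q := by linarith
  have hq1 : I1 ≤ q := by linarith
  have hqn : 2 ≤ q := by exact_mod_cast hq2
  have hYp : I1 < Y := by exact_mod_cast (by omega : 1 < Y)
  have hY0 : I0 < Y := by linarith
  have hk' : ↟q^4 ≤ ↟Y^k := by exact_mod_cast hk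
  obtain ⟨m, k1, hm2, hkm, hk1a, hk1b⟩ : ∃ m k1 : ℕ, 2 ≤ m ∧ k = k1 + j * m ∧ ↟q ≤ ↟Y^k1 ∧
      ↟Y^k1 ≤ q * ↟Y^j := by
    set Pr : ℕ → Prop := fun m => j * m ≤ k ∧ ↟q ≤ ↟Y^(k - j * m) with hPr
    have h2j : ↟q * ↟Y^(j*2) ≤ ↟Y^k := by
      calc ↟q * ↟Y^(j*2) = q * (↟Y^j)^2 := by rw [pow_mul]
        _ ≤ q * (↟q^(1.33:ℝ))^2 := by gcongr
        _ = ↟q^(3.66:ℝ) := by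
          rw [← rpow_natCast, ← rpow_mul hqp.le]
          nth_rewrite 1 [← rpow_one ↟q]
          rw [← rpow_add hqp]; norm_num
        _ ≤ ↟q^↟4 := rpow_le_rpow_of_exponent_le hq1 nnn
        _ = ↟q^4 := by norm_cast
        _ ≤ _ := hk'
    have hjk : j * 2 ≤ k := by
      have : ↟Y^(j*2) ≤ ↟Y^k := le_trans (by nlinarith [pow_pos hY0 (j*2)]) h2j
      exact (pow_le_pow_iff_right₀ hYp).1 this
    have hP2 : Pr 2 := by
      refine ⟨hjk, ?_⟩
      have : ↟Y^k = ↟Y^(k - j*2) * ↟Y^(j*2) := by rw [← pow_add]; congr 1; omega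
      rw [this] at h2j
      exact le_of_mul_le_mul_right h2j ppp
    classical
    have hspec : Pr (findGreatest Pr k) := Nat.findGreatest_spec (m := 2) ooo hP2
    have hge : 2 ≤ findGreatest Pr k := Nat.le_findGreatest ooo hP2
    set m := findGreatest Pr k with hm
    refine ⟨m, k - j * m, hge, by have := hspec.1; omega, hspec.2, ?_⟩
    have hnot : ¬ Pr (m+1) := by
      rcases Nat.lt_or_ge k (m+1) with h | h
      · rintro ⟨h', _⟩
        nlinarith
      · exact Nat.findGreatest_is_greatest (Nat.lt_succ_self _) h
    rcases Nat.lt_or_ge k (j * (m+1)) with h | h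
    · have h5 : k - j * m ≤ j := by rw [Nat.mul_add] at h; omega
      calc ↟Y^(k - j*m) ≤ ↟Y^j := pow_le_pow_right₀ hYp.le h5
        _ ≤ _ := le_mul_of_one_le_left ppp hq1
    · have h6 : ↟Y^(k - j*(m+1)) < q := by
        by_contra! h7
        exact hnot ⟨h, h7⟩
      have : k - j * m = (k - j*(m+1)) + j := by rw [Nat.mul_add] at h ⊢; omega
      rw [this, pow_add]
      exact mul_le_mul_of_nonneg_right h6.le ppp
  have hk10 : 1 ≤ k1 := by
    by_contra! h
    have : k1 = 0 := by omega
    rw [this, pow_zero] at hk1a; linarith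
  set f0 : VV p → ℝ := TM p F (eF p G) with hf0
  have hf0n : New p f0 := (eF_new p h4 G hG).TM p F hF
  have hf0b : nrm p f0 ≤ (F.card:ℝ)^2 * (2^n * q) :=
    (nrm_TM_le p F hF _).trans (mul_le_mul_of_nonneg_left (eF_nrm p h4 G hG) ppp)
  obtain ⟨Fm, hFn, hFb, hFs⟩ := iter_blocks p A Y hA j _ ppp hT k1 a m f0 hf0n
  have hsum : ∑ R ∈ Wd A k, ∑ P ∈ F, eF p G (redV p (a ᵥ* (R * P))) = ∑ R ∈ Wd A k1, Fm (redV p (a ᵥ* R)) := by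
    rw [← hFs, ← hkm]
    apply sum_congr rfl
    intro R _
    rw [hf0, TM]
    apply sum_congr rfl
    intro w _
    rw [← redV_vecMul, vecMul_vecMul]
  have hib := initial_block p hinj (Wd A k1) (fun R => a ᵥ* R) (fun R hR i =>
    redV_ne_zero p _ (coprime_vecMul a hac R (by rw [(hA.wd_props k1 R hR).1]; exact isUnit_one)) i) Fm hFn
  rw [← hsum, ← hq] at hib
  have hpc := pair_count A Y hA k1 hk10 q ooo (by exact_mod_cast hk1a) a hac ha0 ha1 ha2
  rw [← hc] at hpc
  set Sg := ∑ R ∈ Wd A k, ∑ P ∈ F, eF p G (redV p (a ᵥ* (R * P))) with hSg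
  set X : ℝ := ↟Y^j with hX
  set H1 : ℝ := ↟Y^k1 with hH1
  set N : ℝ := (A.card:ℝ) with hN
  have hXp : 0 < X := by positivity
  have hH1p : 0 < H1 := by positivity
  have hNp : 0 < N := lt_of_lt_of_le ppp hcard
  have h2n : I2^n ≤ C2 * ↟q^(0.001:ℝ) := (two_pow_le_tau p hinj).trans (hC2 q ooo)
  have hphi : ↟q ≤ 2^n * ∏ i, ((p i:ℝ) - 1) := by
    have : I2^n = ∏ i : Fin n, I2 := by simp
    rw [this, ← prod_mul_distrib, hq]
    push_cast
    apply prod_le_prod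
    · intro i _; positivity
    · intro i _
      have : I2 ≤ p i := by exact_mod_cast (hp i).out.two_le
      linarith
  have hN1 : H1^(1.97:ℝ) ≤ N^k1 := by
    rw [hH1, ← rpow_natCast, ← rpow_natCast, ← rpow_mul hY0.le, mul_comm, rpow_mul hY0.le]
    exact rpow_le_rpow ppp hcard ppp
  have hHk : ↟Y^k = H1 * X^m := by rw [hkm, pow_add, pow_mul]
  have hNk : N^k = N^k1 * (N^j)^m := by rw [hkm, pow_add, pow_mul]
  have main : Sg^2 * q ≤ ((N^k * F.card)^2) * ((2^n)^2 * (4 * c^2) * (H1^2 / N^k1) * (↟q^(-(0.57:ℝ)))^m) := by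
    calc Sg^2 * q ≤ Sg^2 * (2^n * ∏ i, ((p i:ℝ) - 1)) := by gcongr
      _ = 2^n * (Sg^2 * ∏ i, ((p i:ℝ) - 1)) := by ring
      _ ≤ 2^n * (nrm p Fm * (N^k1 * (4 * (c * H1)^2 / q))) := by
          apply mul_le_mul_of_nonneg_left _ ppp
          exact hib.trans (mul_le_mul_of_nonneg_left hpc (nrm_nonneg p Fm))
      _ ≤ 2^n * (((N^(2*j) * ↟q^(-(0.57:ℝ)))^m * ((F.card:ℝ)^2 * (2^n * q))) * (N^k1 * (4 * (c * H1)^2 / q))) := by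
          apply mul_le_mul_of_nonneg_left _ ppp
          apply mul_le_mul_of_nonneg_right _ ppp
          exact hFb.trans (mul_le_mul_of_nonneg_left hf0b ppp)
      _ = _ := by
          rw [hNk, mul_pow (N^(2*j))]
          have : N^(2*j) = (N^j)^2 := by rw [← pow_mul, mul_comm]
          rw [this, ← pow_mul (N^j) 2 m, mul_comm 2 m, pow_mul (N^j) m 2]
          field_simp
  have hb1 : H1^2 / N^k1 ≤ H1^(0.03:ℝ) := by
    rw [div_le_iff₀ ppp]
    calc H1^2 = H1^(0.03:ℝ) * H1^(1.97:ℝ) := by rw [← rpow_add hH1p]; norm_num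
      _ ≤ _ := by gcongr
  have hH1u : H1 ≤ ↟q^(2.33:ℝ) := by
    calc H1 ≤ q * X := hk1b
      _ ≤ q * ↟q^(1.33:ℝ) := by gcongr
      _ = _ := by nth_rewrite 1 [← rpow_one ↟q]; rw [← rpow_add hqp]; norm_num
  have hHu : ↟Y^k ≤ ↟q^(2.33 + 1.33 * ↟m) := by
    rw [hHk, rpow_add hqp, rpow_mul hqp.le, rpow_natCast]
    gcongr
  have fin : (I2^n)^2 * (4 * c^2) * (H1^2 / N^k1) * (↟q^(-(0.57:ℝ)))^m ≤
      q * (2 * C2 * c * ↟q^(-I1) * (↟Y^k)^(-(0.005:ℝ)))^2 := by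
    have l1 : (↟q^(-(0.57:ℝ)))^m = ↟q^(-(0.57:ℝ) * m) := by rw [rpow_mul hqp.le, rpow_natCast]
    have hm2' : I2 ≤ m := by exact_mod_cast hm2
    have l2 : ↟q^(-((2.33 + 1.33 * ↟m) * 0.005)) ≤ (↟Y^k)^(-(0.005:ℝ)) := by
      rw [rpow_neg hqp.le, rpow_neg ppp]
      apply inv_anti₀ ppp
      rw [rpow_mul hqp.le]
      gcongr
    calc _ ≤ (C2 * ↟q^(0.001:ℝ))^2 * (4 * c^2) * (↟q^(2.33:ℝ))^(0.03:ℝ) * ↟q^(-(0.57:ℝ) * m) := by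
          rw [l1]
          have : H1^2 / N^k1 ≤ (↟q^(2.33:ℝ))^(0.03:ℝ) := hb1.trans (by gcongr)
          gcongr
      _ = (2 * C2 * c)^2 * (↟q^(0.001:ℝ) * ↟q^(0.001:ℝ) * ↟q^((2.33:ℝ)*0.03) * ↟q^(-(0.57:ℝ) * m)) := by
          rw [rpow_mul hqp.le 2.33]; ring
      _ = (2 * C2 * c)^2 * ↟q^(0.001 + 0.001 + (2.33:ℝ)*0.03 + -(0.57:ℝ) * m) := by
          rw [← rpow_add hqp, ← rpow_add hqp, ← rpow_add hqp]
      _ ≤ (2 * C2 * c)^2 * ↟q^(1 + -I1 + -I1 + -((2.33 + 1.33 * ↟m) * 0.005) + -((2.33 + 1.33 * ↟m) * 0.005)) := by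
          apply mul_le_mul_of_nonneg_left _ ppp
          apply rpow_le_rpow_of_exponent_le hq1
          norm_num
          linarith
      _ = q * (2 * C2 * c * ↟q^(-I1) * ↟q^(-((2.33 + 1.33 * ↟m) * 0.005)))^2 := by
          rw [rpow_add hqp, rpow_add hqp, rpow_add hqp, rpow_add hqp, rpow_one]; ring
      _ ≤ _ := by gcongr
  have fin2 : Sg^2 ≤ (N^k * F.card * (2 * C2 * c * ↟q^(-I1) * (↟Y^k)^(-(0.005:ℝ))))^2 := by
    have := main.trans (mul_le_mul_of_nonneg_left fin ppp)
    rw [mul_pow]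
    apply le_of_mul_le_mul_right _ hqp
    calc _ ≤ _ := this
      _ = _ := by ring
  exact abs_le_of_sq_le_sq fin2 ppp


def SW (A : Finset M2) : Set M2 := {w | ∃ j, w ∈ Wd A j}

lemma Wd_mul {A : Finset M2} {i j : ℕ} {u w : M2} (hu : u ∈ Wd A i) (hw : w ∈ Wd A j) :
    u * w ∈ Wd A (i + j) := by
  induction i generalizing u with
  | zero =>
    simp only [Wd, mem_singleton] at hu
    subst hu; simpa using hw
  | succ i ih =>
    simp only [Wd, mem_image, mem_product] at hu
    obtain ⟨⟨g, u'⟩, ⟨h1, h2⟩, rfl⟩ := hu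
    rw [show i + 1 + j = (i + j) + 1 by ring]
    simp only [Wd, mem_image, mem_product]
    exact ⟨(g, u' * w), ⟨h1, ih h2⟩, by simp [Matrix.mul_assoc]⟩

lemma SW_mul {A : Finset M2} {u w : M2} (hu : u ∈ SW A) (hw : w ∈ SW A) : u * w ∈ SW A := by
  obtain ⟨i, hi⟩ := hu
  obtain ⟨j, hj⟩ := hw
  exact ⟨_, Wd_mul hi hj⟩

lemma SW_one {A : Finset M2} : 1 ∈ SW A := ⟨0, by simp [Wd]⟩

lemma SW_pow {A : Finset M2} {u : M2} (hu : u ∈ SW A) (k : ℕ) : u ^ k ∈ SW A := by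
  induction k with
  | zero => simpa using SW_one
  | succ k ih => rw [pow_succ]; exact SW_mul ih hu

lemma rdM_one (k : ℕ) : rdM 1 k = 1 := by
  simp [rdM]

lemma rdM_pow (m : M2) (k j : ℕ) : rdM (m^j) k = (rdM m k)^j := by
  induction j with
  | zero => simp [rdM_one]
  | succ j ih => rw [pow_succ, pow_succ, rdM_mul, ih]

lemma rdM_eq_iff (m m' : M2) (k : ℕ) : rdM m k = rdM m' k ↔ ∀ i j, (k:ℤ) ∣ m' i j - m i j := by
  rw [← Matrix.ext_iff]
  simp only [rdM, map_apply, ZMod.intCast_eq_intCast_iff_dvd_sub]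

lemma rdM_of_dvd {m m' : M2} {k l : ℕ} (h : l ∣ k) (hm : rdM m k = rdM m' k) : rdM m l = rdM m' l := by
  rw [rdM_eq_iff] at *
  exact fun i j => (natCast_dvd_natCast.mpr h).trans (hm i j)

lemma rdM_sq (w : M2) (r : ℕ) (h : rdM w r = 1) : rdM (w^r) (r*r) = 1 := by
  rw [← rdM_one, rdM_eq_iff]
  have hg : ∀ i j, (r:ℤ) ∣ (∑ i ∈ rgg r, w^i) i j := by
    have : rdM (∑ i ∈ rgg r, w^i) r = rdM 0 r := by
      have e : ∀ M : M2, rdM M r = (castRingHom (ZMod r)).mapMatrix M := fun _ => rfl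
      rw [e, e, map_sum, map_zero]
      have : ∀ i ∈ rgg r, (castRingHom (ZMod r)).mapMatrix (w^i) = 1 := by
        intro i _
        rw [← e, rdM_pow, h, one_pow]
      rw [sum_congr rfl this, sum_const, card_range]
      ext a b
      by_cases hab : a = b <;> simp [hab]
    rw [rdM_eq_iff] at this
    intro i j
    have := this i j
    simpa using this
  have h1 : ∀ i j, (r:ℤ) ∣ (w - 1) i j := by
    rw [← rdM_one, eq_comm, rdM_eq_iff] at h
    exact h
  intro i j
  rw [← Matrix.sub_apply, ← neg_sub, Matrix.neg_apply, dvd_neg]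
  rw [← mul_geom_sum, Matrix.mul_apply]
  push_cast
  exact dvd_sum fun k _ => mul_dvd_mul (h1 i k) (hg k j)

lemma rdM_primorial (w : M2) (y : ℕ) (h : ∀ p, p.Prime → p ≤ y → rdM w p = 1) : rdM w (primorial y) = 1 := by
  rw [← rdM_one, eq_comm, rdM_eq_iff]
  intro i j
  rw [natCast_dvd]
  apply Finset.prod_primes_dvd
  · intro p hp
    simp only [mem_filter] at hp
    exact hp.2.prime
  · intro p hp
    simp only [mem_filter, mem_range] at hp
    have := h p hp.2 ooo
    rw [← rdM_one, eq_comm, rdM_eq_iff] at this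
    exact natCast_dvd.mp (this i j)

def ordG (p : ℕ) : ℕ := (p^2 - 1) * (p^2 - p)

lemma ordG_spec (p : ℕ) [Fact p.Prime] (g : Matrix (Fin 2) (Fin 2) (ZMod p)) (hg : g.det = 1) :
    g ^ ordG p = 1 := by
  have hu : IsUnit g := by rw [isUnit_iff_isUnit_det, hg]; exact isUnit_one
  obtain ⟨u, rfl⟩ := hu
  have := pow_card_eq_one' (x := u)
  have hc : Nat.card (GL (Fin 2) (ZMod p)) = ordG p := by
    rw [Matrix.card_GL_field]
    simp [Fin.prod_univ_two, ordG]
  have h2 : u ^ Nat.card (GL (Fin 2) (ZMod p)) = 1 := this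
  rw [hc] at h2
  rw [← Units.val_pow_eq_pow_val, h2, Units.val_one]

lemma ordG_coprime {p P : ℕ} (hp : p.Prime) (hP : P.Prime) (h : p < P) (h3 : 3 < P) : ¬ P ∣ ordG p := by
  unfold ordG
  have e1 : p^2 - 1 = (p+1)*(p-1) := by
    simpa using Nat.sq_sub_sq p 1
  have e2 : p^2 - p = p * (p-1) := by
    rw [Nat.mul_sub]; ring_nf
  rw [e1, e2]
  have hp2 := hp.two_le
  have key : ∀ x, 0 < x → x < P → ¬ P ∣ x := fun x h0 h1 h2 => absurd (Nat.le_of_dvd h0 h2) ooo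
  intro hd
  rw [hP.dvd_mul, hP.dvd_mul, hP.dvd_mul] at hd
  rcases hd with (hd | hd) | (hd | hd)
  · have h1 := Nat.le_of_dvd ooo hd
    have h2 : P = p + 1 := by omega
    subst h2
    rcases hp.eq_two_or_odd with h | h
    · omega
    · rcases hP.eq_two_or_odd with h' | h' <;> omega
  · exact key _ ooo ooo hd
  · exact key _ ooo ooo hd
  · exact key _ ooo ooo hd

lemma ordG_pos {p : ℕ} (hp : p.Prime) : 1 ≤ ordG p := by
  unfold ordG
  have := hp.two_le
  have h1 : 1 < p^2 := by nlinarith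
  have h2 : p < p^2 := by nlinarith
  exact Nat.mul_pos ooo ooo

lemma unip_exists {A : Finset M2} {Y : ℕ} (hA : Code A Y) (p : ℕ) [hp : Fact p.Prime] (j : ℕ)
    (hne : 0 < A.card)
    (hE : ((E2 (Wd A j) p).card : ℝ) ≤ (A.card:ℝ)^(2*j) * ↟p^(-(2.58:ℝ))) (e : Vp p) :
    ∃ W ∈ SW A, e ᵥ* rdM W p = e ∧ rdM W p ≠ 1 ∧ (rdM W p).det = 1 := by
  classical
  set M := Wd A j with hM
  set K := M.image (fun w => rdM w p) with hK
  have hMc : (M.card:ℝ) = (A.card:ℝ)^j := hA.wd_card j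
  have hp2 : I2 ≤ p := by exact_mod_cast hp.out.two_le
  have hfib : M.card = ∑ κ ∈ K, (M.filter (fun w => rdM w p = κ)).card :=
    card_eq_sum_card_fiberwise (s := M) (t := K) (f := fun w => rdM w p)
      (fun s hs => by exact_mod_cast mem_image_of_mem (fun w => rdM w p) (mem_coe.mp hs))
  have hEc : (E2 M p).card = ∑ κ ∈ K, (M.filter (fun w => rdM w p = κ)).card ^ 2 := by
    have h1 := card_eq_sum_card_fiberwise (s := E2 M p) (t := K) (f := fun x => rdM x.1 p)
      (fun s hs => by
        have hs' : s ∈ E2 M p := mem_coe.mp hs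
        simp only [E2, mem_filter, mem_product] at hs'
        exact_mod_cast mem_image_of_mem (fun w => rdM w p) hs'.1.1)
    rw [h1]
    refine sum_congr rfl fun κ _ => ?_
    rw [sq, ← card_product]
    congr 1
    ext ⟨u, w⟩
    simp only [E2, mem_filter, mem_product, ← rdM_eq_iff]
    constructor
    · rintro ⟨⟨⟨a, b⟩, c⟩, d⟩; exact ⟨⟨a, d⟩, b, c ▸ d⟩
    · rintro ⟨⟨a, d⟩, b, c⟩; exact ⟨⟨⟨a, b⟩, d.trans c.symm⟩, d⟩
  have hCS : ((M.card:ℝ))^2 ≤ K.card * (E2 M p).card := by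
    rw [hEc, hfib]; push_cast
    exact sq_sum_le_card_mul_sum_sq
  have hA0 : I0 < (A.card:ℝ)^j := by positivity
  have hKp : p^2 < K.card := by
    by_contra hcon
    push Not at hcon
    have hcon' : (K.card:ℝ) ≤ ↟p^I2 := by
      rw [Real.rpow_ofNat]; exact_mod_cast hcon
    have h1 : ((A.card:ℝ)^j)^2 ≤ ↟p^I2 * ((A.card:ℝ)^(2*j) * ↟p^(-(2.58:ℝ))) := by
      rw [← hMc]
      refine hCS.trans ?_
      rw [hMc] at *
      exact mul_le_mul hcon' hE ppp ppp
    rw [mul_left_comm, ← rpow_add (by linarith), ← pow_mul, mul_comm j 2] at h1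
    have h2 : ↟p^(I2 + -2.58) < 1 := rpow_lt_one_of_one_lt_of_neg (by linarith) nnn
    have h3 : 0 < (A.card:ℝ)^(2*j) := by positivity
    nlinarith
  obtain ⟨g, hg, g', hg', hne', heq⟩ := Finset.exists_ne_map_eq_of_card_lt_of_maps_to
    (s := K) (t := (univ : Finset (Vp p))) (f := fun g => e ᵥ* g)
    (by simpa [Vp, ZMod.card] using hKp) (fun _ _ => by simp)
  simp only [hK, mem_image] at hg hg'
  obtain ⟨w, hw, rfl⟩ := hg
  obtain ⟨w', hw', rfl⟩ := hg'
  have d1 := (hA.wd_props j w hw).1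
  have d2 := (hA.wd_props j w' hw').1
  have D1 : (rdM w p).det = 1 := by rw [rdM_det, d1]; simp
  have D2 : (rdM w' p).det = 1 := by rw [rdM_det, d2]; simp
  obtain ⟨t, ht⟩ : ∃ t, ordG p = t + 1 := ⟨ordG p - 1, by have := ordG_pos hp.out; omega⟩
  have hinv : rdM w' p * rdM w' p ^ t = 1 := by rw [← pow_succ', ← ht]; exact ordG_spec p _ D2
  have hinv' : rdM w' p ^ t * rdM w' p = 1 := by rw [← pow_succ, ← ht]; exact ordG_spec p _ D2
  refine ⟨w * w'^t, SW_mul ⟨j, hw⟩ (SW_pow ⟨j, hw'⟩ t), ?_, ?_, ?_⟩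
  · rw [rdM_mul, rdM_pow, ← vecMul_vecMul]
    rw [heq, vecMul_vecMul, hinv, Matrix.vecMul_one]
  · rw [rdM_mul, rdM_pow]
    intro h
    apply hne'
    calc rdM w p = rdM w p * rdM w' p ^ t * rdM w' p := by rw [Matrix.mul_assoc, hinv', Matrix.mul_one]
      _ = _ := by rw [h, Matrix.one_mul]
  · rw [rdM_mul, rdM_pow, det_mul, det_pow, D1, D2]; simp

lemma Nw_unip (p : ℕ) [hp : Fact p.Prime] (f : Vp p → ℝ) (hf : Nw p f) (s t : ZMod p) (hs : s ≠ 0) (ht : t ≠ 0)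
    (h1 : ∀ x : Vp p, f ![x 0 + s * x 1, x 1] = f x) (h2 : ∀ x : Vp p, f ![x 0, x 1 + t * x 0] = f x) :
    ∀ x, f x = 0 := by
  have e : ∀ x : Vp p, x = ![x 0, x 1] := fun x => by ext i; fin_cases i <;> rfl
  have k1 : ∀ (k : ℕ) (a b : ZMod p), f ![a + k * (s * b), b] = f ![a, b] := by
    intro k a b
    induction k with
    | zero => simp
    | succ k ih =>
      rw [← ih, ← h1 ![a + k * (s * b), b]]
      congr 2; push_cast; ring_nf
  have k2 : ∀ (k : ℕ) (a b : ZMod p), f ![a, b + k * (t * a)] = f ![a, b] := by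
    intro k a b
    induction k with
    | zero => simp
    | succ k ih =>
      rw [← ih, ← h2 ![a, b + k * (t * a)]]
      congr 2; push_cast; ring_nf
  have m1 : ∀ a a' b : ZMod p, b ≠ 0 → f ![a, b] = f ![a', b] := by
    intro a a' b hb
    rw [← k1 (((a' - a) / (s * b)).val) a b]
    congr 2
    rw [ZMod.natCast_zmod_val]; field_simp; ring
  have m2 : ∀ a b b' : ZMod p, a ≠ 0 → f ![a, b] = f ![a, b'] := by
    intro a b b' ha
    rw [← k2 (((b' - b) / (t * a)).val) a b]
    congr 2
    rw [ZMod.natCast_zmod_val]; field_simp; ring_nf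
  have hc : ∀ x : Vp p, x ≠ 0 → f x = f ![1, 0] := by
    intro x hx
    rw [e x]
    by_cases h : x 1 = 0
    · have h0 : x 0 ≠ 0 := by
        intro h0; apply hx; rw [e x, h, h0]; ext i; fin_cases i <;> rfl
      rw [h, ← hf.hom (x 0) h0 ![1, 0]]
      congr 1; simp
    · rw [m1 _ 1 _ h, m2 1 _ 0 one_ne_zero]
  have h0 : f ![1, 0] = 0 := by
    have hsum := hf.sum
    rw [← add_sum_erase _ _ (mem_univ 0), hf.zero, zero_add,
      sum_congr rfl (fun x hx => hc x (ne_of_mem_erase hx)), sum_const, nsmul_eq_mul,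
      card_erase_of_mem (mem_univ _)] at hsum
    rcases mul_eq_zero.mp hsum with h | h
    · exfalso
      have : Fintype.card (Vp p) = p^2 := by simp [Vp, ZMod.card]
      rw [card_univ, this] at h
      have h' : p^2 - 1 = 0 := by exact_mod_cast h
      have := hp.out.two_le
      have : 1 < p^2 := by nlinarith
      omega
    · exact h
  intro x
  by_cases hx : x = 0
  · rw [hx, hf.zero]
  · rw [hc x hx, h0]


lemma reps_exist (A : Finset M2) (N Q : ℕ) (hQ : Q ≠ 0) : ∃ F : Finset M2, F.Nonempty ∧
    (∀ P ∈ F, P ∈ SW A ∧ rdM P N = 1) ∧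
    (∀ w ∈ SW A, rdM w N = 1 → ∃ P ∈ F, rdM P Q = rdM w Q) ∧
    (∀ P ∈ F, ∀ P' ∈ F, rdM P Q = rdM P' Q → P = P') := by
  classical
  have : NeZero Q := ⟨hQ⟩
  set S1 : Set M2 := {w | w ∈ SW A ∧ rdM w N = 1} with hS1
  set I : Set (Matrix (Fin 2) (Fin 2) (ZMod Q)) := (fun w => rdM w Q) '' S1 with hI
  have hfin : I.Finite := Set.toFinite I
  have hex : ∀ x : Matrix (Fin 2) (Fin 2) (ZMod Q), ∃ w : M2, x ∈ I → (w ∈ S1 ∧ rdM w Q = x) := by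
    intro x
    by_cases hx : x ∈ I
    · obtain ⟨w, hw, h⟩ := hx
      exact ⟨w, fun _ => ⟨hw, h⟩⟩
    · exact ⟨1, fun h => absurd h hx⟩
  choose s hs using hex
  refine ⟨hfin.toFinset.image s, ?_, ?_, ?_, ?_⟩
  · refine Finset.Nonempty.image ⟨1, ?_⟩ _
    rw [Set.Finite.mem_toFinset]
    exact ⟨1, ⟨SW_one, rdM_one _⟩, rdM_one _⟩
  · intro P hP
    simp only [mem_image, Set.Finite.mem_toFinset] at hP
    obtain ⟨x, hx, rfl⟩ := hP
    exact (hs x hx).1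
  · intro w hw h1
    have hx : rdM w Q ∈ I := ⟨w, ⟨hw, h1⟩, rfl⟩
    refine ⟨s (rdM w Q), ?_, (hs _ hx).2⟩
    simp only [mem_image, Set.Finite.mem_toFinset]
    exact ⟨_, hx, rfl⟩
  · intro P hP P' hP' h
    simp only [mem_image, Set.Finite.mem_toFinset] at hP hP'
    obtain ⟨x, hx, rfl⟩ := hP
    obtain ⟨x', hx', rfl⟩ := hP'
    rw [(hs x hx).2, (hs x' hx').2] at h
    rw [h]

lemma SW_det {A : Finset M2} {Y : ℕ} (hA : Code A Y) {w : M2} (hw : w ∈ SW A) : w.det = 1 := by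
  obtain ⟨j, hj⟩ := hw
  exact (hA.wd_props j w hj).1

lemma unip_pow (p : ℕ) (s : ZMod p) (M : ℕ) :
    (!![1, 0; s, 1] : Matrix (Fin 2) (Fin 2) (ZMod p))^M = !![1, 0; M * s, 1] := by
  induction M with
  | zero => ext i j; fin_cases i <;> fin_cases j <;> simp
  | succ M ih =>
    rw [pow_succ, ih]; ext i j; fin_cases i <;> fin_cases j <;> simp [Matrix.mul_apply, Fin.sum_univ_two]; ring

lemma unip_pow' (p : ℕ) (s : ZMod p) (M : ℕ) :
    (!![1, s; 0, 1] : Matrix (Fin 2) (Fin 2) (ZMod p))^M = !![1, M * s; 0, 1] := by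
  induction M with
  | zero => ext i j; fin_cases i <;> fin_cases j <;> simp
  | succ M ih =>
    rw [pow_succ, ih]; ext i j; fin_cases i <;> fin_cases j <;> simp [Matrix.mul_apply, Fin.sum_univ_two]; ring

lemma small_primes : ∃ q0 : ℝ, 2 ≤ q0 ∧ ∀ (A : Finset M2) (Y : ℕ), Code A Y → 2 ≤ Y →
    ↟Y^(1.97:ℝ) ≤ A.card → ∀ y : ℕ, 3 ≤ y → Y^100 ≤ y → q0 ≤ y → ∀ q1 : ℕ, ∃ F : Finset M2, F.Nonempty ∧
    (∀ P ∈ F, P ∈ SW A ∧ rdM P (primorial y * primorial y) = 1) ∧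
    ∀ (n : ℕ) (p : Fin n → ℕ) [hp : ∀ i, Fact (p i).Prime], Function.Injective p → 0 < n →
      (∀ i, y < p i ∧ p i ≤ q1) → ∀ f : VV p → ℝ, New p f → ∀ v, ∑ P ∈ F, f (actM p v P) = 0 := by
  classical
  obtain ⟨q0, hq02, hop⟩ := op_block
  refine ⟨q0, hq02, ?_⟩
  intro A Y hA hY hcard y hy3 hYy hq0y q1
  have hApos : 0 < A.card := by
    have : I0 < A.card := lt_of_lt_of_le ppp hcard
    exact_mod_cast this
  set N := primorial y * primorial y with hN
  have hQ0 : primorial q1 ≠ 0 := (primorial_pos q1).ne'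
  obtain ⟨F, hFne, hF1, hF2, hF3⟩ := reps_exist A N (primorial q1) hQ0
  refine ⟨F, hFne, hF1, ?_⟩
  intro n p hp hinj hn hpy f hf v
  have hpQ : ∀ i, p i ∣ primorial q1 := fun i =>
    dvd_prod_of_mem _ (by simp [lt_succ_iff, (hpy i).2, (hp i).out])
  have hact : ∀ (v : VV p) (w w' : M2), rdM w (primorial q1) = rdM w' (primorial q1) → actM p v w = actM p v w' := by
    intro v w w' h
    funext i
    simp only [actM]
    rw [rdM_of_dvd (hpQ i) h]
  have hinv : ∀ x ∈ SW A, rdM x N = 1 → ∀ v, TM p F f (actM p v x) = TM p F f v := by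
    intro x hx hx1 v
    have hex : ∀ P : M2, ∃ P' : M2, P ∈ F → (P' ∈ F ∧ rdM P' (primorial q1) = rdM (x * P) (primorial q1)) := by
      intro P
      by_cases hP : P ∈ F
      · obtain ⟨P', h1, h2⟩ := hF2 (x * P) (SW_mul hx (hF1 P hP).1)
          (by rw [rdM_mul, hx1, (hF1 P hP).2, one_mul])
        exact ⟨P', fun _ => ⟨h1, h2⟩⟩
      · exact ⟨1, fun h => absurd h hP⟩
    choose σ hσ using hex
    have hinjσ : Set.InjOn σ F := by
      intro P hP P' hP' h
      have e1 := (hσ P hP).2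
      have e2 := (hσ P' hP').2
      rw [h, e2, rdM_mul, rdM_mul] at e1
      refine hF3 P hP P' hP' ?_
      have hu := rdM_unit (SW_det hA hx) (primorial q1)
      have := congrArg (fun z => (rdM x (primorial q1))⁻¹ * z) e1
      simp only [← Matrix.mul_assoc, nonsing_inv_mul _ hu, Matrix.one_mul] at this
      exact this.symm
    have himg : F.image σ = F := by
      apply Finset.eq_of_subset_of_card_le
      · intro z hz
        obtain ⟨P, hP, rfl⟩ := mem_image.mp hz
        exact (hσ P hP).1
      · rw [card_image_of_injOn hinjσ]
    unfold TM
    conv_rhs => rw [← himg, sum_image hinjσ]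
    refine sum_congr rfl fun P hP => ?_
    rw [← actM_mul, hact v _ _ (hσ P hP).2]
  have hnew := hf.TM p F (fun P hP => SW_det hA (hF1 P hP).1)
  obtain ⟨i1, -, hi1⟩ := Finset.exists_max_image univ p ⟨⟨0, hn⟩, mem_univ _⟩
  have hmax : ∀ i, i ≠ i1 → p i < p i1 := fun i hi =>
    lt_of_le_of_ne (hi1 i (mem_univ _)) (fun h => hi (hinj h))
  set P1 := p i1 with hP1
  have hPp : P1.Prime := (hp i1).out
  have hP1y : y < P1 := (hpy i1).1
  set M := primorial y * ((∏ q ∈ (rgg (y+1)).filter Nat.Prime, ordG q) *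
    ∏ i ∈ univ.erase i1, ordG (p i)) with hM
  have hMc : ¬ P1 ∣ M := by
    rw [hM, hPp.dvd_mul, hPp.dvd_mul, primorial, hPp.prime.dvd_finsetProd_iff, hPp.prime.dvd_finsetProd_iff,
      hPp.prime.dvd_finsetProd_iff]
    rintro (⟨q, hq, hd⟩ | ⟨q, hq, hd⟩ | ⟨i, hi, hd⟩)
    · simp only [mem_filter, mem_range] at hq
      have := Nat.le_of_dvd hq.2.pos hd
      omega
    · simp only [mem_filter, mem_range] at hq
      exact ordG_coprime hq.2 hPp ooo ooo hd
    · exact ordG_coprime (hp i).out hPp (hmax i (ne_of_mem_erase hi)) ooo hd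
  have hM0 : (M : ZMod P1) ≠ 0 := by
    rw [Ne, ZMod.natCast_eq_zero_iff]; exact hMc
  have pw : ∀ (W : M2) (q M' : ℕ) [Fact q.Prime], W.det = 1 → ordG q ∣ M' → rdM (W^M') q = 1 := by
    intro W q M' _ hW hd
    obtain ⟨c, rfl⟩ := hd
    rw [rdM_pow, pow_mul, ordG_spec q _ (by rw [rdM_det, hW]; simp), one_pow]
  have hMN : ∀ W ∈ SW A, rdM (W^M) N = 1 := by
    intro W hW
    set R := (∏ q ∈ (rgg (y+1)).filter Nat.Prime, ordG q) *
      ∏ i ∈ univ.erase i1, ordG (p i) with hR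
    rw [hM, mul_comm, pow_mul]
    apply rdM_sq
    apply rdM_primorial
    intro q hq hqy
    have : Fact q.Prime := ⟨hq⟩
    exact pw W q R (SW_det hA hW) (Dvd.dvd.mul_right (dvd_prod_of_mem _ (by simp [hq]; omega)) _)
  have hMi : ∀ W ∈ SW A, ∀ i, i ≠ i1 → rdM (W^M) (p i) = 1 := by
    intro W hW i hi
    refine pw W (p i) M (SW_det hA hW) ?_
    exact Dvd.dvd.mul_left (Dvd.dvd.mul_left (dvd_prod_of_mem (fun i => ordG (p i)) (by simp [hi])) _) _
  obtain ⟨j, -, -, -, hE, -⟩ := hop A Y hA hY hcard 1 (fun _ => P1) (hp := fun _ => ⟨hPp⟩)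
    (fun a b _ => Subsingleton.elim a b)
    (by simp only [univ_unique, prod_const, card_singleton, pow_one]
        exact hq0y.trans (by exact_mod_cast hP1y.le))
    (by simp only [univ_unique, prod_const, card_singleton, pow_one]
        omega)
  simp only [univ_unique, prod_const, card_singleton, pow_one] at hE
  have : Fact P1.Prime := ⟨hPp⟩
  have hphi : ∀ W ∈ SW A, ∀ x : Vp P1, TM p F f (Function.update v i1 (x ᵥ* rdM (W^M) P1)) =
      TM p F f (Function.update v i1 x) := by
    intro W hW x
    have := hinv (W^M) (SW_pow hW M) (hMN W hW) (Function.update v i1 x)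
    rw [actM_update] at this
    rw [← this]
    congr 1
    funext i
    by_cases hi : i = i1
    · subst hi; simp; rfl
    · simp [hi, actM, hMi W hW i hi]
  obtain ⟨W1, hW1, a1, b1, c1⟩ := unip_exists hA P1 j hApos hE ![1, 0]
  obtain ⟨W2, hW2, a2, b2, c2⟩ := unip_exists hA P1 j hApos hE ![0, 1]
  have f1 : rdM W1 P1 = !![1, 0; rdM W1 P1 1 0, 1] ∧ rdM W1 P1 1 0 ≠ 0 := by
    have h0 := congrFun a1 0
    have h1 := congrFun a1 1
    simp only [vecMul, dotProduct, Fin.sum_univ_two] at h0 h1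
    simp at h0 h1
    rw [det_fin_two, h0, h1] at c1
    simp at c1
    have key : rdM W1 P1 = !![1, 0; rdM W1 P1 1 0, 1] := by
      ext i j; fin_cases i <;> fin_cases j <;> simp [h0, h1, c1]
    refine ⟨key, fun h => b1 ?_⟩
    rw [key, h]; ext i j; fin_cases i <;> fin_cases j <;> simp
  have f2 : rdM W2 P1 = !![1, rdM W2 P1 0 1; 0, 1] ∧ rdM W2 P1 0 1 ≠ 0 := by
    have h0 := congrFun a2 0
    have h1 := congrFun a2 1
    simp only [vecMul, dotProduct, Fin.sum_univ_two] at h0 h1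
    simp at h0 h1
    rw [det_fin_two, h0, h1] at c2
    simp at c2
    have key : rdM W2 P1 = !![1, rdM W2 P1 0 1; 0, 1] := by
      ext i j; fin_cases i <;> fin_cases j <;> simp [h0, h1, c2]
    refine ⟨key, fun h => b2 ?_⟩
    rw [key, h]; ext i j; fin_cases i <;> fin_cases j <;> simp
  have := Nw_unip P1 _ (hnew i1 v) (M * rdM W1 P1 1 0) (M * rdM W2 P1 0 1) (mul_ne_zero hM0 f1.2) (mul_ne_zero hM0 f2.2)
    (by
      intro x
      have := hphi W1 hW1 x
      rw [rdM_pow, f1.1, unip_pow] at this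
      rw [← this]
      congr 2
      ext i; fin_cases i <;> simp [vecMul, dotProduct, Fin.sum_univ_two]; ring)
    (by
      intro x
      have := hphi W2 hW2 x
      rw [rdM_pow, f2.1, unip_pow'] at this
      rw [← this]
      congr 2
      ext i; fin_cases i <;> simp [vecMul, dotProduct, Fin.sum_univ_two]; ring)
    (v i1)
  simpa [TM] using this


def es (k : ℕ) (Q : Finset ℕ) (x : ℕ → ℝ) : ℝ := ∑ T ∈ Q.powersetCard k, ∏ p ∈ T, x p
def uu (b : ℕ) (Q : Finset ℕ) (x : ℕ → ℝ) : ℝ := ∑ k ∈ rgg (b+1), (-1)^k * es k Q x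

lemma es_zero (Q : Finset ℕ) (x : ℕ → ℝ) : es 0 Q x = 1 := by simp [es]

lemma es_empty (k : ℕ) (x : ℕ → ℝ) : es (k+1) ∅ x = 0 := by
  unfold es; rw [Finset.powersetCard_eq_empty.mpr (by simp)]; simp

lemma es_insert (k : ℕ) (Q : Finset ℕ) (a : ℕ) (ha : a ∉ Q) (x : ℕ → ℝ) :
    es (k+1) (insert a Q) x = es (k+1) Q x + x a * es k Q x := by
  unfold es
  rw [Finset.powersetCard_succ_insert ha, Finset.sum_union]
  · congr 1
    rw [sum_image, mul_sum]
    · refine sum_congr rfl fun T hT => ?_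
      rw [prod_insert]
      exact fun h => ha ((mem_powersetCard.mp hT).1 h)
    · intro S hS T hT h
      have h1 : a ∉ S := fun h => ha ((mem_powersetCard.mp hS).1 h)
      have h2 : a ∉ T := fun h => ha ((mem_powersetCard.mp hT).1 h)
      rw [← erase_insert h1, ← erase_insert h2, h]
  · rw [disjoint_left]
    intro T hT hT'
    simp only [mem_image] at hT'
    obtain ⟨S, _, rfl⟩ := hT'
    exact ha ((mem_powersetCard.mp hT).1 (mem_insert_self _ _))

lemma es_nonneg (k : ℕ) (Q : Finset ℕ) (x : ℕ → ℝ) (hx : ∀ p ∈ Q, 0 ≤ x p) : 0 ≤ es k Q x :=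
  sum_nonneg fun _ hT => prod_nonneg fun p hp => hx p ((mem_powersetCard.mp hT).1 hp)

lemma uu_succ (b : ℕ) (Q : Finset ℕ) (x : ℕ → ℝ) : uu (b+1) Q x = uu b Q x + (-1)^(b+1) * es (b+1) Q x := by
  unfold uu; rw [sum_range_succ]

lemma uu_insert (b : ℕ) (Q : Finset ℕ) (a : ℕ) (ha : a ∉ Q) (x : ℕ → ℝ) :
    uu (b+1) (insert a Q) x = uu (b+1) Q x - x a * uu b Q x := by
  induction b with
  | zero => simp [uu, sum_range_succ, es_zero, es_insert 0 Q a ha]; ring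
  | succ b ih => rw [uu_succ, ih, es_insert _ Q a ha, uu_succ (b+1) Q, uu_succ b Q]; ring

lemma bonf (Q : Finset ℕ) (x : ℕ → ℝ) (hx : ∀ p ∈ Q, 0 ≤ x p ∧ x p ≤ 1) (b : ℕ) :
    0 ≤ (-1)^b * (uu b Q x - ∏ p ∈ Q, (1 - x p)) := by
  induction Q using induction_on generalizing b with
  | empty =>
    have : uu b ∅ x = 1 := by
      induction b with
      | zero => simp [uu, es_zero]
      | succ b ih => rw [uu_succ, ih]; simp [es_empty]
    simp [this]
  | insert a Q ha ih =>
    have hxa := hx a (mem_insert_self _ _)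
    have hxQ : ∀ p ∈ Q, 0 ≤ x p ∧ x p ≤ 1 := fun p hp => hx p (mem_insert_of_mem hp)
    cases b with
    | zero =>
      simp only [pow_zero, one_mul, uu, zero_add, Finset.range_one, sum_singleton, es_zero]
      rw [sub_nonneg]
      exact Finset.prod_le_one (fun p hp => by linarith [(hx p hp).2]) (fun p hp => by linarith [(hx p hp).1])
    | succ b =>
      rw [uu_insert b Q a ha, prod_insert ha]
      have h1 := mul_nonneg (sub_nonneg.mpr hxa.2) (ih hxQ (b+1))
      have h2 := mul_nonneg hxa.1 (es_nonneg (b+1) Q x (fun p hp => (hxQ p hp).1))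
      have h3 := uu_succ b Q x
      have h4 : ((-1:ℝ)^(b+1)) * (-1)^(b+1) = 1 := by rw [← mul_pow]; simp
      have : (-1)^(b + 1) * (uu (b + 1) Q x - x a * uu b Q x - (1 - x a) * ∏ p ∈ Q, (1 - x p)) =
        (1 - x a) * ((-1)^(b + 1) * (uu (b + 1) Q x - ∏ p ∈ Q, (1 - x p))) +
          ((-1)^(b+1) * (-1)^(b+1)) * (x a * es (b+1) Q x) := by
        rw [h3]; ring
      rw [this, h4]; linarith

lemma prod_one_sub_ge (Q : Finset ℕ) (x : ℕ → ℝ) (hx : ∀ p ∈ Q, 0 ≤ x p ∧ x p ≤ 1) :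
    1 - ∑ p ∈ Q, x p ≤ ∏ p ∈ Q, (1 - x p) := by
  have := bonf Q x hx 1
  have h1 : uu 1 Q x = 1 - ∑ p ∈ Q, x p := by
    simp [uu, sum_range_succ, es_zero, es, powersetCard_one]; ring
  rw [h1] at this
  linarith

lemma pow_bern (L a : ℝ) (hL : 0 ≤ L) (ha : 0 ≤ a) (k : ℕ) : L^(k+1) + (k+1) * (a * L^k) ≤ (L+a)^(k+1) := by
  induction k with
  | zero => simp
  | succ k ih =>
    rw [pow_succ (L+a)]
    have h1 := mul_le_mul_of_nonneg_right ih (add_nonneg hL ha)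
    refine le_trans ?_ h1
    have h2 : 0 ≤ (k+1) * (a * L^k) * a := by positivity
    push_cast
    have h3 : (L ^ (k + 1) + (k + 1) * (a * L ^ k)) * (L + a) - (L ^ (k + 1 + 1) + (k + 1 + 1) * (a * L ^ (k + 1)))
      = (k+1) * (a * L^k) * a := by ring
    linarith

lemma es_le (Q : Finset ℕ) (x : ℕ → ℝ) (hx : ∀ p ∈ Q, 0 ≤ x p) (k : ℕ) :
    es k Q x ≤ (∑ p ∈ Q, x p)^k / k.factorial := by
  induction Q using induction_on generalizing k with
  | empty => cases k <;> simp [es_empty, es_zero]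
  | insert a Q ha ih =>
    have hxa := hx a (mem_insert_self _ _)
    have hxQ : ∀ p ∈ Q, 0 ≤ x p := fun p hp => hx p (mem_insert_of_mem hp)
    cases k with
    | zero => simp [es_zero]
    | succ k =>
      rw [es_insert k Q a ha, Finset.sum_insert ha]
      have h1 := ih hxQ (k+1)
      have h2 := mul_le_mul_of_nonneg_left (ih hxQ k) hxa
      have h3 := pow_bern (∑ p ∈ Q, x p) (x a) (sum_nonneg hxQ) hxa k
      have hk : I0 < (k+1).factorial := by positivity
      refine (add_le_add h1 h2).trans ?_
      rw [add_comm (x a), le_div_iff₀ hk]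
      refine le_trans (le_of_eq ?_) h3
      rw [factorial_succ]
      push_cast
      have : (k.factorial:ℝ) ≠ 0 := by positivity
      field_simp

def IsExp (Q : Finset ℕ) (L : ℝ) (Φ : (ℕ → ℝ) → ℝ) : Prop :=
  ∃ c : Finset ℕ → ℝ, (∀ T, |c T| ≤ 1) ∧ (∀ T, T ⊆ Q → c T ≠ 0 → ((∏ p ∈ T, p : ℕ):ℝ) ≤ L) ∧
    ∀ x, Φ x = ∑ T ∈ Q.powerset, c T * ∏ p ∈ T, x p

lemma IsExp.mono {Q : Finset ℕ} {L L' : ℝ} {Φ} (h : IsExp Q L Φ) (hL : L ≤ L') : IsExp Q L' Φ := by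
  obtain ⟨c, h1, h2, h3⟩ := h
  exact ⟨c, h1, fun T hT hc => (h2 T hT hc).trans hL, h3⟩

lemma IsExp.mul {Q Q' : Finset ℕ} {L L' : ℝ} {Φ Φ'} (h : IsExp Q L Φ) (h' : IsExp Q' L' Φ')
    (hd : Disjoint Q Q') (hL : 0 ≤ L) : IsExp (Q ∪ Q') (L * L') (fun x => Φ x * Φ' x) := by
  classical
  obtain ⟨c, h1, h2, h3⟩ := h
  obtain ⟨c', h1', h2', h3'⟩ := h'
  have hsp : ∀ T, T ⊆ Q ∪ Q' → T = (T ∩ Q) ∪ (T ∩ Q') := by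
    intro T hT; rw [← Finset.inter_union_distrib_left]; exact (inter_eq_left.mpr hT).symm
  have hdis : ∀ T : Finset ℕ, Disjoint (T ∩ Q) (T ∩ Q') := fun T =>
    hd.mono inter_subset_right inter_subset_right
  refine ⟨fun T => c (T ∩ Q) * c' (T ∩ Q'), ?_, ?_, ?_⟩
  · intro T; rw [abs_mul]; exact mul_le_one₀ (h1 _) (abs_nonneg _) (h1' _)
  · intro T hT hc
    have ha := h2 _ inter_subset_right (left_ne_zero_of_mul hc)
    have hb := h2' _ inter_subset_right (right_ne_zero_of_mul hc)
    conv_lhs => rw [hsp T hT, prod_union (hdis T)]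
    push_cast at ha hb ⊢
    exact mul_le_mul ha hb ppp hL
  · intro x
    beta_reduce
    rw [h3, h3', sum_mul_sum, ← sum_product']
    refine Finset.sum_nbij' (fun s => s.1 ∪ s.2) (fun T => (T ∩ Q, T ∩ Q')) ?_ ?_ ?_ ?_ ?_
    · intro s hs
      simp only [mem_product, mem_powerset] at hs ⊢
      exact Finset.union_subset_union hs.1 hs.2
    · intro T hT
      simp only [mem_product, mem_powerset]
      exact ⟨inter_subset_right, inter_subset_right⟩
    · rintro ⟨S, S'⟩ hs
      simp only [mem_product, mem_powerset] at hs
      have e1 : S' ∩ Q = ∅ := disjoint_iff_inter_eq_empty.mp (hd.symm.mono_left hs.2)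
      have e2 : S ∩ Q' = ∅ := disjoint_iff_inter_eq_empty.mp (hd.mono_left hs.1)
      simp only [union_inter_distrib_right, e1, e2, union_empty, empty_union,
        inter_eq_left.mpr hs.1, inter_eq_left.mpr hs.2]
    · intro T hT
      exact (hsp T (mem_powerset.mp hT)).symm
    · rintro ⟨S, S'⟩ hs
      simp only [mem_product, mem_powerset] at hs
      have e1 : S' ∩ Q = ∅ := disjoint_iff_inter_eq_empty.mp (hd.symm.mono_left hs.2)
      have e2 : S ∩ Q' = ∅ := disjoint_iff_inter_eq_empty.mp (hd.mono_left hs.1)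
      simp only [union_inter_distrib_right, e1, e2, union_empty, empty_union,
        inter_eq_left.mpr hs.1, inter_eq_left.mpr hs.2]
      rw [prod_union (hd.mono hs.1 hs.2)]; ring

lemma IsExp.prod {ι : Type*} [DecidableEq ι] (I : Finset ι) (Q : ι → Finset ℕ) (L : ι → ℝ) (Φ : ι → (ℕ → ℝ) → ℝ)
    (h : ∀ i ∈ I, IsExp (Q i) (L i) (Φ i)) (hL : ∀ i ∈ I, 0 ≤ L i)
    (hd : ∀ i ∈ I, ∀ j ∈ I, i ≠ j → Disjoint (Q i) (Q j)) :
    IsExp (I.biUnion Q) (∏ i ∈ I, L i) (fun x => ∏ i ∈ I, Φ i x) := by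
  induction I using induction_on with
  | empty =>
    refine ⟨fun _ => 1, by simp, ?_, by simp⟩
    intro T hT _
    simp at hT
    simp [hT]
  | insert i I hi ih =>
    have := (h i (mem_insert_self _ _)).mul (ih (fun j hj => h j (mem_insert_of_mem hj))
      (fun j hj => hL j (mem_insert_of_mem hj))
      (fun j hj k hk => hd j (mem_insert_of_mem hj) k (mem_insert_of_mem hk)))
      (by
        rw [disjoint_biUnion_right]
        intro j hj
        exact hd i (mem_insert_self _ _) j (mem_insert_of_mem hj) (fun h => hi (h ▸ hj)))
      (hL i (mem_insert_self _ _))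
    simpa only [Finset.biUnion_insert, prod_insert hi] using this

lemma prod_le_of_card {z : ℝ} (hz : 1 ≤ z) {Q T : Finset ℕ} {b : ℕ} (hQ : ∀ p ∈ Q, (p:ℝ) ≤ z) (hT : T ⊆ Q)
    (hb : T.card ≤ b) : ((∏ p ∈ T, p : ℕ):ℝ) ≤ z^b := by
  push_cast
  calc ∏ p ∈ T, ↟p ≤ ∏ p ∈ T, z := prod_le_prod (fun _ _ => by positivity) (fun p hp => hQ p (hT hp))
    _ = z ^ T.card := by simp
    _ ≤ z^b := pow_le_pow_right₀ hz hb

lemma isExp_uu {z : ℝ} (hz : 1 ≤ z) {Q : Finset ℕ} (hQ : ∀ p ∈ Q, (p:ℝ) ≤ z) (b : ℕ) : IsExp Q (z^b) (uu b Q) := by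
  classical
  refine ⟨fun T => if T.card ≤ b then (-1)^T.card else 0, ?_, ?_, ?_⟩
  · intro T; dsimp only; split_ifs <;> simp
  · intro T hT hc
    exact prod_le_of_card hz hQ hT (by by_contra h; simp [h] at hc)
  · intro x
    unfold uu es
    simp only [ite_mul, zero_mul]
    rw [← sum_filter]
    rw [← sum_fiberwise_of_maps_to (s := Q.powerset.filter (fun T => T.card ≤ b)) (t := rgg (b+1))
      (g := Finset.card) (fun T hT => by simp only [mem_filter] at hT; simp; omega)]
    refine sum_congr rfl fun k hk => ?_
    rw [mul_sum]
    have : Finset.powersetCard k Q = (Q.powerset.filter (fun T => T.card ≤ b)).filter (fun T => T.card = k) := by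
      ext T
      simp only [mem_powersetCard, mem_filter, mem_powerset, mem_range] at hk ⊢
      constructor
      · rintro ⟨a, b⟩; exact ⟨⟨a, by omega⟩, b⟩
      · rintro ⟨⟨a, _⟩, b⟩; exact ⟨a, b⟩
    rw [this]
    refine sum_congr rfl fun T hT => ?_
    rw [(mem_filter.mp hT).2]

lemma isExp_es {z : ℝ} (hz : 1 ≤ z) {Q : Finset ℕ} (hQ : ∀ p ∈ Q, (p:ℝ) ≤ z) (k : ℕ) : IsExp Q (z^k) (es k Q) := by
  classical
  refine ⟨fun T => if T.card = k then 1 else 0, ?_, ?_, ?_⟩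
  · intro T; dsimp only; split_ifs <;> simp
  · intro T hT hc
    exact prod_le_of_card hz hQ hT (by by_contra h; simp [show T.card ≠ k by omega] at hc)
  · intro x
    unfold es
    simp only [ite_mul, zero_mul, one_mul]
    rw [← sum_filter]
    congr 1
    ext T
    simp [mem_powersetCard]


lemma sum_inv_prod (Q : Finset ℕ) (hQ : ∀ p ∈ Q, p.Prime) (D : ℝ) (hD : 1 ≤ D) :
    ∑ T ∈ Q.powerset.filter (fun T => ((∏ p ∈ T, p : ℕ):ℝ) ≤ D), ((∏ p ∈ T, p : ℕ):ℝ)⁻¹ ≤ 1 + lgg D := by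
  classical
  refine le_trans ?_ (harmonic_floor_le_one_add_log D hD)
  rw [harmonic_eq_sum_Icc]
  push_cast
  have hinj : Set.InjOn (fun T : Finset ℕ => ∏ p ∈ T, p) (Q.powerset.filter (fun T => ((∏ p ∈ T, p : ℕ):ℝ) ≤ D)) := by
    intro S hS T hT h
    simp only [coe_filter, mem_powerset, Set.mem_ofPred_eq] at hS hT
    rw [← primeFactors_prod (fun p hp => hQ p (hS.1 hp)), ← primeFactors_prod (fun p hp => hQ p (hT.1 hp))]
    exact congrArg _ h
  have := sum_image (f := fun n : ℕ => (↟n)⁻¹) hinj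
  simp only [Nat.cast_prod] at this ⊢
  rw [← this]
  apply sum_le_sum_of_subset_of_nonneg
  · intro n hn
    simp only [mem_image, mem_filter, mem_powerset] at hn
    obtain ⟨T, ⟨hT, hle⟩, rfl⟩ := hn
    rw [mem_Icc]
    refine ⟨one_le_iff_ne_zero.mpr (prod_ne_zero_iff.mpr fun p hp => (hQ p (hT hp)).ne_zero), ?_⟩
    apply le_floor
    push_cast; exact hle
  · intros; positivity

section sieve
variable {ι : Type*} (Ω : Finset ι)

def av (f : ι → ℝ) : ℝ := (∑ ω ∈ Ω, f ω) / Ω.card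

lemma av_add (f g : ι → ℝ) : av Ω (fun ω => f ω + g ω) = av Ω f + av Ω g := by
  simp [av, sum_add_distrib, add_div]
lemma av_sub (f g : ι → ℝ) : av Ω (fun ω => f ω - g ω) = av Ω f - av Ω g := by
  simp [av, sum_sub_distrib, sub_div]
lemma av_mul (c : ℝ) (f : ι → ℝ) : av Ω (fun ω => c * f ω) = c * av Ω f := by
  simp [av, ← mul_sum, mul_div_assoc]
lemma av_sum {κ : Type*} (I : Finset κ) (f : κ → ι → ℝ) :
    av Ω (fun ω => ∑ i ∈ I, f i ω) = ∑ i ∈ I, av Ω (f i) := by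
  simp only [av]; rw [sum_comm, sum_div]
lemma av_mono {f g : ι → ℝ} (h : ∀ ω ∈ Ω, f ω ≤ g ω) : av Ω f ≤ av Ω g := by
  unfold av; exact div_le_div_of_nonneg_right (sum_le_sum h) ppp
lemma av_const (h : Ω.Nonempty) (c : ℝ) : av Ω (fun _ => c) = c := by
  have : (Ω.card:ℝ) ≠ 0 := by exact_mod_cast h.card_pos.ne'
  simp [av]; field_simp

lemma exp_error (w : ι → ℕ → ℝ) (g : ℕ → ℝ) (Q : Finset ℕ) (hQ : ∀ p ∈ Q, p.Prime) (D ε : ℝ) (hD : 1 ≤ D)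
    (hε : 0 ≤ ε) (hA : ∀ T, T ⊆ Q → ((∏ p ∈ T, p : ℕ):ℝ) ≤ D →
      |av Ω (fun ω => ∏ p ∈ T, w ω p) - ∏ p ∈ T, g p| ≤ ε * ((∏ p ∈ T, p : ℕ):ℝ)⁻¹)
    (Φ) (hΦ : IsExp Q D Φ) : |av Ω (fun ω => Φ (w ω)) - Φ g| ≤ ε * (1 + lgg D) := by
  obtain ⟨c, h1, h2, h3⟩ := hΦ
  simp only [h3]
  rw [av_sum, ← sum_sub_distrib]
  simp only [av_mul, ← mul_sub]
  refine le_trans ?_ (mul_le_mul_of_nonneg_left (sum_inv_prod Q hQ D hD) hε)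
  rw [mul_sum, sum_filter]
  refine (abs_sum_le_sum_abs _ _).trans (sum_le_sum fun T hT => ?_)
  have hT' := mem_powerset.mp hT
  by_cases hc : c T = 0
  · rw [hc]; simp only [zero_mul, abs_zero]; split_ifs <;> positivity
  · have hl := h2 T hT' hc
    rw [if_pos hl, abs_mul]
    calc _ ≤ 1 * _ := mul_le_mul_of_nonneg_right (h1 T) (abs_nonneg _)
      _ ≤ _ := by rw [one_mul]; exact hA T hT' hl

lemma eps_to_A (w : ι → ℕ → ℝ) (hne : Ω.Nonempty) (g : ℕ → ℝ) (hg : ∀ p, 0 ≤ g p ∧ g p ≤ 2 * (p:ℝ)⁻¹) (y : ℕ)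
    (hy : 3^1000 ≤ y) (D ε : ℝ) (hD : 1 ≤ D) (hε : 0 ≤ ε) (Q : Finset ℕ) (hQ : ∀ p ∈ Q, p.Prime ∧ y < p)
    (he : ∀ T, T ⊆ Q → T.Nonempty → ((∏ p ∈ T, p : ℕ):ℝ) ≤ D →
      |av Ω (fun ω => ∏ p ∈ T, (w ω p - g p))| ≤ ε * ((∏ p ∈ T, p : ℕ):ℝ)⁻¹) :
    ∀ T, T ⊆ Q → ((∏ p ∈ T, p : ℕ):ℝ) ≤ D →
      |av Ω (fun ω => ∏ p ∈ T, w ω p) - ∏ p ∈ T, g p| ≤ (ε * D^(0.001:ℝ)) * ((∏ p ∈ T, p : ℕ):ℝ)⁻¹ := by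
  classical
  intro T hT hTD
  have hpos : ∀ S, S ⊆ T → I1 ≤ ((∏ p ∈ S, p : ℕ):ℝ) := fun S hS => by
    exact_mod_cast one_le_iff_ne_zero.mpr (prod_ne_zero_iff.mpr fun p hp => (hQ p (hT (hS hp))).1.ne_zero)
  have hmon : ∀ S, S ⊆ T → ((∏ p ∈ S, p : ℕ):ℝ) ≤ ((∏ p ∈ T, p : ℕ):ℝ) := fun S hS => by
    have := Nat.le_of_dvd (by exact_mod_cast lt_of_lt_of_le one_pos (hpos T subset_rfl)) (Finset.prod_dvd_prod_of_subset S T (fun p => p) hS)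
    exact_mod_cast this
  have e1 : ∀ ω, ∏ p ∈ T, w ω p = ∑ S ∈ T.powerset, (∏ p ∈ T \ S, g p) * ∏ p ∈ S, (w ω p - g p) := by
    intro ω
    have := prod_add (fun p => w ω p - g p) g T
    simp only [sub_add_cancel] at this
    rw [this]
    exact sum_congr rfl fun S _ => mul_comm _ _
  simp only [e1]
  rw [av_sum]
  simp only [av_mul]
  rw [← Finset.sum_erase_add _ _ (Finset.empty_mem_powerset T)]
  simp only [Finset.sdiff_empty, prod_empty, av_const Ω hne, mul_one, add_sub_cancel_right]
  refine (abs_sum_le_sum_abs _ _).trans ?_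
  have hterm : ∀ S ∈ T.powerset.erase ∅, |(∏ p ∈ T \ S, g p) * av Ω (fun ω => ∏ p ∈ S, (w ω p - g p))| ≤
      (∏ p ∈ S, 1) * (∏ p ∈ T \ S, I2) * (ε * ((∏ p ∈ T, p : ℕ):ℝ)⁻¹) := by
    intro S hS
    rw [mem_erase, mem_powerset] at hS
    have h1 := he S (hS.2.trans hT) (nonempty_iff_ne_empty.mpr hS.1) ((hmon S hS.2).trans hTD)
    have h2 : ∏ p ∈ T \ S, g p ≤ ∏ p ∈ T \ S, (2 * ↟p⁻¹) := prod_le_prod (fun p _ => (hg p).1) (fun p _ => (hg p).2)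
    have h3 : 0 ≤ ∏ p ∈ T \ S, g p := prod_nonneg (fun p _ => (hg p).1)
    rw [abs_mul, abs_of_nonneg h3]
    refine (mul_le_mul h2 h1 (abs_nonneg _) (h3.trans h2)).trans (le_of_eq ?_)
    rw [prod_mul_distrib, Finset.prod_inv_distrib, ← Finset.prod_sdiff hS.2]
    push_cast
    rw [mul_inv]; simp; ring
  refine (sum_le_sum hterm).trans ?_
  rw [← sum_mul]
  have h3 : ∑ S ∈ T.powerset.erase ∅, ((∏ p ∈ S, 1) * (∏ p ∈ T \ S, I2)) ≤ D^(0.001:ℝ) := by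
    calc _ ≤ ∑ S ∈ T.powerset, ((∏ p ∈ S, I1) * (∏ p ∈ T \ S, I2)) :=
          sum_le_sum_of_subset_of_nonneg (Finset.erase_subset _ _) (fun _ _ _ => by positivity)
      _ = ∏ p ∈ T, ↟3 := by rw [← prod_add]; norm_num
      _ ≤ ∏ p ∈ T, ↟p^(0.001:ℝ) := by
          refine prod_le_prod (fun _ _ => by norm_num) fun p hp => ?_
          have h4 : (↟3^1000) ≤ p := by exact_mod_cast hy.trans (hQ p (hT hp)).2.le
          calc ↟3 = (↟3^(1000:ℕ))^(0.001:ℝ) := by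
                rw [← rpow_natCast, ← rpow_mul nnn]; norm_num
            _ ≤ _ := rpow_le_rpow ppp h4 nnn
      _ = (((∏ p ∈ T, p : ℕ):ℝ))^(0.001:ℝ) := by
          push_cast
          exact finsetProd_rpow T (fun p : ℕ => ↟p) (fun _ _ => by positivity) 0.001
      _ ≤ _ := rpow_le_rpow ppp hTD nnn
  have h5 : 0 ≤ ε * ((∏ p ∈ T, p : ℕ):ℝ)⁻¹ := by positivity
  calc _ ≤ D^(0.001:ℝ) * (ε * ((∏ p ∈ T, p : ℕ):ℝ)⁻¹) := mul_le_mul_of_nonneg_right h3 h5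
    _ = _ := by ring

lemma brun_hooley (n : ℕ) (Q : ℕ → Finset ℕ) (Q0 : Finset ℕ) (x : ℕ → ℝ) (hx : ∀ p, x p = 0 ∨ x p = 1) :
    (∏ i ∈ rgg n, uu (2*(i+1)) (Q i) x) -
      (∑ i ∈ rgg n, es (2*(i+1)+1) (Q i) x * ∏ j ∈ (rgg n).erase i, uu (2*(j+1)) (Q j) x) -
      (1/5) * (es 1 Q0 x * ∏ i ∈ rgg n, uu (2*(i+1)) (Q i) x) ≤
    if (∀ i < n, ∀ p ∈ Q i, x p = 0) ∧ (Q0.filter (fun p => x p = 1)).card ≤ 4 then 1 else 0 := by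
  classical
  have hx01 : ∀ p, 0 ≤ x p ∧ x p ≤ 1 := fun p => by rcases hx p with h | h <;> rw [h] <;> norm_num
  have hU : ∀ i, 0 ≤ uu (2*(i+1)) (Q i) x := by
    intro i
    have h1 := bonf (Q i) x (fun p _ => hx01 p) (2*(i+1))
    rw [pow_mul] at h1
    have h2 : 0 ≤ ∏ p ∈ Q i, (1 - x p) := prod_nonneg fun p _ => by linarith [(hx01 p).2]
    norm_num at h1; linarith
  have hV : ∀ i, 0 ≤ es (2*(i+1)+1) (Q i) x := fun i => es_nonneg _ _ _ fun p _ => (hx01 p).1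
  have hP : ∀ s : Finset ℕ, 0 ≤ ∏ i ∈ s, uu (2*(i+1)) (Q i) x := fun s => prod_nonneg fun i _ => hU i
  have h0 : 0 ≤ es 1 Q0 x := es_nonneg _ _ _ fun p _ => (hx01 p).1
  by_cases hall : ∀ i < n, ∀ p ∈ Q i, x p = 0
  · have es0 : ∀ i < n, ∀ k, es (k+1) (Q i) x = 0 := by
      intro i hi k
      refine sum_eq_zero fun T hT => ?_
      rw [mem_powersetCard] at hT
      obtain ⟨p, hp⟩ : T.Nonempty := card_pos.mp ooo
      exact prod_eq_zero hp (hall i hi p (hT.1 hp))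
    have u1 : ∀ i < n, ∀ b, uu b (Q i) x = 1 := by
      intro i hi b
      induction b with
      | zero => simp [uu, es_zero]
      | succ b ih => rw [uu_succ, ih, es0 i hi]; simp
    rw [prod_congr rfl (fun i hi => u1 i (mem_range.mp hi) _),
      sum_eq_zero (fun i hi => by rw [es0 i (mem_range.mp hi), zero_mul])]
    simp only [Finset.prod_const_one, mul_one, sub_zero]
    have e1 : es 1 Q0 x = ((Q0.filter (fun p => x p = 1)).card : ℝ) := by
      simp only [es, powersetCard_one, sum_map, Function.Embedding.coeFn_mk, prod_singleton]
      rw [card_filter]; push_cast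
      refine sum_congr rfl fun p _ => ?_
      rcases hx p with h | h <;> simp [h]
    rw [e1]
    split_ifs with hc
    · have : I0 ≤ ((Q0.filter (fun p => x p = 1)).card : ℝ) := by positivity
      linarith
    · have : 5 ≤ (Q0.filter (fun p => x p = 1)).card := by
        by_contra h; exact hc ⟨hall, by omega⟩
      have : ↟5 ≤ ((Q0.filter (fun p => x p = 1)).card : ℝ) := by exact_mod_cast this
      linarith
  · rw [if_neg (fun h => hall h.1)]
    push Not at hall
    obtain ⟨i, hi, p, hp, hxp⟩ := hall
    have hxp1 : x p = 1 := (hx p).resolve_left hxp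
    have hb := bonf (Q i) x (fun p _ => hx01 p) (2*(i+1)+1)
    rw [uu_succ, prod_eq_zero hp (by rw [hxp1]; ring), pow_succ, pow_mul] at hb
    norm_num at hb
    have hmem := mem_range.mpr hi
    have h1 : ∏ i ∈ rgg n, uu (2*(i+1)) (Q i) x ≤
        es (2*(i+1)+1) (Q i) x * ∏ j ∈ (rgg n).erase i, uu (2*(j+1)) (Q j) x := by
      rw [← mul_prod_erase _ _ hmem]
      exact mul_le_mul_of_nonneg_right (by linarith) (hP _)
    have h2 := single_le_sum (f := fun i => es (2*(i+1)+1) (Q i) x * ∏ j ∈ (rgg n).erase i, uu (2*(j+1)) (Q j) x)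
      (fun i _ => mul_nonneg (hV i) (hP _)) hmem
    have h3 := mul_nonneg h0 (hP (rgg n))
    linarith

end sieve


lemma fac_bound (i : ℕ) : (0.7:ℝ)^(2*(i+1)+1) / (2*(i+1)+1).factorial ≤ 0.0572 * (1/40)^i := by
  induction i with
  | zero => norm_num [Nat.factorial]
  | succ i ih =>
    have e : (2*(i+1+1)+1).factorial = (2*(i+1)+3) * ((2*(i+1)+2) * (2*(i+1)+1).factorial) := by
      rw [show 2*(i+1+1)+1 = (2*(i+1)+1) + 1 + 1 by ring, factorial_succ, factorial_succ]
    have hf : I0 < (2*(i+1)+1).factorial := by positivity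
    rw [e, show 2*(i+1+1)+1 = (2*(i+1)+1) + 2 by ring, pow_add, pow_succ (1/40:ℝ)]
    push_cast
    calc (0.7:ℝ)^(2*(i+1)+1) * 0.7^2 / ((2*(↟i+1)+3) * ((2*(↟i+1)+2) * (2*(i+1)+1).factorial))
        = ((0.7:ℝ)^(2*(i+1)+1) / (2*(i+1)+1).factorial) * (0.7^2 / ((2*(↟i+1)+3) * (2*(↟i+1)+2))) := by
          field_simp
      _ ≤ (0.0572 * (1/40)^i) * (1/40) := by
          apply mul_le_mul ih _ ppp ppp
          have hi : I0 ≤ i := by positivity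
          rw [div_le_div_iff₀ ppp nnn]
          nlinarith
      _ = _ := by ring

lemma LBg (n : ℕ) (Q : ℕ → Finset ℕ) (Q0 : Finset ℕ) (g : ℕ → ℝ) (hg : ∀ p, 0 ≤ g p ∧ g p ≤ 1)
    (h7 : ∀ i < n, ∑ p ∈ Q i, g p ≤ 0.7) (h0 : ∑ p ∈ Q0, g p ≤ 3.7) :
    0.05 * (0.3:ℝ)^n ≤ (∏ i ∈ rgg n, uu (2*(i+1)) (Q i) g) -
      (∑ i ∈ rgg n, es (2*(i+1)+1) (Q i) g * ∏ j ∈ (rgg n).erase i, uu (2*(j+1)) (Q j) g) -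
      (1/5) * (es 1 Q0 g * ∏ i ∈ rgg n, uu (2*(i+1)) (Q i) g) := by
  have hU : ∀ i ∈ rgg n, 0.3 ≤ uu (2*(i+1)) (Q i) g := by
    intro i hi
    have h1 := bonf (Q i) g (fun p _ => hg p) (2*(i+1))
    rw [pow_mul] at h1
    have h2 := prod_one_sub_ge (Q i) g (fun p _ => hg p)
    have := h7 i (mem_range.mp hi)
    norm_num at h1; norm_num at this; norm_num; linarith
  set Pr := ∏ i ∈ rgg n, uu (2*(i+1)) (Q i) g with hPr
  have hPr1 : (0.3:ℝ)^n ≤ Pr := by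
    calc (0.3:ℝ)^n = ∏ i ∈ rgg n, (0.3:ℝ) := by simp
      _ ≤ Pr := prod_le_prod (fun _ _ => by norm_num) hU
  have hPr0 : 0 ≤ Pr := le_trans ppp hPr1
  have hV : ∀ i ∈ rgg n, es (2*(i+1)+1) (Q i) g * ∏ j ∈ (rgg n).erase i, uu (2*(j+1)) (Q j) g ≤
      (0.0572 / 0.3 * Pr) * (1/40)^i := by
    intro i hi
    have h1 : es (2*(i+1)+1) (Q i) g ≤ 0.0572 * (1/40)^i := by
      refine (es_le (Q i) g (fun p _ => (hg p).1) _).trans (le_trans ?_ (fac_bound i))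
      gcongr
      · exact sum_nonneg fun p _ => (hg p).1
      · exact h7 i (mem_range.mp hi)
    have h2 : 0 ≤ ∏ j ∈ (rgg n).erase i, uu (2*(j+1)) (Q j) g :=
      prod_nonneg fun j hj => le_trans nnn (hU j (Finset.mem_of_mem_erase hj))
    have h3 : (∏ j ∈ (rgg n).erase i, uu (2*(j+1)) (Q j) g) * 0.3 ≤ Pr := by
      rw [hPr, ← Finset.prod_erase_mul _ _ hi]
      exact mul_le_mul_of_nonneg_left (hU i hi) h2
    calc _ ≤ (0.0572 * (1/40)^i) * ∏ j ∈ (rgg n).erase i, uu (2*(j+1)) (Q j) g := mul_le_mul_of_nonneg_right h1 h2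
      _ ≤ (0.0572 * (1/40)^i) * (Pr / 0.3) := mul_le_mul_of_nonneg_left (by rw [le_div_iff₀ nnn]; exact h3) ppp
      _ = _ := by ring
  have hS := sum_le_sum hV
  rw [← mul_sum] at hS
  have hgeo : ∑ i ∈ rgg n, (1/40:ℝ)^i ≤ 40/39 := by
    rw [geom_sum_eq nnn]
    have : 0 ≤ (1/40:ℝ)^n := by positivity
    rw [div_le_iff_of_neg nnn]; linarith
  have h5 := mul_le_mul_of_nonneg_left hgeo (show 0 ≤ 0.0572/0.3 * Pr by positivity)
  have e1 : es 1 Q0 g ≤ 3.7 := by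
    simp only [es, powersetCard_one, sum_map, Function.Embedding.coeFn_mk, prod_singleton]
    exact h0
  have h6 := mul_le_mul_of_nonneg_right e1 hPr0
  have h8 : (∑ i ∈ rgg n, es (2*(i+1)+1) (Q i) g * ∏ j ∈ (rgg n).erase i, uu (2*(j+1)) (Q j) g) ≤ 0.2 * Pr := by
    refine (hS.trans h5).trans ?_
    have : (0.0572:ℝ)/0.3 * Pr * (40/39) = (0.0572/0.3*(40/39)) * Pr := by ring
    rw [this]
    exact mul_le_mul_of_nonneg_right nnn hPr0
  linarith

def PQ (a b : ℝ) : Finset ℕ := (rgg (⌊b⌋₊+1)).filter (fun p => p.Prime ∧ p % 4 = 1 ∧ a < p)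

lemma mem_PQ {a b : ℝ} (hb : 0 ≤ b) {p : ℕ} : p ∈ PQ a b ↔ p.Prime ∧ p % 4 = 1 ∧ a < p ∧ (p:ℝ) ≤ b := by
  simp only [PQ, mem_filter, mem_range, lt_succ_iff, Nat.le_floor_iff hb]
  tauto

lemma mert_real : ∃ C : ℝ, 0 ≤ C ∧ ∀ a b : ℝ, 4 ≤ a → a ≤ b →
    ∑ p ∈ PQ a b, (2 / (↟p+1)) ≤ lgg (lgg b / lgg a) + C / lgg a := by
  obtain ⟨C, hC0, hC⟩ := mertens4
  refine ⟨2 * C + 2, by linarith, ?_⟩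
  intro a b ha hab
  have ha0 : 0 ≤ a := by linarith
  have hfl : 2 ≤ ⌊a⌋₊ := le_floor (by norm_num; linarith)
  have h := hC ⌊a⌋₊ ⌊b⌋₊ hfl (floor_le_floor hab)
  have hla : 1 < lgg a := by
    rw [Real.lt_log_iff_exp_lt (by linarith)]; linarith [exp_one_lt_d9]
  have hfa : a / 2 ≤ ⌊a⌋₊ := by linarith [lt_floor_add_one a]
  have hfb : (⌊b⌋₊:ℝ) ≤ b := floor_le (by linarith)
  have hb2 : I2 ≤ ⌊b⌋₊ := by exact_mod_cast hfl.trans (floor_le_floor hab)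
  have l2 : lgg 2 < 0.6931471808 := log_two_lt_d9
  have l2' : 0.6931471803 < lgg 2 := log_two_gt_d9
  have l4 : 2 * lgg 2 ≤ lgg a := by
    rw [← log_rpow nnn]; exact log_le_log ppp (by norm_num; exact ha)
  have hlf : lgg a - lgg 2 ≤ lgg ⌊a⌋₊ := by
    rw [← log_div (by linarith) nnn]; exact log_le_log (by linarith) hfa
  have hlf2 : lgg a / 2 ≤ lgg ⌊a⌋₊ := by linarith
  have h1 : lgg (lgg ⌊b⌋₊) ≤ lgg (lgg b) :=
    log_le_log (log_pos (by linarith)) (log_le_log (by linarith) hfb)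
  have h2 : lgg (lgg a) - 2 / lgg a ≤ lgg (lgg ⌊a⌋₊) := by
    have h3 : lgg (lgg a) - lgg (lgg ⌊a⌋₊) = lgg (lgg a / lgg ⌊a⌋₊) := by
      rw [log_div (by linarith) (by linarith)]
    have hx : 0 < lgg ⌊a⌋₊ := by linarith
    have h4 := log_le_sub_one_of_pos (show 0 < lgg a / lgg ⌊a⌋₊ by positivity)
    have h5 : lgg a / lgg ⌊a⌋₊ - 1 ≤ 2 / lgg a := by
      rw [div_sub_one hx.ne', div_le_div_iff₀ hx (by linarith)]
      nlinarith
    linarith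
  have h3 : C / lgg ⌊a⌋₊ ≤ 2 * C / lgg a := by
    rw [div_le_div_iff₀ (by linarith) (by linarith)]; nlinarith
  have h4 : ∑ p ∈ PQ a b, (2 / (↟p+1)) ≤ ∑ p ∈ (Ioc ⌊a⌋₊ ⌊b⌋₊).filter (fun n => n.Prime ∧ n % 4 = 1), (2/↟p) := by
    have : PQ a b ⊆ (Ioc ⌊a⌋₊ ⌊b⌋₊).filter (fun n => n.Prime ∧ n % 4 = 1) := by
      intro p hp
      simp only [PQ, mem_filter, mem_range, Finset.mem_Ioc] at hp ⊢
      exact ⟨⟨(floor_lt ha0).mpr hp.2.2.2, by omega⟩, hp.2.1, hp.2.2.1⟩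
    calc _ ≤ ∑ p ∈ PQ a b, (2/↟p) := by
          refine sum_le_sum fun p hp => ?_
          simp only [PQ, mem_filter] at hp
          have : I0 < p := by exact_mod_cast hp.2.1.pos
          gcongr; linarith
      _ ≤ _ := sum_le_sum_of_subset_of_nonneg this (fun _ _ _ => by positivity)
  rw [log_div (by have := log_le_log (by linarith) hab; linarith) (by linarith), add_div]
  linarith

lemma final_num (Cst : ℝ) (hC : 0 < Cst) : ∀ᶠ D : ℝ in Filter.atTop,
    D^(-(0.002:ℝ)) + 8 * (lgg D)^2 * (Cst * D^(-(0.019:ℝ))) ≤ 0.0125 / (lgg D)^2 := by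
  have t1 := (tendsto_rpow_neg_atTop (show I0 < 0.0018 by norm_num)).const_mul (10^8:ℝ)
  have t2 := (tendsto_rpow_neg_atTop (show I0 < 0.0186 by norm_num)).const_mul (8 * Cst * 10^16:ℝ)
  have t := t1.add t2
  simp only [mul_zero, add_zero] at t
  filter_upwards [t.eventually (gt_mem_nhds (show I0 < 0.0125 by norm_num)), Filter.eventually_ge_atTop ↟3] with D h1 hD
  have hD0 : 0 < D := by linarith
  have hL : 0 < lgg D := log_pos (by linarith)
  have hle := log_le_rpow_div hD0.le (show I0 < 0.0001 by norm_num)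
  have hle2 : (lgg D)^2 ≤ 10^8 * D^(0.0002:ℝ) := by
    calc _ ≤ (D^(0.0001:ℝ) / 0.0001)^2 := by gcongr
      _ = _ := by rw [div_pow, ← rpow_natCast, ← rpow_mul hD0.le]; norm_num; ring
  have hle4 : (lgg D)^2 * (lgg D)^2 ≤ 10^16 * D^(0.0004:ℝ) := by
    calc _ ≤ (10^8 * D^(0.0002:ℝ)) * (10^8 * D^(0.0002:ℝ)) := mul_le_mul hle2 hle2 ppp ppp
      _ = 10^16 * (D^(0.0002:ℝ) * D^(0.0002:ℝ)) := by ring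
      _ = _ := by rw [← rpow_add hD0]; norm_num
  rw [le_div_iff₀ ppp, add_mul]
  have a1 : D^(-(0.002:ℝ)) * (lgg D)^2 ≤ 10^8 * D^(-(0.0018:ℝ)) := by
    calc _ ≤ D^(-(0.002:ℝ)) * (10^8 * D^(0.0002:ℝ)) := mul_le_mul_of_nonneg_left hle2 ppp
      _ = 10^8 * (D^(-(0.002:ℝ)) * D^(0.0002:ℝ)) := by ring
      _ = _ := by rw [← rpow_add hD0]; norm_num
  have a2 : 8 * (lgg D)^2 * (Cst * D^(-(0.019:ℝ))) * (lgg D)^2 ≤ 8 * Cst * 10^16 * D^(-(0.0186:ℝ)) := by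
    calc _ = (8 * Cst * D^(-(0.019:ℝ))) * ((lgg D)^2 * (lgg D)^2) := by ring
      _ ≤ (8 * Cst * D^(-(0.019:ℝ))) * (10^16 * D^(0.0004:ℝ)) := mul_le_mul_of_nonneg_left hle4 ppp
      _ = 8 * Cst * 10^16 * (D^(-(0.019:ℝ)) * D^(0.0004:ℝ)) := by ring
      _ = _ := by rw [← rpow_add hD0]; norm_num
  linarith


lemma level_sum (n : ℕ) : ∑ i ∈ rgg n, (2*((i:ℝ)+1)) / 2^i = 8 - (4*n+8) / 2^n := by
  induction n with
  | zero => norm_num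
  | succ n ih => rw [sum_range_succ, ih]; push_cast; field_simp; ring

lemma log_ratio : lgg (0.82/0.0225) ≤ 3.65 := by
  have h : ↟5 * lgg (0.82/0.0225) ≤ 26 * lgg 2 := by
    have h1 : lgg ((0.82/0.0225)^5) ≤ lgg (I2^26) := log_le_log nnn nnn
    rw [log_pow, log_pow] at h1
    exact_mod_cast h1
  have := log_two_lt_d9
  norm_num at *; linarith

set_option maxHeartbeats 1000000 in
lemma sieve_main : ∃ y0 : ℕ, ∀ y : ℕ, y0 ≤ y → ∀ Cst : ℝ, 0 < Cst → ∃ D0 : ℝ, 1 ≤ D0 ∧ ∀ D : ℝ, D0 ≤ D →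
    ∀ {ι : Type} (Ω : Finset ι) (_ : Ω.Nonempty) (w : ι → ℕ → ℝ) (_ : ∀ ω p, w ω p = 0 ∨ w ω p = 1),
    (∀ T : Finset ℕ, T.Nonempty → (∀ p ∈ T, p.Prime ∧ p % 4 = 1 ∧ y < p) → ((∏ p ∈ T, p : ℕ):ℝ) ≤ D →
      |av Ω (fun ω => ∏ p ∈ T, (w ω p - 2/(↟p+1)))| ≤ (Cst * D^(-(0.02:ℝ))) * ((∏ p ∈ T, p : ℕ):ℝ)⁻¹) →
    D^(-(0.002:ℝ)) ≤ av Ω (fun ω =>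
      open Classical in if (∀ p : ℕ, p.Prime → p % 4 = 1 → y < p → ↟p ≤ D^(0.0225:ℝ) → w ω p = 0) ∧
        ((PQ (D^(0.0225:ℝ)) (D^(0.82:ℝ))).filter (fun p => w ω p = 1)).card ≤ 4 then 1 else 0) := by
  classical
  obtain ⟨C, hC0, hC⟩ := mert_real
  obtain ⟨K, hK4, hK⟩ : ∃ K : ℕ, 4 ≤ K ∧ ∀ y, K ≤ y → 3^1000 ≤ y :=
    ⟨3^1000, (show 4 ≤ 3^2 by norm_num).trans (Nat.pow_le_pow_right nnn nnn), fun _ h => h⟩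
  refine ⟨max K ⌈exp (200 * C + 1)⌉₊, ?_⟩
  intro y hy Cst hCst
  have hy3 : K ≤ y := (le_max_left _ _).trans hy
  have hy4 : ↟4 ≤ y := by exact_mod_cast hK4.trans hy3
  have hylog : 200 * C + 1 ≤ lgg y := by
    rw [le_log_iff_exp_le (by linarith)]
    exact (Nat.le_ceil _).trans (by exact_mod_cast (le_max_right _ _).trans hy)
  have hCy : ∀ a : ℝ, ↟y ≤ a → C / lgg a ≤ 0.005 := by
    intro a ha
    have : lgg y ≤ lgg a := log_le_log (by linarith) ha
    rw [div_le_iff₀ (by linarith)]; linarith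
  have ev := ((final_num Cst hCst).and (Filter.eventually_ge_atTop ↟3)).and
    ((tendsto_rpow_atTop (show I0 < 0.0225 by norm_num)).eventually (Filter.eventually_ge_atTop ↟y))
  rw [Filter.eventually_atTop] at ev
  obtain ⟨D1, hD1⟩ := ev
  refine ⟨max D1 1, le_max_right _ _, ?_⟩
  intro D hDD ι Ω hne w hw heps
  obtain ⟨⟨hnum, hD3⟩, hyz⟩ := hD1 D ((le_max_left _ _).trans hDD)
  clear hD1
  have hD0 : 0 < D := by linarith
  have hDone : 1 ≤ D := by linarith
  set L := lgg D with hLdef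
  have hL1 : 1 ≤ L := by
    rw [hLdef, le_log_iff_exp_le hD0]; linarith [exp_one_lt_d9]
  obtain ⟨n', hn1, hn2⟩ := exists_nat_pow_near hL1 (show I1 < 2 by norm_num)
  set n := n' + 1 with hn
  have hn3 : I2^n ≤ 2 * L := by rw [hn, pow_succ]; linarith
  set z : ℕ → ℝ := fun i => D^((0.0225:ℝ)/2^i) with hz
  have hz1 : ∀ i, 1 ≤ z i := fun i => one_le_rpow hDone ppp
  have hlogz : ∀ i, lgg (z i) = 0.0225/2^i * L := fun i => log_rpow hD0 _
  have hzanti : ∀ i j, i ≤ j → z j ≤ z i := by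
    intro i j hij
    apply rpow_le_rpow_of_exponent_le hDone
    have : I2^i ≤ 2^j := pow_le_pow_right₀ nnn hij
    gcongr
  have hz0 : z 0 = D^(0.0225:ℝ) := by simp [hz]
  have hzn : z n ≤ y := by
    have : z n ≤ 4 := by
      rw [← Real.log_le_log_iff (by linarith [hz1 n]) nnn, hlogz]
      have h4 : 1 ≤ lgg 4 := by
        rw [le_log_iff_exp_le nnn]; linarith [exp_one_lt_d9]
      have : (0.0225:ℝ)/2^n * L ≤ 0.0225 := by
        rw [div_mul_eq_mul_div, div_le_iff₀ ppp]; nlinarith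
      norm_num at this ⊢; linarith
    linarith
  set Q : ℕ → Finset ℕ := fun i => PQ (max y (z (i+1))) (z i) with hQ
  set Q0 := PQ (D^(0.0225:ℝ)) (D^(0.82:ℝ)) with hQ0
  have hmem : ∀ i p, p ∈ Q i ↔ p.Prime ∧ p % 4 = 1 ∧ max ↟y (z (i+1)) < p ∧ ↟p ≤ z i := fun i p =>
    mem_PQ (by linarith [hz1 i])
  have hmem0 : ∀ p, p ∈ Q0 ↔ p.Prime ∧ p % 4 = 1 ∧ D^(0.0225:ℝ) < p ∧ ↟p ≤ D^(0.82:ℝ) := fun p =>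
    mem_PQ ppp
  set g : ℕ → ℝ := fun p => 2 / (↟p+1) with hg
  set g' : ℕ → ℝ := fun p => if p = 0 then 0 else g p with hg'
  have hgg : ∀ T : Finset ℕ, (∀ p ∈ T, p.Prime) → ∀ p ∈ T, g' p = g p := fun T hT p hp => by
    simp [hg', (hT p hp).ne_zero]
  have hg1 : ∀ p, 0 ≤ g' p ∧ g' p ≤ 1 := by
    intro p; simp only [hg', hg]
    split_ifs with h
    · norm_num
    · have : I1 ≤ p := by exact_mod_cast one_le_iff_ne_zero.mpr h
      exact ⟨by positivity, by rw [div_le_one (by linarith)]; linarith⟩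
  have hg2 : ∀ p, 0 ≤ g' p ∧ g' p ≤ 2 * ↟p⁻¹ := by
    intro p; refine ⟨(hg1 p).1, ?_⟩
    simp only [hg', hg]
    split_ifs with h
    · positivity
    · have : I1 ≤ p := by exact_mod_cast one_le_iff_ne_zero.mpr h
      rw [← div_eq_mul_inv]; gcongr; linarith
  have hQp : ∀ i, ∀ p ∈ Q i, p.Prime := fun i p hp => ((hmem i p).mp hp).1
  have hQ0p : ∀ p ∈ Q0, p.Prime := fun p hp => ((hmem0 p).mp hp).1
  have h7 : ∀ i < n, ∑ p ∈ Q i, g' p ≤ 0.7 := by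
    intro i _
    rw [sum_congr rfl (hgg _ (hQp i))]
    by_cases hc : max ↟y (z (i+1)) ≤ z i
    · refine (hC _ _ (hy4.trans (le_max_left _ _)) hc).trans ?_
      have h1 := hCy _ (le_max_left ↟y (z (i+1)))
      have hpos : 0 < lgg (max ↟y (z (i+1))) := log_pos (by linarith [le_max_left ↟y (z (i+1))])
      have h2 : lgg (z (i+1)) ≤ lgg (max ↟y (z (i+1))) :=
        log_le_log (by linarith [hz1 (i+1)]) (le_max_right _ _)
      have h3 : lgg (z i) = 2 * lgg (z (i+1)) := by rw [hlogz, hlogz, pow_succ]; field_simp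
      have h4 : lgg (z i) / lgg (max ↟y (z (i+1))) ≤ 2 := by
        rw [div_le_iff₀ hpos]; linarith
      have h5 : lgg (lgg (z i) / lgg (max ↟y (z (i+1)))) ≤ lgg 2 := by
        apply log_le_log _ h4
        apply div_pos _ hpos
        exact log_pos (by linarith [le_max_left ↟y (z (i+1))])
      have := log_two_lt_d9
      norm_num at h1 this ⊢; linarith
    · have : Q i = ∅ := by
        rw [Finset.eq_empty_iff_forall_notMem]
        intro p hp
        have := (hmem i p).mp hp
        exact hc (this.2.2.1.le.trans this.2.2.2)
      rw [this]; simp; norm_num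
  have h0 : ∑ p ∈ Q0, g' p ≤ 3.7 := by
    rw [sum_congr rfl (hgg _ hQ0p)]
    refine (hC _ _ (hy4.trans hyz) (rpow_le_rpow_of_exponent_le hDone nnn)).trans ?_
    have h1 := hCy _ hyz
    rw [log_rpow hD0] at h1
    rw [log_rpow hD0, log_rpow hD0, mul_div_mul_right _ _ (by linarith : lgg D ≠ 0)]
    have := log_ratio
    norm_num at h1 this ⊢; linarith
  have hmain := LBg n Q Q0 g' hg1 h7 h0
  set ε := Cst * D^(-(0.02:ℝ)) * D^(0.001:ℝ) with hε
  have hε0 : 0 ≤ ε := by positivity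
  have hε' : ε = Cst * D^(-(0.019:ℝ)) := by
    rw [hε, mul_assoc, ← rpow_add hD0]; norm_num
  have herr : ∀ (R : Finset ℕ) (Φ), (∀ p ∈ R, p.Prime ∧ p % 4 = 1 ∧ y < p) → IsExp R D Φ →
      |av Ω (fun ω => Φ (w ω)) - Φ g'| ≤ ε * (1 + L) := by
    intro R Φ hR hΦ
    refine exp_error Ω w g' R (fun p hp => (hR p hp).1) D ε hDone hε0 ?_ Φ hΦ
    refine eps_to_A Ω w hne g' hg2 y (hK y hy3) D _ hDone ppp R (fun p hp => ⟨(hR p hp).1, (hR p hp).2.2⟩) ?_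
    intro T hT hTne hTD
    refine le_trans (le_of_eq ?_) (heps T hTne (fun p hp => hR p (hT hp)) hTD)
    congr 1; congr 1; funext ω
    exact prod_congr rfl fun p hp => by rw [hgg T (fun p hp => (hR p (hT hp)).1) p hp]
  have hRi : ∀ i, ∀ p ∈ Q i, p.Prime ∧ p % 4 = 1 ∧ y < p := fun i p hp => by
    have := (hmem i p).mp hp
    exact ⟨this.1, this.2.1, by exact_mod_cast lt_of_le_of_lt (le_max_left _ _) this.2.2.1⟩
  have hR0 : ∀ p ∈ Q0, p.Prime ∧ p % 4 = 1 ∧ y < p := fun p hp => by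
    have := (hmem0 p).mp hp
    exact ⟨this.1, this.2.1, by exact_mod_cast lt_of_le_of_lt hyz this.2.2.1⟩
  have hRU : ∀ I : Finset ℕ, ∀ p ∈ I.biUnion Q, p.Prime ∧ p % 4 = 1 ∧ y < p := fun I p hp => by
    obtain ⟨i, _, hi⟩ := Finset.mem_biUnion.mp hp
    exact hRi i p hi
  have hdis : ∀ i j, i ≠ j → Disjoint (Q i) (Q j) := by
    have : ∀ i j, i < j → Disjoint (Q i) (Q j) := by
      intro i j hij
      rw [disjoint_left]
      intro p hp hp'
      have h1 := (hmem i p).mp hp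
      have h2 := (hmem j p).mp hp'
      have h3 := hzanti (i+1) j hij
      have h4 := le_max_right ↟y (z (i+1))
      linarith [h1.2.2.1, h2.2.2.2]
    intro i j hij
    rcases lt_or_gt_of_ne hij with h | h
    · exact this i j h
    · exact (this j i h).symm
  have hdis0 : ∀ i, Disjoint Q0 (Q i) := by
    intro i
    rw [disjoint_left]
    intro p hp hp'
    have h1 := (hmem0 p).mp hp
    have h2 := (hmem i p).mp hp'
    have h3 := hzanti 0 i (Nat.zero_le _)
    rw [hz0] at h3
    linarith [h1.2.2.1, h2.2.2.2]
  have hlev : ∏ i ∈ rgg n, (z i)^(2*(i+1)) ≤ D^(0.18:ℝ) := by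
    have e : ∀ i ∈ rgg n, (z i)^(2*(i+1)) = D^(0.0225 * ((2*(↟i+1)) / 2^i)) := by
      intro i _
      simp only [hz]
      rw [← rpow_natCast, ← rpow_mul hD0.le]
      congr 1; push_cast; ring
    rw [prod_congr rfl e, ← Real.rpow_sum_of_pos hD0, ← mul_sum, level_sum]
    apply rpow_le_rpow_of_exponent_le hDone
    have : 0 ≤ (4*↟n+8)/2^n := by positivity
    norm_num at this ⊢; linarith
  have hzp : ∀ i k, 0 ≤ (z i)^k := fun i k => pow_nonneg (by linarith [hz1 i]) k
  have hUexp : ∀ I : Finset ℕ, IsExp (I.biUnion Q) (∏ i ∈ I, (z i)^(2*(i+1))) (fun x => ∏ i ∈ I, uu (2*(i+1)) (Q i) x) :=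
    fun I => IsExp.prod I Q (fun i => (z i)^(2*(i+1))) (fun i => uu (2*(i+1)) (Q i))
      (fun i _ => isExp_uu (hz1 i) (fun p hp => ((hmem i p).mp hp).2.2.2) _) (fun i _ => hzp i _) (fun i _ j _ => hdis i j)
  have E1 := herr _ _ (hRU (rgg n)) ((hUexp (rgg n)).mono (hlev.trans
    (by conv_rhs => rw [← rpow_one D]
        exact rpow_le_rpow_of_exponent_le hDone nnn)))
  have E2 : ∀ i ∈ rgg n, |av Ω (fun ω => es (2*(i+1)+1) (Q i) (w ω) * ∏ j ∈ (rgg n).erase i, uu (2*(j+1)) (Q j) (w ω))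
      - es (2*(i+1)+1) (Q i) g' * ∏ j ∈ (rgg n).erase i, uu (2*(j+1)) (Q j) g'| ≤ ε * (1+L) := by
    intro i hi
    refine herr (Q i ∪ ((rgg n).erase i).biUnion Q)
      (fun x => es (2*(i+1)+1) (Q i) x * ∏ j ∈ (rgg n).erase i, uu (2*(j+1)) (Q j) x) ?_ ?_
    · intro p hp
      rcases mem_union.mp hp with h | h
      · exact hRi i p h
      · exact hRU _ p h
    · refine ((isExp_es (hz1 i) (fun p hp => ((hmem i p).mp hp).2.2.2) (2*(i+1)+1)).mul (hUexp _) ?_ (hzp i _)).mono ?_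
      · rw [disjoint_biUnion_right]
        exact fun j hj => hdis i j (ne_of_mem_erase hj).symm
      · rw [pow_succ, mul_right_comm, mul_prod_erase _ (fun i => (z i)^(2*(i+1))) hi]
        calc _ ≤ D^(0.18:ℝ) * D^(0.0225:ℝ) := by
              apply mul_le_mul hlev _ (by linarith [hz1 i]) ppp
              rw [← hz0]; exact hzanti 0 i (Nat.zero_le _)
          _ = D^((0.18:ℝ)+0.0225) := by rw [rpow_add hD0]
          _ ≤ D^I1 := rpow_le_rpow_of_exponent_le hDone nnn
          _ = D := rpow_one D
  have E3 := herr (Q0 ∪ (rgg n).biUnion Q) (fun x => es 1 Q0 x * ∏ i ∈ rgg n, uu (2*(i+1)) (Q i) x)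
    (by intro p hp
        rcases mem_union.mp hp with h | h
        · exact hR0 p h
        · exact hRU _ p h)
    (((isExp_es (one_le_rpow hDone nnn : I1 ≤ D^(0.82:ℝ)) (fun p hp => ((hmem0 p).mp hp).2.2.2) 1).mul (hUexp _)
      (by rw [disjoint_biUnion_right]; exact fun j _ => hdis0 j) ppp).mono
      (by calc _ ≤ D^(0.82:ℝ) * D^(0.18:ℝ) := by rw [pow_one]; exact mul_le_mul_of_nonneg_left hlev ppp
            _ = D^((0.82:ℝ)+0.18) := by rw [rpow_add hD0]
            _ = D := by norm_num))
  have hlow := av_mono Ω (fun ω (_ : ω ∈ Ω) => brun_hooley n Q Q0 (w ω) (hw ω))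
  rw [av_sub, av_sub, av_mul, av_sum] at hlow
  have hS : (∑ i ∈ rgg n, av Ω (fun ω => es (2*(i+1)+1) (Q i) (w ω) * ∏ j ∈ (rgg n).erase i, uu (2*(j+1)) (Q j) (w ω)))
      ≤ (∑ i ∈ rgg n, es (2*(i+1)+1) (Q i) g' * ∏ j ∈ (rgg n).erase i, uu (2*(j+1)) (Q j) g') + n * (ε * (1+L)) := by
    have : ↟n * (ε * (1+L)) = ∑ i ∈ rgg n, (ε * (1+L)) := by simp
    rw [this, ← sum_add_distrib]
    refine sum_le_sum fun i hi => ?_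
    linarith [(abs_le.mp (E2 i hi)).2]
  have hE1 := (abs_le.mp E1).1
  have hE3 := (abs_le.mp E3).2
  have hεL : 0 ≤ ε * (1 + L) := by positivity
  have hbig : 0.05 * (0.3:ℝ)^n - (n+2) * (ε * (1+L)) ≤ av Ω (fun ω => if (∀ i < n, ∀ p ∈ Q i, w ω p = 0) ∧ (Q0.filter (fun p => w ω p = 1)).card ≤ 4 then I1 else 0) := by
    refine le_trans ?_ hlow
    linarith
  have hgood : av Ω (fun ω => if (∀ i < n, ∀ p ∈ Q i, w ω p = 0) ∧ (Q0.filter (fun p => w ω p = 1)).card ≤ 4 then I1 else 0) ≤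
      av Ω (fun ω => if (∀ p : ℕ, p.Prime → p % 4 = 1 → y < p → ↟p ≤ D^(0.0225:ℝ) → w ω p = 0) ∧
        (Q0.filter (fun p => w ω p = 1)).card ≤ 4 then 1 else 0) := by
    apply av_mono
    intro ω _
    by_cases hc : (∀ i < n, ∀ p ∈ Q i, w ω p = 0) ∧ (Q0.filter (fun p => w ω p = 1)).card ≤ 4
    · rw [if_pos hc, if_pos]
      refine ⟨?_, hc.2⟩
      intro p hp hp4 hyp hpz
      have hex : ∃ i, z (i+1) < p := ⟨n', lt_of_le_of_lt hzn (by exact_mod_cast hyp)⟩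
      have hi := Nat.find_spec hex
      have hin : find hex ≤ n' := Nat.find_min' hex (lt_of_le_of_lt hzn (by exact_mod_cast hyp))
      refine hc.1 (find hex) ooo p ((hmem _ p).mpr ⟨hp, hp4, max_lt (by exact_mod_cast hyp) hi, ?_⟩)
      rcases Nat.eq_zero_or_pos (find hex) with h | h
      · rw [h, hz0]; exact hpz
      · have := Nat.find_min hex (show find hex - 1 < find hex by omega)
        rw [show find hex - 1 + 1 = find hex by omega] at this
        linarith
    · rw [if_neg hc]; split_ifs <;> norm_num
  refine le_trans ?_ (hbig.trans hgood)
  have hn4 : ↟n ≤ 2 * L := by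
    have : ↟n < 2^n := by exact_mod_cast Nat.lt_two_pow_self
    linarith
  have h3n : 0.0125 / L^2 ≤ 0.05 * (0.3:ℝ)^n := by
    have a1 : (I1/4)^n ≤ (0.3:ℝ)^n := pow_le_pow_left₀ nnn nnn n
    have a2 : (I1/4)^n = 1 / (I2^n)^2 := by rw [div_pow, one_pow, ← pow_mul, mul_comm n 2, pow_mul]; norm_num
    have a3 : (I2^n)^2 ≤ 4 * L^2 := by
      calc _ ≤ (2*L)^2 := pow_le_pow_left₀ ppp hn3 2
        _ = _ := by ring
    have a4 : 1 / (4*L^2) ≤ 1 / (I2^n)^2 := one_div_le_one_div_of_le ppp a3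
    have a5 : (0.0125:ℝ) / L^2 = 0.05 * (1/(4*L^2)) := by field_simp; norm_num
    rw [a5]
    apply mul_le_mul_of_nonneg_left _ nnn
    linarith
  have h8 : (n+2) * (ε * (1+L)) ≤ 8 * L^2 * (Cst * D^(-(0.019:ℝ))) := by
    rw [hε'] at *
    have b1 : (↟n+2) * (1+L) ≤ 8 * L^2 := by
      calc (↟n+2) * (1+L) ≤ (4*L) * (2*L) := mul_le_mul (by linarith) (by linarith) (by linarith) (by linarith)
        _ = _ := by ring
    have b2 : 0 ≤ Cst * D^(-(0.019:ℝ)) := by positivity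
    calc _ = (↟n+2) * (1+L) * (Cst * D^(-(0.019:ℝ))) := by ring
      _ ≤ _ := mul_le_mul_of_nonneg_right b1 b2
  linarith


def vv (a : Fin 2 → ℤ) : Fin 3 → ℤ := ![a 0^2 - a 1^2, 2*a 0*a 1, a 0^2 + a 1^2]

def InL (Γ : Subgroup SL3Z) (g : Matrix (Fin 2) (Fin 2) ℤ) : Prop :=
  ∃ γ ∈ Γ, ∀ a, vv (a ᵥ* g) = vv a ᵥ* (γ : Matrix (Fin 3) (Fin 3) ℤ)

lemma InL.mul {Γ : Subgroup SL3Z} {g h : Matrix (Fin 2) (Fin 2) ℤ} (hg : InL Γ g) (hh : InL Γ h) : InL Γ (g*h) := by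
  obtain ⟨γ, hγ, e⟩ := hg
  obtain ⟨γ', hγ', e'⟩ := hh
  refine ⟨γ*γ', Γ.mul_mem hγ hγ', fun a => ?_⟩
  rw [← vecMul_vecMul, e', e, vecMul_vecMul, Matrix.SpecialLinearGroup.coe_mul]

lemma InL.one {Γ : Subgroup SL3Z} : InL Γ 1 := ⟨1, Γ.one_mem, fun a => by simp⟩

lemma vv_neg (a : Fin 2 → ℤ) : vv (-a) = vv a := by
  simp [vv]

lemma InL.neg {Γ : Subgroup SL3Z} {g : Matrix (Fin 2) (Fin 2) ℤ} (hg : InL Γ g) : InL Γ (-g) := by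
  obtain ⟨γ, hγ, e⟩ := hg
  exact ⟨γ, hγ, fun a => by rw [Matrix.vecMul_neg, vv_neg, e]⟩

lemma InL.pow {Γ : Subgroup SL3Z} {g : Matrix (Fin 2) (Fin 2) ℤ} (hg : InL Γ g) (n : ℕ) : InL Γ (g^n) := by
  induction n with
  | zero => simpa using InL.one
  | succ n ih => rw [pow_succ]; exact ih.mul hg

def JQ : Matrix (Fin 3) (Fin 3) ℤ := !![1,0,0;0,1,0;0,0,-1]

set_option maxHeartbeats 1000000 in
lemma presQ_eq (g : SL3Z) (h : PreservesQ g) :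
    (g : Matrix (Fin 3) (Fin 3) ℤ) * JQ * (g : Matrix (Fin 3) (Fin 3) ℤ)ᵀ = JQ := by
  obtain ⟨g, hg⟩ := g
  unfold PreservesQ Qform at h
  simp only at h
  have key : ∀ x y z : ℝ, (x * g 0 0 + y * g 1 0 + z * g 2 0)^2 + (x * g 0 1 + y * g 1 1 + z * g 2 1)^2
      - (x * g 0 2 + y * g 1 2 + z * g 2 2)^2 = x^2+y^2-z^2 := by
    intro x y z
    have := h ![x,y,z]
    simpa [vecMul, dotProduct, Fin.sum_univ_three] using this
  have k1 := key 1 0 0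
  have k2 := key 0 1 0
  have k3 := key 0 0 1
  have k12 := key 1 1 0
  have k13 := key 1 0 1
  have k23 := key 0 1 1
  simp only [one_mul, zero_mul, add_zero, zero_add] at k1 k2 k3 k12 k13 k23
  norm_num at k1 k2 k3 k12 k13 k23
  have i1 : (g 0 0)^2 + (g 0 1)^2 - (g 0 2)^2 = 1 := by exact_mod_cast k1
  have i2 : (g 1 0)^2 + (g 1 1)^2 - (g 1 2)^2 = 1 := by exact_mod_cast k2
  have i3 : (g 2 0)^2 + (g 2 1)^2 - (g 2 2)^2 = -1 := by exact_mod_cast k3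
  have i12 : (g 0 0 + g 1 0)^2 + (g 0 1 + g 1 1)^2 - (g 0 2 + g 1 2)^2 = 2 := by
    have : ((2:ℤ):ℝ) = 1 + 1 := by norm_num
    have k12' := k12
    exact_mod_cast (by rw [k12']; norm_num : ((g 0 0:ℝ) + g 1 0)^2 + (g 0 1 + g 1 1)^2 - (g 0 2 + g 1 2)^2 = ((2:ℤ):ℝ))
  have i13 : (g 0 0 + g 2 0)^2 + (g 0 1 + g 2 1)^2 - (g 0 2 + g 2 2)^2 = 0 := by exact_mod_cast k13
  have i23 : (g 1 0 + g 2 0)^2 + (g 1 1 + g 2 1)^2 - (g 1 2 + g 2 2)^2 = 0 := by exact_mod_cast k23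
  ext i j
  fin_cases i <;> fin_cases j <;>
    simp [JQ, Matrix.mul_apply, Fin.sum_univ_three] <;> linarith

lemma presQ_eq' (g : SL3Z) (h : PreservesQ g) :
    (g : Matrix (Fin 3) (Fin 3) ℤ)ᵀ * JQ * (g : Matrix (Fin 3) (Fin 3) ℤ) = JQ := by
  have h1 := presQ_eq g h
  have hJ : JQ * JQ = 1 := by ext i j; fin_cases i <;> fin_cases j <;> simp [JQ, Matrix.mul_apply, Fin.sum_univ_three]
  have h2 : ((g : Matrix (Fin 3) (Fin 3) ℤ)) * (JQ * (g : Matrix (Fin 3) (Fin 3) ℤ)ᵀ * JQ) = 1 := by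
    rw [← Matrix.mul_assoc, ← Matrix.mul_assoc, h1, hJ]
  have h3 := mul_eq_one_comm.mp h2
  calc _ = JQ * (JQ * (g : Matrix (Fin 3) (Fin 3) ℤ)ᵀ * JQ * g) := by
        rw [← Matrix.mul_assoc, ← Matrix.mul_assoc, ← Matrix.mul_assoc, hJ, Matrix.one_mul]
    _ = JQ := by rw [h3, Matrix.mul_one]

lemma pyth_param (x y z : ℤ) (h : x^2+y^2 = z^2) (hz : 0 ≤ z) (hy : 2 ∣ y) (hxz : 2 ∣ z - x)
    (hco : ∀ p : ℕ, p.Prime → (p:ℤ) ∣ x → (p:ℤ) ∣ y → (p:ℤ) ∣ z → False) : ∃ a : Fin 2 → ℤ, vv a = ![x,y,z] := by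
  obtain ⟨B, rfl⟩ := hy
  obtain ⟨C, hC⟩ := hxz
  obtain ⟨A, hA⟩ : ∃ A, A = z - C := ⟨_, rfl⟩
  have hx : x = A - C := by linarith
  have hz' : z = A + C := by linarith
  subst hx; subst hz'
  have hAC : A * C = B^2 := by nlinarith
  have hA0 : 0 ≤ A := by
    by_contra hn; push Not at hn
    nlinarith [sq_nonneg B]
  have hC0 : 0 ≤ C := by
    by_contra hn; push Not at hn
    nlinarith [sq_nonneg B]
  have hg : Int.gcd A C = 1 := by
    by_contra hne
    obtain ⟨p, hp, hpd⟩ := Nat.exists_prime_and_dvd hne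
    have hpA : (p:ℤ) ∣ A := (natCast_dvd_natCast.mpr hpd).trans (Int.gcd_dvd_left ..)
    have hpC : (p:ℤ) ∣ C := (natCast_dvd_natCast.mpr hpd).trans (Int.gcd_dvd_right ..)
    have hpB : (p:ℤ) ∣ B := (prime_iff_prime_int.mp hp).dvd_of_dvd_pow (hAC ▸ hpA.mul_right C)
    exact hco p hp (dvd_sub hpA hpC) (hpB.mul_left 2) (dvd_add hpA hpC)
  obtain ⟨α, hα⟩ := sq_of_gcd_eq_one hg hAC
  obtain ⟨β, hβ⟩ := sq_of_gcd_eq_one (by rw [Int.gcd_comm]; exact hg) (by rw [mul_comm]; exact hAC)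
  have hα' : A = α^2 := by
    rcases hα with h | h
    · exact h
    · nlinarith [sq_nonneg α]
  have hβ' : C = β^2 := by
    rcases hβ with h | h
    · exact h
    · nlinarith [sq_nonneg β]
  have : (α*β)^2 = B^2 := by rw [← hAC, hα', hβ']; ring
  rcases sq_eq_sq_iff_eq_or_eq_neg.mp this with h' | h'
  · refine ⟨![α, β], ?_⟩
    simp [vv, hα', hβ', ← h']; ring
  · refine ⟨![α, -β], ?_⟩
    have : B = -(α*β) := by linarith
    simp [vv, hα', hβ', this]; ring


lemma JQ_row (m m' : Matrix (Fin 3) (Fin 3) ℤ) (i j : Fin 3) :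
    (m * JQ * m'ᵀ) i j = m i 0 * m' j 0 + m i 1 * m' j 1 - m i 2 * m' j 2 := by
  simp [JQ, Matrix.mul_apply, Fin.sum_univ_three]; ring

lemma sum_two_sq_lt {a b c : ℤ} (hc : 0 < c) (h : a^2 + b^2 < c^2) : 0 < a + c := by
  nlinarith [sq_nonneg b, sq_nonneg a]

lemma sq_eq_one_iff_of_ne (x : ℤ) (h : x^2 = 1) : x = 1 ∨ x = -1 := by
  have : x^2 = 1^2 := by rw [h]; norm_num
  exact sq_eq_sq_iff_eq_or_eq_neg.mp this

set_option maxHeartbeats 1000000 in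
lemma lift_exists (γ : SL3Z) (hQ : PreservesQ γ) (h2 : ∀ i j, (2:ℤ) ∣ γ.1 i j - (1 : Matrix (Fin 3) (Fin 3) ℤ) i j)
    (h33 : 0 < γ.1 2 2) (T : ℤ) (hT : ∀ i j, |γ.1 i j| ≤ T) :
    ∃ g : M2, g.det = 1 ∧ (∀ i j, (g i j)^2 ≤ 2*T) ∧ ∀ a, vv (a ᵥ* g) = vv a ᵥ* γ.1 := by
  have hr := presQ_eq γ hQ
  have hc := presQ_eq' γ hQ
  obtain ⟨m, hm⟩ := γ
  simp only at *
  have R : ∀ i j, m i 0 * m j 0 + m i 1 * m j 1 - m i 2 * m j 2 = JQ i j := fun i j => by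
    rw [← JQ_row, hr]
  have C : ∀ i j, m 0 i * m 0 j + m 1 i * m 1 j - m 2 i * m 2 j = JQ i j := fun i j => by
    have := JQ_row mᵀ mᵀ i j
    rw [Matrix.transpose_transpose, hc] at this
    rw [this]; rfl
  have r00 := R 0 0
  have r01 := R 0 1
  have r02 := R 0 2
  have r11 := R 1 1
  have r12 := R 1 2
  have r22 := R 2 2
  have c22 := C 2 2
  simp [JQ] at r00 r01 r02 r11 r12 r22 c22
  have p00 := h2 0 0
  have p01 := h2 0 1
  have p02 := h2 0 2
  have p20 := h2 2 0
  have p21 := h2 2 1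
  have p22 := h2 2 2
  simp [Matrix.one_apply] at p00 p01 p02 p20 p21 p22
  rw [Matrix.det_fin_three] at hm
  have prim : ∀ s : ℤ, s^2 = 1 → ∀ p : ℕ, p.Prime → (p:ℤ) ∣ s * m 0 0 + m 2 0 → (p:ℤ) ∣ s * m 0 1 + m 2 1 → (p:ℤ) ∣ s * m 0 2 + m 2 2 → False := by
    intro s hs p hp d0 d1 d2
    have : (p:ℤ) ∣ 1 := by
      have e : (1:ℤ) = (s * m 0 0 + m 2 0) * (m 0 1 * m 1 2 - m 0 2 * m 1 1) - (s * m 0 1 + m 2 1) * (m 0 0 * m 1 2 - m 0 2 * m 1 0)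
        + (s * m 0 2 + m 2 2) * (m 0 0 * m 1 1 - m 0 1 * m 1 0) := by linear_combination -hm
      rw [e]
      exact dvd_add (dvd_sub (d0.mul_right _) (d1.mul_right _)) (d2.mul_right _)
    have := natCast_dvd_natCast.mp (by exact_mod_cast this : ((p:ℕ):ℤ) ∣ ((1:ℕ):ℤ))
    exact hp.one_lt.ne' (Nat.dvd_one.mp this)
  have hlt : m 0 2^2 + m 1 2^2 < m 2 2^2 := by nlinarith
  have hz1 : 0 < m 0 2 + m 2 2 := sum_two_sq_lt h33 hlt
  have hz2 : 0 < -m 0 2 + m 2 2 := sum_two_sq_lt (b := m 1 2) h33 (by rw [neg_sq]; exact hlt)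
  obtain ⟨a, ha⟩ := pyth_param (m 0 0 + m 2 0) (m 0 1 + m 2 1) (m 0 2 + m 2 2) (by linear_combination r00 + 2*r02 + r22)
    hz1.le ooo ooo (fun p hp d0 d1 d2 => prim 1 nnn p hp (by simpa using d0) (by simpa using d1) (by simpa using d2))
  obtain ⟨b, hb⟩ := pyth_param (-m 0 0 + m 2 0) (-m 0 1 + m 2 1) (-m 0 2 + m 2 2) (by linear_combination r00 - 2*r02 + r22)
    hz2.le ooo ooo (fun p hp d0 d1 d2 => prim (-1) nnn p hp (by simpa using d0) (by simpa using d1) (by simpa using d2))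
  have ha0 := congrFun ha 0
  have ha1 := congrFun ha 1
  have ha2 := congrFun ha 2
  simp [vv] at ha0 ha1 ha2
  have hw : (a 0 * b 1 - a 1 * b 0)^2 = 1 := by
    have hb0 := congrFun hb 0
    have hb1 := congrFun hb 1
    have hb2 := congrFun hb 2
    simp [vv] at hb0 hb1 hb2
    have : (a 0^2 - a 1^2)*(b 0^2 - b 1^2) + (2*a 0*a 1)*(2*b 0*b 1) - (a 0^2 + a 1^2)*(b 0^2+b 1^2) = -2 := by
      rw [ha0, ha1, ha2, hb0, hb1, hb2]; linear_combination -r00 + r22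
    nlinarith
  obtain ⟨b', hb', hw'⟩ : ∃ b' : Fin 2 → ℤ, vv b' = ![-m 0 0 + m 2 0, -m 0 1 + m 2 1, -m 0 2 + m 2 2] ∧ a 0 * b' 1 - a 1 * b' 0 = 1 := by
    rcases sq_eq_one_iff_of_ne (a 0 * b 1 - a 1 * b 0) hw with h | h
    · exact ⟨b, hb, h⟩
    · exact ⟨-b, by rw [vv_neg, hb], by simp; linarith⟩
  clear hb hw
  have hb0 := congrFun hb' 0
  have hb1 := congrFun hb' 1
  have hb2 := congrFun hb' 2
  simp [vv] at hb0 hb1 hb2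
  have e0 : a 0 ^2 - a 1^2 - (b' 0^2 - b' 1^2) = 2 * m 0 0 := by linarith
  have e1 : 2*a 0*a 1 - 2*b' 0*b' 1 = 2 * m 0 1 := by linarith
  have e2 : a 0 ^2 + a 1^2 - (b' 0^2 + b' 1^2) = 2 * m 0 2 := by linarith
  have f0 : a 0 ^2 - a 1^2 + (b' 0^2 - b' 1^2) = 2 * m 2 0 := by linarith
  have f1 : 2*a 0*a 1 + 2*b' 0*b' 1 = 2 * m 2 1 := by linarith
  have f2 : a 0 ^2 + a 1^2 + (b' 0^2 + b' 1^2) = 2 * m 2 2 := by linarith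
  have o1 : m 1 0 * (a 0^2 - a 1^2) + m 1 1 * (2*a 0*a 1) - m 1 2 * (a 0^2+a 1^2) = 0 := by
    rw [ha0, ha1, ha2]; linear_combination r01 + r12
  have o2 : m 1 0 * (b' 0^2 - b' 1^2) + m 1 1 * (2*b' 0*b' 1) - m 1 2 * (b' 0^2+b' 1^2) = 0 := by
    rw [hb0, hb1, hb2]; linear_combination -r01 + r12
  have o3 : m 1 0 * ((2*a 0*a 1)*(b' 0^2+b' 1^2) - (a 0^2+a 1^2)*(2*b' 0*b' 1)) - m 1 1 * ((a 0^2-a 1^2)*(b' 0^2+b' 1^2) - (a 0^2+a 1^2)*(b' 0^2-b' 1^2))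
    + m 1 2 * ((a 0^2-a 1^2)*(2*b' 0*b' 1) - (2*a 0*a 1)*(b' 0^2-b' 1^2)) = -2 := by
    rw [ha0, ha1, ha2, hb0, hb1, hb2]; linear_combination -2 * hm
  have o3' : m 1 0 * (a 0*b' 0 - a 1*b' 1) + m 1 1 * (a 0*b' 1 + a 1*b' 0) - m 1 2 * (a 0*b' 0+a 1*b' 1) = 1 := by
    have hx : ((m 1 0 * (a 0*b' 0 - a 1*b' 1) + m 1 1 * (a 0*b' 1 + a 1*b' 0) - m 1 2 * (a 0*b' 0+a 1*b' 1)) * (a 0 * b' 1 - a 1 * b' 0)) = 1 := by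
      linarith
    rw [hw', mul_one] at hx; exact hx
  have hb1w : b' 1 * a 0 = 1 + a 1 * b' 0 := by linarith
  have g0 : m 1 0 = a 0 * b' 0 - a 1 * b' 1 := by
    have : 2 * (a 0 * b' 1 - a 1 * b' 0)^2 * m 1 0 = 2 * (a 0*b' 0 - a 1*b' 1) := by
      linear_combination (-(a 0^2-a 1^2)) * o2 - (b' 0^2-b' 1^2) * o1 + 2*(a 0*b' 0 - a 1*b' 1)*o3'
    rw [hw'] at this; linarith
  have g1 : m 1 1 = a 0 * b' 1 + a 1 * b' 0 := by
    have : 2 * (a 0 * b' 1 - a 1 * b' 0)^2 * m 1 1 = 2 * (a 0*b' 1 + a 1*b' 0) := by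
      linear_combination (-(2*a 0*a 1)) * o2 - (2*b' 0*b' 1) * o1 + 2*(a 0*b' 1 + a 1*b' 0)*o3'
    rw [hw'] at this; linarith
  have g2 : m 1 2 = a 0 * b' 0 + a 1 * b' 1 := by
    have : 2 * (a 0 * b' 1 - a 1 * b' 0)^2 * m 1 2 = 2 * (a 0*b' 0 + a 1*b' 1) := by
      linear_combination (-(a 0^2+a 1^2)) * o2 - (b' 0^2+b' 1^2) * o1 + 2*(a 0*b' 0 + a 1*b' 1)*o3'
    rw [hw'] at this; linarith
  refine ⟨!![a 0, a 1; b' 0, b' 1], by rw [det_fin_two]; simp; linarith, ?_, ?_⟩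
  · have t02 := abs_le.mp (hT 0 2)
    have t22 := abs_le.mp (hT 2 2)
    have s1 := sq_nonneg (a 0)
    have s2 := sq_nonneg (a 1)
    have s3 := sq_nonneg (b' 0)
    have s4 := sq_nonneg (b' 1)
    intro i j
    fin_cases i <;> fin_cases j <;> simp <;> linarith
  · intro s
    ext i
    fin_cases i
    · simp [vv, vecMul, dotProduct, Fin.sum_univ_two, Fin.sum_univ_three]
      rw [g0]
      linarith [congrArg (fun t => (s 0^2 - s 1^2) * t) e0, congrArg (fun t => (s 0^2 + s 1^2) * t) f0]
    · simp [vv, vecMul, dotProduct, Fin.sum_univ_two, Fin.sum_univ_three]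
      rw [g1]
      linarith [congrArg (fun t => (s 0^2 - s 1^2) * t) e1, congrArg (fun t => (s 0^2 + s 1^2) * t) f1]
    · simp [vv, vecMul, dotProduct, Fin.sum_univ_two, Fin.sum_univ_three]
      rw [g2]
      linarith [congrArg (fun t => (s 0^2 - s 1^2) * t) e2, congrArg (fun t => (s 0^2 + s 1^2) * t) f2]


lemma entry_le_frob (γ : SL3Z) (i j : Fin 3) : |((γ.1 i j : ℤ):ℝ)| ≤ frobZ γ := by
  rw [frobZ]
  apply abs_le_sqrt
  calc ((γ.1 i j : ℤ):ℝ)^2 ≤ ∑ j : Fin 3, ((γ.1 i j : ℤ):ℝ)^2 :=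
        single_le_sum (f := fun j => ((γ.1 i j : ℤ):ℝ)^2) (fun _ _ => sq_nonneg _) (mem_univ j)
    _ ≤ _ := single_le_sum (f := fun i => ∑ j : Fin 3, ((γ.1 i j : ℤ):ℝ)^2)
        (fun _ _ => sum_nonneg fun _ _ => sq_nonneg _) (mem_univ i)

lemma one_le_frob (γ : SL3Z) : 1 ≤ frobZ γ := by
  obtain ⟨i, j, h⟩ : ∃ i j, γ.1 i j ≠ 0 := by
    by_contra hn; push Not at hn
    have : γ.1 = 0 := by ext i j; exact hn i j
    have h2 := γ.2
    rw [this] at h2; simp at h2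
  refine le_trans ?_ (entry_le_frob γ i j)
  exact_mod_cast one_le_abs h

lemma crit_count (Γ : Subgroup SL3Z) (h : (0.9992:ℝ) < critExp Γ) (C : ℝ) (hC : 0 < C) (T0 : ℝ) :
    ∃ T : ℝ, T0 ≤ T ∧ 1 ≤ T ∧ ∃ u : Finset SL3Z, (∀ γ ∈ u, γ ∈ Γ ∧ frobZ γ ≤ T) ∧ C * T^(0.9992:ℝ) < u.card := by
  by_contra hcon
  push Not at hcon
  obtain ⟨s, hs1, hs2⟩ := exists_between h
  have hns : ¬ Summable (fun γ : Γ => frobZ (γ : SL3Z) ^ (-s)) := by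
    intro hsum
    have : critExp Γ ≤ s := csInf_le ⟨0, fun x hx => hx.1.le⟩ ⟨by linarith, hsum⟩
    linarith
  apply hns
  set T1 := max T0 1 with hT1
  have h11 : 1 ≤ T1 := le_max_right _ _
  set C' := C * T1^(0.9992:ℝ) with hC'
  have hC'0 : 0 < C' := by positivity
  have hall : ∀ T : ℝ, 1 ≤ T → ∀ u : Finset SL3Z, (∀ γ ∈ u, γ ∈ Γ ∧ frobZ γ ≤ T) → (u.card:ℝ) ≤ C' * T^(0.9992:ℝ) := by
    intro T hT u hu
    rcases le_total T1 T with h | h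
    · refine (hcon T ((le_max_left _ _).trans h) hT u hu).trans ?_
      have : 1 ≤ T1^(0.9992:ℝ) := one_le_rpow h11 nnn
      have h3 : 0 ≤ C * T^(0.9992:ℝ) := by positivity
      rw [hC']; nlinarith
    · refine (hcon T1 (le_max_left _ _) h11 u (fun γ hγ => ⟨(hu γ hγ).1, (hu γ hγ).2.trans h⟩)).trans ?_
      have : 1 ≤ T^(0.9992:ℝ) := one_le_rpow hT nnn
      rw [← hC']; nlinarith
  clear hcon
  set r : ℝ := 2^((0.9992:ℝ) - s) with hr
  have hr0 : 0 < r := by positivity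
  have hr1 : r < 1 := rpow_lt_one_of_one_lt_of_neg nnn (by linarith)
  refine summable_of_sum_le (c := C' * 2^(0.9992:ℝ) * (1 - r)⁻¹) (fun γ => Real.rpow_nonneg (by linarith [one_le_frob (γ:SL3Z)]) _) ?_
  intro u
  set κ : Γ → ℕ := fun γ => Nat.log 2 ⌊frobZ (γ:SL3Z)⌋₊ with hκ
  have hk : ∀ γ : Γ, I2^(κ γ) ≤ frobZ (γ:SL3Z) ∧ frobZ (γ:SL3Z) ≤ 2^(κ γ + 1) := by
    intro γ
    have h1 := one_le_frob (γ:SL3Z)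
    have hf : ⌊frobZ (γ:SL3Z)⌋₊ ≠ 0 := by
      have := (Nat.one_le_floor_iff _).mpr h1
      omega
    constructor
    · have := Nat.pow_log_le_self 2 hf
      exact (by exact_mod_cast this : I2^(κ γ) ≤ ⌊frobZ (γ:SL3Z)⌋₊).trans (floor_le (by linarith))
    · have := Nat.lt_pow_succ_log_self (b := 2) nnn ⌊frobZ (γ:SL3Z)⌋₊
      exact ((floor_lt (by linarith)).mp this).le.trans (by push_cast; exact le_rfl)
  have hfib : ∀ k, ∑ γ ∈ u.filter (fun γ => κ γ = k), frobZ (γ:SL3Z)^(-s) ≤ C' * 2^(0.9992:ℝ) * r^k := by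
    intro k
    have hcard : ((u.filter (fun γ => κ γ = k)).card:ℝ) ≤ C' * (I2^(k+1))^(0.9992:ℝ) := by
      have := hall (2^(k+1)) (one_le_pow₀ nnn) ((u.filter (fun γ => κ γ = k)).map (Function.Embedding.subtype _)) ?_
      · rwa [Finset.card_map] at this
      · intro γ hγ
        obtain ⟨x, hx, rfl⟩ := Finset.mem_map.mp hγ
        have h2 := (mem_filter.mp hx).2
        exact ⟨x.2, h2 ▸ (hk x).2⟩
    calc _ ≤ ∑ γ ∈ u.filter (fun γ => κ γ = k), (I2^k)^(-s) := by
          refine sum_le_sum fun γ hγ => ?_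
          rw [← (mem_filter.mp hγ).2]
          exact rpow_le_rpow_of_nonpos ppp (hk γ).1 (by linarith)
      _ = ((u.filter (fun γ => κ γ = k)).card:ℝ) * (I2^k)^(-s) := by rw [sum_const, nsmul_eq_mul]
      _ ≤ (C' * (I2^(k+1))^(0.9992:ℝ)) * (I2^k)^(-s) := by gcongr
      _ = _ := by
        have e1 : (I2^(k+1))^(0.9992:ℝ) = 2^(0.9992:ℝ) * (I2^k)^(0.9992:ℝ) := by
          rw [pow_succ, mul_rpow ppp nnn]; ring
        have e2 : r^k = (I2^k)^(0.9992:ℝ) * (I2^k)^(-s) := by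
          rw [← rpow_add ppp, hr, ← rpow_natCast, ← rpow_natCast, ← rpow_mul nnn, ← rpow_mul nnn]
          congr 1; ring
        rw [e1, e2]; ring
  rw [← sum_fiberwise_of_maps_to (s := u) (t := u.image κ) (g := κ) (fun γ hγ => mem_image_of_mem _ hγ)]
  refine (sum_le_sum fun k _ => hfib k).trans ?_
  rw [← mul_sum]
  refine mul_le_mul_of_nonneg_left ?_ ppp
  rw [← tsum_geometric_of_lt_one hr0.le hr1]
  exact (summable_geometric_of_lt_one hr0.le hr1).sum_le_tsum _ (fun _ _ => by positivity)

def clG (γ : SL3Z) : Matrix (Fin 3) (Fin 3) (ZMod 2) × Prop := (γ.1.map (Int.cast : ℤ → ZMod 2), 0 < γ.1 2 2)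

lemma presQ_mul_inv (g h : SL3Z) (hg : PreservesQ g) (hh : PreservesQ h) (hc : clG g = clG h) :
    (∀ i j, (2:ℤ) ∣ (g*h⁻¹).1 i j - (1 : Matrix (Fin 3) (Fin 3) ℤ) i j) ∧ 0 < (g*h⁻¹).1 2 2 := by
  obtain ⟨c1, c2⟩ := Prod.ext_iff.mp hc
  simp only [clG] at c1 c2
  constructor
  · intro i j
    have e : ((g*h⁻¹).1 - 1) = (g.1 - h.1) * (h⁻¹).1 := by
      rw [Matrix.sub_mul, ← Matrix.SpecialLinearGroup.coe_mul, ← Matrix.SpecialLinearGroup.coe_mul, mul_inv_cancel]; rfl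
    have : (g*h⁻¹).1 i j - (1 : Matrix (Fin 3) (Fin 3) ℤ) i j = ∑ k, (g.1 i k - h.1 i k) * (h⁻¹).1 k j := by
      have := congrFun (congrFun e i) j
      rw [Matrix.mul_apply] at this; exact this
    rw [this]
    refine dvd_sum fun k _ => Dvd.dvd.mul_right ?_ _
    have := congrFun (congrFun c1 i) k
    simp only [map_apply] at this
    exact (ZMod.intCast_eq_intCast_iff_dvd_sub _ _ 2).mp this.symm
  · have hr := presQ_eq h hh
    have hJ : JQ * JQ = 1 := by ext i j; fin_cases i <;> fin_cases j <;> simp [JQ, Matrix.mul_apply, Fin.sum_univ_three]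
    have hinv : (h⁻¹).1 = JQ * h.1ᵀ * JQ := by
      have h2 : h.1 * (JQ * h.1ᵀ * JQ) = 1 := by
        rw [← Matrix.mul_assoc, ← Matrix.mul_assoc, hr, hJ]
      calc (h⁻¹).1 = (h⁻¹).1 * (h.1 * (JQ * h.1ᵀ * JQ)) := by rw [h2, Matrix.mul_one]
        _ = ((h⁻¹).1 * h.1) * (JQ * h.1ᵀ * JQ) := (Matrix.mul_assoc _ _ _).symm
        _ = _ := by rw [← Matrix.SpecialLinearGroup.coe_mul, inv_mul_cancel]; simp
    have e : (g*h⁻¹).1 2 2 = g.1 2 2 * h.1 2 2 - (g.1 2 0 * h.1 2 0 + g.1 2 1 * h.1 2 1) := by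
      rw [Matrix.SpecialLinearGroup.coe_mul, hinv, ← Matrix.mul_assoc, ← Matrix.mul_assoc]
      have : (g.1 * JQ * h.1ᵀ * JQ) 2 2 = - (g.1 * JQ * h.1ᵀ) 2 2 := by
        generalize g.1 * JQ * h.1ᵀ = m
        simp [JQ, Matrix.mul_apply, Fin.sum_univ_three]
      rw [this, JQ_row]; ring
    rw [e]
    have rg : g.1 2 0 * g.1 2 0 + g.1 2 1 * g.1 2 1 - g.1 2 2 * g.1 2 2 = -1 := by
      rw [← JQ_row, presQ_eq g hg]; rfl
    have rh : h.1 2 0 * h.1 2 0 + h.1 2 1 * h.1 2 1 - h.1 2 2 * h.1 2 2 = -1 := by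
      rw [← JQ_row, hr]; rfl
    generalize g.1 2 0 = a at *
    generalize g.1 2 1 = b at *
    generalize g.1 2 2 = c at *
    generalize h.1 2 0 = a' at *
    generalize h.1 2 1 = b' at *
    generalize h.1 2 2 = c' at *
    have hpos : 0 < c * c' := by
      have hc0 : c ≠ 0 := by rintro rfl; nlinarith [mul_self_nonneg a, mul_self_nonneg b]
      have hc0' : c' ≠ 0 := by rintro rfl; nlinarith [mul_self_nonneg a', mul_self_nonneg b']
      by_cases h : 0 < c
      · exact mul_pos h (by rw [← c2]; exact h)
      · have : ¬ 0 < c' := by rw [← c2]; exact h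
        exact mul_pos_of_neg_of_neg ooo ooo
    have hsq : (a*a'+b*b')^2 < (c*c')^2 := by
      have e1 : (c*c')^2 = (1 + (a*a+b*b)) * (1+(a'*a'+b'*b')) := by
        have : c*c = 1 + (a*a+b*b) := by linarith
        have h2 : c'*c' = 1 + (a'*a'+b'*b') := by linarith
        rw [← this, ← h2]; ring
      rw [e1]; nlinarith [sq_nonneg (a*b'-b*a'), mul_self_nonneg a, mul_self_nonneg b, mul_self_nonneg a', mul_self_nonneg b']
    have := abs_lt_of_sq_lt_sq' hsq hpos.le
    linarith [this.2]


lemma lift_unique (γ γ' : Matrix (Fin 3) (Fin 3) ℤ) (h : ∀ a, vv a ᵥ* γ = vv a ᵥ* γ') : γ = γ' := by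
  have h1 := h ![1,0]
  have h2 := h ![0,1]
  have h3 := h ![1,1]
  ext i j
  have k1 := congrFun h1 j
  have k2 := congrFun h2 j
  have k3 := congrFun h3 j
  simp [vv, vecMul, dotProduct, Fin.sum_univ_three] at k1 k2 k3
  fin_cases i <;> simp <;> linarith

lemma exists_big_fiber {α β : Type*} [DecidableEq β] (u : Finset α) (t : Finset β) (f : α → β) (hf : ∀ a ∈ u, f a ∈ t) (hu : u.Nonempty) :
    ∃ c ∈ t, (u.card:ℝ) ≤ t.card * ((u.filter (fun a => f a = c)).card:ℝ) := by
  by_contra hcon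
  push Not at hcon
  have ht : t.Nonempty := ⟨_, hf _ hu.choose_spec⟩
  have h1 := card_eq_sum_card_fiberwise (s := u) (t := t) (f := f) (fun s hs => by exact_mod_cast hf s (by exact_mod_cast hs))
  have h2 : (t.card:ℝ) * u.card = ∑ c ∈ t, (t.card:ℝ) * ((u.filter (fun a => f a = c)).card:ℝ) := by
    rw [← mul_sum]; congr 1; exact_mod_cast h1
  have h3 : ∑ c ∈ t, (t.card:ℝ) * ((u.filter (fun a => f a = c)).card:ℝ) < ∑ c ∈ t, (u.card:ℝ) :=
    Finset.sum_lt_sum_of_nonempty ht hcon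
  rw [sum_const, nsmul_eq_mul] at h3
  linarith

lemma big_fiber_univ {β : Type*} [Fintype β] [Nonempty β] [DecidableEq β] : ∃ N : ℝ, 0 < N ∧ ∀ {α : Type} (u : Finset α) (f : α → β), u.Nonempty →
    ∃ c, (u.card:ℝ) ≤ N * ((u.filter (fun a => f a = c)).card:ℝ) := by
  refine ⟨(univ : Finset β).card, by exact_mod_cast card_pos.mpr Finset.univ_nonempty, ?_⟩
  intro α u f hu
  obtain ⟨c, _, h⟩ := exists_big_fiber u univ f (fun _ _ => mem_univ _) hu
  exact ⟨c, h⟩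

lemma bd_exists {β : Type*} [Finite β] (f : β → Fin 3 → Fin 3 → ℝ) : ∃ M0 : ℝ, 1 ≤ M0 ∧ ∀ c j, ∑ k, |f c k j| ≤ M0 := by
  obtain ⟨M, hM⟩ := (Set.finite_range (fun x : β × Fin 3 => ∑ k, |f x.1 k x.2|)).bddAbove
  exact ⟨max M 1, le_max_right _ _, fun c j => le_trans (hM ⟨(c, j), rfl⟩) (le_max_left _ _)⟩

set_option maxHeartbeats 600000 in
lemma gamma_to_M2 (Γ : Subgroup SL3Z) (hQ : ∀ γ ∈ Γ, PreservesQ γ) (h : (0.9992:ℝ) < critExp Γ) (C : ℝ) (hC : 0 < C) (Y00 : ℕ) :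
    ∃ Y : ℕ, Y00 ≤ Y ∧ 1 ≤ Y ∧ ∃ A : Finset M2, (∀ g ∈ A, g.det = 1 ∧ (∀ i j, |g i j| ≤ Y) ∧ InL Γ g) ∧ C * ↟Y^(1.9984:ℝ) ≤ A.card := by
  classical
  have hrep : ∀ c, ∃ r : SL3Z, r ∈ Γ ∧ ((∃ γ ∈ Γ, clG γ = c) → clG r = c) := by
    intro c
    by_cases hc : ∃ γ ∈ Γ, clG γ = c
    · obtain ⟨γ, h1, h2⟩ := hc
      exact ⟨γ, h1, fun _ => h2⟩
    · exact ⟨1, Γ.one_mem, fun h => absurd h hc⟩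
  choose rep hrΓ hrc using hrep
  obtain ⟨M0, hM1, hMc⟩ := bd_exists (fun c k j => (((rep c)⁻¹.1 k j : ℤ):ℝ))
  obtain ⟨N, hN0, hN⟩ := big_fiber_univ (β := Matrix (Fin 3) (Fin 3) (ZMod 2) × Prop)
  obtain ⟨T, hT0, hT1, u, hu, hcard⟩ := crit_count Γ h (C * N * (16*M0)^(0.9992:ℝ)) ppp (↟Y00^2)
  set X := T * M0 with hX
  have hX1 : 1 ≤ X := by rw [hX]; nlinarith
  set T' : ℤ := ⌈X⌉ with hT'
  have hT'X : X ≤ T' := Int.le_ceil _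
  have hT'2 : (T':ℝ) ≤ 2 * X := by linarith [Int.ceil_lt_add_one X]
  set Y := ⌈sqrt (2*T')⌉₊ with hY
  have hs0 : sqrt (2*T') ^2 = 2*T' := sq_sqrt (by linarith)
  have hYs : sqrt (2*T') ≤ Y := Nat.le_ceil _
  have hs1 : 1 ≤ sqrt (2*T') := by rw [Real.one_le_sqrt]; linarith
  have hY2 : ↟Y ≤ 2 * sqrt (2*T') := by
    have := Nat.ceil_lt_add_one (Real.sqrt_nonneg (2*(T':ℝ)))
    linarith
  have hY16 : ↟Y^2 ≤ 16 * M0 * T := by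
    calc ↟Y^2 ≤ (2 * sqrt (2*T'))^2 := pow_le_pow_left₀ ppp hY2 2
      _ = 8 * T' := by rw [mul_pow, hs0]; ring
      _ ≤ 16 * X := by linarith
      _ = _ := by rw [hX]; ring
  have hYY : Y00 ≤ Y := by
    have : ↟Y00^2 ≤ ↟Y^2 := by
      calc ↟Y00^2 ≤ T := hT0
        _ ≤ X := by rw [hX]; nlinarith
        _ ≤ 2 * T' := by linarith
        _ = sqrt (2*T')^2 := hs0.symm
        _ ≤ _ := pow_le_pow_left₀ ppp hYs 2
    exact_mod_cast (pow_le_pow_iff_left₀ ppp ppp nnn).mp this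
  have hYr1 : I1 ≤ Y := hs1.trans hYs
  refine ⟨Y, hYY, by exact_mod_cast hYr1, ?_⟩
  have hune : u.Nonempty := by
    rw [← card_pos]
    have : I0 < u.card := lt_of_le_of_lt ppp hcard
    exact_mod_cast this
  obtain ⟨c, hc⟩ := hN u clG hune
  have hlift : ∀ γ ∈ u.filter (fun a => clG a = c), ∃ g : M2, g.det = 1 ∧ (∀ i j, (g i j)^2 ≤ 2*T') ∧
      ∀ a, vv (a ᵥ* g) = vv a ᵥ* (γ * (rep c)⁻¹).1 := by
    intro γ hγ
    obtain ⟨hγu, hγc⟩ := mem_filter.mp hγ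
    have hγΓ := (hu γ hγu).1
    have hcl : clG γ = clG (rep c) := by rw [hγc, hrc c ⟨γ, hγΓ, hγc⟩]
    obtain ⟨k1, k2⟩ := presQ_mul_inv γ (rep c) (hQ _ hγΓ) (hQ _ (hrΓ c)) hcl
    refine lift_exists _ (hQ _ (Γ.mul_mem hγΓ (Γ.inv_mem (hrΓ c)))) k1 k2 T' ?_
    intro i j
    have : |(((γ * (rep c)⁻¹).1 i j : ℤ):ℝ)| ≤ X := by
      have e : (γ * (rep c)⁻¹).1 i j = ∑ k, γ.1 i k * (rep c)⁻¹.1 k j := by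
        rw [Matrix.SpecialLinearGroup.coe_mul, Matrix.mul_apply]
      rw [e]; push_cast
      refine (abs_sum_le_sum_abs _ _).trans ?_
      calc _ ≤ ∑ k, T * |(((rep c)⁻¹.1 k j : ℤ):ℝ)| := sum_le_sum fun k _ => by
            rw [abs_mul]
            exact mul_le_mul_of_nonneg_right ((entry_le_frob γ i k).trans (hu γ hγu).2) (abs_nonneg _)
        _ = T * ∑ k, |(((rep c)⁻¹.1 k j : ℤ):ℝ)| := by rw [mul_sum]
        _ ≤ X := mul_le_mul_of_nonneg_left (hMc c j) (by linarith)
    exact_mod_cast this.trans hT'X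
  choose! G hG1 hG2 hG3 using hlift
  refine ⟨(u.filter (fun a => clG a = c)).image G, ?_, ?_⟩
  · intro g hg
    obtain ⟨γ, hγ, rfl⟩ := mem_image.mp hg
    refine ⟨hG1 γ hγ, fun i j => ?_, γ * (rep c)⁻¹, Γ.mul_mem (hu γ (mem_filter.mp hγ).1).1 (Γ.inv_mem (hrΓ c)), hG3 γ hγ⟩
    have h1 : ((G γ i j : ℤ):ℝ)^2 ≤ 2 * T' := by exact_mod_cast hG2 γ hγ i j
    have h2 : |((G γ i j : ℤ):ℝ)| ≤ Y := (abs_le_sqrt h1).trans hYs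
    exact_mod_cast h2
  · rw [card_image_of_injOn]
    · have h1 : ↟Y^(1.9984:ℝ) ≤ (16*M0)^(0.9992:ℝ) * T^(0.9992:ℝ) := by
        rw [← mul_rpow ppp ppp]
        calc ↟Y^(1.9984:ℝ) = (↟Y^2)^(0.9992:ℝ) := by
              rw [← rpow_natCast, ← rpow_mul ppp]; norm_num
          _ ≤ _ := rpow_le_rpow ppp hY16 nnn
      have h2 : C * N * ↟Y^(1.9984:ℝ) ≤ N * ((u.filter (fun a => clG a = c)).card:ℝ) := by
        calc _ ≤ C * N * ((16*M0)^(0.9992:ℝ) * T^(0.9992:ℝ)) := mul_le_mul_of_nonneg_left h1 ppp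
          _ = C * N * (16*M0)^(0.9992:ℝ) * T^(0.9992:ℝ) := by ring
          _ ≤ _ := hcard.le.trans hc
      have h3 : N * (C * ↟Y^(1.9984:ℝ)) ≤ N * ((u.filter (fun a => clG a = c)).card:ℝ) := by linarith
      exact le_of_mul_le_mul_left h3 hN0
    · intro γ hγ γ' hγ' e
      have : (γ * (rep c)⁻¹).1 = (γ' * (rep c)⁻¹).1 := lift_unique _ _ fun a => by
        rw [← hG3 γ (by exact_mod_cast hγ), ← hG3 γ' (by exact_mod_cast hγ'), e]
      exact mul_right_cancel (Subtype.ext this)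


lemma farey (F : ℤ → ℤ → ℤ) (α β γ : ℤ) (hF : ∀ x y, F x y = α*x^2 + β*x*y + γ*y^2) (hnz : ∀ x y, F x y = 0 → x = 0 ∧ y = 0) :
    ∀ n p q : ℕ, p + q ≤ n → ∀ a b c d : ℤ, 0 ≤ a → 0 ≤ b → 0 ≤ c → 0 ≤ d → a*d-b*c = 1 → 0 < F a b → 0 < F c d →
      F (p*a+q*c) (p*b+q*d) < 0 → ∃ a' b' c' d' : ℤ, 0 ≤ a' ∧ 0 ≤ b' ∧ 0 ≤ c' ∧ 0 ≤ d' ∧ a'*d'-b'*c' = 1 ∧ F a' b' * F c' d' < 0 ∧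
        a' ≤ p*a+q*c ∧ b' ≤ p*b+q*d ∧ c' ≤ p*a+q*c ∧ d' ≤ p*b+q*d := by
  intro n
  induction n with
  | zero =>
    intro p q hpq a b c d _ _ _ _ _ h1 h2 h3
    have hp : p = 0 := by omega
    have hq : q = 0 := by omega
    subst hp; subst hq
    rw [hF] at h3; simp at h3
  | succ n ih =>
    intro p q hpq a b c d ha hb hc hd hdet h1 h2 h3
    rcases Nat.eq_zero_or_pos p with hp | hp
    · subst hp
      exfalso
      have : F ((0:ℕ)*a+q*c) ((0:ℕ)*b+q*d) = (q:ℤ)^2 * F c d := by rw [hF, hF]; push_cast; ring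
      rw [this] at h3
      nlinarith [sq_nonneg (q:ℤ)]
    rcases Nat.eq_zero_or_pos q with hq | hq
    · subst hq
      exfalso
      have : F (p*a+(0:ℕ)*c) (p*b+(0:ℕ)*d) = (p:ℤ)^2 * F a b := by rw [hF, hF]; push_cast; ring
      rw [this] at h3
      nlinarith [sq_nonneg (p:ℤ)]
    have hp1 : (1:ℤ) ≤ p := by exact_mod_cast hp
    have hq1 : (1:ℤ) ≤ q := by exact_mod_cast hq
    have pa : a ≤ p*a := le_mul_of_one_le_left ha hp1
    have pb : b ≤ p*b := le_mul_of_one_le_left hb hp1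
    have qc : c ≤ q*c := le_mul_of_one_le_left hc hq1
    have qd : d ≤ q*d := le_mul_of_one_le_left hd hq1
    rcases lt_trichotomy (F (a+c) (b+d)) 0 with h | h | h
    · exact ⟨a, b, a+c, b+d, ha, hb, by omega, by omega, by linarith, mul_neg_of_pos_of_neg h1 h, by omega, by omega, by omega, by omega⟩
    · obtain ⟨k1, k2⟩ := hnz _ _ h
      have : a = 0 := by omega
      have : c = 0 := by omega
      subst_vars; simp at hdet
    · rcases le_total q p with hqp | hqp
      · have := ih (p-q) q ooo a b (a+c) (b+d) ha hb ooo ooo (by linarith) h1 h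
        have e1 : ((p-q:ℕ):ℤ)*a + q*(a+c) = p*a+q*c := by push_cast [hqp]; ring
        have e2 : ((p-q:ℕ):ℤ)*b + q*(b+d) = p*b+q*d := by push_cast [hqp]; ring
        rw [e1, e2] at this
        exact this h3
      · have := ih p (q-p) ooo (a+c) (b+d) c d ooo ooo hc hd (by linarith) h h2
        have e1 : p*(a+c) + ((q-p:ℕ):ℤ)*c = p*a+q*c := by push_cast [hqp]; ring
        have e2 : p*(b+d) + ((q-p:ℕ):ℤ)*d = p*b+q*d := by push_cast [hqp]; ring
        rw [e1, e2] at this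
        exact this h3

lemma neg_pt_aux (α β γ : ℤ) (Y m : ℕ) (hm : 1 ≤ m) (h1 : 0 < α) (hβ : 0 < β) (hαY : α ≤ Y)
    (hd : (Y:ℤ)^2 < m^2*(β^2-4*α*γ)) (hb : β ≤ 2*α) : ∃ p : ℕ, p ≤ m+1 ∧ α*(p:ℤ)^2 - β*p*m + γ*(m:ℤ)^2 < 0 := by
  have hm' : (1:ℤ) ≤ m := by exact_mod_cast hm
  set P : ℤ := (m*β+α)/(2*α) with hP
  have e := mul_ediv_add_emod (m*β+α) (2*α)
  have r0 := emod_nonneg (m*β+α) (show 2*α ≠ 0 by omega)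
  have r1 := emod_lt_of_pos (m*β+α) (show 0 < 2*α by omega)
  rw [← hP] at e
  generalize (m*β+α) % (2*α) = r at *
  have hP0 : 0 ≤ P := ediv_nonneg ppp ooo
  have hP1 : P ≤ m := by
    by_contra hn; push Not at hn
    have a1 : m*β ≤ m*(2*α) := mul_le_mul_of_nonneg_left hb ppp
    have a2 : 2*α*(m+1) ≤ 2*α*P := mul_le_mul_of_nonneg_left ooo ooo
    nlinarith
  have hPn : ((P.toNat:ℕ):ℤ) = P := toNat_of_nonneg hP0
  refine ⟨P.toNat, by omega, ?_⟩
  rw [hPn]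
  have hs : (2*α*P - m*β)^2 ≤ α^2 := sq_le_sq' (by linarith) (by linarith)
  have hαY2 : α^2 ≤ (Y:ℤ)^2 := pow_le_pow_left₀ h1.le hαY 2
  have : 4*α*(α*P^2 - β*P*m + γ*(m:ℤ)^2) < 0 := by nlinarith
  by_contra hn; push Not at hn
  have := mul_nonneg (show 0 ≤ 4*α by omega) hn
  linarith

lemma neg_pt (α β γ : ℤ) (Y m : ℕ) (hm : 1 ≤ m) (h1 : 0 < α) (hβ : 0 < β) (h2 : 0 < γ) (hαY : α ≤ Y) (hγY : γ ≤ Y)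
    (hd : (Y:ℤ)^2 < m^2*(β^2-4*α*γ)) : ∃ p q : ℕ, p ≤ m+1 ∧ q ≤ m+1 ∧ α*(p:ℤ)^2 - β*p*q + γ*(q:ℤ)^2 < 0 := by
  by_cases h : α + γ < β
  · exact ⟨1, 1, by omega, by omega, by push_cast; linarith⟩
  rcases le_total γ α with hc | hc
  · obtain ⟨p, hp, hh⟩ := neg_pt_aux α β γ Y m hm h1 hβ hαY hd ooo
    exact ⟨p, m, hp, by omega, hh⟩
  · obtain ⟨p, hp, hh⟩ := neg_pt_aux γ β α Y m hm h2 hβ hγY (by linarith) ooo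
    exact ⟨m, p, by omega, hp, by linarith⟩

lemma form_nz (a b c d : ℤ) (hdet : a*d-b*c = 1) (htr : 3 ≤ |a+d|) (x y : ℤ) (h : c*x^2+(d-a)*x*y-b*y^2 = 0) : x = 0 ∧ y = 0 := by
  have htr2 : 9 ≤ (a+d)^2 := by rw [← sq_abs]; nlinarith
  by_cases hy : y = 0
  · subst hy
    refine ⟨?_, rfl⟩
    by_contra hx
    have hc : c = 0 := by
      have : c * x^2 = 0 := by linarith
      rcases mul_eq_zero.mp this with h | h
      · exact h
      · exact absurd (pow_eq_zero_iff nnn |>.mp h) hx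
    subst hc
    have : a * d = 1 := by linarith
    rcases Int.eq_one_or_neg_one_of_mul_eq_one' this with ⟨rfl, rfl⟩ | ⟨rfl, rfl⟩ <;> norm_num at htr2
  · exfalso
    have e : (2*c*x+(d-a)*y)^2 = ((a+d)^2-4)*y^2 := by linear_combination 4*c*h - 4*y^2*hdet
    have hdv : y ∣ 2*c*x+(d-a)*y := (Int.pow_dvd_pow_iff (by norm_num : (2:ℕ) ≠ 0)).mp (e ▸ Dvd.intro_left _ rfl)
    obtain ⟨t, ht⟩ := hdv
    rw [ht, mul_pow, mul_comm] at e
    have e2 : t^2 = (a+d)^2 - 4 := mul_right_cancel₀ (pow_ne_zero 2 hy) e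
    rw [← sq_abs t, ← sq_abs (a+d)] at e2
    have ht0 := abs_nonneg t
    generalize |t| = t' at *
    generalize |a+d| = s at *
    have h1 : t' < s := by nlinarith
    nlinarith

lemma conj_finish (g k ki : M2) (hg : g.det = 1) (h1 : k*ki = 1) (h2 : ki*k = 1) (M : ℤ) (hk : ∀ i j, |k i j| ≤ M) (hki : ∀ i j, |ki i j| ≤ M)
    (hp : 0 < (ki*g*k) 0 1 * (ki*g*k) 1 0) :
    ∃ k ki : M2, k*ki = 1 ∧ ki*k = 1 ∧ (∀ i j, |k i j| ≤ M) ∧ (∀ i j, |ki i j| ≤ M) ∧ ∃ s : ℤ, (s = 1 ∨ s = -1) ∧ ∀ i j, 0 < s * (ki*g*k) i j := by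
  set h := ki*g*k with hh
  have hdet : h.det = 1 := by
    have := congrArg Matrix.det h2
    rw [det_mul, det_one] at this
    rw [hh, det_mul, det_mul, hg]; linarith
  rw [det_fin_two] at hdet
  have had : 0 < h 0 0 * h 1 1 := by nlinarith
  rcases lt_or_gt_of_ne (show h 0 0 * h 0 1 ≠ 0 from mul_ne_zero (fun e => by simp [e] at had) (fun e => by simp [e] at hp)) with hs | hs
  · set D : M2 := !![1,0;0,-1] with hD
    have hDD : D * D = 1 := by ext i j; fin_cases i <;> fin_cases j <;> simp [hD]
    refine ⟨k*D, D*ki, ?_, ?_, ?_, ?_, ?_⟩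
    · rw [Matrix.mul_assoc, ← Matrix.mul_assoc D, hDD, Matrix.one_mul, h1]
    · rw [Matrix.mul_assoc, ← Matrix.mul_assoc ki, h2, Matrix.one_mul, hDD]
    · intro i j
      have := hk i j
      fin_cases j <;> simp [hD, Matrix.mul_apply, Fin.sum_univ_two] <;> simpa using this
    · intro i j
      have := hki i j
      fin_cases i <;> simp [hD, Matrix.mul_apply, Fin.sum_univ_two] <;> simpa using this
    · have e : D*ki*g*(k*D) = D*h*D := by rw [hh]; simp only [Matrix.mul_assoc]
      rw [e]
      have e00 : (D*h*D) 0 0 = h 0 0 := by simp [hD, Matrix.mul_apply, vecMul, dotProduct, Fin.sum_univ_two]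
      have e01 : (D*h*D) 0 1 = -h 0 1 := by simp [hD, Matrix.mul_apply, vecMul, dotProduct, Fin.sum_univ_two]
      have e10 : (D*h*D) 1 0 = -h 1 0 := by simp [hD, Matrix.mul_apply, vecMul, dotProduct, Fin.sum_univ_two]
      have e11 : (D*h*D) 1 1 = h 1 1 := by simp [hD, Matrix.mul_apply, vecMul, dotProduct, Fin.sum_univ_two]
      rcases lt_or_ge (h 0 0) 0 with hn | hn
      · refine ⟨-1, Or.inr rfl, ?_⟩
        have q1 : 0 < h 0 1 := by nlinarith
        have q2 : 0 < h 1 0 := by nlinarith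
        have q3 : h 1 1 < 0 := by nlinarith
        intro i j; fin_cases i <;> fin_cases j <;> simp only [Fin.zero_eta, Fin.mk_one, e00, e01, e10, e11] <;> linarith
      · have hn' : 0 < h 0 0 := lt_of_le_of_ne hn (fun e => by rw [← e] at had; simp at had)
        refine ⟨1, Or.inl rfl, ?_⟩
        have q1 : h 0 1 < 0 := by nlinarith
        have q2 : h 1 0 < 0 := by nlinarith
        have q3 : 0 < h 1 1 := by nlinarith
        intro i j; fin_cases i <;> fin_cases j <;> simp only [Fin.zero_eta, Fin.mk_one, e00, e01, e10, e11] <;> linarith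
  · refine ⟨k, ki, h1, h2, hk, hki, ?_⟩
    rw [← hh]
    rcases lt_or_ge (h 0 0) 0 with hn | hn
    · refine ⟨-1, Or.inr rfl, ?_⟩
      have q1 : h 0 1 < 0 := by nlinarith
      have q2 : h 1 0 < 0 := by nlinarith
      have q3 : h 1 1 < 0 := by nlinarith
      intro i j; fin_cases i <;> fin_cases j <;> simp only [Fin.zero_eta, Fin.mk_one] <;> linarith
    · have hn' : 0 < h 0 0 := lt_of_le_of_ne hn (fun e => by rw [← e] at had; simp at had)
      refine ⟨1, Or.inl rfl, ?_⟩
      have q1 : 0 < h 0 1 := by nlinarith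
      have q2 : 0 < h 1 0 := by nlinarith
      have q3 : 0 < h 1 1 := by nlinarith
      intro i j; fin_cases i <;> fin_cases j <;> simp only [Fin.zero_eta, Fin.mk_one] <;> linarith

lemma conj_pos (g : M2) (hg : g.det = 1) (Y m : ℕ) (hm : 1 ≤ m) (hY : ∀ i j, |g i j| ≤ Y) (htr : 3 ≤ |g 0 0 + g 1 1|)
    (hd : (Y:ℤ)^2 < m^2*((g 0 0 + g 1 1)^2-4)) :
    ∃ k ki : M2, k*ki = 1 ∧ ki*k = 1 ∧ (∀ i j, |k i j| ≤ m+1) ∧ (∀ i j, |ki i j| ≤ m+1) ∧ ∃ s : ℤ, (s = 1 ∨ s = -1) ∧ ∀ i j, 0 < s * (ki*g*k) i j := by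
  have hdet := hg
  rw [det_fin_two] at hdet
  have nz := form_nz (g 0 0) (g 0 1) (g 1 0) (g 1 1) hdet htr
  have key : ∀ x1 y1 x2 y2 e : ℤ, e^2 = 1 → x1*y2-y1*x2 = e → |x1| ≤ m+1 → |y1| ≤ m+1 → |x2| ≤ m+1 → |y2| ≤ m+1 →
      (g 1 0*x1^2+(g 1 1 - g 0 0)*x1*y1-g 0 1*y1^2) * (g 1 0*x2^2+(g 1 1 - g 0 0)*x2*y2-g 0 1*y2^2) < 0 →
      ∃ k ki : M2, k*ki = 1 ∧ ki*k = 1 ∧ (∀ i j, |k i j| ≤ m+1) ∧ (∀ i j, |ki i j| ≤ m+1) ∧ ∃ s : ℤ, (s = 1 ∨ s = -1) ∧ ∀ i j, 0 < s * (ki*g*k) i j := by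
    intro x1 y1 x2 y2 e he hde b1 b2 b3 b4 hneg
    have he' : |e| = 1 := by
      rcases sq_eq_one_iff_of_ne e he with h | h <;> rw [h] <;> norm_num
    refine conj_finish g !![x1,x2;y1,y2] !![e*y2,-(e*x2);-(e*y1),e*x1] hg ?_ ?_ (m+1) ?_ ?_ ?_
    · ext i j; fin_cases i <;> fin_cases j <;> simp <;> first | linear_combination e*hde + he | ring1
    · ext i j; fin_cases i <;> fin_cases j <;> simp <;> first | linear_combination e*hde + he | ring1
    · intro i j; fin_cases i <;> fin_cases j <;> simp <;> assumption
    · intro i j; fin_cases i <;> fin_cases j <;> simp [abs_mul, he'] <;> assumption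
    · have e1 : (!![e*y2,-(e*x2);-(e*y1),e*x1] * g * !![x1,x2;y1,y2]) 0 1 = -e*(g 1 0*x2^2+(g 1 1 - g 0 0)*x2*y2-g 0 1*y2^2) := by
        simp [Matrix.mul_apply, vecMul, dotProduct, Fin.sum_univ_two]; ring
      have e2 : (!![e*y2,-(e*x2);-(e*y1),e*x1] * g * !![x1,x2;y1,y2]) 1 0 = e*(g 1 0*x1^2+(g 1 1 - g 0 0)*x1*y1-g 0 1*y1^2) := by
        simp [Matrix.mul_apply, vecMul, dotProduct, Fin.sum_univ_two]; ring
      rw [e1, e2]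
      generalize (g 1 0*x1^2+(g 1 1 - g 0 0)*x1*y1-g 0 1*y1^2) = f1 at *
      generalize (g 1 0*x2^2+(g 1 1 - g 0 0)*x2*y2-g 0 1*y2^2) = f2 at *
      have : -e * f2 * (e * f1) = -(e^2 * (f1*f2)) := by ring
      rw [this, he]; linarith
  have hc0 : g 1 0 ≠ 0 := fun h => by have := (nz 1 0 (by rw [h]; ring)).1; norm_num at this
  have hb0 : g 0 1 ≠ 0 := fun h => by have := (nz 0 1 (by rw [h]; ring)).2; norm_num at this
  have hm0 : (0:ℤ) ≤ m := by positivity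
  rcases lt_or_gt_of_ne (mul_ne_zero hb0 hc0) with hbc | hbc
  swap
  · refine key 1 0 0 1 1 nnn nnn ?_ ?_ ?_ ?_ (by nlinarith) <;> simp <;> omega
  obtain ⟨σ, hσ, hσc⟩ : ∃ σ : ℤ, σ^2 = 1 ∧ 0 < σ * g 1 0 := by
    rcases lt_or_gt_of_ne hc0 with h | h
    · exact ⟨-1, by norm_num, by linarith⟩
    · exact ⟨1, by norm_num, by linarith⟩
  have hσb : 0 < -(σ * g 0 1) := by
    have : (σ * g 1 0) * (σ * g 0 1) < 0 := by
      have : (σ * g 1 0) * (σ * g 0 1) = σ^2 * (g 0 1 * g 1 0) := by ring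
      rw [this, hσ]; linarith
    nlinarith
  have hdpos : 0 < (g 0 0 + g 1 1)^2-4 := by rw [← sq_abs]; nlinarith
  have hβ0 : g 1 1 - g 0 0 ≠ 0 := fun h => by nlinarith
  obtain ⟨ε, hε, hεβ⟩ : ∃ ε : ℤ, ε^2 = 1 ∧ 0 < -(σ * ε * (g 1 1 - g 0 0)) := by
    have : σ * (g 1 1 - g 0 0) ≠ 0 := mul_ne_zero (fun h => by rw [h] at hσ; norm_num at hσ) hβ0
    rcases lt_or_gt_of_ne this with h | h
    · exact ⟨1, by norm_num, by linarith⟩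
    · exact ⟨-1, by norm_num, by linarith⟩
  have hσa : |σ| = 1 := by
    rcases sq_eq_one_iff_of_ne σ hσ with h | h <;> rw [h] <;> norm_num
  have hεa : |ε| = 1 := by
    rcases sq_eq_one_iff_of_ne ε hε with h | h <;> rw [h] <;> norm_num
  obtain ⟨p, q, hp, hq, hpq⟩ := neg_pt (σ * g 1 0) (-(σ * ε * (g 1 1 - g 0 0))) (-(σ * g 0 1)) Y m hm hσc hεβ hσb
    (by have := hY 1 0; refine (le_abs_self _).trans ?_; rw [abs_mul, hσa, one_mul]; exact this)
    (by have := hY 0 1; refine (le_abs_self _).trans ?_; rw [abs_neg, abs_mul, hσa, one_mul]; exact this)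
    (by
      have : (-(σ * ε * (g 1 1 - g 0 0)))^2 - 4 * (σ * g 1 0) * (-(σ * g 0 1)) = (g 0 0 + g 1 1)^2 - 4 := by
        have : (-(σ * ε * (g 1 1 - g 0 0)))^2 - 4 * (σ * g 1 0) * (-(σ * g 0 1)) = σ^2 * (ε^2 * (g 1 1 - g 0 0)^2 + 4 * (g 1 0 * g 0 1)) := by ring
        rw [this, hσ, hε]; linear_combination (-4)*hdet
      rw [this]; exact hd)
  obtain ⟨a', b', c', d', h1, h2, h3, h4, hdt, hneg, k1, k2, k3, k4⟩ :=
    farey (fun x y => σ * (g 1 0*x^2+(g 1 1 - g 0 0)*x*(ε*y)-g 0 1*(ε*y)^2)) (σ * g 1 0) (σ * ε * (g 1 1 - g 0 0)) (-(σ * g 0 1))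
      (fun x y => by beta_reduce; linear_combination (-(σ * g 0 1 * y^2)) * hε)
      (fun x y h => by
        have hσ0 : σ ≠ 0 := fun h => by rw [h] at hσ; norm_num at hσ
        have hε0 : ε ≠ 0 := fun h => by rw [h] at hε; norm_num at hε
        obtain ⟨r1, r2⟩ := nz x (ε*y) ((mul_eq_zero.mp h).resolve_left hσ0)
        exact ⟨r1, (mul_eq_zero.mp r2).resolve_left hε0⟩)
      (p+q) p q le_rfl 1 0 0 1 nnn nnn nnn nnn nnn
      (by beta_reduce; linarith) (by beta_reduce; rw [mul_one, hε]; linarith)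
      (by beta_reduce
          have : σ * (g 1 0 * (↑p * 1 + ↑q * 0) ^ 2 + (g 1 1 - g 0 0) * (↑p * 1 + ↑q * 0) * (ε * (↑p * 0 + ↑q * 1)) - g 0 1 * (ε * (↑p * 0 + ↑q * 1)) ^ 2)
            = (σ * g 1 0) * (p:ℤ)^2 - -(σ * ε * (g 1 1 - g 0 0)) * p * q + -(σ * g 0 1) * (q:ℤ)^2 := by
            linear_combination (-(σ * g 0 1 * q^2)) * hε
          rw [this]; exact hpq)
  have hp' : (p:ℤ) ≤ m+1 := by exact_mod_cast hp
  have hq' : (q:ℤ) ≤ m+1 := by exact_mod_cast hq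
  refine key a' (ε*b') c' (ε*d') ε hε (by linear_combination ε*hdt) ?_ ?_ ?_ ?_ ?_
  · rw [abs_of_nonneg h1]; linarith
  · rw [abs_mul, hεa, abs_of_nonneg h2]; linarith
  · rw [abs_of_nonneg h3]; linarith
  · rw [abs_mul, hεa, abs_of_nonneg h4]; linarith
  · beta_reduce at hneg
    generalize (g 1 0*a'^2+(g 1 1 - g 0 0)*a'*(ε*b')-g 0 1*(ε*b')^2) = f1 at *
    generalize (g 1 0*c'^2+(g 1 1 - g 0 0)*c'*(ε*d')-g 0 1*(ε*d')^2) = f2 at *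
    have : σ * f1 * (σ * f2) = σ^2 * (f1*f2) := by ring
    rw [this, hσ] at hneg; linarith


lemma lin_count (ε : ℝ) (hε : 0 < ε) : ∃ C : ℝ, 1 ≤ C ∧ ∀ (Y:ℕ) (h:M2), 1 ≤ Y → h ≠ 0 → (∀ i j, |h i j| ≤ Y) →
    ∀ (S : Finset M2) (K : Finset ℤ), (∀ g∈S, g.det=1 ∧ (∀ i j, |g i j| ≤ Y) ∧ h 0 0*g 0 0 + h 0 1*g 0 1 + h 1 0*g 1 0 + h 1 1*g 1 1 ∈ K) →
      (S.card:ℝ) ≤ K.card*(C*↟Y^(1+ε)) := by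
  obtain ⟨C, hC, H⟩ := hp_matrix ε hε
  refine ⟨C, hC, fun Y h hY h0 hh S K hS => ?_⟩
  have h1 := Finset.card_le_mul_card_image_of_maps_to (s := S) (t := K) (f := fun g => h 0 0*g 0 0 + h 0 1*g 0 1 + h 1 0*g 1 0 + h 1 1*g 1 1)
    (fun g hg => (hS g hg).2.2) ⌊C*↟Y^(1+ε)⌋₊ (fun b _ => le_floor (H Y h b hY h0 hh _ (fun g hg => by
      rw [mem_filter] at hg
      exact ⟨(hS g hg.1).1, (hS g hg.1).2.1, hg.2⟩)))
  have h2 : ((⌊C*↟Y^(1+ε)⌋₊:ℕ):ℝ) ≤ C*↟Y^(1+ε) := floor_le ppp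
  have h3 : (S.card:ℝ) ≤ ⌊C*↟Y^(1+ε)⌋₊ * K.card := by exact_mod_cast h1
  nlinarith [show I0 ≤ K.card from by positivity]

lemma code_extract (A : Finset M2) (Y2 K : ℕ) (hd : ∀ g∈A, g.det = 1) (hp : ∀ g∈A, ∀ i j, 0 < g i j) (hs : ∀ g∈A, sg g ≤ Y2)
    (hK : ∀ g∈A, g 0 0 < K * g 0 1 ∧ g 0 1 < K * g 0 0) (hA : A.Nonempty) :
    ∃ A3 ⊆ A, Code A3 Y2 ∧ (A.card:ℝ) ≤ 2*K*(Nat.log 2 Y2+1) * A3.card := by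
  obtain ⟨c, hc, hcard⟩ := exists_big_fiber A ((univ : Finset Bool) ×ˢ rgg K ×ˢ rgg (Nat.log 2 Y2+1))
    (fun g => (decide (g 0 1 ≤ g 0 0), (if g 0 1 ≤ g 0 0 then g 0 0/g 0 1 else g 0 1/g 0 0).toNat, Nat.log 2 (sg g).toNat))
    (fun g hg => by
      obtain ⟨k1, k2⟩ := hK g hg
      have p0 := hp g hg 0 0
      have p1 := hp g hg 0 1
      simp only [mem_product, mem_univ, mem_range, true_and]
      refine ⟨?_, Nat.lt_succ_of_le (log_mono_right (Int.toNat_le.mpr (hs g hg)))⟩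
      split_ifs
      · have := ediv_lt_of_lt_mul p1 k1; have := ediv_nonneg p0.le p1.le; omega
      · have := ediv_lt_of_lt_mul p0 k2; have := ediv_nonneg p1.le p0.le; omega) hA
  have sub := filter_subset (fun g => (decide (g 0 1 ≤ g 0 0), (if g 0 1 ≤ g 0 0 then g 0 0/g 0 1 else g 0 1/g 0 0).toNat, Nat.log 2 (sg g).toNat) = c) A
  refine ⟨_, sub, ⟨fun g hg => hd g (sub hg), fun g hg => hp g (sub hg), fun g hg => hs g (sub hg), ?_⟩, ?_⟩
  rotate_left
  · refine hcard.trans (le_of_eq ?_)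
    simp only [card_product, card_univ, Fintype.card_bool, card_range]
    push_cast; ring
  intro g hg g' hg' P hP hnn he
  rw [mem_filter] at hg hg'
  have hcl := hg.2.trans hg'.2.symm
  have q := fun i j => hp g hg.1 i j
  rw [det_fin_two] at hP
  have n00 := hnn 0 0; have n01 := hnn 0 1; have n10 := hnn 1 0; have n11 := hnn 1 1
  have E : ∀ i j, g' i j = g i 0 * P 0 j + g i 1 * P 1 j := fun i j => by rw [he, Matrix.mul_apply, Fin.sum_univ_two]
  simp only [Prod.mk.injEq, decide_eq_decide] at hcl
  obtain ⟨c1, c2, c3⟩ := hcl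
  have q00 := q 0 0; have q01 := q 0 1; have q10 := q 1 0; have q11 := q 1 1
  rcases n01.eq_or_lt with h01 | h01
  · have hps : P 0 0 * P 1 1 = 1 := by rw [← h01] at hP; linarith
    have p00 : P 0 0 = 1 := eq_one_of_mul_eq_one_right n00 hps
    have p11 : P 1 1 = 1 := by rw [p00] at hps; linarith
    rcases n10.eq_or_lt with h10 | h10
    · rw [he]; ext i j; rw [← he, E]; fin_cases j <;> simp [p00, p11, ← h01, ← h10]
    · exfalso
      have e0 : g' 0 0 = g 0 0 + g 0 1 * P 1 0 := by rw [E, p00]; ring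
      have e1 : g' 0 1 = g 0 1 := by rw [E, p11, ← h01]; ring
      have i1 : g' 0 1 ≤ g' 0 0 := by rw [e0, e1]; nlinarith
      rw [if_pos i1, if_pos (c1.mpr i1), e0, e1, add_mul_ediv_left _ _ q01.ne'] at c2
      have := ediv_nonneg q00.le q01.le
      omega
  · rcases n10.eq_or_lt with h10 | h10
    · have hps : P 0 0 * P 1 1 = 1 := by rw [← h10] at hP; linarith
      have p00 : P 0 0 = 1 := eq_one_of_mul_eq_one_right n00 hps
      have p11 : P 1 1 = 1 := by rw [p00] at hps; linarith
      exfalso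
      have e0 : g' 0 0 = g 0 0 := by rw [E, p00, ← h10]; ring
      have e1 : g' 0 1 = g 0 1 + g 0 0 * P 0 1 := by rw [E, p11]; ring
      have i1 : ¬ g' 0 1 ≤ g' 0 0 := by rw [e0, e1]; nlinarith
      rw [if_neg i1, if_neg (fun h => i1 (c1.mp h)), e0, e1, add_mul_ediv_left _ _ q00.ne'] at c2
      have := ediv_nonneg q01.le q00.le
      omega
    · exfalso
      have a1 : 0 < P 0 0 := n00.lt_of_ne (fun h => by rw [← h] at hP; nlinarith)
      have a2 : 0 < P 1 1 := n11.lt_of_ne (fun h => by rw [← h] at hP; nlinarith)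
      have s1 : 2 * sg g ≤ sg g' := by
        simp only [sg, E]; nlinarith
      have s2 : 0 < sg g := by simp only [sg]; linarith
      have s3 : Nat.log 2 ((sg g).toNat * 2) ≤ Nat.log 2 (sg g').toNat := log_mono_right ooo
      rw [Nat.log_mul_base nnn ooo] at s3
      omega


lemma conj_class (Γ : Subgroup SL3Z) (A : Finset M2) (Y m : ℕ) (hm : 1 ≤ m) (hne : A.Nonempty)
    (hA : ∀ g∈A, g.det = 1 ∧ (∀ i j, |g i j| ≤ Y) ∧ InL Γ g ∧ 3 ≤ |g 0 0 + g 1 1| ∧ (Y:ℤ)^2 < m^2*((g 0 0+g 1 1)^2-4)) :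
    ∃ κ κi : M2, κ*κi = 1 ∧ κi*κ = 1 ∧ ∃ A1 : Finset M2, (∀ g∈A1, g.det = 1 ∧ (∀ i j, 0 < g i j) ∧ (∀ i j, |g i j| ≤ 4*(m+1)^2*Y) ∧ InL Γ (κ*g*κi)) ∧
      (A.card:ℝ) ≤ 2*(2*m+3)^4*A1.card := by
  have : ∀ g∈A, ∃ k ki : M2, ∃ s : ℤ, k*ki=1 ∧ ki*k=1 ∧ (∀ i j,|k i j|≤ m+1) ∧ (∀ i j,|ki i j|≤ m+1) ∧ (s=1∨s=-1) ∧ ∀ i j, 0 < s*(ki*g*k) i j := fun g hg => by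
    obtain ⟨a1, a2, a3, a4, a5⟩ := hA g hg
    obtain ⟨k, ki, h1, h2, h3, h4, s, h5, h6⟩ := conj_pos g a1 Y m hm a2 a4 a5
    exact ⟨k, ki, s, h1, h2, h3, h4, h5, h6⟩
  choose! k ki s h1 h2 h3 h4 h5 h6 using this
  set I := Icc (-(m+1:ℤ)) (m+1) with hI
  obtain ⟨c, hc, hcard⟩ := exists_big_fiber A (I ×ˢ I ×ˢ I ×ˢ I ×ˢ ({1,-1} : Finset ℤ))
    (fun g => (k g 0 0, k g 0 1, k g 1 0, k g 1 1, s g)) (fun g hg => by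
      have := fun i j => abs_le.mp (h3 g hg i j)
      simp only [mem_product, hI, mem_Icc, Finset.mem_insert, mem_singleton]
      exact ⟨this 0 0, this 0 1, this 1 0, this 1 1, h5 g hg⟩) hne
  set B := A.filter (fun g => (k g 0 0, k g 0 1, k g 1 0, k g 1 1, s g) = c) with hB
  have hIc : (I.card:ℝ) = 2*m+3 := by
    rw [hI, card_Icc, show (m+1+1 - -(m+1:ℤ)).toNat = 2*m+3 by omega]; push_cast; ring
  have hBn : B.Nonempty := by
    rw [nonempty_iff_ne_empty]; intro h
    rw [h] at hcard
    have : 0 < A.card := hne.card_pos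
    have : I0 < A.card := by exact_mod_cast this
    simp at hcard; simp [hcard] at this
  obtain ⟨g0, hg0⟩ := hBn
  have hg0' := mem_filter.mp hg0
  have e1 : ∀ g∈B, k g = k g0 ∧ s g = s g0 := fun g hg => by
    have e := (mem_filter.mp hg).2.trans hg0'.2.symm
    simp only [Prod.mk.injEq] at e
    refine ⟨?_, e.2.2.2.2⟩
    ext i j; fin_cases i <;> fin_cases j
    exacts [e.1, e.2.1, e.2.2.1, e.2.2.2.1]
  have sub : ∀ g∈B, g∈A := fun g hg => (mem_filter.mp hg).1
  have e2 : ∀ g∈B, ki g = ki g0 := fun g hg => by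
    calc ki g = ki g * (k g0 * ki g0) := by rw [h1 g0 (sub _ hg0), mul_one]
      _ = ki g0 := by rw [← (e1 g hg).1, ← mul_assoc, h2 g (sub g hg), one_mul]
  have K1 := h1 g0 (sub _ hg0)
  have K2 := h2 g0 (sub _ hg0)
  have hs2 : s g0 * s g0 = 1 := by rcases h5 g0 (sub _ hg0) with h | h <;> rw [h] <;> norm_num
  have inv : ∀ g : M2, k g0 * (s g0 • (ki g0 * g * k g0)) * ki g0 = s g0 • g := fun g => by
    rw [Matrix.mul_smul, Matrix.smul_mul]; congr 1
    rw [show k g0 * (ki g0 * g * k g0) * ki g0 = (k g0 * ki g0) * g * (k g0 * ki g0) by simp only [mul_assoc], K1, one_mul, mul_one]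
  refine ⟨k g0, ki g0, K1, K2, B.image (fun g => s g0 • (ki g0 * g * k g0)), ?_, ?_⟩
  · intro g' hg'
    obtain ⟨g, hg, rfl⟩ := mem_image.mp hg'
    obtain ⟨a1, a2, a3, -⟩ := hA g (sub g hg)
    have p := h6 g (sub g hg)
    rw [(e1 g hg).1, (e1 g hg).2, e2 g hg] at p
    refine ⟨?_, p, ?_, ?_⟩
    · have := congrArg Matrix.det K1
      rw [det_mul, det_one] at this
      rw [Matrix.det_smul, det_mul, det_mul, a1, Fintype.card_fin, sq, hs2]; linarith
    · intro i j
      have q : ∀ i j, |(ki g0 * g) i j| ≤ 2*(m+1)*Y := fun i j => by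
        rw [Matrix.mul_apply, Fin.sum_univ_two]
        refine (abs_add_le _ _).trans ?_
        rw [abs_mul, abs_mul]
        have := mul_le_mul (h4 g0 (sub _ hg0) i 0) (a2 0 j) (abs_nonneg _) ppp
        have := mul_le_mul (h4 g0 (sub _ hg0) i 1) (a2 1 j) (abs_nonneg _) ppp
        linarith
      rw [Matrix.smul_apply, smul_eq_mul, abs_mul, show |s g0| = 1 by rcases h5 g0 (sub _ hg0) with h | h <;> rw [h] <;> norm_num, one_mul, Matrix.mul_apply, Fin.sum_univ_two]
      refine (abs_add_le _ _).trans ?_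
      rw [abs_mul, abs_mul]
      have := mul_le_mul (q i 0) (h3 g0 (sub _ hg0) 0 j) (abs_nonneg _) ppp
      have := mul_le_mul (q i 1) (h3 g0 (sub _ hg0) 1 j) (abs_nonneg _) ppp
      linarith
    · beta_reduce; rw [inv]
      rcases h5 g0 (sub _ hg0) with h | h <;> rw [h]
      · rwa [one_smul]
      · rw [neg_smul, one_smul]; exact a3.neg
  · rw [card_image_of_injOn]
    · refine hcard.trans (le_of_eq ?_)
      simp only [card_product]
      push_cast
      rw [hIc, show (({1,-1}:Finset ℤ).card:ℝ) = 2 by norm_num]; ring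
    · intro g hg g' hg' h
      beta_reduce at h
      have h' := inv g
      rw [h, inv] at h'
      have := congrArg (fun x => s g0 • x) h'
      simp only [smul_smul, hs2, one_smul] at this; exact this.symm

set_option maxHeartbeats 2000000 in
theorem partI (Γ : Subgroup SL3Z) (hQ : ∀ γ∈Γ, PreservesQ γ) (h : (0.9992:ℝ) < critExp Γ) (Y00 : ℕ) :
    ∃ Y0:ℕ, Y00 ≤ Y0 ∧ 2 ≤ Y0 ∧ ∃ κ κi : M2, κ*κi = 1 ∧ κi*κ = 1 ∧ ∃ A3 : Finset M2, Code A3 Y0 ∧ ↟Y0^(1.9705:ℝ) ≤ A3.card ∧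
      ∀ g∈A3, InL Γ (κ*g*κi) := by
  obtain ⟨C, hC, lin⟩ := lin_count 0.00001 nnn
  obtain ⟨Y1, hY1⟩ := Filter.eventually_atTop.mp (((tendsto_rpow_atTop (show I0 < 0.00001 by norm_num)).comp tendsto_natCast_atTop_atTop).eventually_ge_atTop (10^16*C))
  obtain ⟨Y, hYY, hY, A, hA, hAc⟩ := gamma_to_M2 Γ hQ h 1 one_pos (max Y00 Y1)
  have ha := hY1 Y ((le_max_right _ _).trans hYY)
  simp only [Function.comp] at ha
  rw [one_mul] at hAc
  set X : ℝ := ↟Y with hX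
  have hX1 : 1 ≤ X := by rw [hX]; exact_mod_cast hY
  have hX0 : 0 < X := by linarith
  have X1 : ∀ s : ℝ, 0 ≤ s → 1 ≤ X^s := fun s hs => one_le_rpow hX1 hs
  have Xa : ∀ r s t : ℝ, r + s = t → X^r*X^s = X^t := fun r s t e => by rw [← rpow_add hX0, e]
  have Xp : ∀ s t : ℝ, s + 0.00001 ≤ t → 10^16*C*X^s ≤ X^t := fun s t e => by
    rw [← Xa (t-s) s t (by ring)]
    exact mul_le_mul_of_nonneg_right (ha.trans (rpow_le_rpow_of_exponent_le hX1 (by linarith))) ppp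
  set W := X^(0.00162:ℝ) with hW
  have W1 : 1 ≤ W := X1 _ nnn
  set m := 2*⌈W⌉₊ with hm
  have m1 : 2*W ≤ m := by rw [hm]; push_cast; linarith [Nat.le_ceil W]
  have m2 : ↟m ≤ 4*W := by rw [hm]; push_cast; linarith [Nat.ceil_lt_add_one (show 0 ≤ W by linarith)]
  set T := ⌊X^(0.99838:ℝ)⌋₊ with hT
  have Tle : ↟T ≤ X^(0.99838:ℝ) := floor_le ppp
  have bad : ((A.filter (fun g => |g 0 0 + g 1 1| ≤ (T:ℤ))).card:ℝ) ≤ X^(1.9984:ℝ)/2 := by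
    refine (lin Y 1 hY one_ne_zero (fun i j => by
      have : (1:ℤ) ≤ Y := by exact_mod_cast hY
      fin_cases i <;> fin_cases j <;> simp <;> omega) _ (Icc (-T:ℤ) T) (fun g hg => ?_)).trans ?_
    · rw [mem_filter] at hg
      refine ⟨(hA g hg.1).1, (hA g hg.1).2.1, ?_⟩
      simpa using abs_le.mp hg.2
    · rw [card_Icc, show ((T:ℤ)+1 - -T).toNat = 2*T+1 by omega]
      push_cast
      have e1 := Xp 1.99839 1.9984 nnn
      have e2 := Xa 0.99838 (1+0.00001) 1.99839 nnn
      have e3 := X1 0.99838 nnn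
      have e4 : (2*↟T+1)*(C*X^(I1+0.00001)) ≤ (3*X^(0.99838:ℝ))*(C*X^(I1+0.00001)) := mul_le_mul_of_nonneg_right (by linarith) ppp
      have e5 : 0 ≤ C*X^(1.99839:ℝ) := by positivity
      rw [show (3*X^(0.99838:ℝ))*(C*X^(I1+0.00001)) = 3*(C*X^(1.99839:ℝ)) by rw [← e2]; ring] at e4
      linarith
  set G := A.filter (fun g => ¬ |g 0 0 + g 1 1| ≤ (T:ℤ)) with hG
  have Gc : X^(1.9984:ℝ)/2 ≤ G.card := by
    have := card_filter_add_card_filter_not (s := A) (fun g => |g 0 0 + g 1 1| ≤ (T:ℤ))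
    have : ((A.filter (fun g => |g 0 0 + g 1 1| ≤ (T:ℤ))).card:ℝ) + G.card = A.card := by exact_mod_cast this
    linarith
  have Gn : G.Nonempty := by
    rw [← card_pos]
    have : I0 < G.card := lt_of_lt_of_le ppp Gc
    exact_mod_cast this
  have X3 : 3 ≤ X^(0.99838:ℝ) := by
    have := Xp 0 0.99838 nnn
    rw [Real.rpow_zero] at this; linarith
  obtain ⟨κ, κi, K1, K2, A1, hA1, A1c⟩ := conj_class Γ G Y m (by
      have : I1 ≤ m := by linarith
      exact_mod_cast this) Gn (fun g hg => by
    rw [hG, mem_filter, not_le] at hg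
    obtain ⟨a1, a2, a3⟩ := hA g hg.1
    have t1 : X^(0.99838:ℝ) ≤ ((|g 0 0 + g 1 1| : ℤ):ℝ) := by
      have t2 : (T:ℤ) + 1 ≤ |g 0 0 + g 1 1| := hg.2
      have t3 : ↟T + 1 ≤ ((|g 0 0 + g 1 1| : ℤ):ℝ) := by exact_mod_cast t2
      exact (lt_floor_add_one _).le.trans t3
    refine ⟨a1, a2, a3, ?_, ?_⟩
    · have : ↟3 ≤ ((|g 0 0 + g 1 1| : ℤ):ℝ) := X3.trans t1
      exact_mod_cast this
    · rw [← sq_abs (g 0 0 + g 1 1)]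
      generalize |g 0 0 + g 1 1| = τ at t1
      suffices X^2 < ↟m^2*(↟τ^2-4) by rw [hX] at this; exact_mod_cast this
      have t4 : X = W * X^(0.99838:ℝ) := by rw [hW, Xa _ _ 1 nnn, rpow_one]
      have t5 : 3 ≤ ↟τ := X3.trans t1
      calc X^2 = W^2*(X^(0.99838:ℝ))^2 := by rw [t4, mul_pow, ← t4]
        _ ≤ W^2*↟τ^2 := by gcongr
        _ < (2*W)^2*(↟τ^2-4) := by
          have t6 : 0 < W^2 := by positivity
          have := mul_pos t6 (show 0 < 3*↟τ^2-16 by nlinarith)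
          linarith
        _ ≤ _ := by
          have : 0 ≤ ↟τ^2-4 := by nlinarith
          gcongr)
  have A1c' : X^(1.99192:ℝ) ≤ 60000*A1.card := by
    have e1 : (2*↟m+3)^4 ≤ (11*W)^4 := by gcongr; linarith
    have e2 : W^4 = X^(0.00648:ℝ) := by rw [hW, ← rpow_natCast, ← rpow_mul hX0.le]; norm_num
    have e3 := Xa 1.99192 0.00648 1.9984 nnn
    have e4 : I0 ≤ A1.card := by positivity
    have e5 : 0 < X^(0.00648:ℝ) := by positivity
    rw [mul_pow, e2] at e1
    have e6 := mul_le_mul_of_nonneg_right e1 e4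
    have e7 := mul_nonneg e5.le e4
    refine le_of_mul_le_mul_right ?_ e5
    rw [e3]; linarith
  set Y2 := 4*(m+1)^2*Y with hY2
  have Y2le : ↟Y2 ≤ 100*X^(1.00324:ℝ) := by
    have e2 : W^2*X = X^(1.00324:ℝ) := by rw [hW, ← rpow_natCast, ← rpow_mul hX0.le]; nth_rw 2 [← rpow_one X]; rw [Xa _ _ 1.00324 nnn]
    rw [← e2, hY2]; push_cast
    have : (↟m+1)^2 ≤ (5*W)^2 := by gcongr; linarith
    nlinarith
  have Y2Y : Y ≤ Y2 := by exact le_mul_of_pos_left _ ppp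
  have Y21 : I1 ≤ Y2 := hX1.trans (by rw [hX]; exact_mod_cast Y2Y)
  set K := ⌈X^(0.01475:ℝ)⌉₊ with hK
  have Kge : X^(0.01475:ℝ) ≤ K := Nat.le_ceil _
  have Kle : ↟K ≤ 2*X^(0.01475:ℝ) := by
    have := Nat.ceil_lt_add_one (show 0 ≤ X^(0.01475:ℝ) by positivity)
    rw [← hK] at this
    linarith [X1 0.01475 nnn]
  have K0 : 0 < K := by
    have : I0 < K := lt_of_lt_of_le ppp Kge
    exact_mod_cast this
  have Vle : ((Y2/K : ℕ):ℝ)*X^(0.01475:ℝ) ≤ Y2 := by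
    have : ((Y2/K : ℕ):ℝ)*K ≤ Y2 := by exact_mod_cast Nat.div_mul_le_self Y2 K
    exact (mul_le_mul_of_nonneg_left Kge ppp).trans this
  have bad2 : ∀ j : Fin 2, ((A1.filter (fun g => g 0 j ≤ ((Y2/K:ℕ):ℤ))).card:ℝ) ≤ X^(1.99192:ℝ)/1000000 := fun j => by
    refine (lin Y2 (Matrix.single 0 j 1) (hY.trans Y2Y) (fun e => by simpa using congrFun (congrFun e 0) j) (fun i' j' => by
      have : (1:ℤ) ≤ Y2 := by exact_mod_cast hY.trans Y2Y
      rw [single_apply]; split_ifs <;> simp; omega) _ (Icc 1 ((Y2/K:ℕ):ℤ)) (fun g hg => ?_)).trans ?_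
    · rw [mem_filter] at hg
      obtain ⟨a1, a2, a3, -⟩ := hA1 g hg.1
      refine ⟨a1, fun i j => (a3 i j).trans (by rw [hY2]; push_cast; exact le_rfl), ?_⟩
      have := a2 0 j
      have := hg.2
      fin_cases j <;> simp [single_apply] <;> constructor <;> assumption
    · rw [card_Icc, show (((Y2/K:ℕ):ℤ)+1 - 1).toNat = Y2/K by generalize Y2/K = z; omega]
      have e1 : ↟Y2^(I1+0.00001)*Y2 ≤ 1000000*X^(2.0065:ℝ) := by
        calc ↟Y2^(I1+0.00001)*Y2 = ↟Y2^(2.00001:ℝ) := by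
              nth_rw 2 [← rpow_one ↟Y2]; rw [← rpow_add (by linarith)]; norm_num
          _ ≤ (100*X^(1.00324:ℝ))^(2.00001:ℝ) := by gcongr
          _ = 100^(2.00001:ℝ)*X^(1.00324*2.00001:ℝ) := by rw [mul_rpow nnn ppp, ← rpow_mul hX0.le]
          _ ≤ 100^↟3*X^(2.0065:ℝ) := by
            gcongr <;> norm_num
          _ = _ := by norm_num
      have e2 := Xp 1.99175 1.99192 nnn
      have e3 := Xa 1.99175 0.01475 2.0065 nnn
      have e4 : 0 < X^(0.01475:ℝ) := by positivity
      refine le_of_mul_le_mul_right ?_ e4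
      calc ((Y2/K : ℕ):ℝ)*(C*↟Y2^(I1+0.00001))*X^(0.01475:ℝ) = (((Y2/K : ℕ):ℝ)*X^(0.01475:ℝ))*(C*↟Y2^(I1+0.00001)) := by ring
        _ ≤ Y2*(C*↟Y2^(I1+0.00001)) := by gcongr
        _ = C*(↟Y2^(I1+0.00001)*Y2) := by ring
        _ ≤ C*(1000000*X^(2.0065:ℝ)) := by gcongr
        _ = (1000000*C*X^(1.99175:ℝ))*X^(0.01475:ℝ) := by rw [← e3]; ring
        _ ≤ _ := by
          refine mul_le_mul_of_nonneg_right ?_ e4.le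
          have : 0 ≤ C*X^(1.99175:ℝ) := by positivity
          linarith
  set A2 := (A1.filter (fun g => ¬ g 0 0 ≤ ((Y2/K:ℕ):ℤ))).filter (fun g => ¬ g 0 1 ≤ ((Y2/K:ℕ):ℤ)) with hA2
  have A2c : X^(1.99192:ℝ)/100000 ≤ A2.card := by
    have c1 := card_filter_add_card_filter_not (s := A1) (fun g => g 0 0 ≤ ((Y2/K:ℕ):ℤ))
    have c2 := card_filter_add_card_filter_not (s := A1.filter (fun g => ¬ g 0 0 ≤ ((Y2/K:ℕ):ℤ))) (fun g => g 0 1 ≤ ((Y2/K:ℕ):ℤ))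
    have c3 : ((A1.filter (fun g => ¬ g 0 0 ≤ ((Y2/K:ℕ):ℤ))).filter (fun g => g 0 1 ≤ ((Y2/K:ℕ):ℤ))).card ≤ (A1.filter (fun g => g 0 1 ≤ ((Y2/K:ℕ):ℤ))).card :=
      card_le_card (Finset.filter_subset_filter _ (filter_subset _ _))
    have c4 : A1.card ≤ (A1.filter (fun g => g 0 0 ≤ ((Y2/K:ℕ):ℤ))).card + (A1.filter (fun g => g 0 1 ≤ ((Y2/K:ℕ):ℤ))).card + A2.card := by rw [hA2]; omega
    have c5 : (A1.card:ℝ) ≤ (A1.filter (fun g => g 0 0 ≤ ((Y2/K:ℕ):ℤ))).card + (A1.filter (fun g => g 0 1 ≤ ((Y2/K:ℕ):ℤ))).card + A2.card := by exact_mod_cast c4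
    have := bad2 0
    have := bad2 1
    have : 0 ≤ X^(1.99192:ℝ) := by positivity
    linarith
  have sub : ∀ g∈A2, g∈A1 ∧ ((Y2/K:ℕ):ℤ) < g 0 0 ∧ ((Y2/K:ℕ):ℤ) < g 0 1 := fun g hg => by
    simp only [hA2, mem_filter, not_le] at hg; exact ⟨hg.1.1, hg.1.2, hg.2⟩
  have ent : ∀ g∈A1, ∀ i j, g i j ≤ Y2 := fun g hg i j => by
    have := (le_abs_self _).trans ((hA1 g hg).2.2.1 i j)
    rw [hY2]; push_cast; exact this
  have KV : (Y2:ℤ) < K*((Y2/K:ℕ)+1) := by exact_mod_cast lt_mul_div_succ Y2 K0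
  obtain ⟨A3, hA3, code, A3c⟩ := code_extract A2 (4*Y2) K (fun g hg => (hA1 g (sub g hg).1).1) (fun g hg => (hA1 g (sub g hg).1).2.1)
    (fun g hg => by have := ent g (sub g hg).1; unfold sg; push_cast; linarith [this 0 0, this 0 1, this 1 0, this 1 1])
    (fun g hg => by
      obtain ⟨s1, s2, s3⟩ := sub g hg
      have := ent g s1
      have k0 : (0:ℤ) ≤ K := by positivity
      exact ⟨(this 0 0).trans_lt (KV.trans_le (mul_le_mul_of_nonneg_left s3 k0)), (this 0 1).trans_lt (KV.trans_le (mul_le_mul_of_nonneg_left s2 k0))⟩)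
    (by
      rw [← card_pos]
      have : I0 < A2.card := lt_of_lt_of_le ppp A2c
      exact_mod_cast this)
  have Y0le : ((4*Y2:ℕ):ℝ) ≤ 400*X^(1.00324:ℝ) := by push_cast; linarith
  refine ⟨4*Y2, by have := (le_max_left Y00 Y1).trans hYY; omega, by omega, κ, κi, K1, K2, A3, code, ?_, fun g hg => (hA1 g (sub g (hA3 hg)).1).2.2.2⟩
  have Lle : ((Nat.log 2 (4*Y2):ℕ):ℝ)+1 ≤ 40000*X^(0.0001:ℝ) := by
    have l1 : ((Nat.log 2 (4*Y2):ℕ):ℝ) ≤ logb 2 ((4*Y2:ℕ):ℝ) := by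
      have := Real.natLog_le_logb (4*Y2) 2
      exact_mod_cast this
    have l2 : lgg ((4*Y2:ℕ):ℝ) ≤ 2*lgg X := by
      rw [show 2*lgg X = lgg (X^I2) by rw [log_rpow hX0]]
      refine log_le_log (by push_cast; linarith) (Y0le.trans ?_)
      have := Xp 1.00324 2 nnn
      have : 0 < X^(1.00324:ℝ) := by positivity
      nlinarith
    have l3 := log_le_rpow_div hX0.le (show I0 < 0.0001 by norm_num)
    have l4 : logb 2 ((4*Y2:ℕ):ℝ) ≤ 3*lgg X := by
      rw [logb, div_le_iff₀ (log_pos nnn)]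
      have := log_two_gt_d9
      have := Real.log_nonneg hX1
      nlinarith
    have := X1 0.0001 nnn
    have l5 : X^(0.0001:ℝ)/0.0001 = 10000*X^(0.0001:ℝ) := by ring
    linarith
  have f1 : X^(1.97707:ℝ) ≤ 1.6e10*A3.card := by
    have e1 := Xa 1.97707 0.01485 1.99192 nnn
    have e2 := Xa 0.01475 0.0001 0.01485 nnn
    have e3 : (A2.card:ℝ) ≤ 2*(2*X^(0.01475:ℝ))*(40000*X^(0.0001:ℝ))*A3.card := A3c.trans (by gcongr)
    refine le_of_mul_le_mul_right ?_ (show 0 < X^(0.01485:ℝ) by positivity)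
    rw [e1]
    rw [show 2*(2*X^(0.01475:ℝ))*(40000*X^(0.0001:ℝ))*A3.card = 160000*(X^(0.01485:ℝ)*A3.card) by rw [← e2]; ring] at e3
    linarith
  calc ((4*Y2:ℕ):ℝ)^(1.9705:ℝ) ≤ (400*X^(1.00324:ℝ))^(1.9705:ℝ) := by gcongr
    _ = 400^(1.9705:ℝ)*X^(1.00324*1.9705:ℝ) := by rw [mul_rpow nnn ppp, ← rpow_mul hX0.le]
    _ ≤ 400^I2*X^(1.97689:ℝ) := by
      gcongr <;> norm_num
    _ ≤ _ := by
      have := Xp 1.97689 1.97707 nnn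
      have : 0 < X^(1.97689:ℝ) := by positivity
      have : 10^16*X^(1.97689:ℝ) ≤ 10^16*C*X^(1.97689:ℝ) := by nlinarith
      norm_num
      linarith


def zz (u : Fin 2 → ℤ) : ℤ := u 0^2 + u 1^2

lemma zz_cop {p : ℕ} (hp : p.Prime) {u : Fin 2 → ℤ} (hu : IsCoprime (u 0) (u 1)) (h : (p:ℤ) ∣ zz u) : IsCoprime ((p:ℤ)^2) (u 0) ∧ IsCoprime ((p:ℤ)^2) (u 1) := by
  have pp := prime_iff_prime_int.mp hp
  unfold zz at h
  have key : ∀ x y : ℤ, IsCoprime x y → (p:ℤ) ∣ x^2+y^2 → IsCoprime ((p:ℤ)^2) x := fun x y hxy hd => by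
    refine IsCoprime.pow_left ((Prime.coprime_iff_not_dvd pp).mpr fun hx => ?_)
    have hy : (p:ℤ) ∣ y := pp.dvd_of_dvd_pow ((Int.dvd_add_right (dvd_pow hx two_ne_zero)).mp hd)
    exact pp.not_isUnit (hxy.isUnit_of_dvd' hx hy)
  exact ⟨key _ _ hu h, key _ _ hu.symm (by rwa [add_comm])⟩

lemma sq_count {B : Finset M2} {Y : ℕ} (hB : Code B Y) (a : Fin 2 → ℤ) (ha : IsCoprime (a 0) (a 1)) (h0 : 0 < a 0) (h1 : 0 < a 1) (h2 : 2 ≤ a 0*a 1)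
    (k : ℕ) (hk : 1 ≤ k) (M : M2) (hM : IsUnit M.det) (p : ℕ) (hp : p.Prime) (hp4 : p%4=1) (c : ℕ) (hc : a 0 + a 1 = c) (hpY : p^2 ≤ Y^k) :
    (((Wd B k).filter (fun R => (p:ℤ)^2 ∣ zz (a ᵥ* (R*M)))).card:ℝ) ≤ 8*((c*Y^k:ℕ):ℝ)^2/↟p^2 := by
  classical
  set S := (Wd B k).filter (fun R => (p:ℤ)^2 ∣ zz (a ᵥ* (R*M))) with hS
  set S' := S.image (fun R => a ᵥ* R) with hS'
  have W := hB.wd_props k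
  have card : S'.card = S.card := card_image_of_injOn (fun R hR R' hR' e => by
    have w := W R (mem_filter.mp hR).1
    have w' := W R' (mem_filter.mp hR').1
    exact mult_one a ha h0 h1 h2 R R' w.1 w'.1 w.2.1 w'.2.1 e)
  have P : ∀ b∈S', (∀ i, 0 ≤ b i ∧ b i ≤ ((c*Y^k:ℕ):ℤ)) ∧ IsCoprime (b 0) (b 1) ∧ (p:ℤ)^2 ∣ zz (b ᵥ* M) := fun b hb => by
    obtain ⟨R, hR, rfl⟩ := mem_image.mp hb
    rw [hS, mem_filter] at hR
    have w := W R hR.1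
    refine ⟨fun i => ?_, coprime_vecMul a ha R (by rw [w.1]; exact isUnit_one), by rw [vecMul_vecMul]; exact hR.2⟩
    have := vec_bd a h0.le h1.le R w.2.1 (Y^k) (w.2.2.2 hk).2 i
    rw [hc] at this; exact_mod_cast this
  have cp : ∀ b∈S', IsCoprime ((p:ℤ)^2) ((b ᵥ* M) 0) ∧ IsCoprime ((p:ℤ)^2) ((b ᵥ* M) 1) := fun b hb =>
    zz_cop hp (coprime_vecMul b (P b hb).2.1 M hM) ((dvd_pow_self _ two_ne_zero).trans (P b hb).2.2)
  have cnt : ∀ b0∈S', ∀ T ⊆ S', (∀ b∈T, (p:ℤ)^2 ∣ wedge (b0 ᵥ* M) (b ᵥ* M)) → (T.card:ℝ) ≤ 4*((c*Y^k:ℕ):ℝ)^2/↟p^2 := fun b0 hb0 T hT hd => by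
    have c1 : 1 ≤ c := by omega
    have := count_parallel (p^2) (c*Y^k) (one_le_pow _ _ hp.pos) (hpY.trans (le_mul_of_pos_left _ c1)) b0 (P b0 hb0).2.1 T (fun b hb => ⟨(P b (hT hb)).1, by
      have := hd b hb
      rw [wedge_vecMul] at this
      push_cast
      exact (hM.dvd_mul_right).mp this⟩)
    push_cast at this ⊢; exact this
  have pp := prime_iff_prime_int.mp hp
  rw [← card]
  rcases S'.eq_empty_or_nonempty with he | ⟨b0, hb0⟩
  · rw [he]; simp; positivity
  set u := b0 ᵥ* M with hu
  have sp := card_filter_add_card_filter_not (s := S') (fun b => (p:ℤ)^2 ∣ wedge u (b ᵥ* M))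
  have c1 := cnt b0 hb0 (S'.filter (fun b => (p:ℤ)^2 ∣ wedge u (b ᵥ* M))) (filter_subset _ _) (fun b hb => (mem_filter.mp hb).2)
  have cross : ∀ b∈S', ¬ (p:ℤ)^2 ∣ wedge u (b ᵥ* M) → (p:ℤ)^2 ∣ u 0 * (b ᵥ* M) 1 + u 1 * (b ᵥ* M) 0 := fun b hb hn => by
    set v := b ᵥ* M with hv
    have d1 := (P b hb).2.2
    have d0 := (P b0 hb0).2.2
    rw [← hv] at d1
    rw [← hu] at d0
    have d : (p:ℤ)^2 ∣ wedge u v * (u 0 * v 1 + u 1 * v 0) := by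
      have e : wedge u v * (u 0 * v 1 + u 1 * v 0) = (v 1)^2 * zz u - (u 1)^2 * zz v := by unfold wedge zz; ring
      rw [e]; exact dvd_sub (d0.mul_left _) (d1.mul_left _)
    by_cases hq : (p:ℤ) ∣ wedge u v
    · refine absurd ((IsCoprime.pow_left ((Prime.coprime_iff_not_dvd pp).mpr fun hq' => ?_)).dvd_of_dvd_mul_right d) hn
      have e : (p:ℤ) ∣ 2 * (u 0 * v 1) := by
        have := dvd_add hq hq'
        have e : wedge u v + (u 0 * v 1 + u 1 * v 0) = 2 * (u 0 * v 1) := by unfold wedge; ring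
        rwa [e] at this
      have q1 : ¬ (p:ℤ) ∣ u 0 := fun h => pp.not_isUnit ((cp b0 hb0).1.isUnit_of_dvd' (dvd_pow_self _ two_ne_zero) h)
      have q2 : ¬ (p:ℤ) ∣ v 1 := fun h => pp.not_isUnit ((cp b hb).2.isUnit_of_dvd' (dvd_pow_self _ two_ne_zero) h)
      rcases pp.dvd_or_dvd e with h | h
      · have := Nat.le_of_dvd two_pos (natCast_dvd_natCast.mp (by exact_mod_cast h : ((p:ℕ):ℤ) ∣ ((2:ℕ):ℤ)))
        interval_cases p <;> omega
      · exact (pp.dvd_or_dvd h).elim q1 q2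
    · exact (IsCoprime.pow_left ((Prime.coprime_iff_not_dvd pp).mpr hq)).dvd_of_dvd_mul_left d
  have c2 : (((S'.filter (fun b => ¬ (p:ℤ)^2 ∣ wedge u (b ᵥ* M))).card:ℕ):ℝ) ≤ 4*((c*Y^k:ℕ):ℝ)^2/↟p^2 := by
    rcases (S'.filter (fun b => ¬ (p:ℤ)^2 ∣ wedge u (b ᵥ* M))).eq_empty_or_nonempty with he | ⟨b1, hb1⟩
    · rw [he]; simp; positivity
    rw [mem_filter] at hb1
    refine cnt b1 hb1.1 _ (filter_subset _ _) (fun b hb => ?_)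
    rw [mem_filter] at hb
    have x1 := cross b hb.1 hb.2
    have x2 := cross b1 hb1.1 hb1.2
    refine (cp b0 hb0).2.dvd_of_dvd_mul_left (?_ : _ ∣ u 1 * _)
    have e : u 1 * wedge (b1 ᵥ* M) (b ᵥ* M) = (u 0 * (b1 ᵥ* M) 1 + u 1 * (b1 ᵥ* M) 0) * (b ᵥ* M) 1 - (u 0 * (b ᵥ* M) 1 + u 1 * (b ᵥ* M) 0) * (b1 ᵥ* M) 1 := by
      unfold wedge; ring
    rw [e]; exact dvd_sub (x2.mul_right _) (x1.mul_right _)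
  have sp' : ((S'.filter (fun b => (p:ℤ)^2 ∣ wedge u (b ᵥ* M))).card:ℝ) + (S'.filter (fun b => ¬ (p:ℤ)^2 ∣ wedge u (b ᵥ* M))).card = S'.card := by exact_mod_cast sp
  rw [← sp']
  calc _ ≤ _ := add_le_add c1 c2
    _ = _ := by ring


lemma sq_frac {B : Finset M2} {Y : ℕ} (hB : Code B Y) (hY : 2 ≤ Y) (hc : (Y:ℝ)^(1.97:ℝ) ≤ B.card) (a : Fin 2 → ℤ) (ha : IsCoprime (a 0) (a 1)) (h0 : 0 < a 0) (h1 : 0 < a 1) (h2 : 2 ≤ a 0*a 1)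
    (F : Finset M2) (hFd : ∀ P∈F, P.det = 1) (G : M2) (hG : IsUnit G.det) :
    ∃ C:ℝ, 0 < C ∧ ∀ k p : ℕ, p.Prime → p%4=1 → p^2*Y ≤ Y^k →
      av (Wd B k ×ˢ F) (fun ω => open Classical in if (p:ℤ)^2 ∣ zz (a ᵥ* (ω.1*ω.2*G)) then 1 else 0) ≤ C*↟p^(-(1.94:ℝ)) := by
  classical
  obtain ⟨c, hc'⟩ : ∃ c:ℕ, a 0 + a 1 = c := ⟨(a 0+a 1).toNat, by omega⟩
  have cp : 0 < c := by omega
  have Y0 : I0 < Y := by positivity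
  refine ⟨8*↟c^2*↟Y^(0.03:ℝ), by positivity, fun k p hp hp4 hk => ?_⟩
  have p0 : I0 < p := by exact_mod_cast hp.pos
  obtain ⟨n, hn1, hn2⟩ := exists_nat_pow_near (one_le_pow 2 p hp.pos) (by omega : 1 < Y)
  set k1 := n+1 with hk1
  have b1 : Y^k1 ≤ p^2*Y := by rw [hk1, pow_succ]; exact Nat.mul_le_mul_right _ hn1
  obtain ⟨k2, rfl⟩ := exists_eq_add_of_le ((Nat.pow_le_pow_iff_right ooo).mp (b1.trans hk))
  have cB : I0 < B.card := lt_of_lt_of_le ppp hc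
  set X : ℝ := (B.card:ℝ)^k1 with hX
  have X0 : 0 < X := by positivity
  have X1 : (↟Y^k1)^(1.97:ℝ) ≤ X := by
    rw [hX, ← rpow_natCast, ← rpow_mul Y0.le, mul_comm, rpow_mul Y0.le, rpow_natCast]
    exact pow_le_pow_left₀ ppp hc _
  have S : ∑ ω ∈ Wd B (k1+k2) ×ˢ F, (if (p:ℤ)^2 ∣ zz (a ᵥ* (ω.1*ω.2*G)) then I1 else 0) ≤ (B.card:ℝ)^k2*F.card*(8*((c*Y^k1:ℕ):ℝ)^2/↟p^2) := by
    rw [sum_product, hB.wd_add k1 k2 (fun R => ∑ P∈F, (if (p:ℤ)^2 ∣ zz (a ᵥ* (R*P*G)) then I1 else 0)), sum_comm, ← hB.wd_card, mul_assoc, ← nsmul_eq_mul]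
    refine sum_le_card_nsmul _ _ _ fun R2 h2' => ?_
    rw [sum_comm, ← nsmul_eq_mul]
    refine sum_le_card_nsmul _ _ _ fun P hP => ?_
    have := sq_count hB a ha h0 h1 h2 k1 ooo (R2*P*G) (by rw [det_mul, det_mul, (hB.wd_props k2 R2 h2').1, hFd P hP]; simpa using hG) p hp hp4 c hc' hn2.le
    rw [← sum_boole] at this
    simpa only [mul_assoc] using this
  unfold av
  rw [card_product]
  push_cast
  rw [hB.wd_card, pow_add, ← hX]
  rcases F.eq_empty_or_nonempty with he | hF
  · rw [he]; simp; positivity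
  have F0 : I0 < F.card := by exact_mod_cast hF.card_pos
  have K0 : I0 < (B.card:ℝ)^k2 := by positivity
  rw [div_le_iff₀ ppp]
  refine S.trans ?_
  have b1' : ↟Y^k1 ≤ ↟p^2*Y := by exact_mod_cast b1
  set Z := ↟Y^k1 with hZ
  have Z0 : 0 < Z := by positivity
  have e1 : Z^2 ≤ X*(↟p^(0.06:ℝ)*↟Y^(0.03:ℝ)) := by
    calc Z^2 = Z^(1.97:ℝ)*Z^(0.03:ℝ) := by rw [← rpow_add Z0, ← rpow_natCast]; norm_num
      _ ≤ X*(↟p^2*Y)^(0.03:ℝ) := by gcongr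
      _ = _ := by rw [mul_rpow ppp Y0.le, ← rpow_natCast, ← rpow_mul p0.le]; norm_num
  have e2 : ↟p^(-(1.94:ℝ)) = ↟p^(0.06:ℝ)/↟p^2 := by
    rw [← rpow_natCast, ← Real.rpow_sub p0]; norm_num
  rw [e2]
  push_cast
  calc (B.card:ℝ)^k2*F.card*(8*(↟c*Z)^2/↟p^2) = ((B.card:ℝ)^k2*F.card*8*↟c^2/↟p^2)*Z^2 := by ring
    _ ≤ ((B.card:ℝ)^k2*F.card*8*↟c^2/↟p^2)*(X*(↟p^(0.06:ℝ)*↟Y^(0.03:ℝ))) := by gcongr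
    _ = _ := by ring

lemma sq_total : ∃ C:ℝ, 0 < C ∧ ∀ z b : ℝ, 1 ≤ z → 0 ≤ b → ∑ p ∈ PQ z b, (p:ℝ)^(-(1.94:ℝ)) ≤ C*z^(-(1/2:ℝ)) := by
  have hs : Summable (fun n:ℕ => ↟n^(-(1.44:ℝ))) := by rw [Real.summable_nat_rpow]; norm_num
  refine ⟨∑' n:ℕ, ↟n^(-(1.44:ℝ)) + 1, by have : 0 ≤ ∑' n:ℕ, ↟n^(-(1.44:ℝ)) := tsum_nonneg (fun n => by positivity); linarith, fun z b hz hb => ?_⟩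
  have : ∑ p ∈ PQ z b, ↟p^(-(1.94:ℝ)) ≤ ∑ p∈PQ z b, ↟p^(-(1.44:ℝ))*z^(-(1/2:ℝ)) := sum_le_sum fun p hp => by
    have h := (mem_PQ hb).mp hp
    have p0 : I0 < p := by linarith [h.2.2.1]
    rw [show -(1.94:ℝ) = -1.44 + -(1/2) by norm_num, rpow_add p0]
    refine mul_le_mul_of_nonneg_left (rpow_le_rpow_of_nonpos (by linarith) h.2.2.1.le nnn) ppp
  refine this.trans ?_
  rw [← sum_mul]
  refine mul_le_mul_of_nonneg_right ?_ ppp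
  linarith [hs.sum_le_tsum (PQ z b) (fun i _ => by positivity)]


lemma box_bd {B : Finset M2} {Y : ℕ} (hB : Code B Y) (a : Fin 2 → ℤ) (h0 : 0 < a 0) (h1 : 0 < a 1) (F : Finset M2) (G : M2) :
    ∃ N:ℕ, 0 < N ∧ ∀ k, 1 ≤ k → ∀ R ∈ Wd B k, ∀ P∈F, ∀ i, |(a ᵥ* (R*P*G)) i| ≤ ((N*Y^k:ℕ):ℤ) := by
  obtain ⟨c, hc⟩ : ∃ c:ℕ, a 0 + a 1 = c := ⟨(a 0+a 1).toNat, by omega⟩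
  set m := ∑ P∈F, ∑ i, ∑ j, ((P*G) i j).natAbs with hm
  refine ⟨c*m+c*m+1, by omega, fun k hk R hR P hP i => ?_⟩
  have w := hB.wd_props k R hR
  have b := vec_bd a h0.le h1.le R w.2.1 (Y^k) (w.2.2.2 hk).2
  have e : ∀ j, |(P*G) j i| ≤ m := fun j => by
    rw [Int.abs_eq_natAbs, hm]
    refine Int.ofNat_le.mpr (le_trans ?_ (single_le_sum (f := fun P => ∑ i, ∑ j, ((P*G) i j).natAbs) (fun _ _ => Nat.zero_le _) hP))
    exact le_trans (single_le_sum (f := fun l => ((P*G) j l).natAbs) (fun _ _ => Nat.zero_le _) (mem_univ i))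
      (single_le_sum (f := fun j => ∑ l, ((P*G) j l).natAbs) (fun _ _ => Nat.zero_le _) (mem_univ j))
  rw [hc] at b
  have t : ∀ j, |(a ᵥ* R) j * (P*G) j i| ≤ c*(Y:ℤ)^k*m := fun j => by
    rw [abs_mul, abs_of_nonneg (b j).1]
    exact mul_le_mul (b j).2 (e j) (abs_nonneg _) ppp
  rw [mul_assoc, ← vecMul_vecMul]
  have : (a ᵥ* R ᵥ* (P*G)) i = (a ᵥ* R) 0 * (P*G) 0 i + (a ᵥ* R) 1 * (P*G) 1 i := by
    rw [vecMul, dotProduct, Fin.sum_univ_two]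
  rw [this]
  refine (abs_add_le _ _).trans ((add_le_add (t 0) (t 1)).trans ?_)
  have : (0:ℤ) ≤ (Y:ℤ)^k := by positivity
  push_cast
  linarith

lemma poly_frac {B : Finset M2} {Y : ℕ} (hB : Code B Y) (hY : 2 ≤ Y) (hc : (Y:ℝ)^(1.97:ℝ) ≤ B.card) (a : Fin 2 → ℤ) (ha : IsCoprime (a 0) (a 1)) (h0 : 0 < a 0) (h1 : 0 < a 1) (h2 : 2 ≤ a 0*a 1)
    (F : Finset M2) (hFd : ∀ P∈F, P.det = 1) (G : M2) (hG : IsUnit G.det) (q : MvPolynomial (Fin 2) ℝ) (hq : q ≠ 0) :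
    ∃ C:ℝ, 0 < C ∧ ∀ k : ℕ, 1 ≤ k →
      av (Wd B k ×ˢ F) (fun ω => open Classical in if MvPolynomial.eval (fun i => ((a ᵥ* (ω.1*ω.2*G)) i:ℝ)) q = 0 then 1 else 0) ≤ C*(↟Y^k)^(-(0.97:ℝ)) := by
  classical
  obtain ⟨N, hN, hb⟩ := box_bd hB a h0 h1 F G
  refine ⟨(q.totalDegree+1)*(2*N+1), by positivity, fun k hk => ?_⟩
  have Y0 : I0 < Y := by positivity
  set L := N*Y^k with hL
  have cB : I0 < B.card := lt_of_lt_of_le ppp hc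
  set S : Finset ℝ := (Icc (-(L:ℤ)) L).image (fun x:ℤ => ↟x) with hS
  have Sc : S.card = 2*L+1 := by
    rw [hS, card_image_of_injective _ Int.cast_injective, card_Icc]; omega
  have sz := MvPolynomial.schwartz_zippel_totalDegree hq S
  rw [Sc, div_le_div_iff₀ ppp ppp] at sz
  have sz' : (((Fintype.piFinset fun _ : Fin 2 => S).filter (fun f => MvPolynomial.eval f q = 0)).card:ℝ) ≤ q.totalDegree*(2*L+1) := by
    have : ((Fintype.piFinset fun _ : Fin 2 => S).filter (fun f => MvPolynomial.eval f q = 0)).card*(2*L+1) ≤ q.totalDegree*(2*L+1)^2 := by exact_mod_cast sz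
    have := Nat.le_of_mul_le_mul_right (this.trans_eq (by ring : _ = (q.totalDegree*(2*L+1))*(2*L+1))) (by omega : 0 < 2*L+1)
    exact_mod_cast this
  have key : ∀ P∈F, ∑ R∈Wd B k, (if MvPolynomial.eval (fun i => ((a ᵥ* (R*P*G)) i:ℝ)) q = 0 then I1 else 0) ≤ q.totalDegree*(2*L+1) := fun P hP => by
    rw [sum_boole]
    refine le_trans ?_ sz'
    refine cast_le.mpr (card_le_card_of_injOn (fun R i => ((a ᵥ* (R*P*G)) i:ℝ)) (fun R hR => ?_) (fun R hR R' hR' e => ?_))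
    · rw [mem_coe, mem_filter] at hR
      rw [mem_coe, mem_filter, Fintype.mem_piFinset]
      refine ⟨fun i => mem_image.mpr ⟨_, mem_Icc.mpr (abs_le.mp (hb k hk R hR.1 P hP i)), rfl⟩, hR.2⟩
    · have w := hB.wd_props k R (mem_filter.mp hR).1
      have w' := hB.wd_props k R' (mem_filter.mp hR').1
      have e' : a ᵥ* R ᵥ* (P*G) = a ᵥ* R' ᵥ* (P*G) := by
        rw [vecMul_vecMul, vecMul_vecMul, ← mul_assoc, ← mul_assoc]
        funext i
        have := congrFun e i
        simp only at this
        exact_mod_cast this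
      exact mult_one a ha h0 h1 h2 R R' w.1 w'.1 w.2.1 w'.2.1 (Matrix.vecMul_injective_of_isUnit ((isUnit_iff_isUnit_det _).mpr (by rw [det_mul, hFd P hP, one_mul]; exact hG)) e')
  have S1 := sum_le_card_nsmul F _ _ key
  unfold av
  rw [sum_product, sum_comm, card_product]
  push_cast
  rw [hB.wd_card]
  rcases F.eq_empty_or_nonempty with he | hF
  · rw [he]; simp; positivity
  have F0 : I0 < F.card := by exact_mod_cast hF.card_pos
  rw [div_le_iff₀ ppp]
  refine S1.trans ?_
  rw [nsmul_eq_mul, hL]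
  push_cast
  have X1 : (↟Y^k)^(1.97:ℝ) ≤ (B.card:ℝ)^k := by
    rw [← rpow_natCast, ← rpow_mul Y0.le, mul_comm, rpow_mul Y0.le, rpow_natCast]
    exact pow_le_pow_left₀ ppp hc _
  have Z1 : I1 ≤ ↟Y^k := one_le_pow₀ (by exact_mod_cast (by omega : 1 ≤ Y))
  set Z := ↟Y^k with hZ
  have Z0 : 0 < Z := by positivity
  have e1 : Z ≤ Z^(-(0.97:ℝ))*(B.card:ℝ)^k := by
    calc Z = Z^(-(0.97:ℝ))*Z^(1.97:ℝ) := by rw [← rpow_add Z0]; norm_num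
      _ ≤ _ := by gcongr
  calc (F.card:ℝ)*(q.totalDegree*(2*(N*Z)+1)) ≤ F.card*((q.totalDegree+1)*((2*N+1)*Z)) := by
        gcongr
        · linarith
        · linarith
    _ ≤ F.card*((q.totalDegree+1)*((2*N+1)*(Z^(-(0.97:ℝ))*(B.card:ℝ)^k))) := by gcongr
    _ = _ := by ring

def polyVV (P : MvPolynomial (Fin 3) ℝ) : MvPolynomial (Fin 2) ℝ :=
  MvPolynomial.bind₁ ![MvPolynomial.X 0^2 - MvPolynomial.X 1^2, MvPolynomial.C 2 * MvPolynomial.X 0 * MvPolynomial.X 1, MvPolynomial.X 0^2 + MvPolynomial.X 1^2] P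

lemma polyVV_eval (P : MvPolynomial (Fin 3) ℝ) (b : Fin 2 → ℝ) :
    MvPolynomial.eval b (polyVV P) = MvPolynomial.eval ![b 0^2-b 1^2, 2*b 0*b 1, b 0^2+b 1^2] P := by
  unfold polyVV
  rw [← MvPolynomial.aeval_eq_eval, ← MvPolynomial.aeval_eq_eval]
  show MvPolynomial.aeval b _ = MvPolynomial.aeval _ P
  rw [MvPolynomial.aeval_bind₁]
  congr 2
  funext i
  fin_cases i <;> simp

lemma polyVV_zero (P : MvPolynomial (Fin 3) ℝ) (h : polyVV P = 0) (w : Fin 3 → ℝ) (hw : Qform w = 0) : MvPolynomial.eval w P = 0 := by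
  have pos : ∀ w : Fin 3 → ℝ, Qform w = 0 → 0 ≤ w 2 → MvPolynomial.eval w P = 0 := fun w hw h2 => by
    unfold Qform at hw
    have a0 : 0 ≤ (w 2+w 0)/2 := by nlinarith [sq_nonneg (w 1)]
    have b0 : 0 ≤ (w 2-w 0)/2 := by nlinarith [sq_nonneg (w 1)]
    have ea := sq_sqrt a0
    have eb := sq_sqrt b0
    set x := √((w 2+w 0)/2)
    set y := √((w 2-w 0)/2)
    have e : (2*x*y)^2 = (w 1)^2 := by
      calc _ = 4*x^2*y^2 := by ring
        _ = _ := by rw [ea, eb]; linarith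
    obtain ⟨s, hs, hs'⟩ : ∃ s:ℝ, s^2 = y^2 ∧ 2*x*s = w 1 := by
      rcases sq_eq_sq_iff_eq_or_eq_neg.mp e with h | h
      · exact ⟨y, rfl, h⟩
      · exact ⟨-y, by ring, by linarith⟩
    have := polyVV_eval P ![x, s]
    rw [h, map_zero] at this
    rw [this]
    congr 2
    funext i
    fin_cases i
    · simp; linarith
    · simp; linarith
    · simp; linarith
  rcases le_or_gt 0 (w 2) with h2 | h2
  · exact pos w hw h2
  set q : Polynomial ℝ := MvPolynomial.aeval (fun i => Polynomial.C (w i) * Polynomial.X) P with hq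
  have ev : ∀ s:ℝ, q.eval s = MvPolynomial.eval (fun i => w i * s) P := fun s => by
    rw [hq, ← Polynomial.coe_aeval_eq_eval, ← MvPolynomial.aeval_eq_eval]
    show ((Polynomial.aeval s).comp (MvPolynomial.aeval _)) P = MvPolynomial.aeval _ P
    rw [MvPolynomial.comp_aeval]
    congr 2
    funext i; simp
  have q0 : q = 0 := Polynomial.eq_zero_of_infinite_isRoot q ((Set.Iio_infinite I0).mono fun s hs => by
    show q.eval s = 0
    rw [ev]
    refine pos _ ?_ (mul_nonneg_of_nonpos_of_nonpos h2.le (Set.mem_Iio.mp hs).le)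
    unfold Qform at *
    linear_combination s^2*hw)
  have := ev 1
  rw [q0, Polynomial.eval_zero] at this
  simpa using this.symm


lemma len3 {p q r : ℕ → Prop} [DecidablePred p] [DecidablePred q] [DecidablePred r] (l : List ℕ) (h : ∀ x∈l, p x ∨ q x ∨ r x) {a b c : ℕ}
    (h1 : (l.filter p).length ≤ a) (h2 : (l.filter q).length ≤ b) (h3 : (l.filter r).length ≤ c) : l.length ≤ a+b+c := by
  induction l generalizing a b c with
  | nil => simp
  | cons x l ih =>
    have ih := @ih fun y hy => h y (List.mem_cons_of_mem _ hy)
    have hx := h x List.mem_cons_self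
    have := ih le_rfl le_rfl le_rfl
    simp only [List.filter_cons, List.length_cons, decide_eq_true_eq] at h1 h2 h3 ⊢
    split_ifs at h1 h2 h3 <;> (try simp only [List.length_cons] at h1 h2 h3) <;> first | omega | tauto

lemma list_prod_lb (l : List ℕ) (x : ℝ) (hx : 0 ≤ x) (h : ∀ p∈l, x ≤ p) : x^l.length ≤ (l.prod:ℕ) := by
  induction l with
  | nil => simp
  | cons p l ih =>
    rw [List.length_cons, List.prod_cons, pow_succ', Nat.cast_mul]
    exact mul_le_mul (h p List.mem_cons_self) (ih fun y hy => h y (List.mem_cons_of_mem _ hy)) ppp ppp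

lemma omega_bd (u : Fin 2 → ℤ) (hu : IsCoprime (u 0) (u 1)) (y : ℕ) (hy : 5 ≤ y) (hz : ((primorial y*primorial y:ℕ):ℤ) ∣ zz u - 5)
    (D : ℝ) (hD : 1 < D) (hs : ∀ p:ℕ, p.Prime → p%4=1 → y<p → ↟p ≤ D^(0.0225:ℝ) → ¬ (p:ℤ) ∣ zz u)
    (hf : open Classical in ((PQ (D^(0.0225:ℝ)) (D^(0.82:ℝ))).filter (fun p:ℕ => (p:ℤ) ∣ zz u)).card ≤ 4)
    (hq : ∀ p∈PQ (D^(0.0225:ℝ)) (D^(0.82:ℝ)), ¬ (p:ℤ)^2 ∣ zz u) (hb : (zz u:ℝ) < D^(8.2:ℝ)) : zz u ≠ 0 ∧ OmegaZ (zz u) ≤ 14 := by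
  classical
  have D0 : 0 < D := by linarith
  have nz : 0 ≤ zz u := by unfold zz; positivity
  have d5 : ((5:ℕ):ℤ)^2 ∣ zz u - 5 := by
    refine dvd_trans ?_ hz
    have := (Nat.Prime.dvd_primorial_iff prime_five).mpr hy
    rw [pow_two]; exact_mod_cast Nat.mul_dvd_mul this this
  have z0 : zz u ≠ 0 := fun h => by rw [h] at d5; norm_num at d5
  refine ⟨z0, ?_⟩
  unfold OmegaZ
  set z := (zz u).natAbs with hzz
  have ez : (z:ℤ) = zz u := by omega
  have z0' : z ≠ 0 := by omega
  have dv : ∀ p:ℕ, (p:ℤ) ∣ zz u ↔ p ∣ z := fun p => by rw [← ez, natCast_dvd_natCast]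
  have dv2 : ∀ p:ℕ, (p:ℤ)^2 ∣ zz u ↔ p^2 ∣ z := fun p => by rw [← ez]; exact_mod_cast natCast_dvd_natCast
  have isq : IsSquare (-1 : ZMod z) := ZMod.isSquare_neg_one_of_eq_sq_add_sq_of_isCoprime (show zz u = _ from rfl) hu
  set l := z.primeFactorsList with hl
  have cnt : ∀ p:ℕ, p.Prime → ¬ p^2 ∣ z → l.count p ≤ 1 := fun p hp h => by
    rw [hl, Nat.primeFactorsList_count_eq]
    by_contra hc
    exact h ((hp.pow_dvd_iff_le_factorization z0').mpr ooo)
  have cls : ∀ p∈l, p = 5 ∨ p∈PQ (D^(0.0225:ℝ)) (D^(0.82:ℝ)) ∨ D^(0.82:ℝ) ≤ p := fun p hp => by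
    rw [hl, Nat.mem_primeFactorsList z0'] at hp
    obtain ⟨pp, pd⟩ := hp
    by_cases h5 : p = 5
    · exact Or.inl h5
    right
    have py : y < p := by
      by_contra hpy
      have a1 : (p:ℤ) ∣ zz u - 5 := dvd_trans (natCast_dvd_natCast.mpr (((Nat.Prime.dvd_primorial_iff pp).mpr ooo).mul_right _)) hz
      have a2 := (dvd_sub_right ((dv p).mpr pd)).mp a1
      exact h5 ((Nat.prime_dvd_prime_iff_eq pp prime_five).mp (by exact_mod_cast a2))
    have p4 : p%4=1 := by
      have h3 := Nat.mod_four_ne_three_of_mem_primeFactors_of_isSquare_neg_one (Nat.mem_primeFactors.mpr ⟨pp, pd, z0'⟩) isq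
      rcases pp.eq_two_or_odd with h | h <;> omega
    rcases le_or_gt (D^(0.82:ℝ)) p with h | h
    · exact Or.inr h
    refine Or.inl ((mem_PQ ppp).mpr ⟨pp, p4, ?_, h.le⟩)
    by_contra hn
    exact hs p pp p4 py (not_lt.mp hn) ((dv p).mpr pd)
  have l1 : (l.filter (fun p => p = 5)).length ≤ 1 := by
    have : (l.filter (fun p => p = 5)).length = l.count 5 := by
      rw [List.count, List.countP_eq_length_filter]; congr 1
    rw [this]
    refine cnt 5 prime_five fun h => ?_
    have := dvd_sub ((dv2 5).mpr h) d5
    norm_num at this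
  have l2 : (l.filter (fun p => p∈PQ (D^(0.0225:ℝ)) (D^(0.82:ℝ)))).length ≤ 4 := by
    have nd : (l.filter (fun p => p∈PQ (D^(0.0225:ℝ)) (D^(0.82:ℝ)))).Nodup := by
      refine List.nodup_iff_count_le_one.mpr fun p => ?_
      by_cases hp : p∈PQ (D^(0.0225:ℝ)) (D^(0.82:ℝ))
      · rw [List.count_filter (by simpa using hp)]
        exact cnt p ((mem_PQ ppp).mp hp).1 fun h => hq p hp ((dv2 p).mpr h)
      · rw [List.count_eq_zero_of_not_mem (by simp [hp])]; omega
    rw [← List.toFinset_card_of_nodup nd]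
    refine le_trans (card_le_card fun p hp => ?_) hf
    simp only [List.mem_toFinset, List.mem_filter, decide_eq_true_eq] at hp
    exact mem_filter.mpr ⟨hp.2, (dv p).mpr (Nat.dvd_of_mem_primeFactorsList hp.1)⟩
  have l3 : (l.filter (fun p:ℕ => D^(0.82:ℝ) ≤ ↟p)).length ≤ 9 := by
    by_contra hc
    set l' := l.filter (fun p:ℕ => D^(0.82:ℝ) ≤ ↟p) with hl'
    have a1 := list_prod_lb l' (D^(0.82:ℝ)) ppp fun p hp => by simpa using (List.mem_filter.mp hp).2
    have a2 : l'.prod ≤ z := Nat.le_of_dvd ooo (by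
      conv_rhs => rw [← Nat.prod_primeFactorsList z0']
      exact List.Sublist.prod_dvd_prod List.filter_sublist)
    have a3 : D^(8.2:ℝ) ≤ (D^(0.82:ℝ))^l'.length := by
      rw [← rpow_natCast, ← rpow_mul D0.le]
      refine rpow_le_rpow_of_exponent_le hD.le ?_
      have : ↟10 ≤ l'.length := by exact_mod_cast not_le.mp hc
      linarith
    have a4 : ((l'.prod:ℕ):ℝ) ≤ zz u := by rw [← ez, Int.cast_natCast]; exact cast_le.mpr a2
    linarith
  exact len3 l cls l1 l2 l3


lemma mp1 (h : M2) (hp : ∀ i j, 0 < h i j) (hd : h.det = 1) (N : ℕ) : ∀ v : Fin 2 → ℤ, |v 0|+|v 1| ≤ N → ∃ n, 0 ≤ (v ᵥ* h^n) 0 * (v ᵥ* h^n) 1 := by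
  induction N with
  | zero => intro v hv; exact ⟨0, by
      have : v 0 = 0 := by have := abs_nonneg (v 0); have := abs_nonneg (v 1); push_cast at hv; exact abs_eq_zero.mp ooo
      simp [this]⟩
  | succ N ih =>
    intro v hv
    by_cases hn : 0 ≤ (v ᵥ* h) 0 * (v ᵥ* h) 1
    · exact ⟨1, by simpa using hn⟩
    by_cases hv0 : 0 ≤ v 0 * v 1
    · exact ⟨0, by simpa using hv0⟩
    obtain ⟨n, hn'⟩ := ih (v ᵥ* h) (by
      have e0 : (v ᵥ* h) 0 = v 0 * h 0 0 + v 1 * h 1 0 := by simp [vecMul, dotProduct, Fin.sum_univ_two]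
      have e1 : (v ᵥ* h) 1 = v 0 * h 0 1 + v 1 * h 1 1 := by simp [vecMul, dotProduct, Fin.sum_univ_two]
      set x := (v ᵥ* h) 0
      set y := (v ᵥ* h) 1
      rw [det_fin_two] at hd
      have f0 : v 0 = x * h 1 1 - y * h 1 0 := by rw [e0, e1]; linear_combination (-v 0)*hd
      have f1 : v 1 = y * h 0 0 - x * h 0 1 := by rw [e0, e1]; linear_combination (-v 1)*hd
      have a := hp 0 0
      have b := hp 0 1
      have c := hp 1 0
      have d := hp 1 1
      push_cast at hv
      have hv0' : v 1 ≠ 0 := fun h => hv0 (by simp [h])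
      have q1 : 1 ≤ |v 1| := one_le_abs hv0'
      push Not at hn
      rcases mul_neg_iff.mp hn with ⟨hx, hy⟩ | ⟨hx, hy⟩
      · rw [abs_of_pos hx, abs_of_neg hy]
        have : x - y ≤ v 0 := by nlinarith
        have := le_abs_self (v 0)
        omega
      · rw [abs_of_neg hx, abs_of_pos hy]
        have : y - x ≤ -v 0 := by nlinarith
        have := neg_le_abs (v 0)
        omega)
    exact ⟨n+1, by rw [pow_succ', ← vecMul_vecMul]; exact hn'⟩

lemma make_pos (h : M2) (hp : ∀ i j, 0 < h i j) (hd : h.det = 1) (v : Fin 2 → ℤ) (hv : IsCoprime (v 0) (v 1)) :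
    ∃ j0, ∀ n, j0 ≤ n → ∃ s : ℤ, (s = 1 ∨ s = -1) ∧ 2 ≤ (s • (v ᵥ* h^n)) 0 ∧ 2 ≤ (s • (v ᵥ* h^n)) 1 := by
  obtain ⟨n0, hn0⟩ := mp1 h hp hd (|v 0|+|v 1|).toNat v (by rw [toNat_of_nonneg ppp])
  have cpr := coprime_vecMul v hv (h^n0) (by rw [det_pow, hd, one_pow]; exact isUnit_one)
  set u := v ᵥ* h^n0 with hu
  obtain ⟨s, hs, s0, s1⟩ : ∃ s:ℤ, (s = 1 ∨ s = -1) ∧ 0 ≤ (s • u) 0 ∧ 0 ≤ (s • u) 1 := by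
    rcases mul_nonneg_iff.mp hn0 with ⟨x, y⟩ | ⟨x, y⟩
    · exact ⟨1, Or.inl rfl, by simpa using x, by simpa using y⟩
    · exact ⟨-1, Or.inr rfl, by simpa using x, by simpa using y⟩
  have ne : (s • u) 0 + (s • u) 1 ≠ 0 := fun h => by
    have z0 : u 0 = 0 := by rcases hs with rfl | rfl <;> simp at h s0 s1 ⊢ <;> omega
    have z1 : u 1 = 0 := by rcases hs with rfl | rfl <;> simp at h s0 s1 ⊢ <;> omega
    rw [z0, z1] at cpr; exact not_isUnit_zero (isCoprime_self.mp cpr)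
  have st : ∀ w : Fin 2 → ℤ, 0 ≤ w 0 → 0 ≤ w 1 → ∀ i, w 0 + w 1 ≤ (w ᵥ* h) i := fun w h0 h1 i => by
    have e0 : (w ᵥ* h) i = w 0 * h 0 i + w 1 * h 1 i := by simp [vecMul, dotProduct, Fin.sum_univ_two]
    have := hp 0 i
    have := hp 1 i
    rw [e0]; nlinarith
  have key : ∀ m, 2 ≤ ((s • u) ᵥ* h^(m+2)) 0 ∧ 2 ≤ ((s • u) ᵥ* h^(m+2)) 1 := fun m => by
    induction m with
    | zero =>
      have a := st _ s0 s1
      have a0 := a 0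
      have a1 := a 1
      have b := st ((s • u) ᵥ* h) ooo ooo
      have e : (s • u) ᵥ* h^(0+2) = (s • u) ᵥ* h ᵥ* h := by rw [zero_add, pow_two, vecMul_vecMul]
      rw [e]
      exact ⟨by linarith [b 0, (by omega : 1 ≤ (s • u) 0 + (s • u) 1)], by linarith [b 1, (by omega : 1 ≤ (s • u) 0 + (s • u) 1)]⟩
    | succ m ih =>
      rw [show m+1+2 = (m+2)+1 by ring, pow_succ, ← vecMul_vecMul]
      have b := st _ ooo (by omega : 0 ≤ ((s • u) ᵥ* h^(m+2)) 1)
      exact ⟨by linarith [b 0], by linarith [b 1]⟩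
  refine ⟨n0+2, fun n hn => ⟨s, hs, ?_⟩⟩
  obtain ⟨m, rfl⟩ := exists_eq_add_of_le hn
  have := key m
  rw [hu, smul_vecMul, vecMul_vecMul, ← pow_add, show n0+(m+2) = n0+2+m by ring] at this
  exact this

lemma unit_pow {M : Type*} [Monoid M] [Finite M] (x : M) (hx : IsUnit x) : ∃ t, 1 ≤ t ∧ x^t = 1 := by
  obtain ⟨u, rfl⟩ := hx
  exact ⟨orderOf u, orderOf_pos u, by rw [← Units.val_pow_eq_pow_val, pow_orderOf_eq_one, Units.val_one]⟩

lemma rd_pow (g : M2) (hg : g.det = 1) (N : ℕ) (hN : N ≠ 0) : ∃ t, 1 ≤ t ∧ (rdM g N)^t = 1 := by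
  have : NeZero N := ⟨hN⟩
  exact unit_pow _ (by rw [isUnit_iff_isUnit_det, rdM_det, hg]; simp)

lemma SW_inL {Γ : Subgroup SL3Z} {κ κi : M2} (h1 : κ*κi=1) (h2 : κi*κ=1) {A : Finset M2} (h : ∀ g∈A, InL Γ (κ*g*κi)) : ∀ g∈SW A, InL Γ (κ*g*κi) := by
  rintro g ⟨j, hj⟩
  induction j generalizing g with
  | zero => rw [Wd, mem_singleton] at hj; rw [hj, mul_one, h1]; exact InL.one
  | succ j ih =>
    rw [Wd, mem_image] at hj
    obtain ⟨⟨x, w⟩, hx, rfl⟩ := hj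
    rw [mem_product] at hx
    have := (h x hx.1).mul (ih w hx.2)
    rwa [show κ*x*κi*(κ*w*κi) = κ*(x*w)*κi by
      calc _ = κ*x*(κi*κ)*w*κi := by simp only [mul_assoc]
        _ = _ := by rw [h2, mul_one]; simp only [mul_assoc]] at this

lemma Wd_SW {A B : Finset M2} (h : ∀ g∈B, g∈SW A) (N : ℕ) (c) (hc : ∀ g∈B, rdM g N = c) (k : ℕ) : ∀ R∈Wd B k, R∈SW A ∧ rdM R N = c^k := by
  induction k with
  | zero => intro R hj; rw [Wd, mem_singleton] at hj; rw [hj, rdM_one, pow_zero]; exact ⟨SW_one, rfl⟩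
  | succ j ih =>
    intro R hj
    rw [Wd, mem_image] at hj
    obtain ⟨⟨x, w⟩, hx, rfl⟩ := hj
    rw [mem_product] at hx
    have := ih w hx.2
    exact ⟨SW_mul (h x hx.1) this.1, by simp only; rw [rdM_mul, hc x hx.1, this.2, pow_succ']⟩

lemma zz_five (M : M2) (N : ℕ) (h : rdM M N = 1) (s : ℤ) (hs : s = 1 ∨ s = -1) : (N:ℤ) ∣ zz (s • (![2,1] ᵥ* M)) - 5 := by
  rw [← rdM_one, eq_comm, rdM_eq_iff] at h
  have e : ∀ i j, ∃ e, M i j = (1:M2) i j + N*e := fun i j => by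
    obtain ⟨e, he⟩ := h i j
    exact ⟨e, by linarith⟩
  obtain ⟨e00, h00⟩ := e 0 0
  obtain ⟨e01, h01⟩ := e 0 1
  obtain ⟨e10, h10⟩ := e 1 0
  obtain ⟨e11, h11⟩ := e 1 1
  simp at h00 h01 h10 h11
  have : zz (s • (![2,1] ᵥ* M)) = (2*M 0 0 + M 1 0)^2 + (2*M 0 1+M 1 1)^2 := by
    rcases hs with rfl | rfl <;> simp [zz, vecMul, dotProduct, Fin.sum_univ_two] <;> ring
  rw [this, h00, h01, h10, h11]
  exact ⟨4*(2*e00+e10)+N*(2*e00+e10)^2+2*(2*e01+e11)+N*(2*e01+e11)^2, by ring⟩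


lemma make_B {A : Finset M2} {Y : ℕ} (hA : Code A Y) (hY : 2 ≤ Y) (hc : (Y:ℝ)^(1.9705:ℝ) ≤ A.card) (N : ℕ) (hN : N ≠ 0) :
    ∃ Y1:ℕ, 2 ≤ Y1 ∧ ∃ B : Finset M2, Code B Y1 ∧ ↟Y1^(1.97:ℝ) ≤ B.card ∧ ∃ t, 1 ≤ t ∧ ∀ k, t ∣ k → ∀ R∈Wd B k, R∈SW A ∧ rdM R N = 1 := by
  classical
  have : NeZero N := ⟨hN⟩
  obtain ⟨Nf, hNf, hfib⟩ := big_fiber_univ (β := Matrix (Fin 2) (Fin 2) (ZMod N))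
  have Y0 : I0 < Y := by positivity
  obtain ⟨m, hm⟩ := pow_unbounded_of_one_lt Nf (Real.one_lt_rpow (by exact_mod_cast hY : I1 < Y) (by norm_num : I0 < 0.0005))
  have m1 : (↟Y^(0.0005:ℝ))^m ≤ (↟Y^(0.0005:ℝ))^(m+1) := pow_le_pow_right₀ (one_le_rpow (by exact_mod_cast (by omega : 1 ≤ Y)) nnn) ooo
  have cA : I0 < A.card := lt_of_lt_of_le ppp hc
  have cW : I0 < (Wd A (m+1)).card := by rw [hA.wd_card]; positivity
  obtain ⟨c, hcc⟩ := hfib (Wd A (m+1)) (fun g => rdM g N) (card_pos.mp (by exact_mod_cast cW))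
  set B := (Wd A (m+1)).filter (fun g => rdM g N = c) with hB
  have hBs : B ⊆ Wd A (m+1) := filter_subset _ _
  have Bc : 0 < (B.card:ℝ) := by
    by_contra h
    nlinarith
  obtain ⟨g, hg⟩ := card_pos.mp (by exact_mod_cast Bc : 0 < B.card)
  obtain ⟨t, ht, ht'⟩ := rd_pow g (hA.wd_props _ g (hBs hg)).1 N hN
  rw [(mem_filter.mp hg).2] at ht'
  refine ⟨Y^(m+1), hY.trans (Nat.le_self_pow ooo Y), B, (hA.wd_code (m+1) ooo).mono hBs, ?_, t, ht, ?_⟩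
  · rw [hA.wd_card] at hcc
    have a1 := pow_le_pow_left₀ ppp hc (m+1)
    push_cast
    have e : (↟Y^(1.9705:ℝ))^(m+1) = ((↟Y^(m+1))^(1.97:ℝ))*(↟Y^(0.0005:ℝ))^(m+1) := by
      simp only [← rpow_natCast, ← rpow_mul Y0.le]
      rw [← rpow_add Y0]
      congr 1; ring
    rw [e] at a1
    set Z := (↟Y^(0.0005:ℝ))^(m+1)
    have Z0 : 0 < Z := by positivity
    have : (↟Y^(m+1))^(1.97:ℝ)*Z ≤ (B.card:ℝ)*Z := by nlinarith
    exact le_of_mul_le_mul_right this Z0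
  · rintro k ⟨j, rfl⟩ R hR
    have := Wd_SW (A := A) (fun g hg => ⟨m+1, hBs hg⟩) N c (fun g hg => (mem_filter.mp hg).2) _ R hR
    rwa [pow_mul, ht', one_pow] at this

lemma setup (Γ : Subgroup SL3Z) (hQ : ∀ γ ∈ Γ, PreservesQ γ) (h : (0.9992:ℝ) < critExp Γ) (y0 : ℕ) (q0 : ℝ) :
    ∃ y, y0 ≤ y ∧ 5 ≤ y ∧ ∃ Y:ℕ, 2 ≤ Y ∧ ∃ B, Code B Y ∧ ↟Y^(1.97:ℝ) ≤ B.card ∧ ∃ a : Fin 2 → ℤ, IsCoprime (a 0) (a 1) ∧ 0 < a 0 ∧ 0 < a 1 ∧ 2 ≤ a 0 * a 1 ∧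
    ∃ G : M2, IsUnit G.det ∧ ∃ F : Finset M2, F.Nonempty ∧ (∀ P∈F, P.det = 1) ∧ ∃ q1:ℕ, Y^100 ≤ q1 ∧ q0 ≤ q1 ∧
    (∀ (n : ℕ) (p : Fin n → ℕ) [hp : ∀ i, Fact (p i).Prime], Function.Injective p → 0 < n →
      (∀ i, y < p i ∧ p i ≤ q1) → ∀ f : VV p → ℝ, New p f → ∀ v, ∑ P ∈ F, f (actM p v P) = 0) ∧
    ∃ t, 1 ≤ t ∧ ∀ k, t ∣ k → ∀ R∈Wd B k, ∀ P∈F, vv (a ᵥ* (R*P*G)) ∈ orbit345 Γ ∧ ((primorial y*primorial y:ℕ):ℤ) ∣ zz (a ᵥ* (R*P*G)) - 5 := by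
  obtain ⟨q0', _, sp⟩ := small_primes
  obtain ⟨Y0, _, hY0, κ, κi, k1, k2, A, hA, hAc, hAL⟩ := partI Γ hQ h 2
  have hAc' : ↟Y0^(1.97:ℝ) ≤ A.card := (rpow_le_rpow_of_exponent_le (by exact_mod_cast (by omega : 1 ≤ Y0)) nnn).trans hAc
  obtain ⟨y, hy1, hy2, hy3, hy4⟩ : ∃ y:ℕ, y0 ≤ y ∧ 5 ≤ y ∧ Y0^100 ≤ y ∧ q0' ≤ y :=
    ⟨y0+5+Y0^100+⌈q0'⌉₊, by omega, by omega, by omega, (Nat.le_ceil _).trans (cast_le.mpr ooo)⟩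
  set N := primorial y*primorial y with hN
  have N0 : N ≠ 0 := Nat.mul_ne_zero (primorial_ne_zero _) (primorial_ne_zero _)
  obtain ⟨Y, hY, B, hB, hBc, t, ht, hRt⟩ := make_B hA hY0 hAc N N0
  obtain ⟨q1, hq1, hq2⟩ : ∃ q1:ℕ, Y^100 ≤ q1 ∧ q0 ≤ q1 := ⟨Y^100+⌈q0⌉₊, by omega, (Nat.le_ceil _).trans (cast_le.mpr ooo)⟩
  obtain ⟨F, hF, hFP, hFs⟩ := sp A Y0 hA hY0 hAc' y ooo hy3 hy4 q1
  have cA : I0 < A.card := lt_of_lt_of_le ppp hAc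
  obtain ⟨g, hg⟩ := card_pos.mp (by exact_mod_cast cA : 0 < A.card)
  have uκ : IsUnit κ.det := IsUnit.of_mul_eq_one κi.det (by rw [← det_mul, k1, det_one])
  have uκi : IsUnit κi.det := IsUnit.of_mul_eq_one κ.det (by rw [← det_mul, k2, det_one])
  have c0 : IsCoprime ((![2,1] ᵥ* κ) 0) ((![2,1] ᵥ* κ) 1) := coprime_vecMul _ (by simp [isCoprime_one_right]) κ uκ
  obtain ⟨j0, hj0⟩ := make_pos g (hA.pos g hg) (hA.det g hg) (![2,1] ᵥ* κ) c0
  obtain ⟨τ, hτ, hτ'⟩ := rd_pow g (hA.det g hg) N N0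
  obtain ⟨s, hs, s0, s1⟩ := hj0 (τ*j0) (le_mul_of_pos_left _ hτ)
  have hgSW : g^(τ*j0) ∈ SW A := SW_pow ⟨1, by simpa [Wd] using hg⟩ _
  have hgN : rdM (g^(τ*j0)) N = 1 := by rw [rdM_pow, pow_mul, hτ', one_pow]
  set H := g^(τ*j0) with hH
  set a := s • (![2,1] ᵥ* κ ᵥ* H) with ha
  have ac : IsCoprime (a 0) (a 1) := by
    have := coprime_vecMul _ c0 H (by rw [SW_det hA hgSW]; exact isUnit_one)
    rw [ha]
    rcases hs with rfl | rfl
    · simpa using this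
    · simpa using this.neg_neg
  refine ⟨y, hy1, hy2, Y, hY, B, hB, hBc, a, ac, by omega, by omega, by nlinarith, κi, uκi, F, hF, fun P hP => SW_det hA (hFP P hP).1, q1, hq1, hq2, hFs, t, ht, fun k hk R hR P hP => ?_⟩
  obtain ⟨r1, r2⟩ := hRt k hk R hR
  obtain ⟨p1, p2⟩ := hFP P hP
  have e : a ᵥ* (R*P*κi) = s • (![2,1] ᵥ* (κ*(H*R*P)*κi)) := by
    rw [ha, smul_vecMul]; simp only [vecMul_vecMul, mul_assoc]
  rw [e]
  constructor
  · obtain ⟨γ, hγ, hv⟩ := SW_inL k1 k2 hAL (H*R*P) (SW_mul (SW_mul hgSW r1) p1)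
    refine ⟨γ, hγ, ?_⟩
    have : vv (s • (![2,1] ᵥ* (κ*(H*R*P)*κi))) = vv (![2,1] ᵥ* (κ*(H*R*P)*κi)) := by
      rcases hs with rfl | rfl
      · rw [one_smul]
      · rw [neg_one_smul, vv_neg]
    rw [this, hv]
    congr 1
  · refine zz_five _ N ?_ s hs
    rw [rdM_mul, rdM_mul, rdM_mul, rdM_mul, hgN, r2, p2, one_mul, one_mul, mul_one, ← rdM_mul, k1, rdM_one]


lemma eF_eq {n : ℕ} (p : Fin n → ℕ) [hp : ∀ i, Fact (p i).Prime] (G : M2) (u : Fin 2 → ℤ) (hu : IsCoprime (u 0) (u 1)) :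
    eF p G (redV p u) = ∏ i, ((open Classical in if (p i:ℤ) ∣ zz (u ᵥ* G) then I1 else 0) - 2/((p i:ℝ)+1)) := by
  classical
  refine prod_congr rfl fun i _ => ?_
  rw [ep, if_neg (redV_ne_zero p u hu i)]
  congr 1
  have e := congrFun (redV_vecMul p u G) i
  rw [actM] at e
  rw [← e]
  have : (redV p (u ᵥ* G) i 0)^2 + (redV p (u ᵥ* G) i 1)^2 = ((zz (u ᵥ* G):ℤ):ZMod (p i)) := by simp [redV, zz]
  rw [this]
  simp only [ZMod.intCast_zmod_eq_zero_iff_dvd, ZMod.intCast_zmod_eq_zero_iff_dvd]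

lemma equidist {B : Finset M2} {Y : ℕ} (hB : Code B Y) (hB0 : 0 < B.card) (hY : 2 ≤ Y) (a : Fin 2 → ℤ) (ha : IsCoprime (a 0) (a 1)) (F : Finset M2) (hF : F.Nonempty) (hFd : ∀ P∈F, P.det = 1) (G : M2) (hG : IsUnit G.det)
    (q0 C : ℝ) (hC : 0 < C) (he : ∀ (n : ℕ) (p : Fin n → ℕ) [hp : ∀ i, Fact (p i).Prime],
    Function.Injective p → (∀ i, p i % 4 = 1) → q0 ≤ ((∏ i, p i : ℕ):ℝ) → Y^100 ≤ ∏ i, p i →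
    ∀ k : ℕ, (∏ i, p i)^4 ≤ Y^k →
    |∑ R ∈ Wd B k, ∑ P ∈ F, eF p G (redV p (a ᵥ* (R * P)))| ≤
      (B.card:ℝ)^k * F.card * (C * ((∏ i, p i : ℕ):ℝ)^(-I1) * (↟Y^k)^(-(0.005:ℝ))))
    (q1 y : ℕ) (h1 : Y^100 ≤ q1) (h2 : q0 ≤ q1) (hs : ∀ (n : ℕ) (p : Fin n → ℕ) [hp : ∀ i, Fact (p i).Prime], Function.Injective p → 0 < n →
      (∀ i, y < p i ∧ p i ≤ q1) → ∀ f : VV p → ℝ, New p f → ∀ v, ∑ P ∈ F, f (actM p v P) = 0)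
    (k : ℕ) (D : ℝ) (hD : 0 < D) (hDk : D^4 = ↟Y^k) (T : Finset ℕ) (hT : T.Nonempty) (hTp : ∀ p∈T, p.Prime ∧ p%4=1 ∧ y<p) (hTD : ((∏ p∈T, p:ℕ):ℝ) ≤ D) :
    |av (Wd B k ×ˢ F) (fun ω => ∏ p∈T, ((open Classical in if (p:ℤ) ∣ zz (a ᵥ* (ω.1*ω.2*G)) then I1 else 0) - 2/(↟p+1)))| ≤ (C*D^(-(0.02:ℝ)))*((∏ p∈T, p:ℕ):ℝ)⁻¹ := by
  classical
  set p : Fin T.card → ℕ := fun i => (T.equivFin.symm i : ℕ) with hp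
  have pm : ∀ i, p i ∈ T := fun i => (T.equivFin.symm i).2
  haveI : ∀ i, Fact (p i).Prime := fun i => ⟨(hTp _ (pm i)).1⟩
  have inj : Function.Injective p := Subtype.val_injective.comp T.equivFin.symm.injective
  have tr : ∀ {M : Type} [CommMonoid M] (f : ℕ → M), ∏ q∈T, f q = ∏ i, f (p i) := fun f => by
    rw [← Finset.prod_coe_sort, ← Equiv.prod_comp T.equivFin.symm]
  have S : ∑ ω∈Wd B k ×ˢ F, ∏ p∈T, ((if (p:ℤ) ∣ zz (a ᵥ* (ω.1*ω.2*G)) then I1 else 0) - 2/(↟p+1)) = ∑ R ∈ Wd B k, ∑ P ∈ F, eF p G (redV p (a ᵥ* (R * P))) := by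
    rw [sum_product]
    refine sum_congr rfl fun R hR => sum_congr rfl fun P hP => ?_
    rw [eF_eq p G _ (coprime_vecMul a ha _ (by rw [det_mul, (hB.wd_props k R hR).1, hFd P hP]; simp)), tr, vecMul_vecMul]
  set X := ∏ p∈T, p with hX
  have eX : ∏ i, p i = X := (tr (fun q => q)).symm
  unfold av
  rw [S, card_product]
  push_cast
  rw [hB.wd_card, abs_div, abs_of_nonneg (by positivity : I0 ≤ (B.card:ℝ)^k*F.card)]
  have F0 : I0 < F.card := by exact_mod_cast hF.card_pos
  have B0 : I0 < B.card := by exact_mod_cast hB0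
  rw [div_le_iff₀ ppp]
  rcases le_or_gt q1 X with h | h
  · have := he _ p inj (fun i => (hTp _ (pm i)).2.1) (by rw [eX]; exact h2.trans (by exact_mod_cast h)) (by rw [eX]; exact h1.trans h) k (by
      rw [eX]
      have : ↟X^4 ≤ ↟Y^k := by rw [← hDk]; exact pow_le_pow_left₀ ppp hTD 4
      exact_mod_cast this)
    refine this.trans (le_of_eq ?_)
    have e : (D^4)^(-(0.005:ℝ)) = D^(-(0.02:ℝ)) := by rw [← rpow_natCast, ← rpow_mul hD.le]; norm_num
    rw [eX, ← hDk, e, Real.rpow_neg_one]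
    ring
  · have z : ∑ R ∈ Wd B k, ∑ P ∈ F, eF p G (redV p (a ᵥ* (R * P))) = 0 := sum_eq_zero fun R _ => by
      have := hs _ p inj hT.card_pos (fun i => ⟨(hTp _ (pm i)).2.2, ?_⟩) (eF p G) (eF_new p (fun i => (hTp _ (pm i)).2.1) G hG) (redV p (a ᵥ* R))
      · rw [← this]
        refine sum_congr rfl fun P _ => ?_
        rw [← redV_vecMul, vecMul_vecMul]
      · exact (Nat.le_of_dvd (prod_pos fun q hq => (hTp q hq).1.pos) (dvd_prod_of_mem (fun q => q) (pm i))).trans h.le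
    rw [z, abs_zero]
    positivity

lemma large_D (D0 Y N C1 C2 C3 : ℝ) : ∃ D1, ∀ D:ℝ, D1 ≤ D → D0 ≤ D ∧ 1 < D ∧ Y ≤ D ∧ 2*N^2 < D^(0.2:ℝ) ∧ (C1*C2+C3) < D^(0.005:ℝ) := by
  refine Filter.eventually_atTop.mp ?_
  filter_upwards [Filter.eventually_ge_atTop D0, Filter.eventually_gt_atTop 1, Filter.eventually_ge_atTop Y,
    (tendsto_rpow_atTop (by norm_num : I0 < 0.2)).eventually_gt_atTop (2*N^2), (tendsto_rpow_atTop (by norm_num : I0 < 0.005)).eventually_gt_atTop (C1*C2+C3)] with D h1 h2 h3 h4 h5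
  exact ⟨h1, h2, h3, h4, h5⟩

theorem almost_prime_hypotenuse_zariski_dense (Γ : Subgroup SL3Z) (hfg : Γ.FG)
    (hQ : ∀ γ ∈ Γ, PreservesQ γ)
    (δ : ℝ) (hδdef : δ = critExp Γ) (hδ : δ > 0.9992)
    (hprim : ∀ q : ℤ, 2 ≤ q → ∃ v ∈ orbit345 Γ, ¬ (q ∣ v 2)) :
    ∀ P : MvPolynomial (Fin 3) ℝ,
      (∀ v : Fin 3 → ℤ, v ∈ orbit345 Γ → v 2 ≠ 0 → OmegaZ (v 2) ≤ 14 →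
        MvPolynomial.eval (fun i => (v i : ℝ)) P = 0) →
      ∀ w : Fin 3 → ℝ, Qform w = 0 → MvPolynomial.eval w P = 0 := by
  classical
  intro P hP w hw
  refine polyVV_zero P ?_ w hw
  by_contra hne
  obtain ⟨y0, sm⟩ := sieve_main
  obtain ⟨q0, _, el⟩ := eps_large
  obtain ⟨y, hy0, hy5, Y, hY, B, hB, hBc, a, ha, ha0, ha1, ha2, G, hG, F, hF, hFd, q1, hq1, hq1', hs, t, ht, hO⟩ := setup Γ hQ (by rw [← hδdef]; exact hδ) y0 q0
  obtain ⟨C, hC, el⟩ := el B Y hB hY hBc a ha ha0 ha1 ha2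
  obtain ⟨D0, hD0, sm⟩ := sm y hy0 C hC
  obtain ⟨C1, hC1, sf⟩ := sq_frac hB hY hBc a ha ha0 ha1 ha2 F hFd G hG
  obtain ⟨C2, hC2, st⟩ := sq_total
  obtain ⟨C3, hC3, pf⟩ := poly_frac hB hY hBc a ha ha0 ha1 ha2 F hFd G hG _ hne
  obtain ⟨N, hN, bb⟩ := box_bd hB a ha0 ha1 F G
  obtain ⟨D1, hD1⟩ := large_D D0 Y N C1 C2 C3
  have Y0 : I1 < Y := by exact_mod_cast hY
  obtain ⟨n, hn⟩ := pow_unbounded_of_one_lt (|D1|^4) Y0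
  obtain ⟨k, hk1, htk, hnk⟩ : ∃ k, 1 ≤ k ∧ t ∣ k ∧ n ≤ k := ⟨t*(n+1), Nat.mul_pos ht ooo, dvd_mul_right _ _, (by omega : n ≤ n+1).trans (le_mul_of_pos_left _ ht)⟩
  set D : ℝ := (↟Y^k)^(I1/4) with hD
  have D0' : 0 < D := by positivity
  have hDk : D^4 = ↟Y^k := by
    rw [hD, ← rpow_natCast, ← rpow_mul ppp]; norm_num
  obtain ⟨d0, d1, dY, dN, dC⟩ := hD1 D (by
    refine (le_abs_self _).trans (le_of_pow_le_pow_left₀ (n := 4) nnn D0'.le ?_)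
    rw [hDk]
    exact hn.le.trans (pow_le_pow_right₀ Y0.le hnk))
  have B0 : 0 < B.card := by
    have : I0 < B.card := lt_of_lt_of_le ppp hBc
    exact_mod_cast this
  set Ω := Wd B k ×ˢ F with hΩ
  have ΩN : Ω.Nonempty := by
    refine Finset.Nonempty.product (card_pos.mp ?_) hF
    have : I0 < (Wd B k).card := by rw [hB.wd_card]; positivity
    exact_mod_cast this
  have good := sm D d0 Ω ΩN (fun ω p => if (p:ℤ) ∣ zz (a ᵥ* (ω.1*ω.2*G)) then I1 else 0) (fun ω p => by by_cases h : (p:ℤ) ∣ zz (a ᵥ* (ω.1*ω.2*G)) <;> simp [h])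
    (fun T hT hTp hTD => equidist hB B0 hY a ha F hF hFd G hG q0 C hC (el F hFd G hG) q1 y hq1 hq1' hs k D D0' hDk T hT hTp hTD)
  set Q := PQ (D^(0.0225:ℝ)) (D^(0.82:ℝ)) with hQ'
  have up := av_mono Ω (g := fun ω => ∑ p∈Q, (if (p:ℤ)^2 ∣ zz (a ᵥ* (ω.1*ω.2*G)) then I1 else 0) + (if MvPolynomial.eval (fun i => ((a ᵥ* (ω.1*ω.2*G)) i:ℝ)) (polyVV P) = 0 then I1 else 0)) (f := fun ω =>
      if (∀ p : ℕ, p.Prime → p % 4 = 1 → y < p → ↟p ≤ D^(0.0225:ℝ) → (if (p:ℤ) ∣ zz (a ᵥ* (ω.1*ω.2*G)) then I1 else 0) = 0) ∧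
        (Q.filter (fun p:ℕ => (if (p:ℤ) ∣ zz (a ᵥ* (ω.1*ω.2*G)) then I1 else 0) = 1)).card ≤ 4 then 1 else 0) (fun ω hω => by
    have ω1 := (mem_product.mp hω).1
    have ω2 := (mem_product.mp hω).2
    have nn1 : 0 ≤ ∑ p∈Q, (if (p:ℤ)^2 ∣ zz (a ᵥ* (ω.1*ω.2*G)) then I1 else 0) := sum_nonneg fun p _ => by split_ifs <;> norm_num
    obtain ⟨o1, o2⟩ := hO k htk ω.1 ω1 ω.2 ω2
    have bd := bb k hk1 ω.1 ω1 ω.2 ω2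
    have cpr := coprime_vecMul a ha (ω.1*ω.2*G) (by rw [det_mul, det_mul, (hB.wd_props k _ ω1).1, hFd _ ω2]; simpa using hG)
    set u := a ᵥ* (ω.1*ω.2*G) with hu
    by_cases hc : MvPolynomial.eval (fun i => (u i:ℝ)) (polyVV P) = 0
    · rw [if_pos hc]; split_ifs <;> linarith
    by_cases hsq : ∃ p∈Q, (p:ℤ)^2 ∣ zz u
    · obtain ⟨p, hp, hd⟩ := hsq
      have := single_le_sum (f := fun p:ℕ => if (p:ℤ)^2 ∣ zz u then I1 else 0) (fun p _ => by split_ifs <;> norm_num) hp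
      simp only [if_pos hd] at this
      rw [if_neg hc]; split_ifs <;> linarith
    rw [if_neg]
    · rw [if_neg hc]; linarith
    rintro ⟨g1, g2⟩
    push Not at hsq
    have sz : (zz u:ℝ) < D^(8.2:ℝ) := by
      have b : ∀ i, ((u i:ℤ):ℝ)^2 ≤ ((N*Y^k:ℕ):ℝ)^2 := fun i => by
        have := sq_le_sq' (abs_le.mp (bd i)).1 (abs_le.mp (bd i)).2
        exact_mod_cast this
      have e : (zz u:ℝ) = (u 0:ℝ)^2+(u 1:ℝ)^2 := by simp [zz]
      have e2 : D^(8.2:ℝ) = D^(0.2:ℝ)*(↟Y^k)^2 := by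
        rw [← hDk, ← pow_mul, ← rpow_natCast, ← rpow_add D0']; norm_num
      rw [e, e2]
      have b0 := b 0
      have b1 := b 1
      push_cast at b0 b1
      have : 2*↟N^2*(↟Y^k)^2 < D^(0.2:ℝ)*(↟Y^k)^2 := mul_lt_mul_of_pos_right dN ppp
      rw [mul_pow] at b0 b1
      linarith
    have om := omega_bd u cpr y hy5 o2 D d1 (fun p h1 h2 h3 h4 hd => by have := g1 p h1 h2 h3 h4; rw [if_pos hd] at this; norm_num at this)
      (le_trans (card_le_card (Finset.monotone_filter_right _ fun p _ hd => if_pos hd)) g2) hsq sz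
    refine hc ?_
    rw [polyVV_eval]
    have e2 : vv u 2 = zz u := rfl
    have := hP (vv u) o1 (by rw [e2]; exact om.1) (by rw [e2]; exact om.2)
    rw [← this]
    congr 2
    funext i
    fin_cases i <;> simp [vv])
  rw [av_add, av_sum] at up
  have k1 : ∑ p∈Q, av Ω (fun ω => if (p:ℤ)^2 ∣ zz (a ᵥ* (ω.1*ω.2*G)) then I1 else 0) ≤ C1*(C2*D^(-(0.007:ℝ))) := by
    calc _ ≤ ∑ p∈Q, C1*↟p^(-(1.94:ℝ)) := sum_le_sum fun p hp => by
          have hp' := (mem_PQ ppp).mp hp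
          refine sf k p hp'.1 hp'.2.1 ?_
          have e : ↟p^2*Y ≤ ↟Y^k := by
            calc ↟p^2*Y ≤ (D^(0.82:ℝ))^2*D := by gcongr; exact hp'.2.2.2
              _ = D^(2.64:ℝ) := by
                nth_rw 2 [← rpow_one D]
                rw [← rpow_natCast, ← rpow_mul D0'.le, ← rpow_add D0']; norm_num
              _ ≤ D^((4:ℕ):ℝ) := rpow_le_rpow_of_exponent_le d1.le nnn
              _ = _ := by rw [rpow_natCast, hDk]
          exact_mod_cast e
      _ ≤ C1*(C2*(D^(0.0225:ℝ))^(-(1/2:ℝ))) := by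
          rw [← mul_sum]
          exact mul_le_mul_of_nonneg_left (st _ _ (one_le_rpow d1.le nnn) ppp) hC1.le
      _ ≤ _ := by
          rw [← rpow_mul D0'.le]
          gcongr
          · exact d1.le
          · norm_num
  have k2 : av Ω (fun ω => if MvPolynomial.eval (fun i => ((a ᵥ* (ω.1*ω.2*G)) i:ℝ)) (polyVV P) = 0 then I1 else 0) ≤ C3*D^(-(0.007:ℝ)) := by
    refine (pf k hk1).trans ?_
    rw [← hDk, ← rpow_natCast, ← rpow_mul D0'.le]
    gcongr
    · exact d1.le
    · norm_num
  have k3 : (C1*C2+C3)*D^(-(0.007:ℝ)) < D^(-(0.002:ℝ)) := by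
    calc _ < D^(0.005:ℝ)*D^(-(0.007:ℝ)) := mul_lt_mul_of_pos_right dC ppp
      _ = _ := by rw [← rpow_add D0']; norm_num
  have k4 := good.trans up
  linarith
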